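/- All first partial derivatives of f (with respect to t, θ, v₁, v₂, v₃) are bounded on (t_p,t_i] × ℝ × ℝ³, and α_θ is bounded on (t_p,t_i] × ℝ. -/

import Mathlib

open MeasureTheory Set

noncomputable section

set_option linter.unusedVariables false

/-- the velocity space `ℝ³` -/
abbrev V3 : Type := ℝ × ℝ × ℝ

/-- partial derivative with respect to the time variable `t` -/
def pt (F : ℝ → ℝ → ℝ) : ℝ → ℝ → ℝ := fun t θ => deriv (fun s => F s θ) t

/-- partial derivative with respect to the space variable `θ` -/
def pθ (F : ℝ → ℝ → ℝ) : ℝ → ℝ → ℝ := fun t θ => deriv (fun x => F t x) θ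

/-- time derivative within `Ici tp` (one-sided at the left endpoint `tp`) -/
def ptW (tp : ℝ) (F : ℝ → ℝ → ℝ) : ℝ → ℝ → ℝ :=
  fun t θ => derivWithin (fun s => F s θ) (Set.Ici tp) t

/-- time derivative of the matter distribution function -/
def ptf (f : ℝ → ℝ → V3 → ℝ) (t θ : ℝ) (v : V3) : ℝ := deriv (fun s => f s θ v) t

/-- one-sided time derivative of the matter distribution function -/
def ptWf (tp : ℝ) (f : ℝ → ℝ → V3 → ℝ) (t θ : ℝ) (v : V3) : ℝ :=
  derivWithin (fun s => f s θ v) (Set.Ici tp) t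

/-- `θ`-derivative of the matter distribution function -/
def pθf (f : ℝ → ℝ → V3 → ℝ) (t θ : ℝ) (v : V3) : ℝ := deriv (fun x => f t x v) θ

/-- derivative in the first velocity variable `v₁` -/
def pv1 (g : V3 → ℝ) (v : V3) : ℝ := deriv (fun y => g (y, v.2.1, v.2.2)) v.1

/-- derivative in the second velocity variable `v₂` -/
def pv2 (g : V3 → ℝ) (v : V3) : ℝ := deriv (fun y => g (v.1, y, v.2.2)) v.2.1

/-- derivative in the third velocity variable `v₃` -/
def pv3 (g : V3 → ℝ) (v : V3) : ℝ := deriv (fun y => g (v.1, v.2.1, y)) v.2.2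

/-- the velocity component `v₀ = −√(α e^{2ν−2U} + α v₁² + α e^{2ν−4U} v₂² + α t⁻² e^{2ν} (v₃ − A v₂)²)` -/
def v0 (α ν U A : ℝ → ℝ → ℝ) (t θ : ℝ) (v : V3) : ℝ :=
  - Real.sqrt (α t θ * Real.exp (2 * ν t θ - 2 * U t θ)
    + α t θ * v.1 ^ 2
    + α t θ * Real.exp (2 * ν t θ - 4 * U t θ) * v.2.1 ^ 2
    + α t θ * (t ^ 2)⁻¹ * Real.exp (2 * ν t θ) * (v.2.2 - A t θ * v.2.1) ^ 2)

/-- `β = ν + (ln α)/2` -/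
def betaF (ν α : ℝ → ℝ → ℝ) : ℝ → ℝ → ℝ := fun t θ => ν t θ + Real.log (α t θ) / 2

/-- the energy `𝓔̃(t) = ∫₀¹ ν_t/(√α t) dθ` -/
def Etilde (ν α : ℝ → ℝ → ℝ) (t : ℝ) : ℝ :=
  ∫ θ in (0:ℝ)..1, pt ν t θ / (Real.sqrt (α t θ) * t)

/-! ### Smooth functions on a strip -/

section Strip

open Filter Topology

/-- `G` is smooth on the open strip `(a,b) × ℝ`. -/
def Sm (a b : ℝ) (G : ℝ → ℝ → ℝ) : Prop :=
  ContDiffOn ℝ (⊤ : ℕ∞) (fun p : ℝ × ℝ => G p.1 p.2) (Ioo a b ×ˢ (univ : Set ℝ))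

variable {a b : ℝ} {G H : ℝ → ℝ → ℝ} {t θ : ℝ}

theorem two_le_smooth : (2 : WithTop ℕ∞) ≤ ((⊤ : ℕ∞) : WithTop ℕ∞) :=
  WithTop.coe_le_coe.2 (le_top : (2 : ℕ∞) ≤ ⊤)

theorem isOpen_strip (a b : ℝ) : IsOpen (Ioo a b ×ˢ (univ : Set ℝ)) := isOpen_Ioo.prod isOpen_univ

theorem Sm.contDiffAt (h : Sm a b G) (ht : t ∈ Ioo a b) (θ : ℝ) :
    ContDiffAt ℝ (⊤ : ℕ∞) (fun p : ℝ × ℝ => G p.1 p.2) (t, θ) :=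
  ContDiffOn.contDiffAt h ((isOpen_strip a b).mem_nhds ⟨ht, mem_univ _⟩)

theorem Sm.differentiableAt (h : Sm a b G) (ht : t ∈ Ioo a b) (θ : ℝ) :
    DifferentiableAt ℝ (fun p : ℝ × ℝ => G p.1 p.2) (t, θ) :=
  (h.contDiffAt ht θ).differentiableAt (by simp)

theorem Sm.pt_eq (h : Sm a b G) (ht : t ∈ Ioo a b) (θ : ℝ) :
    pt G t θ = fderiv ℝ (fun p : ℝ × ℝ => G p.1 p.2) (t, θ) (1, 0) := by
  have h1 : HasDerivAt (fun s : ℝ => ((s, θ) : ℝ × ℝ)) (1, 0) t :=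
    (hasDerivAt_id t).prodMk (hasDerivAt_const t θ)
  exact ((h.differentiableAt ht θ).hasFDerivAt.comp_hasDerivAt t h1).deriv

theorem Sm.pθ_eq (h : Sm a b G) (ht : t ∈ Ioo a b) (θ : ℝ) :
    pθ G t θ = fderiv ℝ (fun p : ℝ × ℝ => G p.1 p.2) (t, θ) (0, 1) := by
  have h1 : HasDerivAt (fun s : ℝ => ((t, s) : ℝ × ℝ)) (0, 1) θ :=
    (hasDerivAt_const θ t).prodMk (hasDerivAt_id θ)
  exact ((h.differentiableAt ht θ).hasFDerivAt.comp_hasDerivAt θ h1).deriv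

theorem Sm.dpath (h : Sm a b G) (ht : t ∈ Ioo a b) (θ c : ℝ) :
    HasDerivAt (fun s => G (t + s) (θ + s * c)) (pt G t θ + c * pθ G t θ) 0 := by
  have h1 : HasDerivAt (fun s : ℝ => ((t + s, θ + s * c) : ℝ × ℝ)) (1, c) 0 := by
    refine HasDerivAt.prodMk ((hasDerivAt_id _).const_add t) ?_
    simpa using ((hasDerivAt_id (0:ℝ)).mul_const c).const_add θ
  have h2 : HasFDerivAt (fun p : ℝ × ℝ => G p.1 p.2) (fderiv ℝ (fun p : ℝ × ℝ => G p.1 p.2) (t, θ))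
      ((fun s : ℝ => ((t + s, θ + s * c) : ℝ × ℝ)) 0) := by
    simpa using (h.differentiableAt ht θ).hasFDerivAt
  have h3 := h2.comp_hasDerivAt (0:ℝ) h1
  have h4 : ((1, c) : ℝ × ℝ) = (1, 0) + c • (0, 1) := by simp
  rw [h4, map_add, map_smul, ← h.pt_eq ht, ← h.pθ_eq ht, smul_eq_mul] at h3
  exact h3

theorem Sm.dt (h : Sm a b G) (ht : t ∈ Ioo a b) (θ : ℝ) :
    HasDerivAt (fun s => G s θ) (pt G t θ) t := by
  have h1 : HasDerivAt (fun s : ℝ => ((s, θ) : ℝ × ℝ)) (1, 0) t :=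
    (hasDerivAt_id t).prodMk (hasDerivAt_const t θ)
  exact ((h.differentiableAt ht θ).hasFDerivAt.comp_hasDerivAt t h1).differentiableAt.hasDerivAt

theorem Sm.dθ (h : Sm a b G) (ht : t ∈ Ioo a b) (θ : ℝ) :
    HasDerivAt (fun x => G t x) (pθ G t θ) θ := by
  have h1 : HasDerivAt (fun s : ℝ => ((t, s) : ℝ × ℝ)) (0, 1) θ :=
    (hasDerivAt_const θ t).prodMk (hasDerivAt_id θ)
  exact ((h.differentiableAt ht θ).hasFDerivAt.comp_hasDerivAt θ h1).differentiableAt.hasDerivAt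

theorem Sm.congr (h : Sm a b G) (hGH : ∀ t ∈ Ioo a b, ∀ θ, H t θ = G t θ) : Sm a b H :=
  ContDiffOn.congr h fun p hp => hGH p.1 hp.1 p.2

theorem Sm.fderiv_apply (h : Sm a b G) (w : ℝ × ℝ) :
    Sm a b (fun t θ => fderiv ℝ (fun p : ℝ × ℝ => G p.1 p.2) (t, θ) w) := by
  have := ContDiffOn.fderiv_of_isOpen (m := (⊤ : ℕ∞)) h (isOpen_strip a b) (by simp)
  exact this.clm_apply contDiffOn_const

theorem Sm.pt (h : Sm a b G) : Sm a b (pt G) :=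
  (h.fderiv_apply (1, 0)).congr fun t ht θ => h.pt_eq ht θ

theorem Sm.pθ (h : Sm a b G) : Sm a b (pθ G) :=
  (h.fderiv_apply (0, 1)).congr fun t ht θ => h.pθ_eq ht θ

theorem pt_congr (hGH : ∀ t ∈ Ioo a b, ∀ θ, H t θ = G t θ) (ht : t ∈ Ioo a b) (θ : ℝ) :
    pt H t θ = pt G t θ := by
  refine Filter.EventuallyEq.deriv_eq ?_
  filter_upwards [isOpen_Ioo.mem_nhds ht] with s hs using hGH s hs θ

theorem pθ_congr (hGH : ∀ t ∈ Ioo a b, ∀ θ, H t θ = G t θ) (ht : t ∈ Ioo a b) (θ : ℝ) :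
    pθ H t θ = pθ G t θ := by
  have : (fun x => H t x) = fun x => G t x := funext fun x => hGH t ht x
  simp only [_root_.pθ, this]

theorem Sm.comm (h : Sm a b G) (ht : t ∈ Ioo a b) (θ : ℝ) :
    _root_.pt (_root_.pθ G) t θ = _root_.pθ (_root_.pt G) t θ := by
  set g : ℝ × ℝ → ℝ := fun p => G p.1 p.2 with hg
  have hs : IsSymmSndFDerivAt ℝ g (t, θ) :=
    (h.contDiffAt ht θ).isSymmSndFDerivAt (by simpa using two_le_smooth)
  have hd : DifferentiableAt ℝ (fderiv ℝ g) (t, θ) :=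
    ((h.contDiffAt ht θ).fderiv_right (m := 1) (by simpa [one_add_one_eq_two] using two_le_smooth)).differentiableAt (by simp)
  have e1 : ∀ w u : ℝ × ℝ, fderiv ℝ (fun p => fderiv ℝ g p w) (t, θ) u
      = fderiv ℝ (fderiv ℝ g) (t, θ) u w := by
    intro w u
    have := (hd.hasFDerivAt.clm_apply (hasFDerivAt_const w (t, θ))).fderiv
    rw [this]; simp
  rw [pt_congr (fun t ht θ => h.pθ_eq ht θ) ht θ, pθ_congr (fun t ht θ => h.pt_eq ht θ) ht θ,
    (h.fderiv_apply (0, 1)).pt_eq ht, (h.fderiv_apply (1, 0)).pθ_eq ht, e1, e1]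
  exact hs _ _

theorem Sm.continuousOn (h : Sm a b G) :
    ContinuousOn (fun p : ℝ × ℝ => G p.1 p.2) (Ioo a b ×ˢ (univ : Set ℝ)) :=
  ContDiffOn.continuousOn h

theorem Sm.contθ (h : Sm a b G) (ht : t ∈ Ioo a b) : Continuous fun θ => G t θ :=
  continuous_iff_continuousAt.2 fun θ => (h.dθ ht θ).continuousAt

theorem Sm.const (c : ℝ) : Sm a b (fun _ _ => c) := contDiffOn_const
theorem Sm.time : Sm a b (fun t _ => t) := contDiffOn_fst
theorem Sm.of_time {g : ℝ → ℝ} (hg : ContDiffOn ℝ (⊤ : ℕ∞) g (Ioo a b)) : Sm a b (fun t _ => g t) :=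
  ContDiffOn.comp hg contDiffOn_fst fun p hp => hp.1
theorem Sm.add (h : Sm a b G) (k : Sm a b H) : Sm a b (fun t θ => G t θ + H t θ) :=
  ContDiffOn.add h k
theorem Sm.sub (h : Sm a b G) (k : Sm a b H) : Sm a b (fun t θ => G t θ - H t θ) :=
  ContDiffOn.sub h k
theorem Sm.mul (h : Sm a b G) (k : Sm a b H) : Sm a b (fun t θ => G t θ * H t θ) :=
  ContDiffOn.mul h k
theorem Sm.neg (h : Sm a b G) : Sm a b (fun t θ => - G t θ) := ContDiffOn.neg h
theorem Sm.pow (h : Sm a b G) (n : ℕ) : Sm a b (fun t θ => G t θ ^ n) := ContDiffOn.pow h n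
theorem Sm.exp (h : Sm a b G) : Sm a b (fun t θ => Real.exp (G t θ)) := ContDiffOn.exp h
theorem Sm.log (h : Sm a b G) (h0 : ∀ t ∈ Ioo a b, ∀ θ, G t θ ≠ 0) :
    Sm a b (fun t θ => Real.log (G t θ)) := ContDiffOn.log h fun p hp => h0 p.1 hp.1 p.2
theorem Sm.sqrt (h : Sm a b G) (h0 : ∀ t ∈ Ioo a b, ∀ θ, G t θ ≠ 0) :
    Sm a b (fun t θ => Real.sqrt (G t θ)) := ContDiffOn.sqrt h fun p hp => h0 p.1 hp.1 p.2
theorem Sm.inv (h : Sm a b G) (h0 : ∀ t ∈ Ioo a b, ∀ θ, G t θ ≠ 0) :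
    Sm a b (fun t θ => (G t θ)⁻¹) := ContDiffOn.inv h fun p hp => h0 p.1 hp.1 p.2
theorem Sm.div (h : Sm a b G) (k : Sm a b H) (h0 : ∀ t ∈ Ioo a b, ∀ θ, H t θ ≠ 0) :
    Sm a b (fun t θ => G t θ / H t θ) := ContDiffOn.div h k fun p hp => h0 p.1 hp.1 p.2

/-- `G` is periodic in `θ` with period one. -/
def Per (G : ℝ → ℝ → ℝ) : Prop := ∀ t θ, G t (θ + 1) = G t θ

theorem Per.pt (h : Per G) : Per (pt G) := fun t θ => by simp only [_root_.pt, h _ θ]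
theorem Per.pθ (h : Per G) : Per (pθ G) := fun t θ => by
  have := deriv_comp_add_const (fun x => G t x) 1 θ
  simp only [h t] at this
  exact this.symm

theorem Per.fract (h : Per G) (t θ : ℝ) : G t (Int.fract θ) = G t θ := by
  have : Function.Periodic (fun x => G t x) 1 := fun x => h t x
  have h2 := this.sub_zsmul_eq (x := θ) ⌊θ⌋
  rw [zsmul_one] at h2
  exact h2

theorem Per.eq_zero_one (h : Per G) (t : ℝ) : G t 1 = G t 0 := by simpa using h t 0

theorem fract_mem (θ : ℝ) : Int.fract θ ∈ Icc (0:ℝ) 1 := ⟨Int.fract_nonneg _, (Int.fract_lt_one _).le⟩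

theorem Sm.bdd (h : Sm a b G) (hp : Per G) {c d : ℝ} (hc : a < c) (hd : d < b) :
    ∃ C, 0 ≤ C ∧ ∀ t ∈ Icc c d, ∀ θ, |G t θ| ≤ C := by
  have hK : IsCompact (Icc c d ×ˢ Icc (0:ℝ) 1) := isCompact_Icc.prod isCompact_Icc
  have hs : Icc c d ×ˢ Icc (0:ℝ) 1 ⊆ Ioo a b ×ˢ (univ : Set ℝ) := fun p hp =>
    ⟨⟨hc.trans_le hp.1.1, hp.1.2.trans_lt hd⟩, mem_univ _⟩
  obtain ⟨C, hC⟩ := hK.exists_bound_of_continuousOn (h.continuousOn.mono hs)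
  refine ⟨max C 0, le_max_right _ _, fun t ht θ => ?_⟩
  rw [← hp.fract]
  exact (hC (t, Int.fract θ) ⟨ht, fract_mem θ⟩).trans (le_max_left _ _)

theorem Sm.hasDerivAt_integral (h : Sm a b G) (ht : t ∈ Ioo a b) (x y : ℝ) :
    HasDerivAt (fun s => ∫ θ in x..y, G s θ) (∫ θ in x..y, _root_.pt G t θ) t := by
  obtain ⟨c, hc1, hc2⟩ := exists_between ht.1
  obtain ⟨d, hd1, hd2⟩ := exists_between ht.2
  have hK : IsCompact (Icc c d ×ˢ uIcc x y) := isCompact_Icc.prod isCompact_uIcc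
  have hs : Icc c d ×ˢ uIcc x y ⊆ Ioo a b ×ˢ (univ : Set ℝ) := fun p hp =>
    ⟨⟨hc1.trans_le hp.1.1, hp.1.2.trans_lt hd2⟩, mem_univ _⟩
  obtain ⟨C, hC⟩ := hK.exists_bound_of_continuousOn (h.pt.continuousOn.mono hs)
  have hsub : ∀ s ∈ Ioo c d, s ∈ Ioo a b := fun s hs => ⟨hc1.trans hs.1, hs.2.trans hd2⟩
  refine (intervalIntegral.hasDerivAt_integral_of_dominated_loc_of_deriv_le
    (bound := fun _ => C) (s := Ioo c d) (Ioo_mem_nhds hc2 hd1) ?_ ?_ ?_ ?_ ?_ ?_).2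
  · filter_upwards [isOpen_Ioo.mem_nhds ht] with s hs
    exact (h.contθ hs).aestronglyMeasurable
  · exact (h.contθ ht).intervalIntegrable _ _
  · exact (h.pt.contθ ht).aestronglyMeasurable
  · refine Filter.Eventually.of_forall fun θ hθ s hs => ?_
    exact hC (s, θ) ⟨Ioo_subset_Icc_self hs, uIoc_subset_uIcc hθ⟩
  · exact intervalIntegrable_const
  · exact Filter.Eventually.of_forall fun θ hθ s hs => h.dt (hsub s hs) θ

theorem Sm.integral_pθ (h : Sm a b G) (ht : t ∈ Ioo a b) (x y : ℝ) :
    ∫ θ in x..y, _root_.pθ G t θ = G t y - G t x :=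
  intervalIntegral.integral_eq_sub_of_hasDerivAt (fun θ _ => h.dθ ht θ)
    ((h.pθ.contθ ht).intervalIntegrable _ _)

theorem Sm.integral_pθ_per (h : Sm a b G) (hp : Per G) (ht : t ∈ Ioo a b) :
    ∫ θ in (0:ℝ)..1, _root_.pθ G t θ = 0 := by
  rw [h.integral_pθ ht, hp.eq_zero_one, sub_self]

theorem integral01_mono_sub {g : ℝ → ℝ} (hg : Continuous g) (h0 : ∀ x, 0 ≤ g x) {x y : ℝ}
    (hx : 0 ≤ x) (hxy : x ≤ y) (hy : y ≤ 1) : ∫ θ in x..y, g θ ≤ ∫ θ in (0:ℝ)..1, g θ :=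
  intervalIntegral.integral_mono_interval hx hxy hy (ae_of_all _ h0) (hg.intervalIntegrable _ _)

/-- The oscillation of a periodic function is bounded by the integral of its derivative. -/
theorem Sm.osc (h : Sm a b G) (hp : Per G) (ht : t ∈ Ioo a b) (θ θ' : ℝ) :
    |G t θ - G t θ'| ≤ ∫ x in (0:ℝ)..1, |_root_.pθ G t x| := by
  rw [← hp.fract t θ, ← hp.fract t θ']
  have hb : ∀ x ∈ Icc (0:ℝ) 1, ∀ y ∈ Icc (0:ℝ) 1, x ≤ y →
      |G t y - G t x| ≤ ∫ x in (0:ℝ)..1, |_root_.pθ G t x| := by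
    intro x hx y hy hxy
    rw [← h.integral_pθ ht]
    exact (intervalIntegral.abs_integral_le_integral_abs hxy).trans
      (integral01_mono_sub (h.pθ.contθ ht).abs (fun _ => abs_nonneg _) hx.1 hxy hy.2)
  rcases le_total (Int.fract θ) (Int.fract θ') with hl | hl
  · rw [abs_sub_comm]; exact hb _ (fract_mem θ) _ (fract_mem θ') hl
  · exact hb _ (fract_mem θ') _ (fract_mem θ) hl

theorem integral01_mono {g k : ℝ → ℝ} (hg : Continuous g) (hk : Continuous k)
    (h : ∀ x, g x ≤ k x) : ∫ x in (0:ℝ)..1, g x ≤ ∫ x in (0:ℝ)..1, k x :=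
  intervalIntegral.integral_mono_on zero_le_one (hg.intervalIntegrable _ _)
    (hk.intervalIntegrable _ _) fun x _ => h x

theorem integral01_nonneg {g : ℝ → ℝ} (h : ∀ x, 0 ≤ g x) : 0 ≤ ∫ x in (0:ℝ)..1, g x :=
  intervalIntegral.integral_nonneg zero_le_one fun x _ => h x

theorem abs_integral01_le {g k : ℝ → ℝ} (hg : Continuous g) (hk : Continuous k)
    (h : ∀ x, |g x| ≤ k x) : |∫ x in (0:ℝ)..1, g x| ≤ ∫ x in (0:ℝ)..1, k x :=
  (intervalIntegral.abs_integral_le_integral_abs zero_le_one).trans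
    (integral01_mono hg.abs hk h)

theorem eventually_lt_of_deriv_pos {g : ℝ → ℝ} {d : ℝ} (hder : HasDerivAt g d 0) (hd : 0 < d) :
    ∀ᶠ s in 𝓝[>] (0:ℝ), g 0 < g s := by
  have h2 : ∀ᶠ s in 𝓝[≠] (0:ℝ), 0 < s⁻¹ • (g (0 + s) - g 0) :=
    (hasDerivAt_iff_tendsto_slope_zero.1 hder).eventually_const_lt hd
  have h3 : ∀ᶠ s in 𝓝[>] (0:ℝ), 0 < s⁻¹ • (g (0 + s) - g 0) :=
    h2.filter_mono (nhdsWithin_mono _ fun x hx => ne_of_gt hx)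
  filter_upwards [h3, self_mem_nhdsWithin] with s hs hs0
  have hs0' : (0:ℝ) < s := hs0
  have := (mul_pos_iff_of_pos_left (inv_pos.2 hs0')).1 hs
  simp only [zero_add] at this
  linarith

/-- A maximum principle: a continuous function which can be strictly increased along a curve
in the domain from any point where it exceeds `c` is bounded by `c`. -/
theorem max_principle {X : Type*} [TopologicalSpace X] {S S' : Set X} (hS' : IsCompact S')
    {ψ : X → ℝ} (hψ : ContinuousOn ψ S') (hred : ∀ p ∈ S, ∃ p' ∈ S', ψ p' = ψ p) {c : ℝ}
    (hesc : ∀ p ∈ S', c < ψ p → ∃ γ : ℝ → X, ∃ d > 0, γ 0 = p ∧ (∀ᶠ s in 𝓝[>] (0:ℝ), γ s ∈ S) ∧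
      HasDerivAt (fun s => ψ (γ s)) d 0) : ∀ p ∈ S, ψ p ≤ c := by
  intro p hp
  obtain ⟨p', hp', hpp'⟩ := hred p hp
  by_contra! hc
  obtain ⟨m, hm, hmax⟩ := hS'.exists_isMaxOn ⟨p', hp'⟩ hψ
  have hcm : c < ψ m := hc.trans_le (hpp' ▸ hmax hp')
  obtain ⟨γ, d, hd, h0, hS, hder⟩ := hesc m hm hcm
  have h1 := eventually_lt_of_deriv_pos hder hd
  obtain ⟨s, hs1, hs2⟩ := (h1.and hS).exists
  obtain ⟨q, hq, hqe⟩ := hred _ hs2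
  have := hmax hq
  rw [h0] at hs1
  have this : ψ q ≤ ψ m := this
  linarith

end Strip

/-! Functions which are smooth up to the final time -/

section Closed

variable {a b : ℝ} {G : ℝ → ℝ → ℝ} {t : ℝ}

theorem uniqueDiff_strip (a b : ℝ) : UniqueDiffOn ℝ (Ioc a b ×ˢ (univ : Set ℝ)) :=
  (uniqueDiffOn_Ioc a b).prod uniqueDiffOn_univ

theorem pθ_eq_within
    (h : ContDiffOn ℝ (⊤ : ℕ∞) (fun p : ℝ × ℝ => G p.1 p.2) (Ioc a b ×ˢ (univ : Set ℝ)))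
    (ht : t ∈ Ioc a b) (θ : ℝ) : pθ G t θ
      = fderivWithin ℝ (fun p : ℝ × ℝ => G p.1 p.2) (Ioc a b ×ˢ univ) (t, θ) (0, 1) := by
  have h1 : HasDerivAt (fun s : ℝ => ((t, s) : ℝ × ℝ)) (0, 1) θ :=
    (hasDerivAt_const θ t).prodMk (hasDerivAt_id θ)
  have h2 := (h.differentiableOn (by simp) (t, θ) ⟨ht, mem_univ _⟩).hasFDerivWithinAt
  have h3 := HasFDerivWithinAt.comp_hasDerivWithinAt (t := Ioc a b ×ˢ univ) (s := univ) θ h2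
    h1.hasDerivWithinAt fun x _ => ⟨ht, mem_univ _⟩
  rw [hasDerivWithinAt_univ] at h3
  exact h3.deriv

theorem deriv_bdd_closed
    (h : ContDiffOn ℝ (⊤ : ℕ∞) (fun p : ℝ × ℝ => G p.1 p.2) (Ioc a b ×ˢ (univ : Set ℝ)))
    (hp : Per G) {c : ℝ} (hc : a < c) :
    ∃ C, 0 ≤ C ∧ (∀ t ∈ Icc c b, ∀ θ, |G t θ| ≤ C) ∧ (∀ t ∈ Icc c b, ∀ θ, |pθ G t θ| ≤ C) ∧
      (∀ t ∈ Ico c b, ∀ θ, |pt G t θ| ≤ C) := by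
  have hK : IsCompact (Icc c b ×ˢ Icc (0:ℝ) 1) := isCompact_Icc.prod isCompact_Icc
  have hs : Icc c b ×ˢ Icc (0:ℝ) 1 ⊆ Ioc a b ×ˢ (univ : Set ℝ) := fun p hp =>
    ⟨⟨hc.trans_le hp.1.1, hp.1.2⟩, mem_univ _⟩
  obtain ⟨C1, h1⟩ := hK.exists_bound_of_continuousOn (h.continuousOn.mono hs)
  obtain ⟨C2, h2⟩ := hK.exists_bound_of_continuousOn
    ((h.continuousOn_fderivWithin (uniqueDiff_strip a b) (by simp)).mono hs)
  have hCC : C2 ≤ max (max C1 C2) 0 := (le_max_right _ _).trans (le_max_left _ _)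
  have hle : ∀ t ∈ Icc c b, ∀ θ, ∀ w : ℝ × ℝ, ‖w‖ ≤ 1 → |fderivWithin ℝ (fun p : ℝ × ℝ => G p.1 p.2)
      (Ioc a b ×ˢ univ) (t, Int.fract θ) w| ≤ max (max C1 C2) 0 := by
    intro t ht θ w hw
    have h3 := ContinuousLinearMap.le_opNorm (fderivWithin ℝ (fun p : ℝ × ℝ => G p.1 p.2)
      (Ioc a b ×ˢ univ) (t, Int.fract θ)) w
    have h4 := h2 (t, Int.fract θ) ⟨ht, fract_mem θ⟩
    exact h3.trans ((mul_le_of_le_one_right (norm_nonneg _) hw).trans (h4.trans hCC))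
  refine ⟨max (max C1 C2) 0, le_max_right _ _, fun t ht θ => ?_, fun t ht θ => ?_, fun t ht θ => ?_⟩
  · rw [← hp.fract]
    exact (h1 (t, Int.fract θ) ⟨ht, fract_mem θ⟩).trans ((le_max_left _ _).trans (le_max_left _ _))
  · rw [← hp.pθ.fract, pθ_eq_within h ⟨hc.trans_le ht.1, ht.2⟩]
    exact hle t ht θ _ (by simp)
  · have ht' : t ∈ Ioo a b := ⟨hc.trans_le ht.1, ht.2⟩
    have hsm : Sm a b G := h.mono (prod_mono Ioo_subset_Ioc_self Subset.rfl)
    have hn : Ioc a b ×ˢ (univ : Set ℝ) ∈ nhds (t, Int.fract θ) :=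
      Filter.mem_of_superset ((isOpen_strip a b).mem_nhds ⟨ht', mem_univ _⟩)
        (prod_mono Ioo_subset_Ioc_self Subset.rfl)
    rw [← hp.pt.fract, hsm.pt_eq ht', ← fderivWithin_of_mem_nhds hn]
    exact hle t (Ico_subset_Icc_self ht) θ _ (by simp)

end Closed

/-! ### The Einstein–Vlasov system -/

/-- A solution of the `T²`-symmetric areal Einstein–Vlasov system on `(tp, ti]`. -/
structure EV where
  (tp ti : ℝ)
  (htp : 0 < tp)
  (hti : tp < ti)
  (U A ν α J K : ℝ → ℝ → ℝ)
  (f : ℝ → ℝ → V3 → ℝ)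
  (hUsm : ContDiffOn ℝ (⊤ : ℕ∞) (fun p : ℝ × ℝ => U p.1 p.2) (Ioc tp ti ×ˢ (univ : Set ℝ)))
  (hAsm : ContDiffOn ℝ (⊤ : ℕ∞) (fun p : ℝ × ℝ => A p.1 p.2) (Ioc tp ti ×ˢ (univ : Set ℝ)))
  (hνsm : ContDiffOn ℝ (⊤ : ℕ∞) (fun p : ℝ × ℝ => ν p.1 p.2) (Ioc tp ti ×ˢ (univ : Set ℝ)))
  (hαsm : ContDiffOn ℝ (⊤ : ℕ∞) (fun p : ℝ × ℝ => α p.1 p.2) (Ioc tp ti ×ˢ (univ : Set ℝ)))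
  (hJsm : ContDiffOn ℝ (⊤ : ℕ∞) (fun p : ℝ × ℝ => J p.1 p.2) (Ioc tp ti ×ˢ (univ : Set ℝ)))
  (hKsm : ContDiffOn ℝ (⊤ : ℕ∞) (fun p : ℝ × ℝ => K p.1 p.2) (Ioc tp ti ×ˢ (univ : Set ℝ)))
  (hfsm : ContDiffOn ℝ (⊤ : ℕ∞) (fun p : ℝ × ℝ × V3 => f p.1 p.2.1 p.2.2) (Ioc tp ti ×ˢ (univ : Set (ℝ × V3))))
  (hUper : ∀ t θ, U t (θ + 1) = U t θ)
  (hAper : ∀ t θ, A t (θ + 1) = A t θ)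
  (hνper : ∀ t θ, ν t (θ + 1) = ν t θ)
  (hαper : ∀ t θ, α t (θ + 1) = α t θ)
  (hJper : ∀ t θ, J t (θ + 1) = J t θ)
  (hKper : ∀ t θ, K t (θ + 1) = K t θ)
  (hfper : ∀ t θ v, f t (θ + 1) v = f t θ v)
  (hαpos : ∀ t ∈ Ioc tp ti, ∀ θ : ℝ, 0 < α t θ)
  (hfnn : ∀ t ∈ Ioc tp ti, ∀ (θ : ℝ) (v : V3), 0 ≤ f t θ v)
  (hfsupp : ∀ t ∈ Ioc tp ti, ∃ R : ℝ, ∀ (θ : ℝ) (v : V3), R < ‖v‖ → f t θ v = 0)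
  (hvlasov :
      ∀ t ∈ Ioc tp ti, ∀ (θ : ℝ) (v : V3),
      ptf f t θ v
        = pv1 (v0 α ν U A t θ) v * pθf f t θ v
          - (deriv (fun x => v0 α ν U A t x v) θ
              + Real.sqrt (α t θ) * Real.exp (2 * ν t θ) / t ^ 3 * (K t θ - A t θ * J t θ) * (v.2.2 - A t θ * v.2.1)
              + Real.sqrt (α t θ) * Real.exp (2 * ν t θ - 4 * U t θ) / t * J t θ * v.2.1)
            * pv1 (f t θ) v)
  (hnut :
      ∀ t ∈ Ioc tp ti, ∀ θ : ℝ,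
      (pt ν t θ)
        = t * ((pt U t θ) ^ 2 + α t θ * (pθ U t θ) ^ 2
              + Real.exp (4 * U t θ) / (4 * t ^ 2) * ((pt A t θ) ^ 2 + α t θ * (pθ A t θ) ^ 2))
          + α t θ * Real.exp (2 * ν t θ - 4 * U t θ) / (4 * t) * J t θ ^ 2
          + α t θ * Real.exp (2 * ν t θ) / (4 * t ^ 3) * (K t θ - A t θ * J t θ) ^ 2
          + Real.sqrt (α t θ) * ∫ v : V3, f t θ v * |v0 α ν U A t θ v|)
  (hnuth :
      ∀ t ∈ Ioc tp ti, ∀ θ : ℝ,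
      (pθ ν t θ)
        = 2 * t * ((pt U t θ) * (pθ U t θ) + Real.exp (4 * U t θ) / (4 * t ^ 2) * (pt A t θ) * (pθ A t θ))
          - (pθ α t θ) / (2 * α t θ)
          - Real.sqrt (α t θ) * ∫ v : V3, f t θ v * v.1)
  (halt :
      ∀ t ∈ Ioc tp ti, ∀ θ : ℝ,
      (pt α t θ) / α t θ
        = - (α t θ * Real.exp (2 * ν t θ - 4 * U t θ) * J t θ ^ 2 / t)
          - α t θ * Real.exp (2 * ν t θ) * (K t θ - A t θ * J t θ) ^ 2 / t ^ 3
          - 2 * (α t θ * Real.sqrt (α t θ)) * Real.exp (2 * ν t θ)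
            * ∫ v : V3, f t θ v
                * (Real.exp (-2 * U t θ) + Real.exp (-4 * U t θ) * v.2.1 ^ 2
                    + (t ^ 2)⁻¹ * (v.2.2 - A t θ * v.2.1) ^ 2)
                / |v0 α ν U A t θ v|)
  (hjt :
      ∀ t ∈ Ioc tp ti, ∀ θ : ℝ,
      (pt J t θ) = -2 * α t θ * ∫ v : V3, f t θ v * v.1 * v.2.1 / |v0 α ν U A t θ v|)
  (hjth :
      ∀ t ∈ Ioc tp ti, ∀ θ : ℝ,
      (pθ J t θ) = 2 * ∫ v : V3, f t θ v * v.2.1)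
  (hkt :
      ∀ t ∈ Ioc tp ti, ∀ θ : ℝ,
      (pt K t θ) = -2 * α t θ * ∫ v : V3, f t θ v * v.1 * v.2.2 / |v0 α ν U A t θ v|)
  (hkth :
      ∀ t ∈ Ioc tp ti, ∀ θ : ℝ,
      (pθ K t θ) = 2 * ∫ v : V3, f t θ v * v.2.2)
  (hutt :
      ∀ t ∈ Ioc tp ti, ∀ θ : ℝ,
      (pt (pt U) t θ)
        = α t θ * (pθ (pθ U) t θ) - (pt U t θ) / t
          + (pt α t θ) * (pt U t θ) / (2 * α t θ) + (pθ α t θ) * (pθ U t θ) / 2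
          + Real.exp (4 * U t θ) / (2 * t ^ 2) * ((pt A t θ) ^ 2 - α t θ * (pθ A t θ) ^ 2)
          + α t θ * Real.exp (2 * ν t θ - 4 * U t θ) / (2 * t ^ 2) * J t θ ^ 2
          + (α t θ * Real.sqrt (α t θ)) * Real.exp (2 * ν t θ - 2 * U t θ) / (2 * t)
            * ∫ v : V3, f t θ v * (1 + 2 * Real.exp (-2 * U t θ) * v.2.1 ^ 2) / |v0 α ν U A t θ v|)
  (hatt :
      ∀ t ∈ Ioc tp ti, ∀ θ : ℝ,
      (pt (pt A) t θ)
        = α t θ * (pθ (pθ A) t θ) + (pt A t θ) / t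
          + (pt α t θ) * (pt A t θ) / (2 * α t θ) + (pθ α t θ) * (pθ A t θ) / 2
          - 4 * ((pt A t θ) * (pt U t θ) - α t θ * (pθ A t θ) * (pθ U t θ))
          + α t θ * Real.exp (2 * ν t θ - 4 * U t θ) / t ^ 2 * J t θ * (K t θ - A t θ * J t θ)
          + 2 * (α t θ * Real.sqrt (α t θ)) * Real.exp (2 * ν t θ - 4 * U t θ) / t
            * ∫ v : V3, f t θ v * v.2.1 * (v.2.2 - A t θ * v.2.1) / |v0 α ν U A t θ v|)
  (hnutt :
      ∀ t ∈ Ioc tp ti, ∀ θ : ℝ,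
      (pt (pt ν) t θ)
        = α t θ * (pθ (pθ ν) t θ)
          + (pt α t θ) * (pt ν t θ) / (2 * α t θ) + (pθ α t θ) * (pθ ν t θ) / 2
          + (pθ (pθ α) t θ) / 2 - (pθ α t θ) ^ 2 / (4 * α t θ)
          - (pt U t θ) ^ 2 + α t θ * (pθ U t θ) ^ 2
          + Real.exp (4 * U t θ) / (4 * t ^ 2) * ((pt A t θ) ^ 2 - α t θ * (pθ A t θ) ^ 2)
          - α t θ * Real.exp (2 * ν t θ - 4 * U t θ) * J t θ ^ 2 / (4 * t ^ 2)
          - 3 * α t θ * Real.exp (2 * ν t θ) * (K t θ - A t θ * J t θ) ^ 2 / (4 * t ^ 4)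
          - (α t θ * Real.sqrt (α t θ)) * Real.exp (2 * ν t θ) / t ^ 3
            * ∫ v : V3, f t θ v * (v.2.2 - A t θ * v.2.1) ^ 2 / |v0 α ν U A t θ v|)
  (hC2 : 0 < ∫ θ in (0:ℝ)..1, ∫ v : V3, f ti θ v)

namespace EV

variable (S : EV) {t θ : ℝ}

/-- `√α` -/
def a (t θ : ℝ) : ℝ := Real.sqrt (S.α t θ)
/-- `1/√α` -/
def h (t θ : ℝ) : ℝ := (S.a t θ)⁻¹
/-- `√α β_θ` -/
def B (t θ : ℝ) : ℝ := S.a t θ * pθ S.ν t θ + pθ S.α t θ / (2 * S.a t θ)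
/-- the twist energy density -/
def p (t θ : ℝ) : ℝ :=
  S.α t θ * Real.exp (2 * S.ν t θ - 4 * S.U t θ) * S.J t θ ^ 2 / t
    + S.α t θ * Real.exp (2 * S.ν t θ) * (S.K t θ - S.A t θ * S.J t θ) ^ 2 / t ^ 3
/-- the angular part of the squared velocity -/
def mu (t θ : ℝ) (v : V3) : ℝ :=
  Real.exp (-2 * S.U t θ) + Real.exp (-4 * S.U t θ) * v.2.1 ^ 2
    + (t ^ 2)⁻¹ * (v.2.2 - S.A t θ * v.2.1) ^ 2
/-- the square of `v₀` -/
def Q (t θ : ℝ) (v : V3) : ℝ := S.α t θ * (v.1 ^ 2 + Real.exp (2 * S.ν t θ) * S.mu t θ v)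
/-- the absolute value of `v₀` -/
def w (t θ : ℝ) (v : V3) : ℝ := Real.sqrt (S.Q t θ v)
/-- particle density -/
def n (t θ : ℝ) : ℝ := ∫ v : V3, S.f t θ v
/-- energy density -/
def rho (t θ : ℝ) : ℝ := S.a t θ * ∫ v : V3, S.f t θ v * S.w t θ v
/-- momentum density -/
def j (t θ : ℝ) : ℝ := S.α t θ * ∫ v : V3, S.f t θ v * v.1
/-- the matter contribution to the decay of `α` -/
def r (t θ : ℝ) : ℝ :=
  S.α t θ * S.a t θ * Real.exp (2 * S.ν t θ) * ∫ v : V3, S.f t θ v * S.mu t θ v / S.w t θ v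
/-- matter source of the equation for `U` -/
def SU (t θ : ℝ) : ℝ :=
  S.α t θ * S.a t θ * Real.exp (2 * S.ν t θ - 2 * S.U t θ) / (2 * t)
    * ∫ v : V3, S.f t θ v * (1 + 2 * Real.exp (-2 * S.U t θ) * v.2.1 ^ 2) / S.w t θ v
/-- matter source of the equation for `A` -/
def SA (t θ : ℝ) : ℝ :=
  2 * (S.α t θ * S.a t θ) * Real.exp (2 * S.ν t θ - 4 * S.U t θ) / t
    * ∫ v : V3, S.f t θ v * v.2.1 * (v.2.2 - S.A t θ * v.2.1) / S.w t θ v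
/-- matter source of the equation for `ν` -/
def s3 (t θ : ℝ) : ℝ :=
  S.α t θ * S.a t θ * Real.exp (2 * S.ν t θ) / t ^ 3
    * ∫ v : V3, S.f t θ v * (v.2.2 - S.A t θ * v.2.1) ^ 2 / S.w t θ v
/-- the logarithmic decay rate of `α` -/
def q (t θ : ℝ) : ℝ := S.p t θ + 2 * S.r t θ

variable {S}

theorem abs_v0 (t θ : ℝ) (v : V3) : |v0 S.α S.ν S.U S.A t θ v| = S.w t θ v := by
  rw [v0, abs_neg, abs_of_nonneg (Real.sqrt_nonneg _), w, Q, mu]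
  congr 1
  rw [show 2 * S.ν t θ - 2 * S.U t θ = 2 * S.ν t θ + (-2 * S.U t θ) by ring,
    show 2 * S.ν t θ - 4 * S.U t θ = 2 * S.ν t θ + (-4 * S.U t θ) by ring, Real.exp_add, Real.exp_add]
  ring

theorem v0_eq (t θ : ℝ) (v : V3) : v0 S.α S.ν S.U S.A t θ v = - S.w t θ v := by
  rw [← abs_v0, v0, abs_neg, abs_of_nonneg (Real.sqrt_nonneg _)]

theorem mem_Ioc (ht : t ∈ Ioo S.tp S.ti) : t ∈ Ioc S.tp S.ti := Ioo_subset_Ioc_self ht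
theorem tpos (ht : t ∈ Ioo S.tp S.ti) : 0 < t := S.htp.trans ht.1
theorem tpos' (ht : t ∈ Ioc S.tp S.ti) : 0 < t := S.htp.trans ht.1
theorem αpos (ht : t ∈ Ioo S.tp S.ti) (θ : ℝ) : 0 < S.α t θ := S.hαpos t (mem_Ioc ht) θ
theorem apos' (ht : t ∈ Ioc S.tp S.ti) (θ : ℝ) : 0 < S.a t θ := Real.sqrt_pos.2 (S.hαpos t ht θ)
theorem apos (ht : t ∈ Ioo S.tp S.ti) (θ : ℝ) : 0 < S.a t θ := apos' (mem_Ioc ht) θ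
theorem a_sq (ht : t ∈ Ioo S.tp S.ti) (θ : ℝ) : S.a t θ ^ 2 = S.α t θ := Real.sq_sqrt (αpos ht θ).le
theorem a_sq' (ht : t ∈ Ioc S.tp S.ti) (θ : ℝ) : S.a t θ ^ 2 = S.α t θ :=
  Real.sq_sqrt (S.hαpos t ht θ).le
theorem hpos (ht : t ∈ Ioo S.tp S.ti) (θ : ℝ) : 0 < S.h t θ := inv_pos.2 (apos ht θ)

theorem smU : Sm S.tp S.ti S.U := S.hUsm.mono (prod_mono Ioo_subset_Ioc_self Subset.rfl)
theorem smA : Sm S.tp S.ti S.A := S.hAsm.mono (prod_mono Ioo_subset_Ioc_self Subset.rfl)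
theorem smν : Sm S.tp S.ti S.ν := S.hνsm.mono (prod_mono Ioo_subset_Ioc_self Subset.rfl)
theorem smα : Sm S.tp S.ti S.α := S.hαsm.mono (prod_mono Ioo_subset_Ioc_self Subset.rfl)
theorem smJ : Sm S.tp S.ti S.J := S.hJsm.mono (prod_mono Ioo_subset_Ioc_self Subset.rfl)
theorem smK : Sm S.tp S.ti S.K := S.hKsm.mono (prod_mono Ioo_subset_Ioc_self Subset.rfl)
theorem sma : Sm S.tp S.ti S.a := smα.sqrt fun t ht θ => (αpos ht θ).ne'
theorem smh : Sm S.tp S.ti S.h := sma.inv fun t ht θ => (apos ht θ).ne'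
theorem smB : Sm S.tp S.ti S.B :=
  (sma.mul smν.pθ).add (smα.pθ.div ((Sm.const 2).mul sma) fun t ht θ =>
    (mul_pos two_pos (apos ht θ)).ne')
theorem smp : Sm S.tp S.ti S.p :=
  (((smα.mul (((Sm.const 2).mul smν).sub ((Sm.const 4).mul smU)).exp).mul (smJ.pow 2)).div Sm.time
    fun t ht θ => (tpos ht).ne').add
  (((smα.mul ((Sm.const 2).mul smν).exp).mul ((smK.sub (smA.mul smJ)).pow 2)).div (Sm.time.pow 3)
    fun t ht θ => (pow_pos (tpos ht) 3).ne')

theorem perU : Per S.U := S.hUper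
theorem perA : Per S.A := S.hAper
theorem perν : Per S.ν := S.hνper
theorem perα : Per S.α := S.hαper
theorem perJ : Per S.J := S.hJper
theorem perK : Per S.K := S.hKper
theorem pera : Per S.a := fun t θ => by simp only [a, S.hαper]
theorem perh : Per S.h := fun t θ => by simp only [h, pera t θ]
theorem perB : Per S.B := fun t θ => by simp only [B, pera t θ, perν.pθ t θ, perα.pθ t θ]

theorem q_eq (ht : t ∈ Ioo S.tp S.ti) (θ : ℝ) : pt S.α t θ = - S.q t θ * S.α t θ := by
  have h1 := S.halt t (mem_Ioc ht) θ
  simp only [abs_v0] at h1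
  rw [div_eq_iff (αpos ht θ).ne'] at h1
  rw [h1, q, p, r]
  simp only [mu, a]
  ring

theorem smq : Sm S.tp S.ti S.q :=
  (((smα.pt.div smα fun t ht θ => (αpos ht θ).ne').neg).congr fun t ht θ => by
    rw [q_eq ht, neg_mul, neg_div, mul_div_cancel_right₀ _ (αpos ht θ).ne', neg_neg])

theorem pt_a (ht : t ∈ Ioo S.tp S.ti) (θ : ℝ) : pt S.a t θ = - S.q t θ / 2 * S.a t θ := by
  have h1 : HasDerivAt (fun s => S.a s θ) (pt S.α t θ / (2 * Real.sqrt (S.α t θ))) t :=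
    (smα.dt ht θ).sqrt (αpos ht θ).ne'
  rw [pt, h1.deriv, q_eq ht, ← a_sq ht, Real.sqrt_sq (apos ht θ).le]
  have := (apos ht θ).ne'
  field_simp

theorem pt_h (ht : t ∈ Ioo S.tp S.ti) (θ : ℝ) : pt S.h t θ = S.q t θ / 2 * S.h t θ := by
  have h1 := (sma.dt ht θ).inv (apos ht θ).ne'
  rw [pt, show (fun s => S.h s θ) = (fun s => S.a s θ)⁻¹ from rfl, h1.deriv, pt_a ht, h]
  have := (apos ht θ).ne'
  field_simp

theorem pθ_a (ht : t ∈ Ioo S.tp S.ti) (θ : ℝ) : pθ S.a t θ = pθ S.α t θ / (2 * S.a t θ) :=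
  ((smα.dθ ht θ).sqrt (αpos ht θ).ne').deriv

theorem pt_ν (ht : t ∈ Ioo S.tp S.ti) (θ : ℝ) :
    pt S.ν t θ = t * (pt S.U t θ ^ 2 + (S.a t θ * pθ S.U t θ) ^ 2
      + Real.exp (4 * S.U t θ) / (4 * t ^ 2) * (pt S.A t θ ^ 2 + (S.a t θ * pθ S.A t θ) ^ 2))
      + S.p t θ / 4 + S.rho t θ := by
  have h1 := S.hnut t (mem_Ioc ht) θ
  simp only [abs_v0] at h1
  rw [h1, p, rho, mul_pow, mul_pow, a_sq ht, a]
  have := tpos ht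
  field_simp
  ring

theorem B_eq (ht : t ∈ Ioo S.tp S.ti) (θ : ℝ) :
    S.B t θ = 2 * t * (pt S.U t θ * (S.a t θ * pθ S.U t θ)
      + Real.exp (4 * S.U t θ) / (4 * t ^ 2) * (pt S.A t θ * (S.a t θ * pθ S.A t θ)))
      - S.j t θ := by
  have h1 := S.hnuth t (mem_Ioc ht) θ
  rw [B, h1, j, ← a_sq ht, a, Real.sqrt_sq (Real.sqrt_nonneg _)]
  have h2 : Real.sqrt (S.α t θ) ≠ 0 := (apos ht θ).ne'
  have := tpos ht
  generalize Real.sqrt (S.α t θ) = x at *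
  field_simp
  ring

theorem pθ_aθ {W : ℝ → ℝ → ℝ} (hW : Sm S.tp S.ti W) (ht : t ∈ Ioo S.tp S.ti) (θ : ℝ) :
    S.a t θ * pθ (fun t θ => S.a t θ * pθ W t θ) t θ
      = S.α t θ * pθ (pθ W) t θ + pθ S.α t θ * pθ W t θ / 2 := by
  have h1 := ((sma.dθ ht θ).mul (hW.pθ.dθ ht θ)).deriv
  have h2 : pθ (fun t θ => S.a t θ * pθ W t θ) t θ
    = pθ S.a t θ * pθ W t θ + S.a t θ * pθ (pθ W) t θ := h1
  rw [h2, pθ_a ht, ← a_sq ht]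
  have := (apos ht θ).ne'
  field_simp
  ring

theorem eqU (ht : t ∈ Ioo S.tp S.ti) (θ : ℝ) :
    pt (pt S.U) t θ = S.a t θ * pθ (fun t θ => S.a t θ * pθ S.U t θ) t θ
      - pt S.U t θ / t - S.q t θ / 2 * pt S.U t θ
      + Real.exp (4 * S.U t θ) / (2 * t ^ 2) * (pt S.A t θ ^ 2 - (S.a t θ * pθ S.A t θ) ^ 2)
      + S.α t θ * Real.exp (2 * S.ν t θ - 4 * S.U t θ) / (2 * t ^ 2) * S.J t θ ^ 2
      + S.SU t θ := by
  have h1 := S.hutt t (mem_Ioc ht) θ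
  simp only [abs_v0] at h1
  rw [h1, pθ_aθ smU ht, mul_pow, a_sq ht, SU, q_eq ht, a]
  have h3 := (αpos ht θ).ne'
  field_simp
  ring

theorem eqA (ht : t ∈ Ioo S.tp S.ti) (θ : ℝ) :
    pt (pt S.A) t θ = S.a t θ * pθ (fun t θ => S.a t θ * pθ S.A t θ) t θ
      + pt S.A t θ / t - S.q t θ / 2 * pt S.A t θ
      - 4 * (pt S.A t θ * pt S.U t θ - (S.a t θ * pθ S.A t θ) * (S.a t θ * pθ S.U t θ))
      + S.α t θ * Real.exp (2 * S.ν t θ - 4 * S.U t θ) / t ^ 2 * S.J t θ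
        * (S.K t θ - S.A t θ * S.J t θ)
      + S.SA t θ := by
  have h1 := S.hatt t (mem_Ioc ht) θ
  simp only [abs_v0] at h1
  have h4 : (S.a t θ * pθ S.A t θ) * (S.a t θ * pθ S.U t θ)
    = S.α t θ * pθ S.A t θ * pθ S.U t θ := by rw [← a_sq ht]; ring
  rw [h1, pθ_aθ smA ht, h4, SA, q_eq ht, a]
  have h3 := (αpos ht θ).ne'
  field_simp
  ring

theorem eqν (ht : t ∈ Ioo S.tp S.ti) (θ : ℝ) :
    pt (pt S.ν) t θ = S.a t θ * pθ S.B t θ - S.q t θ / 2 * pt S.ν t θ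
      - pt S.U t θ ^ 2 + (S.a t θ * pθ S.U t θ) ^ 2
      + Real.exp (4 * S.U t θ) / (4 * t ^ 2) * (pt S.A t θ ^ 2 - (S.a t θ * pθ S.A t θ) ^ 2)
      - S.α t θ * Real.exp (2 * S.ν t θ - 4 * S.U t θ) * S.J t θ ^ 2 / (4 * t ^ 2)
      - 3 * S.α t θ * Real.exp (2 * S.ν t θ) * (S.K t θ - S.A t θ * S.J t θ) ^ 2 / (4 * t ^ 4)
      - S.s3 t θ := by
  have h1 := S.hnutt t (mem_Ioc ht) θ
  simp only [abs_v0] at h1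
  have ha := (apos ht θ).ne'
  have h2 : pθ S.B t θ = pθ S.a t θ * pθ S.ν t θ + S.a t θ * pθ (pθ S.ν) t θ +
      (pθ (pθ S.α) t θ * (2 * S.a t θ) - pθ S.α t θ * (2 * pθ S.a t θ)) / (2 * S.a t θ) ^ 2 :=
    (((sma.dθ ht θ).mul (smν.pθ.dθ ht θ)).add
      ((smα.pθ.dθ ht θ).div ((sma.dθ ht θ).const_mul 2) (mul_ne_zero two_ne_zero ha))).deriv
  have h4 : S.a t θ * pθ S.B t θ = S.α t θ * pθ (pθ S.ν) t θ + pθ S.α t θ * pθ S.ν t θ / 2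
      + pθ (pθ S.α) t θ / 2 - pθ S.α t θ ^ 2 / (4 * S.α t θ) := by
    rw [h2, pθ_a ht, ← a_sq ht]
    field_simp
    ring
  rw [h1, h4, mul_pow, mul_pow, a_sq ht, s3, q_eq ht, a]
  have h3 := (αpos ht θ).ne'
  field_simp
  ring

end EV

/-! ### Pointwise inequalities for the matter quantities -/

namespace EV

variable {S : EV} {t θ : ℝ}

theorem mu_pos (t θ : ℝ) (v : V3) : 0 < S.mu t θ v := by
  unfold mu
  have := Real.exp_pos (-2 * S.U t θ)
  positivity

theorem Q_pos' (ht : t ∈ Ioc S.tp S.ti) (θ : ℝ) (v : V3) : 0 < S.Q t θ v := by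
  have h1 := mu_pos (S := S) t θ v
  have h2 := S.hαpos t ht θ
  unfold Q
  positivity

theorem w_pos' (ht : t ∈ Ioc S.tp S.ti) (θ : ℝ) (v : V3) : 0 < S.w t θ v :=
  Real.sqrt_pos.2 (Q_pos' ht θ v)

theorem w_sq' (ht : t ∈ Ioc S.tp S.ti) (θ : ℝ) (v : V3) :
    S.w t θ v ^ 2 = S.α t θ * v.1 ^ 2 + S.α t θ * Real.exp (2 * S.ν t θ) * S.mu t θ v := by
  rw [w, Real.sq_sqrt (Q_pos' ht θ v).le, Q]; ring

theorem cont_mu (t θ : ℝ) : Continuous fun v => S.mu t θ v := by unfold mu; fun_prop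

theorem cont_w (t θ : ℝ) : Continuous fun v => S.w t θ v := by
  have := cont_mu (S := S) t θ
  unfold w Q; fun_prop

theorem cont_f (ht : t ∈ Ioc S.tp S.ti) (θ : ℝ) : Continuous fun v => S.f t θ v :=
  S.hfsm.continuousOn.comp_continuous (f := fun v : V3 => ((t, θ, v) : ℝ × ℝ × V3))
    (by fun_prop) fun v => ⟨ht, mem_univ _⟩

theorem supp_f (ht : t ∈ Ioc S.tp S.ti) (θ : ℝ) : HasCompactSupport fun v => S.f t θ v := by
  obtain ⟨R, hR⟩ := S.hfsupp t ht
  refine HasCompactSupport.of_support_subset_isCompact (isCompact_closedBall (0:V3) R) ?_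
  intro v hv
  by_contra hc
  exact hv (hR θ v (by simpa using hc))

theorem integrable_f (ht : t ∈ Ioc S.tp S.ti) (θ : ℝ) {g : V3 → ℝ} (hg : Continuous g) :
    Integrable fun v => S.f t θ v * g v :=
  ((cont_f ht θ).mul hg).integrable_of_hasCompactSupport ((supp_f ht θ).mul_right)

theorem integral_f_mono (ht : t ∈ Ioc S.tp S.ti) (θ : ℝ) {g k : V3 → ℝ} (hg : Continuous g)
    (hk : Continuous k) {c d : ℝ} (h : ∀ v, c * g v ≤ d * k v) :
    c * ∫ v, S.f t θ v * g v ≤ d * ∫ v, S.f t θ v * k v := by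
  rw [← integral_const_mul, ← integral_const_mul]
  refine integral_mono ((integrable_f ht θ hg).const_mul c) ((integrable_f ht θ hk).const_mul d) ?_
  intro v
  have := mul_le_mul_of_nonneg_left (h v) (S.hfnn t ht θ v)
  simp only
  linarith

theorem integral_f_nonneg (ht : t ∈ Ioc S.tp S.ti) (θ : ℝ) {g : V3 → ℝ} (h : ∀ v, 0 ≤ g v) :
    0 ≤ ∫ v, S.f t θ v * g v :=
  integral_nonneg fun v => mul_nonneg (S.hfnn t ht θ v) (h v)

theorem cont_div_w (ht : t ∈ Ioc S.tp S.ti) (θ : ℝ) {g : V3 → ℝ} (hg : Continuous g) :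
    Continuous fun v => g v / S.w t θ v :=
  hg.div (cont_w t θ) fun v => (w_pos' ht θ v).ne'

theorem a_v1_le (ht : t ∈ Ioc S.tp S.ti) (θ : ℝ) (v : V3) : S.a t θ * |v.1| ≤ S.w t θ v := by
  refine abs_le_of_sq_le_sq' ?_ (w_pos' ht θ v).le |>.2
  rw [w_sq' ht, mul_pow, sq_abs, a_sq' ht]
  have h1 := mu_pos (S := S) t θ v
  have h2 := S.hαpos t ht θ
  have : 0 < S.α t θ * Real.exp (2 * S.ν t θ) * S.mu t θ v := by positivity
  linarith

theorem rho_nonneg (ht : t ∈ Ioc S.tp S.ti) (θ : ℝ) : 0 ≤ S.rho t θ :=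
  mul_nonneg (apos' ht θ).le (integral_f_nonneg ht θ fun v => (w_pos' ht θ v).le)

theorem n_nonneg (ht : t ∈ Ioc S.tp S.ti) (θ : ℝ) : 0 ≤ S.n t θ :=
  integral_nonneg fun v => S.hfnn t ht θ v

theorem j_abs_le (ht : t ∈ Ioc S.tp S.ti) (θ : ℝ) : |S.j t θ| ≤ S.rho t θ := by
  have hw := cont_w (S := S) t θ
  have ha := apos' ht θ
  have key := fun v => a_v1_le ht θ v
  rw [abs_le, j, rho]
  constructor
  · rw [neg_le, ← neg_mul]
    refine integral_f_mono ht θ (by fun_prop) hw fun v => ?_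
    rw [← a_sq' ht]
    nlinarith [key v, neg_abs_le v.1, mul_le_mul_of_nonneg_left (key v) ha.le]
  · refine integral_f_mono ht θ (by fun_prop) hw fun v => ?_
    rw [← a_sq' ht]
    nlinarith [key v, le_abs_self v.1, mul_le_mul_of_nonneg_left (key v) ha.le]

theorem r_nonneg (ht : t ∈ Ioc S.tp S.ti) (θ : ℝ) : 0 ≤ S.r t θ := by
  have h1 := S.hαpos t ht θ
  have h2 := apos' ht θ
  have h3 : 0 ≤ ∫ v : V3, S.f t θ v * S.mu t θ v / S.w t θ v := by
    simp only [mul_div_assoc]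
    exact integral_f_nonneg ht θ fun v => div_nonneg (mu_pos t θ v).le (w_pos' ht θ v).le
  unfold r
  positivity

theorem r_le_aux (ht : t ∈ Ioc S.tp S.ti) (θ : ℝ) {σ : ℝ} (hσ : |σ| ≤ 1) :
    S.r t θ ≤ 2 * (S.rho t θ - σ * S.j t θ) := by
  have hw := cont_w (S := S) t θ
  have hmu := cont_mu (S := S) t θ
  have ha := apos' ht θ
  have e1 : 2 * (S.rho t θ - σ * S.j t θ)
      = 2 * S.a t θ * ∫ v, S.f t θ v * (S.w t θ v - σ * S.a t θ * v.1) := by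
    have : ∀ v, S.f t θ v * (S.w t θ v - σ * S.a t θ * v.1)
      = S.f t θ v * S.w t θ v - σ * S.a t θ * (S.f t θ v * v.1) := fun v => by ring
    simp only [this]
    rw [integral_sub (integrable_f ht θ hw) ((integrable_f ht θ (by fun_prop)).const_mul _),
      integral_const_mul, rho, j, ← a_sq' ht]
    ring
  rw [e1, r]
  simp only [mul_div_assoc]
  refine integral_f_mono ht θ (cont_div_w ht θ hmu) (by fun_prop) fun v => ?_
  have hwp := w_pos' ht θ v
  have hsq := w_sq' ht θ v
  have h1 := a_v1_le ht θ v
  have hm : S.α t θ * Real.exp (2 * S.ν t θ) * S.mu t θ v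
      = (S.w t θ v - S.a t θ * |v.1|) * (S.w t θ v + S.a t θ * |v.1|) := by
    have : S.α t θ * v.1 ^ 2 = (S.a t θ * |v.1|) ^ 2 := by rw [mul_pow, sq_abs, a_sq' ht]
    rw [this] at hsq
    linarith
  have h2 : σ * S.a t θ * v.1 ≤ S.a t θ * |v.1| := by
    have h3 : |σ * v.1| ≤ |v.1| := by
      rw [abs_mul]; exact mul_le_of_le_one_left (abs_nonneg _) hσ
    have := mul_le_mul_of_nonneg_left ((le_abs_self _).trans h3) ha.le
    linarith
  have e2 : S.α t θ * S.a t θ * Real.exp (2 * S.ν t θ) * (S.mu t θ v / S.w t θ v)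
      = S.a t θ * (S.w t θ v - S.a t θ * |v.1|) * ((S.w t θ v + S.a t θ * |v.1|) / S.w t θ v) := by
    calc _ = S.a t θ * (S.α t θ * Real.exp (2 * S.ν t θ) * S.mu t θ v) / S.w t θ v := by ring
      _ = _ := by rw [hm]; ring
  rw [e2]
  have h4 : (S.w t θ v + S.a t θ * |v.1|) / S.w t θ v ≤ 2 := by
    rw [div_le_iff₀ hwp]; linarith
  have h5 : 0 ≤ S.a t θ * (S.w t θ v - S.a t θ * |v.1|) := mul_nonneg ha.le (by linarith)
  calc _ ≤ S.a t θ * (S.w t θ v - S.a t θ * |v.1|) * 2 := mul_le_mul_of_nonneg_left h4 h5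
    _ ≤ _ := by nlinarith

theorem r_le_sub (ht : t ∈ Ioc S.tp S.ti) (θ : ℝ) : S.r t θ ≤ 2 * (S.rho t θ - S.j t θ) := by
  simpa using r_le_aux ht θ (σ := 1) (by simp)
theorem r_le_add (ht : t ∈ Ioc S.tp S.ti) (θ : ℝ) : S.r t θ ≤ 2 * (S.rho t θ + S.j t θ) := by
  simpa using r_le_aux ht θ (σ := -1) (by simp)
theorem r_le (ht : t ∈ Ioc S.tp S.ti) (θ : ℝ) : S.r t θ ≤ 2 * S.rho t θ := by
  simpa using r_le_aux ht θ (σ := 0) (by simp)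

/-- the prefactor common to the matter terms -/
theorem r_eq_mul (t θ : ℝ) : S.r t θ = S.α t θ * S.a t θ * Real.exp (2 * S.ν t θ)
    * ∫ v, S.f t θ v * (S.mu t θ v / S.w t θ v) := by
  simp only [r, mul_div_assoc]

theorem matter_le (ht : t ∈ Ioc S.tp S.ti) (θ : ℝ) {g : V3 → ℝ} (hg : Continuous g) {c d : ℝ}
    (h : ∀ v, c * g v ≤ d * S.mu t θ v) :
    S.α t θ * S.a t θ * Real.exp (2 * S.ν t θ) * c * ∫ v, S.f t θ v * (g v / S.w t θ v)
      ≤ d * S.r t θ := by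
  have h1 := S.hαpos t ht θ
  have h2 := apos' ht θ
  have h0 : 0 < S.α t θ * S.a t θ * Real.exp (2 * S.ν t θ) := by positivity
  have := integral_f_mono ht θ (c := c) (d := d) (cont_div_w ht θ hg)
    (cont_div_w ht θ (cont_mu (S := S) t θ)) fun v => by
      have := div_le_div_of_nonneg_right (h v) (w_pos' ht θ v).le
      rwa [mul_div_assoc, mul_div_assoc] at this
  have := mul_le_mul_of_nonneg_left this h0.le
  rw [r_eq_mul]
  linarith

theorem SU_nonneg (ht : t ∈ Ioc S.tp S.ti) (θ : ℝ) : 0 ≤ S.SU t θ := by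
  have h1 := S.hαpos t ht θ
  have h2 := apos' ht θ
  have h3 := tpos' ht
  have h4 : 0 ≤ ∫ v : V3, S.f t θ v * (1 + 2 * Real.exp (-2 * S.U t θ) * v.2.1 ^ 2) / S.w t θ v := by
    simp only [mul_div_assoc]
    exact integral_f_nonneg ht θ fun v => div_nonneg (by positivity) (w_pos' ht θ v).le
  unfold SU
  positivity

theorem SU_le (ht : t ∈ Ioc S.tp S.ti) (θ : ℝ) : S.SU t θ ≤ S.r t θ / t := by
  have h3 := tpos' ht
  have key := matter_le ht θ (g := fun v => 1 + 2 * Real.exp (-2 * S.U t θ) * v.2.1 ^ 2)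
    (by fun_prop) (c := Real.exp (-2 * S.U t θ) / (2 * t)) (d := 1 / t) (fun v => by
      have e1 : Real.exp (-4 * S.U t θ) = Real.exp (-2 * S.U t θ) * Real.exp (-2 * S.U t θ) := by
        rw [← Real.exp_add]; ring_nf
      unfold mu
      rw [e1, div_mul_eq_mul_div, div_mul_eq_mul_div, div_le_div_iff₀ (by positivity) h3]
      have h5 := Real.exp_pos (-2 * S.U t θ)
      have : 0 ≤ (t ^ 2)⁻¹ * (v.2.2 - S.A t θ * v.2.1) ^ 2 := by positivity
      have : 0 ≤ (2 * ((t ^ 2)⁻¹ * (v.2.2 - S.A t θ * v.2.1) ^ 2) + Real.exp (-2 * S.U t θ)) * t := by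
        positivity
      linarith)
  rw [SU, show 2 * S.ν t θ - 2 * S.U t θ = 2 * S.ν t θ + (-2 * S.U t θ) by ring, Real.exp_add]
  simp only [mul_div_assoc] at key ⊢
  rw [div_eq_mul_one_div (S.r t θ)]
  linarith

theorem s3_nonneg (ht : t ∈ Ioc S.tp S.ti) (θ : ℝ) : 0 ≤ S.s3 t θ := by
  have h1 := S.hαpos t ht θ
  have h2 := apos' ht θ
  have h3 := tpos' ht
  have h4 : 0 ≤ ∫ v : V3, S.f t θ v * (v.2.2 - S.A t θ * v.2.1) ^ 2 / S.w t θ v := by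
    simp only [mul_div_assoc]
    exact integral_f_nonneg ht θ fun v => div_nonneg (by positivity) (w_pos' ht θ v).le
  unfold s3
  positivity

theorem s3_le (ht : t ∈ Ioc S.tp S.ti) (θ : ℝ) : S.s3 t θ ≤ S.r t θ / t := by
  have h3 := tpos' ht
  have key := matter_le ht θ (g := fun v => (v.2.2 - S.A t θ * v.2.1) ^ 2)
    (by fun_prop) (c := 1 / t ^ 3) (d := 1 / t) (fun v => by
      unfold mu
      have h5 := Real.exp_pos (-2 * S.U t θ)
      have : 0 ≤ 1 / t * (Real.exp (-2 * S.U t θ) + Real.exp (-4 * S.U t θ) * v.2.1 ^ 2) := by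
        positivity
      have e : 1 / t ^ 3 * (v.2.2 - S.A t θ * v.2.1) ^ 2
        = 1 / t * ((t ^ 2)⁻¹ * (v.2.2 - S.A t θ * v.2.1) ^ 2) := by field_simp
      linarith)
  rw [s3]
  simp only [mul_div_assoc] at key ⊢
  rw [div_eq_mul_one_div (S.r t θ), div_eq_mul_one_div _ (t ^ 3)]
  linarith

theorem SA_le (ht : t ∈ Ioc S.tp S.ti) (θ : ℝ) :
    Real.exp (2 * S.U t θ) / t * |S.SA t θ| ≤ S.r t θ / t := by
  have h3 := tpos' ht
  have hE : Real.exp (-4 * S.U t θ) = Real.exp (-2 * S.U t θ) * Real.exp (-2 * S.U t θ) := by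
        rw [← Real.exp_add]; ring_nf
  have hE2 : Real.exp (2 * S.U t θ) * Real.exp (-2 * S.U t θ) = 1 := by
        rw [← Real.exp_add]; ring_nf; simp
  have key : ∀ σ : ℝ, |σ| = 1 → Real.exp (2 * S.U t θ) / t * (σ * S.SA t θ) ≤ S.r t θ / t := by
    intro σ hσ
    have hσ2 : σ ^ 2 = 1 := by rw [← sq_abs, hσ, one_pow]
    have := matter_le ht θ (g := fun v => v.2.1 * (v.2.2 - S.A t θ * v.2.1))
      (by fun_prop) (c := σ * (2 * Real.exp (-2 * S.U t θ) / t ^ 2)) (d := 1 / t) (fun v => by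
        unfold mu
        rw [hE]
        generalize v.2.2 - S.A t θ * v.2.1 = y
        generalize v.2.1 = x
        have h5 := Real.exp_pos (-2 * S.U t θ)
        generalize Real.exp (-2 * S.U t θ) = E at *
        have h6 : 0 ≤ 1 / t * ((E * x - σ * y / t) ^ 2 + E) := by positivity
        have e : (E * x - σ * y / t) ^ 2
          = E * E * x ^ 2 + (t ^ 2)⁻¹ * y ^ 2 - 2 * σ * E * x * y / t := by
          have : (t ^ 2)⁻¹ * y ^ 2 = (t ^ 2)⁻¹ * (σ ^ 2 * y ^ 2) := by rw [hσ2]; ring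
          rw [this]; field_simp; ring
        rw [e] at h6
        have e2 : σ * (2 * E / t ^ 2) * (x * y) = 1 / t * (2 * σ * E * x * y / t) := by
          field_simp
        rw [e2]
        linarith)
    rw [SA, show 2 * S.ν t θ - 4 * S.U t θ = 2 * S.ν t θ + (-4 * S.U t θ) by ring, Real.exp_add, hE]
    simp only [mul_div_assoc] at this ⊢
    simp only [mul_assoc] at this ⊢
    generalize (∫ (v : V3), S.f t θ v * (v.2.1 * ((v.2.2 - S.A t θ * v.2.1) / S.w t θ v))) = X at *
    have e3 : Real.exp (2 * S.U t θ) * (1 / t * (σ * (2 * (S.α t θ * (S.a t θ * (Real.exp (2 * S.ν t θ)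
        * (Real.exp (-2 * S.U t θ) * (Real.exp (-2 * S.U t θ) / t * X))))))))
        = (Real.exp (2 * S.U t θ) * Real.exp (-2 * S.U t θ)) * (S.α t θ * (S.a t θ *
        (Real.exp (2 * S.ν t θ) * (σ * (2 * (Real.exp (-2 * S.U t θ) / t ^ 2 * X)))))) := by
      field_simp
    rw [hE2, one_mul] at e3
    rw [div_eq_mul_one_div (S.r t θ)]
    rw [div_eq_mul_one_div (Real.exp (2 * S.U t θ)), mul_assoc, e3]
    linarith
  rcases abs_cases (S.SA t θ) with ⟨h, _⟩ | ⟨h, _⟩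
  · rw [h]; simpa using key 1 (by simp)
  · rw [h]; simpa using key (-1) (by simp)

theorem n_le_rho (ht : t ∈ Ioc S.tp S.ti) (θ : ℝ) :
    S.α t θ * Real.exp (S.ν t θ - S.U t θ) * S.n t θ ≤ S.rho t θ := by
  have hw := cont_w (S := S) t θ
  have ha := apos' ht θ
  have e : S.n t θ = ∫ v, S.f t θ v * 1 := by simp [n]
  rw [rho, e]
  refine integral_f_mono ht θ continuous_const hw fun v => ?_
  have h1 : S.a t θ * Real.exp (S.ν t θ - S.U t θ) ≤ S.w t θ v := by
    refine abs_le_of_sq_le_sq' ?_ (w_pos' ht θ v).le |>.2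
    rw [w_sq' ht, mul_pow, a_sq' ht, ← Real.exp_nat_mul]
    have h2 := S.hαpos t ht θ
    have e2 : Real.exp ((2:ℕ) * (S.ν t θ - S.U t θ))
      = Real.exp (2 * S.ν t θ) * Real.exp (-2 * S.U t θ) := by
      rw [← Real.exp_add]; congr 1; push_cast; ring
    rw [e2, mul_assoc]
    have h3 : Real.exp (-2 * S.U t θ) ≤ S.mu t θ v := by
      unfold mu
      have : 0 ≤ Real.exp (-4 * S.U t θ) * v.2.1 ^ 2
        + (t ^ 2)⁻¹ * (v.2.2 - S.A t θ * v.2.1) ^ 2 := by positivity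
      linarith
    have h4 : Real.exp (2 * S.ν t θ) * Real.exp (-2 * S.U t θ)
        ≤ Real.exp (2 * S.ν t θ) * S.mu t θ v := by gcongr
    have h5 := mul_le_mul_of_nonneg_left h4 h2.le
    have : 0 ≤ S.α t θ * v.1 ^ 2 := by positivity
    linarith
  rw [← a_sq' ht]
  have := mul_le_mul_of_nonneg_left h1 ha.le
  linarith

end EV

/-! ### Transport along characteristics -/

namespace EV

open Filter Topology

variable {S : EV} {t θ : ℝ}

variable (S) in
/-- the mass-shell part `α e^{2ν} μ` of `v₀²` -/
def m2 (v : V3) (t θ : ℝ) : ℝ := S.α t θ * Real.exp (2 * S.ν t θ) * S.mu t θ v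
variable (S) in
/-- spatial velocity of the characteristics -/
def a1 (t θ : ℝ) (v : V3) : ℝ := S.α t θ * v.1 / S.w t θ v
variable (S) in
/-- the magnetic part of the force -/
def F1 (t θ : ℝ) (v : V3) : ℝ :=
  S.a t θ * Real.exp (2 * S.ν t θ) / t ^ 3 * (S.K t θ - S.A t θ * S.J t θ)
      * (v.2.2 - S.A t θ * v.2.1)
    + S.a t θ * Real.exp (2 * S.ν t θ - 4 * S.U t θ) / t * S.J t θ * v.2.1
variable (S) in
/-- the force in direction `v₁` -/
def bF (t θ : ℝ) (v : V3) : ℝ :=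
  - (pθ S.α t θ * v.1 ^ 2 + pθ (S.m2 v) t θ) / (2 * S.w t θ v) + S.F1 t θ v
variable (S) in
/-- growth rate in the bounds for the squared velocity -/
def Lq (t θ : ℝ) : ℝ :=
  4 * |pt S.U t θ| + 2 / t + |pt S.A t θ| * Real.exp (2 * S.U t θ) / t
    + S.a t θ * Real.exp (S.ν t θ) * (|S.K t θ - S.A t θ * S.J t θ| / t ^ 2
      + Real.exp (-2 * S.U t θ) * |S.J t θ| / t)

theorem smmu (v : V3) : Sm S.tp S.ti (fun t θ => S.mu t θ v) :=
  ((((Sm.const (-2)).mul smU).exp).add ((((Sm.const (-4)).mul smU).exp).mul (Sm.const _))).add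
    (((Sm.time.pow 2).inv fun t ht _ => (pow_pos (tpos ht) 2).ne').mul
      (((Sm.const _).sub (smA.mul (Sm.const _))).pow 2))

theorem smm2 (v : V3) : Sm S.tp S.ti (S.m2 v) :=
  (smα.mul ((Sm.const 2).mul smν).exp).mul (smmu v)

theorem m2_pos (ht : t ∈ Ioc S.tp S.ti) (θ : ℝ) (v : V3) : 0 < S.m2 v t θ :=
  mul_pos (mul_pos (S.hαpos t ht θ) (Real.exp_pos _)) (mu_pos _ _ _)

theorem w_sq (ht : t ∈ Ioc S.tp S.ti) (θ : ℝ) (v : V3) :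
    S.w t θ v ^ 2 = S.α t θ * v.1 ^ 2 + S.m2 v t θ := w_sq' ht θ v

theorem Q_eq (t θ : ℝ) (v : V3) : S.Q t θ v = S.α t θ * v.1 ^ 2 + S.m2 v t θ := by
  unfold Q m2; ring

theorem v0_dθ (ht : t ∈ Ioo S.tp S.ti) (θ : ℝ) (v : V3) :
    deriv (fun x => v0 S.α S.ν S.U S.A t x v) θ
      = - (pθ S.α t θ * v.1 ^ 2 + pθ (S.m2 v) t θ) / (2 * S.w t θ v) := by
  have h1 : HasDerivAt (fun x => S.α t x * v.1 ^ 2 + S.m2 v t x)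
      (pθ S.α t θ * v.1 ^ 2 + pθ (S.m2 v) t θ) θ :=
    ((smα.dθ ht θ).mul_const _).add ((smm2 v).dθ ht θ)
  have h2 : S.α t θ * v.1 ^ 2 + S.m2 v t θ ≠ 0 := by
    rw [← Q_eq]; exact (Q_pos' (mem_Ioc ht) θ v).ne'
  have h3 := (h1.sqrt h2).neg.deriv
  have e : (fun x => v0 S.α S.ν S.U S.A t x v) = -fun x => Real.sqrt (S.α t x * v.1 ^ 2 + S.m2 v t x) := by
    funext x; rw [v0_eq, w, Q_eq]; rfl
  rw [e, h3, w, Q_eq, neg_div]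

theorem pv1_v0 (ht : t ∈ Ioc S.tp S.ti) (θ : ℝ) (v : V3) :
    pv1 (v0 S.α S.ν S.U S.A t θ) v = - S.a1 t θ v := by
  have h1 : HasDerivAt (fun y => S.α t θ * y ^ 2 + S.m2 v t θ) (S.α t θ * (2 * v.1)) v.1 := by
    simpa using ((hasDerivAt_pow 2 v.1).const_mul (S.α t θ)).add_const (S.m2 v t θ)
  have h2 : S.α t θ * v.1 ^ 2 + S.m2 v t θ ≠ 0 := by
    rw [← Q_eq]; exact (Q_pos' ht θ v).ne'
  have h3 := (h1.sqrt h2).neg.deriv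
  have e : (fun y => v0 S.α S.ν S.U S.A t θ (y, v.2.1, v.2.2))
      = -fun y => Real.sqrt (S.α t θ * y ^ 2 + S.m2 v t θ) := by
    funext x; rw [v0_eq, w, Q_eq]; rfl
  rw [pv1, e, h3, a1, w, Q_eq]
  field_simp

theorem vlasov (ht : t ∈ Ioo S.tp S.ti) (θ : ℝ) (v : V3) :
    ptf S.f t θ v = - S.a1 t θ v * pθf S.f t θ v - S.bF t θ v * pv1 (S.f t θ) v := by
  rw [S.hvlasov t (mem_Ioc ht), pv1_v0 (mem_Ioc ht), v0_dθ ht, bF, F1, a]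
  ring

/-- the distribution function on the product space -/
def fu (S : EV) (x : ℝ × ℝ × V3) : ℝ := S.f x.1 x.2.1 x.2.2

theorem fu_contDiffAt (ht : t ∈ Ioo S.tp S.ti) (θ : ℝ) (v : V3) :
    ContDiffAt ℝ (⊤ : ℕ∞) S.fu (t, θ, v) :=
  ContDiffOn.contDiffAt S.hfsm (Filter.mem_of_superset
    ((isOpen_Ioo.prod isOpen_univ).mem_nhds (show (t, θ, v) ∈ Ioo S.tp S.ti ×ˢ univ from ⟨ht, mem_univ _⟩))
    (prod_mono Ioo_subset_Ioc_self Subset.rfl))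

theorem fu_diff (ht : t ∈ Ioo S.tp S.ti) (θ : ℝ) (v : V3) : DifferentiableAt ℝ S.fu (t, θ, v) :=
  (fu_contDiffAt ht θ v).differentiableAt (by simp)

theorem fu_line (ht : t ∈ Ioo S.tp S.ti) (θ : ℝ) (v : V3) (d : ℝ × ℝ × V3) :
    HasDerivAt (fun s : ℝ => S.f (t + s * d.1) (θ + s * d.2.1)
      (v.1 + s * d.2.2.1, v.2.1 + s * d.2.2.2.1, v.2.2 + s * d.2.2.2.2))
      (fderiv ℝ S.fu (t, θ, v) d) 0 := by
  have aux : ∀ x y : ℝ, HasDerivAt (fun s : ℝ => x + s * y) y 0 := fun x y => by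
    simpa using ((hasDerivAt_id (0:ℝ)).mul_const y).const_add x
  have h1 : HasDerivAt (fun s : ℝ => ((t + s * d.1, θ + s * d.2.1,
      (v.1 + s * d.2.2.1, v.2.1 + s * d.2.2.2.1, v.2.2 + s * d.2.2.2.2)) : ℝ × ℝ × V3)) d 0 :=
    (aux _ _).prodMk ((aux _ _).prodMk ((aux _ _).prodMk ((aux _ _).prodMk (aux _ _))))
  have h2 : HasFDerivAt S.fu (fderiv ℝ S.fu (t, θ, v)) ((fun s : ℝ => ((t + s * d.1, θ + s * d.2.1,
      (v.1 + s * d.2.2.1, v.2.1 + s * d.2.2.2.1, v.2.2 + s * d.2.2.2.2)) : ℝ × ℝ × V3)) 0) := by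
    simpa using (fu_diff ht θ v).hasFDerivAt
  exact h2.comp_hasDerivAt (0:ℝ) h1

theorem deriv_line (g : ℝ → ℝ) {x d : ℝ} (h : HasDerivAt (fun s : ℝ => g (x + s)) d 0) :
    deriv g x = d := by
  have h0 : HasDerivAt (fun y : ℝ => y - x) 1 x := (hasDerivAt_id x).sub_const x
  have h1 : HasDerivAt (fun s : ℝ => g (x + s)) d ((fun y : ℝ => y - x) x) := by simpa using h
  have h2 := HasDerivAt.comp (h₂ := fun s : ℝ => g (x + s)) (h := fun y : ℝ => y - x) x h1 h0
  have e : ((fun s : ℝ => g (x + s)) ∘ fun y : ℝ => y - x) = g := by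
    funext y; simp
  rw [e, mul_one] at h2
  exact h2.deriv

theorem fu_dt (ht : t ∈ Ioo S.tp S.ti) (θ : ℝ) (v : V3) :
    ptf S.f t θ v = fderiv ℝ S.fu (t, θ, v) (1, 0) :=
  deriv_line _ (by simpa using fu_line ht θ v (1, 0))
theorem fu_dθ (ht : t ∈ Ioo S.tp S.ti) (θ : ℝ) (v : V3) :
    pθf S.f t θ v = fderiv ℝ S.fu (t, θ, v) (0, 1, 0) :=
  deriv_line _ (by simpa using fu_line ht θ v (0, 1, 0))
theorem fu_d1 (ht : t ∈ Ioo S.tp S.ti) (θ : ℝ) (v : V3) :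
    pv1 (S.f t θ) v = fderiv ℝ S.fu (t, θ, v) (0, 0, 1, 0) :=
  deriv_line (fun y => S.f t θ (y, v.2.1, v.2.2)) (by simpa using fu_line ht θ v (0, 0, 1, 0))
theorem fu_d2 (ht : t ∈ Ioo S.tp S.ti) (θ : ℝ) (v : V3) :
    pv2 (S.f t θ) v = fderiv ℝ S.fu (t, θ, v) (0, 0, 0, 1, 0) :=
  deriv_line (fun y => S.f t θ (v.1, y, v.2.2)) (by simpa using fu_line ht θ v (0, 0, 0, 1, 0))
theorem fu_d3 (ht : t ∈ Ioo S.tp S.ti) (θ : ℝ) (v : V3) :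
    pv3 (S.f t θ) v = fderiv ℝ S.fu (t, θ, v) (0, 0, 0, 0, 1) :=
  deriv_line (fun y => S.f t θ (v.1, v.2.1, y)) (by simpa using fu_line ht θ v (0, 0, 0, 0, 1))

/-- the transport direction -/
def dir (S : EV) (t θ : ℝ) (v : V3) : ℝ × ℝ × V3 := (1, S.a1 t θ v, S.bF t θ v, 0, 0)

theorem fu_dir (ht : t ∈ Ioo S.tp S.ti) (θ : ℝ) (v : V3) :
    fderiv ℝ S.fu (t, θ, v) (S.dir t θ v) = 0 := by
  have e : S.dir t θ v = (1, 0) + S.a1 t θ v • (0, 1, 0) + S.bF t θ v • (0, 0, 1, 0) := by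
    simp [dir]
  rw [e, map_add, map_add, map_smul, map_smul, ← fu_dt ht, ← fu_dθ ht, ← fu_d1 ht, vlasov ht]
  simp only [smul_eq_mul]
  ring

theorem f_path (ht : t ∈ Ioo S.tp S.ti) (θ : ℝ) (v : V3) :
    HasDerivAt (fun s : ℝ => S.f (t + s) (θ + s * S.a1 t θ v) (v.1 + s * S.bF t θ v, v.2)) 0 0 := by
  have := fu_line ht θ v (S.dir t θ v)
  rw [fu_dir ht] at this
  simpa [dir] using this

variable (S) in
/-- derivative of the squared velocity along characteristics -/
def DQ (t θ : ℝ) (v : V3) : ℝ :=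
  pt S.α t θ * v.1 ^ 2 + pt (S.m2 v) t θ + 2 * S.α t θ * v.1 * S.F1 t θ v

theorem Q_path (ht : t ∈ Ioo S.tp S.ti) (θ : ℝ) (v : V3) :
    HasDerivAt (fun s : ℝ => S.Q (t + s) (θ + s * S.a1 t θ v) (v.1 + s * S.bF t θ v, v.2))
      (S.DQ t θ v) 0 := by
  have h1 := smα.dpath ht θ (S.a1 t θ v)
  have h2 := (smm2 v).dpath ht θ (S.a1 t θ v)
  have h3 : HasDerivAt (fun s : ℝ => v.1 + s * S.bF t θ v) (S.bF t θ v) 0 := by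
    simpa using ((hasDerivAt_id (0:ℝ)).mul_const (S.bF t θ v)).const_add v.1
  have h4 := (h1.mul (h3.pow 2)).add h2
  have e : (fun s : ℝ => S.Q (t + s) (θ + s * S.a1 t θ v) (v.1 + s * S.bF t θ v, v.2))
    = (fun s => S.α (t + s) (θ + s * S.a1 t θ v)) * (fun s : ℝ => v.1 + s * S.bF t θ v) ^ 2
      + fun s => S.m2 v (t + s) (θ + s * S.a1 t θ v) := by
    funext s; rw [Q_eq]; rfl
  rw [e]
  refine h4.congr_deriv (Eq.symm ?_)
  have hw := (w_pos' (mem_Ioc ht) θ v).ne'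
  simp only [DQ, bF, a1, Pi.pow_apply, add_zero, zero_mul]
  field_simp
  push_cast
  ring

theorem pt_mu_eq (ht : t ∈ Ioo S.tp S.ti) (θ : ℝ) (v : V3) :
    pt (fun t θ => S.mu t θ v) t θ = -2 * pt S.U t θ * Real.exp (-2 * S.U t θ)
      - 4 * pt S.U t θ * (Real.exp (-4 * S.U t θ) * v.2.1 ^ 2)
      - 2 / t * ((t ^ 2)⁻¹ * (v.2.2 - S.A t θ * v.2.1) ^ 2)
      - 2 * pt S.A t θ * ((t ^ 2)⁻¹ * (v.2.2 - S.A t θ * v.2.1) * v.2.1) := by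
  have h0 := (tpos ht).ne'
  have h1 := ((smU.dt ht θ).const_mul (-2)).exp
  have h2 := (((smU.dt ht θ).const_mul (-4)).exp).mul_const (v.2.1 ^ 2)
  have h3 := (((hasDerivAt_id t).pow 2).inv (pow_ne_zero 2 h0)).mul
    ((((smA.dt ht θ).mul_const v.2.1).const_sub v.2.2).pow 2)
  have h4 := ((h1.add h2).add h3).deriv
  refine h4.trans ?_
  simp
  field_simp
  ring

theorem abs_pt_mu_le (ht : t ∈ Ioo S.tp S.ti) (θ : ℝ) (v : V3) :
    |pt (fun t θ => S.mu t θ v) t θ| ≤ (4 * |pt S.U t θ| + 2 / t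
      + |pt S.A t θ| * Real.exp (2 * S.U t θ) / t) * S.mu t θ v := by
  have h0 := tpos ht
  rw [pt_mu_eq ht, mu]
  have hE : Real.exp (-4 * S.U t θ) = Real.exp (-2 * S.U t θ) * Real.exp (-2 * S.U t θ) := by
        rw [← Real.exp_add]; ring_nf
  have hE2 : Real.exp (2 * S.U t θ) * Real.exp (-2 * S.U t θ) = 1 := by
        rw [← Real.exp_add]; ring_nf; simp
  rw [hE]
  generalize v.2.2 - S.A t θ * v.2.1 = y
  generalize v.2.1 = x
  have hp := Real.exp_pos (-2 * S.U t θ)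
  have hp2 := Real.exp_pos (2 * S.U t θ)
  generalize Real.exp (-2 * S.U t θ) = E at *
  generalize Real.exp (2 * S.U t θ) = D at *
  generalize pt S.U t θ = u
  generalize pt S.A t θ = z
  have hz : |2 * z * ((t ^ 2)⁻¹ * y * x)| ≤ |z| * D / t * (E * E * x ^ 2 + (t ^ 2)⁻¹ * y ^ 2) := by
    have e1 : |2 * z * ((t ^ 2)⁻¹ * y * x)| = |z| * D / t * (2 * (E * |x|) * (|y| / t)) := by
      rw [abs_mul, abs_mul, abs_mul, abs_mul, abs_two, abs_of_pos (inv_pos.2 (pow_pos h0 2))]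
      have : |z| * D / t * (2 * (E * |x|) * (|y| / t)) = (D * E) * (|z| * (2 * |x| * |y|) / t ^ 2) := by
        field_simp
      rw [this, hE2]
      field_simp
    rw [e1]
    have e2 : E * E * x ^ 2 + (t ^ 2)⁻¹ * y ^ 2 = (E * |x|) ^ 2 + (|y| / t) ^ 2 := by
      rw [mul_pow, div_pow, sq_abs, sq_abs]; field_simp
    rw [e2]
    refine mul_le_mul_of_nonneg_left (two_mul_le_add_sq _ _) (by positivity)
  have hA : |-2 * u * E| ≤ 4 * |u| * E := by
    rw [abs_mul, abs_mul, abs_of_pos hp]; norm_num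
    have := abs_nonneg u; nlinarith [mul_nonneg this hp.le]
  have hB : |4 * u * (E * E * x ^ 2)| ≤ 4 * |u| * (E * E * x ^ 2) := by
    rw [abs_mul, abs_mul, abs_of_nonneg (by positivity : 0 ≤ E * E * x ^ 2)]; norm_num
  have hC : |2 / t * ((t ^ 2)⁻¹ * y ^ 2)| ≤ 2 / t * ((t ^ 2)⁻¹ * y ^ 2) := by
    rw [abs_of_nonneg (by positivity)]
  have hsum := (abs_sub _ _).trans (add_le_add ((abs_sub _ _).trans (add_le_add
    ((abs_sub _ _).trans (add_le_add hA hB)) hC)) hz)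
  refine hsum.trans ?_
  have e3 : 0 ≤ 4 * |u| * ((t ^ 2)⁻¹ * y ^ 2) := by positivity
  have e4 : 0 ≤ 2 / t * (E + E * E * x ^ 2) := by positivity
  have e5 : 0 ≤ |z| * D / t * E := by positivity
  linarith

theorem pt_m2 (ht : t ∈ Ioo S.tp S.ti) (θ : ℝ) (v : V3) :
    pt (S.m2 v) t θ = (-S.q t θ + 2 * pt S.ν t θ) * S.m2 v t θ
      + S.α t θ * Real.exp (2 * S.ν t θ) * pt (fun t θ => S.mu t θ v) t θ := by
  have h1 := (((smα.dt ht θ).mul ((smν.dt ht θ).const_mul 2).exp).mul ((smmu v).dt ht θ)).deriv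
  refine h1.trans ?_
  simp only [Pi.mul_apply, q_eq ht, m2]
  ring

theorem F1_abs_le (ht : t ∈ Ioo S.tp S.ti) (θ : ℝ) (v : V3) :
    |F1 S t θ v| ≤ S.a t θ * Real.exp (2 * S.ν t θ) * (|S.K t θ - S.A t θ * S.J t θ| / t ^ 2
      + Real.exp (-2 * S.U t θ) * |S.J t θ| / t) * Real.sqrt (S.mu t θ v) := by
  have h0 := tpos ht
  have ha := apos ht θ
  have hE : Real.exp (-4 * S.U t θ) = Real.exp (-2 * S.U t θ) * Real.exp (-2 * S.U t θ) := by
        rw [← Real.exp_add]; ring_nf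
  have hy : |v.2.2 - S.A t θ * v.2.1| / t ≤ Real.sqrt (S.mu t θ v) := by
    apply Real.le_sqrt_of_sq_le
    rw [div_pow, sq_abs, mu, div_eq_inv_mul]
    have : 0 ≤ Real.exp (-2 * S.U t θ) + Real.exp (-4 * S.U t θ) * v.2.1 ^ 2 := by positivity
    linarith
  have hx : Real.exp (-2 * S.U t θ) * |v.2.1| ≤ Real.sqrt (S.mu t θ v) := by
    apply Real.le_sqrt_of_sq_le
    rw [mul_pow, sq_abs, mu, hE]
    have : 0 ≤ Real.exp (-2 * S.U t θ) + (t ^ 2)⁻¹ * (v.2.2 - S.A t θ * v.2.1) ^ 2 := by positivity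
    linarith
  rw [F1, show 2 * S.ν t θ - 4 * S.U t θ = 2 * S.ν t θ + (-4 * S.U t θ) by ring, Real.exp_add, hE]
  have hp := Real.exp_pos (-2 * S.U t θ)
  have hp2 := Real.exp_pos (2 * S.ν t θ)
  refine (abs_add_le _ _).trans ?_
  have e1 : |S.a t θ * Real.exp (2 * S.ν t θ) / t ^ 3 * (S.K t θ - S.A t θ * S.J t θ)
      * (v.2.2 - S.A t θ * v.2.1)| = S.a t θ * Real.exp (2 * S.ν t θ)
        * (|S.K t θ - S.A t θ * S.J t θ| / t ^ 2) * (|v.2.2 - S.A t θ * v.2.1| / t) := by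
    rw [abs_mul, abs_mul, abs_of_pos (by positivity : 0 < S.a t θ * Real.exp (2 * S.ν t θ) / t ^ 3)]
    field_simp
  have e2 : |S.a t θ * (Real.exp (2 * S.ν t θ) * (Real.exp (-2 * S.U t θ) * Real.exp (-2 * S.U t θ)))
      / t * S.J t θ * v.2.1| = S.a t θ * Real.exp (2 * S.ν t θ)
        * (Real.exp (-2 * S.U t θ) * |S.J t θ| / t) * (Real.exp (-2 * S.U t θ) * |v.2.1|) := by
    rw [abs_mul, abs_mul, abs_of_pos (by positivity)]
    field_simp
  rw [e1, e2]
  have h1 := mul_le_mul_of_nonneg_left hy (by positivity : 0 ≤ S.a t θ * Real.exp (2 * S.ν t θ)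
        * (|S.K t θ - S.A t θ * S.J t θ| / t ^ 2))
  have h2 := mul_le_mul_of_nonneg_left hx (by positivity : 0 ≤ S.a t θ * Real.exp (2 * S.ν t θ)
        * (Real.exp (-2 * S.U t θ) * |S.J t θ| / t))
  linarith

theorem pt_ν_nonneg (ht : t ∈ Ioo S.tp S.ti) (θ : ℝ) : 0 ≤ pt S.ν t θ := by
  have h0 := tpos ht
  have h1 := rho_nonneg (mem_Ioc ht) θ
  have h2 := αpos ht θ
  have h3 : 0 ≤ S.p t θ := by unfold p; positivity
  rw [pt_ν ht]
  positivity

theorem p_nonneg (ht : t ∈ Ioo S.tp S.ti) (θ : ℝ) : 0 ≤ S.p t θ := by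
  have h0 := tpos ht
  have h2 := αpos ht θ
  unfold p; positivity

theorem q_nonneg (ht : t ∈ Ioo S.tp S.ti) (θ : ℝ) : 0 ≤ S.q t θ := by
  have := p_nonneg ht θ
  have := r_nonneg (mem_Ioc ht) θ
  unfold q; positivity

theorem DQ_error (ht : t ∈ Ioo S.tp S.ti) (θ : ℝ) (v : V3) :
    |S.DQ t θ v - (-S.q t θ * S.Q t θ v + 2 * pt S.ν t θ * S.m2 v t θ)| ≤ S.Lq t θ * S.Q t θ v := by
  have h0 := tpos ht
  have ha := apos ht θ
  have hα := αpos ht θ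
  have hm := m2_pos (mem_Ioc ht) θ v
  have e : S.DQ t θ v - (-S.q t θ * S.Q t θ v + 2 * pt S.ν t θ * S.m2 v t θ)
    = S.α t θ * Real.exp (2 * S.ν t θ) * pt (fun t θ => S.mu t θ v) t θ
      + 2 * S.α t θ * v.1 * S.F1 t θ v := by
    rw [DQ, pt_m2 ht, Q_eq, q_eq ht]; ring
  rw [e]
  refine (abs_add_le _ _).trans ?_
  rw [Lq, add_mul]
  refine add_le_add ?_ ?_
  · rw [abs_mul, abs_of_pos (by positivity : 0 < S.α t θ * Real.exp (2 * S.ν t θ))]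
    refine (mul_le_mul_of_nonneg_left (abs_pt_mu_le ht θ v) (by positivity)).trans ?_
    have e1 : S.m2 v t θ ≤ S.Q t θ v := by
      rw [Q_eq]
      have : 0 ≤ S.α t θ * v.1 ^ 2 := by positivity
      linarith
    have := mul_le_mul_of_nonneg_left e1 (by positivity :
      0 ≤ 4 * |pt S.U t θ| + 2 / t + |pt S.A t θ| * Real.exp (2 * S.U t θ) / t)
    unfold m2 at this
    linarith
  · set X := |S.K t θ - S.A t θ * S.J t θ| / t ^ 2 + Real.exp (-2 * S.U t θ) * |S.J t θ| / t with hX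
    have hX0 : 0 ≤ X := by positivity
    have hF := F1_abs_le ht θ v
    rw [← hX] at hF
    have hν : Real.exp (2 * S.ν t θ) = Real.exp (S.ν t θ) ^ 2 := by
      rw [← Real.exp_nat_mul]; push_cast; rfl
    have hs := Real.sq_sqrt (mu_pos (S := S) t θ v).le
    have h1 : |2 * S.α t θ * v.1 * S.F1 t θ v| = 2 * S.a t θ * (S.a t θ * |v.1|) * |S.F1 t θ v| := by
      rw [abs_mul, abs_mul, abs_mul, abs_two, abs_of_pos hα, ← a_sq ht]; ring
    rw [h1]
    have h2 := mul_le_mul_of_nonneg_left hF (by positivity : 0 ≤ 2 * S.a t θ * (S.a t θ * |v.1|))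
    refine h2.trans ?_
    have h3 := two_mul_le_add_sq (S.a t θ * |v.1|) (S.a t θ * Real.exp (S.ν t θ) * Real.sqrt (S.mu t θ v))
    have h4 := mul_le_mul_of_nonneg_left h3 (by positivity : 0 ≤ S.a t θ * Real.exp (S.ν t θ) * X)
    rw [mul_pow, mul_pow, mul_pow, sq_abs, hs, a_sq ht, ← hν] at h4
    have e2 : S.Q t θ v = S.α t θ * v.1 ^ 2 + S.α t θ * Real.exp (2 * S.ν t θ) * S.mu t θ v := Q_eq t θ v
    rw [e2, hν] at *
    linarith

theorem DQ_lower (ht : t ∈ Ioo S.tp S.ti) (θ : ℝ) (v : V3) :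
    -(S.q t θ + S.Lq t θ) * S.Q t θ v ≤ S.DQ t θ v := by
  have h1 := (abs_le.1 (DQ_error ht θ v)).1
  have h2 := mul_nonneg (pt_ν_nonneg ht θ) (m2_pos (mem_Ioc ht) θ v).le
  linarith

theorem DQ_upper (ht : t ∈ Ioo S.tp S.ti) (θ : ℝ) (v : V3) :
    S.DQ t θ v ≤ (2 * pt S.ν t θ + S.Lq t θ) * S.Q t θ v := by
  have h1 := (abs_le.1 (DQ_error ht θ v)).2
  have h2 := mul_nonneg (q_nonneg ht θ) (Q_pos' (mem_Ioc ht) θ v).le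
  have h3 : S.m2 v t θ ≤ S.Q t θ v := by
    rw [Q_eq]
    have := αpos ht θ
    have : 0 ≤ S.α t θ * v.1 ^ 2 := by positivity
    linarith
  have h4 := mul_le_mul_of_nonneg_left h3 (pt_ν_nonneg ht θ)
  linarith

end EV

/-! ### Bounds for `f` and its support away from the singular time -/

namespace EV

open Filter Topology

variable {S : EV} {t θ : ℝ}

theorem cont_field {G : ℝ → ℝ → ℝ}
    (hG : ContDiffOn ℝ (⊤ : ℕ∞) (fun p : ℝ × ℝ => G p.1 p.2) (Ioc S.tp S.ti ×ˢ (univ : Set ℝ)))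
    {X : Type*} [TopologicalSpace X] {g : X → ℝ} {k : X → ℝ} {D : Set X} (hg : ContinuousOn g D)
    (hk : ContinuousOn k D) (hD : ∀ x ∈ D, g x ∈ Ioc S.tp S.ti) :
    ContinuousOn (fun x => G (g x) (k x)) D :=
  hG.continuousOn.comp (f := fun x => (g x, k x)) (hg.prodMk hk) fun x hx => ⟨hD x hx, mem_univ _⟩

theorem cont_Q {X : Type*} [TopologicalSpace X] {g k : X → ℝ} {v : X → V3} {D : Set X}
    (hg : ContinuousOn g D) (hk : ContinuousOn k D) (hv : ContinuousOn v D)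
    (hD : ∀ x ∈ D, g x ∈ Ioc S.tp S.ti) : ContinuousOn (fun x => S.Q (g x) (k x) (v x)) D := by
  have h1 := cont_field S.hαsm hg hk hD
  have h2 := cont_field S.hνsm hg hk hD
  have h3 := cont_field S.hUsm hg hk hD
  have h4 := cont_field S.hAsm hg hk hD
  have h5 : ContinuousOn (fun x => (g x ^ 2)⁻¹) D :=
    (hg.pow 2).inv₀ fun x hx => (pow_pos (tpos' (hD x hx)) 2).ne'
  have c1 : ContinuousOn (fun x => (v x).1) D := continuous_fst.comp_continuousOn hv
  have c2 : ContinuousOn (fun x => (v x).2.1) D := (continuous_fst.comp continuous_snd).comp_continuousOn hv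
  have c3 : ContinuousOn (fun x => (v x).2.2) D := (continuous_snd.comp continuous_snd).comp_continuousOn hv
  unfold Q mu
  exact h1.mul ((c1.pow 2).add ((continuousOn_const.mul h2).rexp.mul
    (((continuousOn_const.mul h3).rexp.add ((continuousOn_const.mul h3).rexp.mul (c2.pow 2))).add
      (h5.mul ((c3.sub (h4.mul c2)).pow 2)))))

theorem cont_fX {X : Type*} [TopologicalSpace X] {g k : X → ℝ} {v : X → V3} {D : Set X}
    (hg : ContinuousOn g D) (hk : ContinuousOn k D) (hv : ContinuousOn v D)
    (hD : ∀ x ∈ D, g x ∈ Ioc S.tp S.ti) : ContinuousOn (fun x => S.f (g x) (k x) (v x)) D :=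
  S.hfsm.continuousOn.comp (f := fun x => (g x, k x, v x)) (hg.prodMk (hk.prodMk hv))
    fun x hx => ⟨hD x hx, mem_univ _⟩

theorem perQ (v : V3) : Per (fun t θ => S.Q t θ v) := fun t θ => by
  simp only [Q, mu, perα t θ, perν t θ, perU t θ, perA t θ]
theorem perf (v : V3) : Per (fun t θ => S.f t θ v) := fun t θ => S.hfper t θ v

theorem α_lower {t1 : ℝ} (h1 : S.tp < t1) :
    ∃ c > 0, ∀ t ∈ Icc t1 S.ti, ∀ θ, c ≤ S.α t θ := by
  rcases lt_or_ge S.ti t1 with hlt | hle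
  · exact ⟨1, one_pos, fun t ht => absurd (ht.1.trans ht.2) (not_le.2 hlt)⟩
  have hK : IsCompact (Icc t1 S.ti ×ˢ Icc (0:ℝ) 1) := isCompact_Icc.prod isCompact_Icc
  have hs : Icc t1 S.ti ×ˢ Icc (0:ℝ) 1 ⊆ Ioc S.tp S.ti ×ˢ (univ : Set ℝ) := fun p hp =>
    ⟨⟨h1.trans_le hp.1.1, hp.1.2⟩, mem_univ _⟩
  obtain ⟨m, hm, hmin⟩ := hK.exists_isMinOn ⟨(t1, 0), ⟨le_rfl, hle⟩, by simp⟩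
    (S.hαsm.continuousOn.mono hs)
  refine ⟨S.α m.1 m.2, S.hαpos _ (hs hm).1 _, fun t ht θ => ?_⟩
  rw [← perα.fract t θ]
  exact hmin (show (t, Int.fract θ) ∈ _ from ⟨ht, fract_mem θ⟩)

/-- Propagation of pointwise bounds for `f` backwards in time. -/
theorem propagate {t1 t2 L L' R0 c : ℝ} (h1 : S.tp < t1) (h12 : t1 ≤ t2) (h2 : t2 ≤ S.ti)
    (hL : ∀ t ∈ Ico t1 t2, ∀ θ, S.q t θ + S.Lq t θ < L)
    (hL' : ∀ t ∈ Ico t1 t2, ∀ θ, 2 * pt S.ν t θ + S.Lq t θ < L') (u : ℝ × ℝ)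
    (hend : ∀ θ y, R0 ≤ S.Q t2 θ (y, u) → S.f t2 θ (y, u) ≤ c) (θ y : ℝ)
    (hR : R0 * Real.exp (L * (t2 - t1)) ≤ S.Q t1 θ (y, u)) : S.f t1 θ (y, u) ≤ c := by
  have ht1 : t1 ∈ Ioc S.tp S.ti := ⟨h1, h12.trans h2⟩
  set R1 := S.Q t1 θ (y, u) with hR1
  have hR1pos : 0 < R1 := Q_pos' ht1 _ _
  have hmem : ∀ t ∈ Icc t1 t2, t ∈ Ioc S.tp S.ti := fun t ht => ⟨h1.trans_le ht.1, ht.2.trans h2⟩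
  set D : Set (ℝ × ℝ × ℝ) := {p | p.1 ∈ Icc t1 t2 ∧ 
    R1 ≤ S.Q p.1 p.2.1 (p.2.2, u) * Real.exp (L * (p.1 - t1)) ∧
    S.Q p.1 p.2.1 (p.2.2, u) * Real.exp (-L' * (p.1 - t1)) ≤ R1} with hD
  obtain ⟨α0, hα0, hα⟩ := α_lower h1
  set N := R1 * Real.exp (|L'| * (t2 - t1)) / α0 + 1 with hN
  have hNpos : 1 ≤ N := le_add_of_nonneg_left (by positivity)
  set K : Set (ℝ × ℝ × ℝ) := Icc t1 t2 ×ˢ Icc (0:ℝ) 1 ×ˢ Icc (-N) N with hK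
  have hKc : IsCompact K := isCompact_Icc.prod (isCompact_Icc.prod isCompact_Icc)
  have hQc : ContinuousOn (fun p : ℝ × ℝ × ℝ => S.Q p.1 p.2.1 (p.2.2, u)) K :=
    cont_Q (by fun_prop) (by fun_prop) (by fun_prop) fun p hp => hmem _ hp.1
  have hfc : ContinuousOn (fun p : ℝ × ℝ × ℝ => S.f p.1 p.2.1 (p.2.2, u)) K :=
    cont_fX (by fun_prop) (by fun_prop) (by fun_prop) fun p hp => hmem _ hp.1
  have hD'c : IsCompact (K ∩ {p | R1 ≤ S.Q p.1 p.2.1 (p.2.2, u) * Real.exp (L * (p.1 - t1)) ∧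
      S.Q p.1 p.2.1 (p.2.2, u) * Real.exp (-L' * (p.1 - t1)) ≤ R1}) := by
    refine hKc.of_isClosed_subset ?_ inter_subset_left
    have c1 : ContinuousOn (fun p : ℝ × ℝ × ℝ => (S.Q p.1 p.2.1 (p.2.2, u) * Real.exp (L * (p.1 - t1)),
        S.Q p.1 p.2.1 (p.2.2, u) * Real.exp (-L' * (p.1 - t1)))) K :=
      (hQc.mul (by fun_prop)).prodMk (hQc.mul (by fun_prop))
    exact c1.preimage_isClosed_of_isClosed hKc.isClosed
      ((isClosed_Ici (a := R1)).prod (isClosed_Iic (a := R1)))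
  have hN_of : ∀ p ∈ D, p.2.2 ∈ Icc (-N) N := by
    intro p hp
    obtain ⟨hp1, hp2, hp3⟩ := hp
    have e1 : S.Q p.1 p.2.1 (p.2.2, u) ≤ R1 * Real.exp (|L'| * (t2 - t1)) := by
      have e2 : S.Q p.1 p.2.1 (p.2.2, u) = S.Q p.1 p.2.1 (p.2.2, u) * Real.exp (-L' * (p.1 - t1))
          * Real.exp (L' * (p.1 - t1)) := by
        rw [mul_assoc, ← Real.exp_add]; simp
      rw [e2]
      refine mul_le_mul hp3 (Real.exp_le_exp.2 ?_) (Real.exp_pos _).le hR1pos.le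
      exact mul_le_mul (le_abs_self _) (by linarith [hp1.2]) (by linarith [hp1.1]) (abs_nonneg _)
    have e3 : α0 * p.2.2 ^ 2 ≤ S.Q p.1 p.2.1 (p.2.2, u) := by
      rw [Q_eq]
      have h3 := hα p.1 ⟨hp1.1, hp1.2.trans h2⟩ p.2.1
      have := (m2_pos (hmem _ hp1) p.2.1 ((p.2.2, u) : V3)).le
      have := mul_le_mul_of_nonneg_right h3 (sq_nonneg p.2.2)
      simp only
      linarith
    have e4 : p.2.2 ^ 2 ≤ N := by
      have : p.2.2 ^ 2 ≤ R1 * Real.exp (|L'| * (t2 - t1)) / α0 := by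
        rw [le_div_iff₀ hα0]; linarith
      linarith
    constructor <;> nlinarith
  have main : ∀ η > 0, ∀ p ∈ D, S.f p.1 p.2.1 (p.2.2, u) + η * (p.1 - t2) ≤ c := by
    intro η hη
    have hψc : ContinuousOn (fun p : ℝ × ℝ × ℝ => S.f p.1 p.2.1 (p.2.2, u) + η * (p.1 - t2)) K :=
      hfc.add (by fun_prop)
    refine max_principle (ψ := fun p : ℝ × ℝ × ℝ => S.f p.1 p.2.1 (p.2.2, u) + η * (p.1 - t2))
      hD'c (hψc.mono inter_subset_left) ?_ ?_
    · intro p hp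
      refine ⟨(p.1, Int.fract p.2.1, p.2.2), ⟨⟨hp.1, fract_mem _, hN_of p hp⟩, ?_⟩, ?_⟩
      · have h3 : S.Q p.1 (Int.fract p.2.1) (p.2.2, u) = S.Q p.1 p.2.1 (p.2.2, u) :=
          (perQ (S := S) (p.2.2, u)).fract p.1 p.2.1
        show R1 ≤ S.Q p.1 (Int.fract p.2.1) (p.2.2, u) * Real.exp (L * (p.1 - t1)) ∧
          S.Q p.1 (Int.fract p.2.1) (p.2.2, u) * Real.exp (-L' * (p.1 - t1)) ≤ R1
        rw [h3]; exact hp.2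
      · have h3 : S.f p.1 (Int.fract p.2.1) (p.2.2, u) = S.f p.1 p.2.1 (p.2.2, u) :=
          (perf (S := S) (p.2.2, u)).fract p.1 p.2.1
        show S.f p.1 (Int.fract p.2.1) (p.2.2, u) + η * (p.1 - t2) = _
        rw [h3]
    · rintro ⟨s0, x, z⟩ ⟨⟨hs0, hx, hz⟩, hp1, hp2⟩ hcp
      simp only at hs0 hx hz hp1 hp2 hcp
      have hlt : s0 < t2 := by
        refine lt_of_le_of_ne hs0.2 fun he => ?_
        rw [he, sub_self, mul_zero, add_zero] at hcp
        refine absurd (hend x z ?_) (not_le.2 hcp)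
        rw [he] at hp1
        have := hR.trans hp1
        exact le_of_mul_le_mul_right this (Real.exp_pos _)
      have hs : s0 ∈ Ioo S.tp S.ti := ⟨h1.trans_le hs0.1, hlt.trans_le h2⟩
      set v : V3 := (z, u) with hv
      have hQp := Q_pos' (mem_Ioc hs) x v
      have hlin : HasDerivAt (fun s : ℝ => s0 + s - t1) 1 0 :=
        ((hasDerivAt_id (0:ℝ)).const_add s0).sub_const t1
      have dQ1 := (Q_path hs x v).mul (hlin.const_mul L).exp
      have dQ2 := (Q_path hs x v).mul (hlin.const_mul (-L')).exp
      have hlo := DQ_lower hs x v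
      have hup := DQ_upper hs x v
      have hl1 := mul_lt_mul_of_pos_right (hL s0 ⟨hs0.1, hlt⟩ x) hQp
      have hl2 := mul_lt_mul_of_pos_right (hL' s0 ⟨hs0.1, hlt⟩ x) hQp
      have ev1 := eventually_lt_of_deriv_pos dQ1 (by
        simp only [add_zero, zero_mul, mul_one]
        have e0 := Real.exp_pos (L * (s0 - t1))
        have : 0 < (S.DQ s0 x v + L * S.Q s0 x v) * Real.exp (L * (s0 - t1)) :=
          mul_pos (by linarith) e0
        simp only [hv] at this ⊢
        linarith)
      have ev2 := eventually_lt_of_deriv_pos dQ2.neg (by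
        simp only [add_zero, zero_mul, mul_one]
        have e0 := Real.exp_pos (-L' * (s0 - t1))
        have : 0 < (L' * S.Q s0 x v - S.DQ s0 x v) * Real.exp (-L' * (s0 - t1)) :=
          mul_pos (by linarith) e0
        simp only [hv] at this ⊢
        linarith)
      refine ⟨fun s => (s0 + s, x + s * S.a1 s0 x v, z + s * S.bF s0 x v), η, hη, by simp, ?_, ?_⟩
      · have ev3 : ∀ᶠ s in 𝓝[>] (0:ℝ), s < t2 - s0 :=
          (eventually_lt_nhds (by linarith)).filter_mono nhdsWithin_le_nhds
        filter_upwards [ev1, ev2, ev3, self_mem_nhdsWithin] with s i1 i2 i3 i4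
        have i4' : 0 < s := i4
        simp only [Pi.mul_apply, Pi.neg_apply, add_zero, zero_mul, hv] at i1 i2
        refine ⟨⟨by simp only; linarith [hs0.1], by simp only; linarith⟩, ?_, ?_⟩
        · exact hp1.trans i1.le
        · simp only [hv]; linarith
      · have := (f_path hs x v).add ((hlin.add_const (t1 - t2)).const_mul η)
        refine (this.congr_deriv (by simp)).congr_of_eventuallyEq (Eventually.of_forall fun s => ?_)
        simp only [hv, Pi.add_apply]
        ring
  have hin : ((t1, θ, y) : ℝ × ℝ × ℝ) ∈ D := by
    refine ⟨⟨le_rfl, h12⟩, ?_, ?_⟩ <;> simp [hR1]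
  refine le_of_forall_pos_le_add fun ε hε => ?_
  have hpos : 0 < t2 - t1 + 1 := by linarith
  have := main (ε / (t2 - t1 + 1)) (by positivity) _ hin
  have e : ε / (t2 - t1 + 1) * (t2 - t1) ≤ ε := by
    rw [div_mul_eq_mul_div, div_le_iff₀ hpos]
    nlinarith
  simp only at this
  linarith

theorem abs_mul_le_of {x y a b : ℝ} (hx : |x| ≤ a) (hy : |y| ≤ b) : |x * y| ≤ a * b := by
  rw [abs_mul]; exact mul_le_mul hx hy (abs_nonneg _) ((abs_nonneg _).trans hx)

/-- Rates of change are bounded away from the singular time. -/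
theorem rates_bdd {t1 : ℝ} (h1 : S.tp < t1) :
    ∃ L, (∀ t ∈ Ico t1 S.ti, ∀ θ, S.q t θ + S.Lq t θ < L) ∧
      (∀ t ∈ Ico t1 S.ti, ∀ θ, 2 * pt S.ν t θ + S.Lq t θ < L) := by
  obtain ⟨CU, hCU, hU0, _, hU⟩ := deriv_bdd_closed S.hUsm perU h1
  obtain ⟨CA, hCA, hA0, _, hA⟩ := deriv_bdd_closed S.hAsm perA h1
  obtain ⟨Cν, hCν, hν0, _, hν⟩ := deriv_bdd_closed S.hνsm perν h1
  obtain ⟨Cα, hCα, hα0, _, hα⟩ := deriv_bdd_closed S.hαsm perα h1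
  obtain ⟨CJ, hCJ, hJ0, _, hJ⟩ := deriv_bdd_closed S.hJsm perJ h1
  obtain ⟨CK, hCK, hK0, _, hK⟩ := deriv_bdd_closed S.hKsm perK h1
  obtain ⟨c, hc, hαl⟩ := α_lower h1
  have htp1 : 0 < t1 := S.htp.trans h1
  have hLq : ∀ t ∈ Ico t1 S.ti, ∀ θ, S.Lq t θ ≤ 4 * CU + 2 / t1 + CA * Real.exp (2 * CU) / t1
      + Real.sqrt Cα * Real.exp Cν * ((CK + CA * CJ) / t1 ^ 2 + Real.exp (2 * CU) * CJ / t1) := by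
    intro t ht θ
    have ht' : t ∈ Icc t1 S.ti := Ico_subset_Icc_self ht
    have htt : t1 ≤ t := ht.1
    have b1 := hU t ht θ
    have b2 := hA t ht θ
    have b3 : S.U t θ ≤ CU := (le_abs_self _).trans (hU0 t ht' θ)
    have b4 : -CU ≤ S.U t θ := (abs_le.1 (hU0 t ht' θ)).1
    have b5 : S.a t θ ≤ Real.sqrt Cα := Real.sqrt_le_sqrt ((le_abs_self _).trans (hα0 t ht' θ))
    have b6 : S.ν t θ ≤ Cν := (le_abs_self _).trans (hν0 t ht' θ)
    have b7 : |S.K t θ - S.A t θ * S.J t θ| ≤ CK + CA * CJ :=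
      (abs_sub _ _).trans (add_le_add (hK0 t ht' θ) (abs_mul_le_of (hA0 t ht' θ) (hJ0 t ht' θ)))
    have b8 := hJ0 t ht' θ
    have htpos : 0 < t := htp1.trans_le htt
    have b9 : 0 ≤ |S.K t θ - S.A t θ * S.J t θ| / t ^ 2 + Real.exp (-2 * S.U t θ) * |S.J t θ| / t := by
      positivity
    have b10 : -2 * S.U t θ ≤ 2 * CU := by linarith
    unfold Lq
    gcongr
  refine ⟨Cα / c + 2 * Cν + (4 * CU + 2 / t1 + CA * Real.exp (2 * CU) / t1
      + Real.sqrt Cα * Real.exp Cν * ((CK + CA * CJ) / t1 ^ 2 + Real.exp (2 * CU) * CJ / t1)) + 1,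
    fun t ht θ => ?_, fun t ht θ => ?_⟩
  · have ht' : t ∈ Ioo S.tp S.ti := ⟨h1.trans_le ht.1, ht.2⟩
    have hq : S.q t θ ≤ Cα / c := by
      have h3 := hα t ht θ
      rw [q_eq ht', abs_mul, abs_neg, abs_of_pos (αpos ht' θ), abs_of_nonneg (q_nonneg ht' θ)] at h3
      rw [le_div_iff₀ hc]
      exact (mul_le_mul_of_nonneg_left (hαl t (Ico_subset_Icc_self ht) θ) (q_nonneg ht' θ)).trans h3
    linarith [hLq t ht θ]
  · have := (le_abs_self _).trans (hν t ht θ)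
    have : 0 ≤ Cα / c := by positivity
    linarith [hLq t ht θ]

/-- `f` is bounded, the support in `(v₂, v₃)` is bounded, and the support is bounded
away from the singular time. -/
theorem exists_max_f : ∃ F, 0 < F ∧ ∀ t ∈ Ioc S.tp S.ti, ∀ θ v, S.f t θ v ≤ F := by
  have hi : S.ti ∈ Ioc S.tp S.ti := ⟨S.hti, le_rfl⟩
  obtain ⟨R, hR⟩ := S.hfsupp S.ti hi
  have hK : IsCompact (Icc (0:ℝ) 1 ×ˢ Metric.closedBall (0:V3) R) :=
    isCompact_Icc.prod (isCompact_closedBall _ _)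
  obtain ⟨C, hC⟩ := hK.exists_bound_of_continuousOn (f := fun p : ℝ × V3 => S.f S.ti p.1 p.2)
    (cont_fX (S := S) (by fun_prop) (by fun_prop) (by fun_prop) fun _ _ => hi)
  have hend : ∀ θ v, S.f S.ti θ v ≤ max C 1 := by
    intro θ v
    by_cases hv : R < ‖v‖
    · rw [hR θ v hv]; exact zero_le_one.trans (le_max_right _ _)
    · have h3 : S.f S.ti (Int.fract θ) v = S.f S.ti θ v := (perf (S := S) v).fract S.ti θ
      rw [← h3]
      exact (le_abs_self _).trans ((hC (Int.fract θ, v) ⟨fract_mem θ, by simpa using hv⟩).trans (le_max_left _ _))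
  refine ⟨max C 1, lt_max_of_lt_right one_pos, fun t ht θ v => ?_⟩
  obtain ⟨L, hL1, hL2⟩ := rates_bdd (S := S) ht.1
  have := propagate ht.1 ht.2 le_rfl hL1 hL2 v.2 (R0 := 0) (c := max C 1) (fun θ y _ => hend θ _)
    θ v.1 (by rw [zero_mul]; exact (Q_pos' ht _ _).le)
  exact this

theorem exists_supp23 : ∃ V, 0 < V ∧ ∀ t ∈ Ioc S.tp S.ti, ∀ θ v, V < |v.2.1| ∨ V < |v.2.2| →
    S.f t θ v = 0 := by
  have hi : S.ti ∈ Ioc S.tp S.ti := ⟨S.hti, le_rfl⟩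
  obtain ⟨R, hR⟩ := S.hfsupp S.ti hi
  refine ⟨max R 1, lt_max_of_lt_right one_pos, fun t ht θ v hv => ?_⟩
  obtain ⟨L, hL1, hL2⟩ := rates_bdd (S := S) ht.1
  refine le_antisymm ?_ (S.hfnn t ht θ v)
  refine propagate ht.1 ht.2 le_rfl hL1 hL2 v.2 (R0 := 0) (c := 0) (fun θ y _ => ?_)
    θ v.1 (by rw [zero_mul]; exact (Q_pos' ht _ _).le)
  refine (hR θ (y, v.2) ?_).le
  have h2 : ‖v.2‖ ≤ ‖((y, v.2) : V3)‖ := norm_snd_le ((y, v.2) : V3)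
  refine lt_of_lt_of_le ?_ h2
  rcases hv with hv | hv
  · exact (le_max_left _ _).trans_lt (hv.trans_le (norm_fst_le v.2))
  · exact (le_max_left _ _).trans_lt (hv.trans_le (norm_snd_le v.2))

theorem exists_suppQ {t1 : ℝ} (h1 : S.tp < t1) : ∃ R, 1 ≤ R ∧ ∀ t ∈ Icc t1 S.ti, ∀ θ v,
    R ≤ S.Q t θ v → S.f t θ v = 0 := by
  have hi : S.ti ∈ Ioc S.tp S.ti := ⟨S.hti, le_rfl⟩
  obtain ⟨R, hR⟩ := S.hfsupp S.ti hi
  have hK : IsCompact (Icc (0:ℝ) 1 ×ˢ Metric.closedBall (0:V3) R) :=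
    isCompact_Icc.prod (isCompact_closedBall _ _)
  obtain ⟨C, hC⟩ := hK.exists_bound_of_continuousOn (f := fun p : ℝ × V3 => S.Q S.ti p.1 p.2)
    (cont_Q (S := S) (by fun_prop) (by fun_prop) (by fun_prop) fun _ _ => hi)
  have hend : ∀ θ v, |C| + 1 ≤ S.Q S.ti θ v → S.f S.ti θ v ≤ 0 := by
    intro θ v hQ
    by_cases hv : R < ‖v‖
    · rw [hR θ v hv]
    · have h3 : S.Q S.ti (Int.fract θ) v = S.Q S.ti θ v := (perQ (S := S) v).fract S.ti θ
      rw [← h3] at hQ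
      have := (le_abs_self _).trans (hC (Int.fract θ, v) ⟨fract_mem θ, by simpa using hv⟩)
      simp only at this
      linarith [le_abs_self C]
  obtain ⟨L, hL1, hL2⟩ := rates_bdd (S := S) h1
  refine ⟨(|C| + 1) * Real.exp (|L| * (S.ti - t1)) + 1, ?_, fun t ht θ v hQ => ?_⟩
  · have : 0 ≤ (|C| + 1) * Real.exp (|L| * (S.ti - t1)) := by positivity
    linarith
  have ht' : t ∈ Ioc S.tp S.ti := ⟨h1.trans_le ht.1, ht.2⟩
  refine le_antisymm ?_ (S.hfnn t ht' θ v)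
  refine propagate (R0 := |C| + 1) (c := 0) ht'.1 ht'.2 le_rfl
    (fun s hs => hL1 s ⟨ht.1.trans hs.1, hs.2⟩) (fun s hs => hL2 s ⟨ht.1.trans hs.1, hs.2⟩) v.2
    (fun θ y h => hend θ _ h) θ v.1 ?_
  have : Real.exp (L * (S.ti - t)) ≤ Real.exp (|L| * (S.ti - t1)) :=
    Real.exp_le_exp.2 (mul_le_mul (le_abs_self _) (by linarith [ht.1]) (by linarith [ht.2]) (abs_nonneg _))
  have := mul_le_mul_of_nonneg_left this (by positivity : 0 ≤ |C| + 1)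
  simp only [Prod.mk.eta]
  linarith

theorem exists_suppR {t1 : ℝ} (h1 : S.tp < t1) : ∃ R, 0 < R ∧ ∀ t ∈ Icc t1 S.ti, ∀ θ v,
    R < ‖v‖ → S.f t θ v = 0 := by
  obtain ⟨R, hR1, hR⟩ := exists_suppQ h1
  obtain ⟨V, hV, hfV⟩ := exists_supp23 (S := S)
  obtain ⟨c, hc, hα⟩ := α_lower h1
  refine ⟨max V (R / c + 1), lt_max_of_lt_left hV, fun t ht θ v hv => ?_⟩
  have ht' : t ∈ Ioc S.tp S.ti := ⟨h1.trans_le ht.1, ht.2⟩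
  by_cases h23 : V < |v.2.1| ∨ V < |v.2.2|
  · exact hfV t ht' θ v h23
  push Not at h23
  refine hR t ht θ v ?_
  have h4 : R / c + 1 < |v.1| := by
    by_contra! hcon
    have : ‖v‖ ≤ max V (R / c + 1) := by
      simp only [Prod.norm_def, Real.norm_eq_abs]
      exact max_le (hcon.trans (le_max_right _ _)) (max_le (h23.1.trans (le_max_left _ _)) (h23.2.trans (le_max_left _ _)))
    linarith
  rw [Q_eq]
  have h5 : 0 ≤ R / c := by positivity
  have h6 : R / c ≤ v.1 ^ 2 := by rw [← sq_abs]; nlinarith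
  rw [div_le_iff₀ hc] at h6
  have h7 := mul_le_mul_of_nonneg_right (hα t ht θ) (sq_nonneg v.1)
  have := m2_pos ht' θ v
  linarith

end EV

section PhaseSpace

/-! ### Smooth functions on phase space and conservation of the number of particles -/

open Filter Topology

/-- `Φ` is smooth on the part `tp < t < ti` of phase space. -/
def Sm5 (a b : ℝ) (Φ : ℝ × ℝ × V3 → ℝ) : Prop :=
  ContDiffOn ℝ (⊤ : ℕ∞) Φ (Ioo a b ×ˢ (univ : Set (ℝ × V3)))

section

variable {a b : ℝ} {Φ Ψ : ℝ × ℝ × V3 → ℝ} {x : ℝ × ℝ × V3}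

theorem isOpen_strip5 (a b : ℝ) : IsOpen (Ioo a b ×ˢ (univ : Set (ℝ × V3))) :=
  isOpen_Ioo.prod isOpen_univ

theorem Sm5.contDiffAt (h : Sm5 a b Φ) (hx : x.1 ∈ Ioo a b) : ContDiffAt ℝ (⊤ : ℕ∞) Φ x :=
  ContDiffOn.contDiffAt h ((isOpen_strip5 a b).mem_nhds ⟨hx, mem_univ _⟩)

theorem Sm5.diff (h : Sm5 a b Φ) (hx : x.1 ∈ Ioo a b) : HasFDerivAt Φ (fderiv ℝ Φ x) x :=
  ((h.contDiffAt hx).differentiableAt (by simp)).hasFDerivAt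

theorem Sm5.line (h : Sm5 a b Φ) (hx : x.1 ∈ Ioo a b) (d : ℝ × ℝ × V3) :
    HasDerivAt (fun s : ℝ => Φ (x + s • d)) (fderiv ℝ Φ x d) 0 := by
  have h1 : HasDerivAt (fun s : ℝ => x + s • d) d 0 := by
    simpa using ((hasDerivAt_id (0:ℝ)).smul_const d).const_add x
  have h2 : HasFDerivAt Φ (fderiv ℝ Φ x) (x + (0:ℝ) • d) := by simpa using h.diff hx
  exact h2.comp_hasDerivAt 0 h1

theorem Sm5.line_eq (h : Sm5 a b Φ) (hx : x.1 ∈ Ioo a b) {d : ℝ × ℝ × V3} {c : ℝ}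
    (hc : HasDerivAt (fun s : ℝ => Φ (x + s • d)) c 0) : fderiv ℝ Φ x d = c :=
  (h.line hx d).unique hc

theorem Sm5.fderiv_apply (h : Sm5 a b Φ) (d : ℝ × ℝ × V3) : Sm5 a b (fun x => fderiv ℝ Φ x d) := by
  have h1 : ContDiffOn ℝ (⊤ : ℕ∞) (fun x => fderiv ℝ Φ x) (Ioo a b ×ˢ (univ : Set (ℝ × V3))) :=
    ContDiffOn.fderiv_of_isOpen h (isOpen_strip5 a b) (by simp)
  exact h1.clm_apply contDiffOn_const

theorem Sm5.continuousOn (h : Sm5 a b Φ) : ContinuousOn Φ (Ioo a b ×ˢ (univ : Set (ℝ × V3))) :=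
  ContDiffOn.continuousOn h

theorem Sm5.comm (h : Sm5 a b Φ) (hx : x.1 ∈ Ioo a b) (d e : ℝ × ℝ × V3) :
    fderiv ℝ (fun y => fderiv ℝ Φ y d) x e = fderiv ℝ (fun y => fderiv ℝ Φ y e) x d := by
  have h1 : DifferentiableAt ℝ (fderiv ℝ Φ) x :=
    ((h.contDiffAt hx).fderiv_right (m := 1)
      (by simpa [one_add_one_eq_two] using two_le_smooth)).differentiableAt (by simp)
  have h2 : ∀ d, fderiv ℝ (fun y => fderiv ℝ Φ y d) x = (fderiv ℝ (fderiv ℝ Φ) x).flip d := by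
    intro d
    rw [fderiv_clm_apply h1 (differentiableAt_const d)]
    simp
  rw [h2, h2]
  exact ((h.contDiffAt hx).isSymmSndFDerivAt (by simpa using two_le_smooth)).eq e d

theorem Sm5.congr (h : Sm5 a b Φ) (he : ∀ x : ℝ × ℝ × V3, x.1 ∈ Ioo a b → Ψ x = Φ x) : Sm5 a b Ψ :=
  ContDiffOn.congr h fun p hp => he p hp.1

theorem Sm5.of_contDiff (h : ContDiff ℝ (⊤ : ℕ∞) Φ) : Sm5 a b Φ := h.contDiffOn

theorem Sm.sm5 {G : ℝ → ℝ → ℝ} (h : Sm a b G) : Sm5 a b (fun x => G x.1 x.2.1) :=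
  ContDiffOn.comp (t := Ioo a b ×ˢ (univ : Set ℝ)) h
    (f := fun x : ℝ × ℝ × V3 => (x.1, x.2.1)) (by fun_prop) fun x hx => ⟨hx.1, mem_univ _⟩

theorem Sm5.add (h : Sm5 a b Φ) (k : Sm5 a b Ψ) : Sm5 a b (fun x => Φ x + Ψ x) := ContDiffOn.add h k
theorem Sm5.sub (h : Sm5 a b Φ) (k : Sm5 a b Ψ) : Sm5 a b (fun x => Φ x - Ψ x) := ContDiffOn.sub h k
theorem Sm5.mul (h : Sm5 a b Φ) (k : Sm5 a b Ψ) : Sm5 a b (fun x => Φ x * Ψ x) := ContDiffOn.mul h k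
theorem Sm5.pow (h : Sm5 a b Φ) (n : ℕ) : Sm5 a b (fun x => Φ x ^ n) := ContDiffOn.pow h n
theorem Sm5.sqrt (h : Sm5 a b Φ) (h0 : ∀ x : ℝ × ℝ × V3, x.1 ∈ Ioo a b → Φ x ≠ 0) :
    Sm5 a b (fun x => Real.sqrt (Φ x)) := ContDiffOn.sqrt h fun p hp => h0 p hp.1
theorem Sm5.inv (h : Sm5 a b Φ) (h0 : ∀ x : ℝ × ℝ × V3, x.1 ∈ Ioo a b → Φ x ≠ 0) :
    Sm5 a b (fun x => (Φ x)⁻¹) := ContDiffOn.inv h fun p hp => h0 p hp.1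
theorem Sm5.div (h : Sm5 a b Φ) (k : Sm5 a b Ψ)
    (h0 : ∀ x : ℝ × ℝ × V3, x.1 ∈ Ioo a b → Ψ x ≠ 0) :
    Sm5 a b (fun x => Φ x / Ψ x) := ContDiffOn.div h k fun p hp => h0 p hp.1

theorem Sm5.fderiv_mul (h : Sm5 a b Φ) (k : Sm5 a b Ψ) (hx : x.1 ∈ Ioo a b) (d : ℝ × ℝ × V3) :
    fderiv ℝ (fun x => Φ x * Ψ x) x d = fderiv ℝ Φ x d * Ψ x + Φ x * fderiv ℝ Ψ x d := by
  have := ((h.diff hx).mul (k.diff hx)).fderiv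
  have e : fderiv ℝ (fun x => Φ x * Ψ x) x = Φ x • fderiv ℝ Ψ x + Ψ x • fderiv ℝ Φ x := this
  rw [e]
  simp
  ring

variable {t1 R : ℝ}

theorem fderiv_zero_of_supp (hs : ∀ t ∈ Ioo t1 b, ∀ θ v, R < ‖v‖ → Φ (t, θ, v) = 0) {t θ : ℝ} {v : V3}
    (ht : t ∈ Ioo t1 b) (hv : R < ‖v‖) : fderiv ℝ Φ (t, θ, v) = 0 := by
  have h1 : Φ =ᶠ[𝓝 (t, θ, v)] fun _ => 0 := by
    have o : IsOpen {x : ℝ × ℝ × V3 | x.1 ∈ Ioo t1 b ∧ R < ‖x.2.2‖} :=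
      (isOpen_Ioo.preimage continuous_fst).inter
        (isOpen_lt continuous_const (show Continuous fun x : ℝ × ℝ × V3 => ‖x.2.2‖ by fun_prop))
    filter_upwards [o.mem_nhds ⟨ht, hv⟩] with x hx
    exact hs x.1 hx.1 x.2.1 x.2.2 hx.2
  rw [h1.fderiv_eq]; simp

theorem Sm5.integral_cont (h : Sm5 a b Φ) (ha : a ≤ t1)
    (hs : ∀ t ∈ Ioo t1 b, ∀ θ v, R < ‖v‖ → Φ (t, θ, v) = 0) :
    ContinuousOn (fun p : ℝ × ℝ => ∫ v, Φ (p.1, p.2, v)) (Ioo t1 b ×ˢ (univ : Set ℝ)) := by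
  refine continuousOn_integral_of_compact_support (f := fun (p : ℝ × ℝ) v => Φ (p.1, p.2, v))
    (isCompact_closedBall (0 : V3) R) ?_ ?_
  · refine h.continuousOn.comp (f := fun x : (ℝ × ℝ) × V3 => (x.1.1, x.1.2, x.2)) (by fun_prop) ?_
    exact fun x hx => ⟨⟨ha.trans_lt hx.1.1.1, hx.1.1.2⟩, mem_univ _⟩
  · intro p v hp hv
    exact hs p.1 hp.1 p.2 v (by simpa using hv)

theorem Sm5.integrable (h : Sm5 a b Φ) (ha : a ≤ t1)
    (hs : ∀ t ∈ Ioo t1 b, ∀ θ v, R < ‖v‖ → Φ (t, θ, v) = 0) {t : ℝ} (ht : t ∈ Ioo t1 b) (θ : ℝ) :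
    Integrable (fun v => Φ (t, θ, v)) := by
  refine Continuous.integrable_of_hasCompactSupport ?_ ?_
  · exact h.continuousOn.comp_continuous (f := fun v : V3 => (t, θ, v)) (by fun_prop)
      fun v => ⟨⟨ha.trans_lt ht.1, ht.2⟩, mem_univ _⟩
  · exact HasCompactSupport.intro (isCompact_closedBall (0 : V3) R)
      fun v hv => hs t ht θ v (by simpa using hv)

theorem Sm5.integral_line (h : Sm5 a b Φ) (ha : a ≤ t1)
    (hs : ∀ t ∈ Ioo t1 b, ∀ θ v, R < ‖v‖ → Φ (t, θ, v) = 0) {t : ℝ} (ht : t ∈ Ioo t1 b) (θ : ℝ)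
    (d e : ℝ) : HasDerivAt (fun s : ℝ => ∫ v, Φ (t + s * d, θ + s * e, v))
      (∫ v, fderiv ℝ Φ (t, θ, v) (d, e, 0)) 0 := by
  have hev : ∀ᶠ s in 𝓝 (0:ℝ), t + s * d ∈ Ioo t1 b := by
    have : ContinuousAt (fun s : ℝ => t + s * d) 0 := by fun_prop
    exact this.eventually (isOpen_Ioo.mem_nhds (by simpa using ht))
  obtain ⟨ε, hε, hball⟩ := Metric.eventually_nhds_iff_ball.1 hev
  have hs' : ∀ s ∈ Icc (-(ε/2)) (ε/2), t + s * d ∈ Ioo t1 b := fun s hs => by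
    refine hball s ?_
    rw [mem_ball_zero_iff, Real.norm_eq_abs, abs_lt]
    constructor <;> linarith [hs.1, hs.2]
  have hK : IsCompact (Icc (-(ε/2)) (ε/2) ×ˢ Metric.closedBall (0 : V3) R) :=
    isCompact_Icc.prod (isCompact_closedBall _ _)
  obtain ⟨C, hC⟩ := hK.exists_bound_of_continuousOn
    (f := fun p : ℝ × V3 => fderiv ℝ Φ (t + p.1 * d, θ + p.1 * e, p.2) (d, e, 0))
    ((h.fderiv_apply (d, e, 0)).continuousOn.comp
      (f := fun p : ℝ × V3 => (t + p.1 * d, θ + p.1 * e, p.2)) (by fun_prop)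
      fun p hp => ⟨⟨ha.trans_lt (hs' p.1 hp.1).1, (hs' p.1 hp.1).2⟩, mem_univ _⟩)
  have hmem : Icc (-(ε/2)) (ε/2) ∈ 𝓝 (0:ℝ) := Icc_mem_nhds (by linarith) (by linarith)
  have key := (hasDerivAt_integral_of_dominated_loc_of_deriv_le (μ := volume) (x₀ := (0:ℝ))
    (F := fun s v => Φ (t + s * d, θ + s * e, v))
    (F' := fun s v => fderiv ℝ Φ (t + s * d, θ + s * e, v) (d, e, 0))
    (bound := (Metric.closedBall (0 : V3) R).indicator fun _ => C) hmem ?_ ?_ ?_ ?_ ?_ ?_).2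
  · simpa using key
  · filter_upwards [hmem] with s hs1
    exact (h.integrable ha hs (hs' s hs1) _).aestronglyMeasurable
  · exact h.integrable ha hs (by simpa using ht) _
  · have := (h.fderiv_apply (d, e, 0)).integrable ha (R := R)
      (fun t ht θ v hv => by rw [fderiv_zero_of_supp hs ht hv]; rfl) ht θ
    simpa using this.aestronglyMeasurable
  · refine Eventually.of_forall fun v s hs1 => ?_
    by_cases hv : v ∈ Metric.closedBall (0 : V3) R
    · rw [indicator_of_mem hv]
      exact hC (s, v) ⟨hs1, hv⟩
    · rw [indicator_of_notMem hv, fderiv_zero_of_supp hs (hs' s hs1) (by simpa using hv)]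
      simp
  · exact (integrable_indicator_iff Metric.isClosed_closedBall.measurableSet).2
      (integrableOn_const (isCompact_closedBall _ _).measure_ne_top)
  · refine Eventually.of_forall fun v s hs1 => ?_
    have h1 : HasDerivAt (fun s : ℝ => ((t + s * d, θ + s * e, v) : ℝ × ℝ × V3)) (d, e, 0) s := by
      have i1 : HasDerivAt (fun s : ℝ => t + s * d) d s := by
        simpa using ((hasDerivAt_id s).mul_const d).const_add t
      have i2 : HasDerivAt (fun s : ℝ => θ + s * e) e s := by
        simpa using ((hasDerivAt_id s).mul_const e).const_add θ
      exact i1.prodMk (i2.prodMk (hasDerivAt_const s v))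
    have h2 := h.diff (x := (t + s * d, θ + s * e, v)) ⟨ha.trans_lt (hs' s hs1).1, (hs' s hs1).2⟩
    exact h2.comp_hasDerivAt s h1

theorem Sm5.integral_vderiv (h : Sm5 a b Φ) (ha : a ≤ t1)
    (hs : ∀ t ∈ Ioo t1 b, ∀ θ v, R < ‖v‖ → Φ (t, θ, v) = 0) {t : ℝ} (ht : t ∈ Ioo t1 b) (θ : ℝ)
    (e : V3) : ∫ v, fderiv ℝ Φ (t, θ, v) (0, 0, e) = 0 := by
  have i1 := (h.fderiv_apply (0, 0, e)).integrable ha (R := R)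
      (fun t ht θ v hv => by rw [fderiv_zero_of_supp hs ht hv]; rfl) ht θ
  have i2 := h.integrable ha hs ht θ
  have h2 : (volume : Measure (ℝ × ℝ)).IsAddHaarMeasure :=
    Measure.prod.instIsAddHaarMeasure (volume : Measure ℝ) (volume : Measure ℝ)
  have h3 : (volume : Measure V3).IsAddHaarMeasure :=
    Measure.prod.instIsAddHaarMeasure (volume : Measure ℝ) (volume : Measure (ℝ × ℝ))
  have key := integral_bilinear_hasLineDerivAt_right_eq_neg_left_of_integrable
    (μ := (volume : Measure V3)) (f := fun v => Φ (t, θ, v))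
    (f' := fun v => fderiv ℝ Φ (t, θ, v) (0, 0, e)) (g := fun _ => (1:ℝ)) (g' := fun _ => (0:ℝ))
    (v := e) (B := ContinuousLinearMap.mul ℝ ℝ) (by simpa using i1) (by simp) (by simpa using i2)
    (fun v _ => ?_) (fun v _ => hasDerivAt_const _ _)
  · simpa using key
  · have h1 := h.line (x := (t, θ, v)) ⟨ha.trans_lt ht.1, ht.2⟩ (0, 0, e)
    simpa [HasLineDerivAt] using h1

end

namespace EV

variable {S : EV} {t θ : ℝ}

theorem smf : Sm5 S.tp S.ti S.fu :=
  ContDiffOn.mono S.hfsm (prod_mono Ioo_subset_Ioc_self Subset.rfl)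

theorem smQu : Sm5 S.tp S.ti (fun x => S.Q x.1 x.2.1 x.2.2) := by
  have c1 : Sm5 S.tp S.ti (fun x => x.2.2.1) := Sm5.of_contDiff (by fun_prop)
  have c2 : Sm5 S.tp S.ti (fun x => x.2.2.2.1) := Sm5.of_contDiff (by fun_prop)
  have c3 : Sm5 S.tp S.ti (fun x => x.2.2.2.2) := Sm5.of_contDiff (by fun_prop)
  have e1 := (((Sm.const (-2)).mul (smU (S := S))).exp).sm5
  have e2 := (((Sm.const (-4)).mul (smU (S := S))).exp).sm5
  have e3 := (((Sm.const 2).mul (smν (S := S))).exp).sm5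
  have e4 : Sm5 S.tp S.ti (fun x => (x.1 ^ 2)⁻¹) :=
    (Sm5.of_contDiff (by fun_prop)).inv fun x hx => (pow_pos (tpos hx) 2).ne'
  exact smα.sm5.mul ((c1.pow 2).add (e3.mul ((e1.add (e2.mul (c2.pow 2))).add
    (e4.mul ((c3.sub (smA.sm5.mul c2)).pow 2)))))

theorem smw : Sm5 S.tp S.ti (fun x => S.w x.1 x.2.1 x.2.2) :=
  smQu.sqrt fun x hx => (Q_pos' (mem_Ioc hx) _ _).ne'

theorem smF1 : Sm5 S.tp S.ti (fun x => S.F1 x.1 x.2.1 x.2.2) := by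
  have c2 : Sm5 S.tp S.ti (fun x => x.2.2.2.1) := Sm5.of_contDiff (by fun_prop)
  have c3 : Sm5 S.tp S.ti (fun x => x.2.2.2.2) := Sm5.of_contDiff (by fun_prop)
  have e3 := (((Sm.const 2).mul (smν (S := S))).exp).sm5
  have e4 := ((((Sm.const 2).mul (smν (S := S))).sub ((Sm.const 4).mul smU)).exp).sm5
  have t1 : Sm5 S.tp S.ti (fun x => x.1) := Sm5.of_contDiff (by fun_prop)
  exact ((((sma.sm5.mul e3).div (t1.pow 3) fun x hx => (pow_pos (tpos hx) 3).ne').mul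
    (smK.sub (smA.mul smJ)).sm5).mul (c3.sub (smA.sm5.mul c2))).add
    ((((sma.sm5.mul e4).div t1 fun x hx => (tpos hx).ne').mul smJ.sm5).mul c2)

theorem w_d1 (ht : t ∈ Ioo S.tp S.ti) (θ : ℝ) (v : V3) :
    fderiv ℝ (fun x : ℝ × ℝ × V3 => S.w x.1 x.2.1 x.2.2) (t, θ, v) (0, 0, 1, 0) = S.a1 t θ v := by
  refine smw.line_eq ht ?_
  have h1 : HasDerivAt (fun s : ℝ => S.Q t θ (v.1 + s, v.2)) (2 * S.α t θ * v.1) 0 := by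
    have := ((((hasDerivAt_id (0:ℝ)).const_add v.1).pow 2).add_const
      (Real.exp (2 * S.ν t θ) * S.mu t θ v)).const_mul (S.α t θ)
    exact (this.congr_deriv (by simp; ring)).congr_of_eventuallyEq (Eventually.of_forall fun s => rfl)
  have h2 := h1.sqrt (by simpa using (Q_pos' (mem_Ioc ht) θ _).ne')
  refine (h2.congr_deriv ?_).congr_of_eventuallyEq (Eventually.of_forall fun s => ?_)
  · simp only [add_zero, a1, w]
    rw [mul_assoc, mul_div_mul_left _ _ two_ne_zero]
  · simp [w, Prod.add_def]

theorem w_dθ (ht : t ∈ Ioo S.tp S.ti) (θ : ℝ) (v : V3) :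
    fderiv ℝ (fun x : ℝ × ℝ × V3 => S.w x.1 x.2.1 x.2.2) (t, θ, v) (0, 1, 0)
      = S.F1 t θ v - S.bF t θ v := by
  have h0 := v0_dθ ht θ v
  have h1 := (smw (S := S)).line (x := (t, θ, v)) ht (0, 1, 0)
  have h2 : HasDerivAt (fun s : ℝ => S.w t (θ + s) v)
      (fderiv ℝ (fun x : ℝ × ℝ × V3 => S.w x.1 x.2.1 x.2.2) (t, θ, v) (0, 1, 0)) 0 := by
    simpa using h1
  have h3 := deriv_line (fun x => S.w t x v) h2
  simp only [v0_eq] at h0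
  rw [deriv.fun_neg, h3] at h0
  rw [bF]
  linarith

theorem sma1 : Sm5 S.tp S.ti (fun x => S.a1 x.1 x.2.1 x.2.2) :=
  (smw.fderiv_apply (0, 0, 1, 0)).congr fun x hx => (w_d1 hx _ _).symm

theorem smbF : Sm5 S.tp S.ti (fun x => S.bF x.1 x.2.1 x.2.2) :=
  (smF1.sub (smw.fderiv_apply (0, 1, 0))).congr fun x hx => by
    rw [show x = (x.1, x.2.1, x.2.2) from rfl, w_dθ hx]; ring

theorem transport_div (ht : t ∈ Ioo S.tp S.ti) (θ : ℝ) (v : V3) :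
    fderiv ℝ S.fu (t, θ, v) (1, 0, 0)
      + fderiv ℝ (fun x : ℝ × ℝ × V3 => S.a1 x.1 x.2.1 x.2.2 * S.fu x) (t, θ, v) (0, 1, 0)
      + fderiv ℝ (fun x : ℝ × ℝ × V3 => S.bF x.1 x.2.1 x.2.2 * S.fu x) (t, θ, v) (0, 0, 1, 0)
      = 0 := by
  have htx : ((t, θ, v) : ℝ × ℝ × V3).1 ∈ Ioo S.tp S.ti := ht
  rw [sma1.fderiv_mul smf htx, smbF.fderiv_mul smf htx]
  have hv := vlasov ht θ v
  rw [fu_dt ht, fu_dθ ht, fu_d1 ht] at hv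
  have e1 : fderiv ℝ (fun x : ℝ × ℝ × V3 => S.a1 x.1 x.2.1 x.2.2) (t, θ, v) (0, 1, 0)
      = fderiv ℝ (fun y => fderiv ℝ (fun x : ℝ × ℝ × V3 => S.w x.1 x.2.1 x.2.2) y (0, 0, 1, 0))
        (t, θ, v) (0, 1, 0) := by
    congr 1
    refine Filter.EventuallyEq.fderiv_eq ?_
    filter_upwards [(isOpen_strip5 S.tp S.ti).mem_nhds ⟨ht, mem_univ _⟩] with x hx
    exact (w_d1 hx.1 _ _).symm
  have e2 : fderiv ℝ (fun x : ℝ × ℝ × V3 => S.bF x.1 x.2.1 x.2.2) (t, θ, v) (0, 0, 1, 0)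
      = fderiv ℝ (fun x : ℝ × ℝ × V3 => S.F1 x.1 x.2.1 x.2.2 - 
        fderiv ℝ (fun x : ℝ × ℝ × V3 => S.w x.1 x.2.1 x.2.2) x (0, 1, 0))
        (t, θ, v) (0, 0, 1, 0) := by
    congr 1
    refine Filter.EventuallyEq.fderiv_eq ?_
    filter_upwards [(isOpen_strip5 S.tp S.ti).mem_nhds ⟨ht, mem_univ _⟩] with x hx
    have := w_dθ hx.1 x.2.1 x.2.2
    show S.bF x.1 x.2.1 x.2.2 = _ - fderiv ℝ _ (x.1, x.2.1, x.2.2) _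
    rw [this]; ring
  have e3 : fderiv ℝ (fun x : ℝ × ℝ × V3 => S.F1 x.1 x.2.1 x.2.2 - 
        fderiv ℝ (fun x : ℝ × ℝ × V3 => S.w x.1 x.2.1 x.2.2) x (0, 1, 0)) (t, θ, v) (0, 0, 1, 0)
      = fderiv ℝ (fun x : ℝ × ℝ × V3 => S.F1 x.1 x.2.1 x.2.2) (t, θ, v) (0, 0, 1, 0)
        - fderiv ℝ (fun y => fderiv ℝ (fun x : ℝ × ℝ × V3 => S.w x.1 x.2.1 x.2.2) y (0, 1, 0))
          (t, θ, v) (0, 0, 1, 0) := by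
    have h : HasFDerivAt (fun x : ℝ × ℝ × V3 => S.F1 x.1 x.2.1 x.2.2 -
        fderiv ℝ (fun x : ℝ × ℝ × V3 => S.w x.1 x.2.1 x.2.2) x (0, 1, 0)) _ (t, θ, v) :=
      (smF1.diff htx).sub ((smw.fderiv_apply (0, 1, 0)).diff htx)
    rw [h.fderiv]
    rfl
  have e4 : fderiv ℝ (fun x : ℝ × ℝ × V3 => S.F1 x.1 x.2.1 x.2.2) (t, θ, v) (0, 0, 1, 0) = 0 :=
    smF1.line_eq htx ((hasDerivAt_const (0:ℝ) (S.F1 t θ v)).congr_of_eventuallyEq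
      (Eventually.of_forall fun s => by simp [F1]))
  rw [e1, e2, e3, e4, smw.comm htx]
  have : fderiv ℝ S.fu (t, θ, v) (1, 0, 0) = fderiv ℝ S.fu (t, θ, v) (1, 0) := rfl
  rw [this, hv]
  ring

/-- the particle flux -/
def flux (S : EV) (t θ : ℝ) : ℝ := ∫ v, S.a1 t θ v * S.f t θ v

theorem n_dt (ht : t ∈ Ioo S.tp S.ti) (θ : ℝ) : ∃ d, HasDerivAt (fun s => S.n s θ) (-d) t ∧
    HasDerivAt (fun x => S.flux t x) d θ ∧ d = - ∫ v, fderiv ℝ S.fu (t, θ, v) (1, 0, 0) := by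
  obtain ⟨t1, h1, h2⟩ := exists_between ht.1
  obtain ⟨R, hR, hs⟩ := exists_suppR h1
  have hs0 : ∀ t ∈ Ioo t1 S.ti, ∀ θ v, R < ‖v‖ → S.fu (t, θ, v) = 0 :=
    fun t ht θ v hv => hs t (Ioo_subset_Icc_self ht) θ v hv
  have ht1 : t ∈ Ioo t1 S.ti := ⟨h2, ht.2⟩
  have d1 := smf.integral_line h1.le hs0 ht1 θ 1 0
  have d2 := (sma1.mul smf).integral_line h1.le (R := R)
    (fun t ht θ v hv => by simp only [hs0 t ht θ v hv, mul_zero]) ht1 θ 0 1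
  have d3 := (smbF.mul smf).integral_vderiv h1.le (R := R)
    (fun t ht θ v hv => by simp only [hs0 t ht θ v hv, mul_zero]) ht1 θ (1, 0)
  have i1 := (smf.fderiv_apply (1, 0, 0)).integrable h1.le (R := R)
      (fun t ht θ v hv => by rw [fderiv_zero_of_supp hs0 ht hv]; rfl) ht1 θ
  have i2 := ((sma1.mul smf).fderiv_apply (0, 1, 0)).integrable h1.le (R := R)
      (fun t ht θ v hv => by
        rw [fderiv_zero_of_supp (R := R) (b := S.ti) (t1 := t1)
          (fun t ht θ v hv => by simp only [hs0 t ht θ v hv, mul_zero]) ht hv]; rfl) ht1 θ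
  have i3 := ((smbF.mul smf).fderiv_apply (0, 0, 1, 0)).integrable h1.le (R := R)
      (fun t ht θ v hv => by
        rw [fderiv_zero_of_supp (R := R) (b := S.ti) (t1 := t1)
          (fun t ht θ v hv => by simp only [hs0 t ht θ v hv, mul_zero]) ht hv]; rfl) ht1 θ
  have hsum := integral_add (i1.add i2) i3
  have h0 := integral_congr_ae (μ := (volume : Measure V3)) (g := fun _ => (0:ℝ))
    (Eventually.of_forall fun v => transport_div ht θ v)
  have hsum' := integral_add i1 i2
  have d3' : ∫ v, fderiv ℝ (fun x : ℝ × ℝ × V3 => S.bF x.1 x.2.1 x.2.2 * S.fu x) (t, θ, v)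
      (0, 0, 1, 0) = 0 := d3
  simp only [integral_zero] at h0
  have hsum2 := hsum.symm.trans h0
  rw [d3', add_zero] at hsum2
  have hsum3 := hsum'.symm.trans hsum2
  refine ⟨_, ?_, ?_, rfl⟩
  · rw [neg_neg]
    have d1' : HasDerivAt (fun s => S.n (t + s) θ) (∫ v, fderiv ℝ S.fu (t, θ, v) (1, 0, 0)) (t - t) := by
      rw [sub_self]
      refine d1.congr_of_eventuallyEq (Eventually.of_forall fun s => ?_)
      simp [n, fu]
    have := d1'.comp_sub_const t t
    simpa using this
  · have e : -∫ v, fderiv ℝ S.fu (t, θ, v) (1, 0, 0)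
        = ∫ v, fderiv ℝ (fun x : ℝ × ℝ × V3 => S.a1 x.1 x.2.1 x.2.2 * S.fu x) (t, θ, v) (0, 1, 0) := by
      linarith
    rw [e]
    have d2' : HasDerivAt (fun s => S.flux t (θ + s)) (∫ v, fderiv ℝ (fun x : ℝ × ℝ × V3 =>
        S.a1 x.1 x.2.1 x.2.2 * S.fu x) (t, θ, v) (0, 1, 0)) (θ - θ) := by
      rw [sub_self]
      refine d2.congr_of_eventuallyEq (Eventually.of_forall fun s => ?_)
      simp [flux, fu]
    have := d2'.comp_sub_const θ θ
    simpa using this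

theorem n_cont' {t1 : ℝ} (h1 : S.tp < t1) :
    ContinuousOn (fun p : ℝ × ℝ => S.n p.1 p.2) (Icc t1 S.ti ×ˢ (univ : Set ℝ)) := by
  obtain ⟨R, hR, hs⟩ := exists_suppR h1
  refine continuousOn_integral_of_compact_support (f := fun (p : ℝ × ℝ) v => S.f p.1 p.2 v)
    (isCompact_closedBall (0 : V3) R) ?_ ?_
  · exact cont_fX (X := (ℝ × ℝ) × V3) (g := fun x => x.1.1) (k := fun x => x.1.2) (v := fun x => x.2)
      (by fun_prop) (by fun_prop) (by fun_prop) fun x hx => ⟨h1.trans_le hx.1.1.1, hx.1.1.2⟩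
  · intro p v hp hv
    exact hs p.1 hp.1 p.2 v (by simpa using hv)

theorem n_contθ (ht : t ∈ Ioc S.tp S.ti) : Continuous fun θ => S.n t θ :=
  (n_cont' ht.1).comp_continuous (f := fun θ : ℝ => (t, θ)) (by fun_prop)
    fun θ => ⟨⟨le_rfl, ht.2⟩, mem_univ _⟩

theorem number_deriv (ht : t ∈ Ioo S.tp S.ti) :
    HasDerivAt (fun s => ∫ θ in (0:ℝ)..1, S.n s θ) 0 t := by
  obtain ⟨t1, h1, h2⟩ := exists_between ht.1
  obtain ⟨R, hR, hs⟩ := exists_suppR h1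
  have hs0 : ∀ t ∈ Ioo t1 S.ti, ∀ θ v, R < ‖v‖ → S.fu (t, θ, v) = 0 :=
    fun t ht θ v hv => hs t (Ioo_subset_Icc_self ht) θ v hv
  have ht1 : t ∈ Ioo t1 S.ti := ⟨h2, ht.2⟩
  have hc := (smf.fderiv_apply (1, 0, 0)).integral_cont h1.le (R := R)
      (fun t ht θ v hv => by rw [fderiv_zero_of_supp hs0 ht hv]; rfl)
  obtain ⟨c, hc1, hc2⟩ := exists_between ht1.1
  obtain ⟨d, hd1, hd2⟩ := exists_between ht1.2
  have hK : IsCompact (Icc c d ×ˢ Icc (0:ℝ) 1) := isCompact_Icc.prod isCompact_Icc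
  have hsub : ∀ s ∈ Icc c d, s ∈ Ioo t1 S.ti := fun s hs => ⟨hc1.trans_le hs.1, hs.2.trans_lt hd2⟩
  obtain ⟨C, hC⟩ := hK.exists_bound_of_continuousOn
    (hc.mono (prod_mono (fun s hs => hsub s hs) (subset_univ _)))
  have hcθ : Continuous fun θ => ∫ v, fderiv ℝ S.fu (t, θ, v) (1, 0, 0) :=
    hc.comp_continuous (f := fun θ : ℝ => (t, θ)) (by fun_prop) fun θ => ⟨ht1, mem_univ _⟩
  have hin : ∀ s ∈ Icc c d, s ∈ Ioo S.tp S.ti := fun s hs => ⟨h1.trans (hsub s hs).1, (hsub s hs).2⟩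
  have key := (intervalIntegral.hasDerivAt_integral_of_dominated_loc_of_deriv_le
    (F := fun s θ => S.n s θ) (F' := fun s θ => ∫ v, fderiv ℝ S.fu (s, θ, v) (1, 0, 0))
    (a := 0) (b := 1) (μ := volume) (x₀ := t)
    (bound := fun _ => C) (s := Ioo c d) (Ioo_mem_nhds hc2 hd1) ?_ ?_ ?_ ?_ ?_ ?_).2
  · refine key.congr_deriv ?_
    have e : ∫ θ in (0:ℝ)..1, (-(∫ v, fderiv ℝ S.fu (t, θ, v) (1, 0, 0))) = S.flux t 1 - S.flux t 0 := by
      refine intervalIntegral.integral_eq_sub_of_hasDerivAt (f := fun x => S.flux t x) (fun θ _ => ?_)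
        (hcθ.neg.intervalIntegrable _ _)
      obtain ⟨d, -, hd, rfl⟩ := n_dt ht θ
      exact hd
    have e2 : S.flux t 1 = S.flux t 0 := by
      have := S.hfper t 0
      rw [zero_add] at this
      have eα := perα (S := S) t 0
      have eQ : ∀ v, S.Q t 1 v = S.Q t 0 v := fun v => (perQ v).eq_zero_one t
      rw [zero_add] at eα
      simp only [flux, a1, w, this, eα, eQ]
    rw [e2, sub_self, intervalIntegral.integral_neg, neg_eq_zero] at e
    exact e
  · filter_upwards [Ioo_mem_nhds hc2 hd1] with s hs
    exact (n_contθ (mem_Ioc (hin s (Ioo_subset_Icc_self hs)))).aestronglyMeasurable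
  · exact (n_contθ (mem_Ioc ht)).intervalIntegrable _ _
  · exact hcθ.aestronglyMeasurable
  · refine Filter.Eventually.of_forall fun θ hθ s hs => ?_
    rw [uIoc_of_le zero_le_one] at hθ
    exact hC (s, θ) ⟨Ioo_subset_Icc_self hs, Ioc_subset_Icc_self hθ⟩
  · exact intervalIntegrable_const
  · refine Filter.Eventually.of_forall fun θ hθ s hs => ?_
    obtain ⟨d, hd, -, rfl⟩ := n_dt (hin s (Ioo_subset_Icc_self hs)) θ
    simpa using hd

/-- The number of particles is conserved. -/
theorem number_eq (ht : t ∈ Ioo S.tp S.ti) :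
    ∫ θ in (0:ℝ)..1, S.n t θ = ∫ θ in (0:ℝ)..1, S.n S.ti θ := by
  have hc : ContinuousOn (fun s => ∫ θ in (0:ℝ)..1, S.n s θ) (Icc t S.ti) := by
    have h1 : Continuous (fun p : ℝ × ℝ => S.n (projIcc t S.ti ht.2.le p.1) p.2) :=
      (n_cont' ht.1).comp_continuous
        (f := fun p : ℝ × ℝ => ((projIcc t S.ti ht.2.le p.1 : ℝ), p.2)) (by fun_prop)
        fun p => ⟨(projIcc t S.ti ht.2.le p.1).2, mem_univ _⟩
    have h2 := intervalIntegral.continuous_parametric_intervalIntegral_of_continuous'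
      (μ := volume) (f := fun s θ => S.n (projIcc t S.ti ht.2.le s) θ) h1 0 1
    refine h2.continuousOn.congr fun s hs => ?_
    simp only [projIcc_of_mem _ hs]
  refine (constant_of_has_deriv_right_zero hc (fun s hs => ?_) S.ti ⟨ht.2.le, le_rfl⟩).symm
  exact (number_deriv ⟨ht.1.trans_le hs.1, hs.2⟩).hasDerivWithinAt

end EV

end PhaseSpace

/-! ### Energy estimate -/

namespace EV

variable {S : EV} {t θ : ℝ}

/-- the midpoint of the time interval -/
def t0 (S : EV) : ℝ := (S.tp + S.ti) / 2

theorem tp_lt_t0 : S.tp < S.t0 := by have := S.hti; unfold t0; linarith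
theorem t0_lt_ti : S.t0 < S.ti := by have := S.hti; unfold t0; linarith
theorem t0_mem : S.t0 ∈ Ioo S.tp S.ti := ⟨tp_lt_t0, t0_lt_ti⟩
theorem mem_Ioo (ht : t ∈ Ioc S.tp S.t0) : t ∈ Ioo S.tp S.ti := ⟨ht.1, ht.2.trans_lt t0_lt_ti⟩

/-- `G` is bounded on the first half `(tp, t0]` of the time interval. -/
def Bd (S : EV) (G : ℝ → ℝ → ℝ) : Prop := ∃ C, 0 ≤ C ∧ ∀ t ∈ Ioc S.tp S.t0, ∀ θ, |G t θ| ≤ C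

theorem Bd.mk' {G : ℝ → ℝ → ℝ} {C : ℝ} (h : ∀ t ∈ Ioc S.tp S.t0, ∀ θ, |G t θ| ≤ C) : S.Bd G :=
  ⟨C, (abs_nonneg _).trans (h S.t0 ⟨tp_lt_t0, le_rfl⟩ 0), h⟩

theorem Bd.const (c : ℝ) : S.Bd (fun _ _ => c) := Bd.mk' fun _ _ _ => le_rfl
theorem Bd.time : S.Bd (fun t _ => t) :=
  Bd.mk' (C := S.t0) fun t ht _ => by rw [abs_of_pos (tpos (mem_Ioo ht))]; exact ht.2
theorem Bd.time_inv : S.Bd (fun t _ => t⁻¹) :=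
  Bd.mk' (C := S.tp⁻¹) fun t ht _ => by
    rw [abs_of_pos (inv_pos.2 (tpos (mem_Ioo ht)))]
    exact inv_anti₀ S.htp ht.1.le

section
variable {G H : ℝ → ℝ → ℝ}
theorem Bd.le (h : S.Bd G) (k : ∀ t ∈ Ioc S.tp S.t0, ∀ θ, |H t θ| ≤ |G t θ|) : S.Bd H := by
  obtain ⟨C, -, hC⟩ := h
  exact Bd.mk' fun t ht θ => (k t ht θ).trans (hC t ht θ)
theorem Bd.congr (h : S.Bd G) (k : ∀ t ∈ Ioc S.tp S.t0, ∀ θ, H t θ = G t θ) : S.Bd H :=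
  h.le fun t ht θ => by rw [k t ht θ]
theorem Bd.add (h : S.Bd G) (k : S.Bd H) : S.Bd (fun t θ => G t θ + H t θ) := by
  obtain ⟨C, -, hC⟩ := h
  obtain ⟨D, -, hD⟩ := k
  exact Bd.mk' fun t ht θ => (abs_add_le _ _).trans (add_le_add (hC t ht θ) (hD t ht θ))
theorem Bd.neg (h : S.Bd G) : S.Bd (fun t θ => - G t θ) := h.le fun t ht θ => by rw [abs_neg]
theorem Bd.sub (h : S.Bd G) (k : S.Bd H) : S.Bd (fun t θ => G t θ - H t θ) := by
  simpa only [sub_eq_add_neg] using h.add k.neg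
theorem Bd.mul (h : S.Bd G) (k : S.Bd H) : S.Bd (fun t θ => G t θ * H t θ) := by
  obtain ⟨C, hC0, hC⟩ := h
  obtain ⟨D, -, hD⟩ := k
  exact Bd.mk' fun t ht θ => by
    rw [abs_mul]; exact mul_le_mul (hC t ht θ) (hD t ht θ) (abs_nonneg _) hC0
theorem Bd.pow (h : S.Bd G) (n : ℕ) : S.Bd (fun t θ => G t θ ^ n) := by
  obtain ⟨C, hC0, hC⟩ := h
  exact Bd.mk' fun t ht θ => by rw [abs_pow]; exact pow_le_pow_left₀ (abs_nonneg _) (hC t ht θ) n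
theorem Bd.exp (h : S.Bd G) : S.Bd (fun t θ => Real.exp (G t θ)) := by
  obtain ⟨C, -, hC⟩ := h
  exact Bd.mk' fun t ht θ => by
    rw [abs_of_pos (Real.exp_pos _)]; exact Real.exp_le_exp.2 ((le_abs_self _).trans (hC t ht θ))
theorem Bd.div_time (h : S.Bd G) : S.Bd (fun t θ => G t θ / t) := h.mul Bd.time_inv
theorem Bd.upper (h : S.Bd G) : ∃ C, 0 < C ∧ ∀ t ∈ Ioc S.tp S.t0, ∀ θ, |G t θ| ≤ C := by
  obtain ⟨C, hC0, hC⟩ := h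
  exact ⟨C + 1, by linarith, fun t ht θ => (hC t ht θ).trans (by linarith)⟩
end

/-- `√ν_t`-type quadratic density for the right- and left-moving derivatives -/
theorem pt_ν_sub_B (ht : t ∈ Ioo S.tp S.ti) (θ : ℝ) : pt S.ν t θ - S.B t θ
    = t * ((pt S.U t θ - S.a t θ * pθ S.U t θ) ^ 2
      + Real.exp (4 * S.U t θ) / (4 * t ^ 2) * (pt S.A t θ - S.a t θ * pθ S.A t θ) ^ 2)
      + S.p t θ / 4 + (S.rho t θ + S.j t θ) := by
  rw [pt_ν ht, B_eq ht]; ring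

theorem pt_ν_add_B (ht : t ∈ Ioo S.tp S.ti) (θ : ℝ) : pt S.ν t θ + S.B t θ
    = t * ((pt S.U t θ + S.a t θ * pθ S.U t θ) ^ 2
      + Real.exp (4 * S.U t θ) / (4 * t ^ 2) * (pt S.A t θ + S.a t θ * pθ S.A t θ) ^ 2)
      + S.p t θ / 4 + (S.rho t θ - S.j t θ) := by
  rw [pt_ν ht, B_eq ht]; ring

theorem abs_B_le (ht : t ∈ Ioo S.tp S.ti) (θ : ℝ) : |S.B t θ| ≤ pt S.ν t θ := by
  have h1 := pt_ν_sub_B ht θ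
  have h2 := pt_ν_add_B ht θ
  have hj := abs_le.1 (j_abs_le (mem_Ioc ht) θ)
  have hp := p_nonneg ht θ
  have h3 : 0 ≤ t * ((pt S.U t θ - S.a t θ * pθ S.U t θ) ^ 2
      + Real.exp (4 * S.U t θ) / (4 * t ^ 2) * (pt S.A t θ - S.a t θ * pθ S.A t θ) ^ 2) := by
    have := tpos ht; positivity
  have h4 : 0 ≤ t * ((pt S.U t θ + S.a t θ * pθ S.U t θ) ^ 2
      + Real.exp (4 * S.U t θ) / (4 * t ^ 2) * (pt S.A t θ + S.a t θ * pθ S.A t θ) ^ 2) := by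
    have := tpos ht; positivity
  exact abs_le.2 ⟨by linarith [hj.1, hj.2], by linarith [hj.1, hj.2]⟩

theorem wave_part_nonneg (ht : t ∈ Ioo S.tp S.ti) (θ : ℝ) :
    0 ≤ t * (pt S.U t θ ^ 2 + (S.a t θ * pθ S.U t θ) ^ 2
      + Real.exp (4 * S.U t θ) / (4 * t ^ 2) * (pt S.A t θ ^ 2 + (S.a t θ * pθ S.A t θ) ^ 2)) := by
  have := tpos ht; positivity

theorem q_le (ht : t ∈ Ioo S.tp S.ti) (θ : ℝ) : S.q t θ ≤ 4 * pt S.ν t θ := by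
  have h1 := pt_ν ht θ
  have h2 := wave_part_nonneg ht θ
  have h3 := r_le (mem_Ioc ht) θ
  rw [q]; linarith

theorem rho_le (ht : t ∈ Ioo S.tp S.ti) (θ : ℝ) : S.rho t θ ≤ pt S.ν t θ := by
  have h1 := pt_ν ht θ
  have h2 := wave_part_nonneg ht θ
  have h3 := p_nonneg ht θ
  linarith

/-- the energy density -/
def en (S : EV) (t θ : ℝ) : ℝ := S.h t θ * pt S.ν t θ / t

theorem smen : Sm S.tp S.ti S.en := (smh.mul smν.pt).div Sm.time fun t ht θ => (tpos ht).ne'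
theorem peren : Per S.en := fun t θ => by simp only [en, perh t θ, perν.pt t θ]
theorem en_nonneg (ht : t ∈ Ioo S.tp S.ti) (θ : ℝ) : 0 ≤ S.en t θ :=
  div_nonneg (mul_nonneg (hpos ht θ).le (pt_ν_nonneg ht θ)) (tpos ht).le

theorem pt_en (ht : t ∈ Ioo S.tp S.ti) (θ : ℝ) : pθ S.B t θ / t - 4 / t * S.en t θ ≤ pt S.en t θ ∧
    pt S.en t θ ≤ pθ S.B t θ / t := by
  have h1 : pt S.en t θ = ((pt S.h t θ * pt S.ν t θ + S.h t θ * pt (pt S.ν) t θ) * t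
      - S.h t θ * pt S.ν t θ * 1) / t ^ 2 :=
    (((smh.dt ht θ).mul (smν.pt.dt ht θ)).div (hasDerivAt_id t) (tpos ht).ne').deriv
  have hh := hpos ht θ
  have ha := apos ht θ
  have htp := tpos ht
  have hah : S.h t θ * S.a t θ = 1 := inv_mul_cancel₀ ha.ne'
  set W : ℝ := 2 * pt S.U t θ ^ 2
    + Real.exp (4 * S.U t θ) / (2 * t ^ 2) * (S.a t θ * pθ S.A t θ) ^ 2
    + S.α t θ * Real.exp (2 * S.ν t θ - 4 * S.U t θ) * S.J t θ ^ 2 / (2 * t ^ 2)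
    + S.α t θ * Real.exp (2 * S.ν t θ) * (S.K t θ - S.A t θ * S.J t θ) ^ 2 / t ^ 4
    + S.rho t θ / t + S.s3 t θ with hW
  have h2 : pt S.en t θ = pθ S.B t θ / t - S.h t θ / t * W := by
    have e1 : S.h t θ * (S.a t θ * pθ S.B t θ) = pθ S.B t θ := by rw [← mul_assoc, hah, one_mul]
    rw [h1, pt_h ht, eqν ht]
    have e2 : (S.q t θ / 2 * S.h t θ * pt S.ν t θ + S.h t θ * (S.a t θ * pθ S.B t θ
        - S.q t θ / 2 * pt S.ν t θ - pt S.U t θ ^ 2 + (S.a t θ * pθ S.U t θ) ^ 2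
      + Real.exp (4 * S.U t θ) / (4 * t ^ 2) * (pt S.A t θ ^ 2 - (S.a t θ * pθ S.A t θ) ^ 2)
      - S.α t θ * Real.exp (2 * S.ν t θ - 4 * S.U t θ) * S.J t θ ^ 2 / (4 * t ^ 2)
      - 3 * S.α t θ * Real.exp (2 * S.ν t θ) * (S.K t θ - S.A t θ * S.J t θ) ^ 2 / (4 * t ^ 4)
      - S.s3 t θ)) = pθ S.B t θ + S.h t θ * (- pt S.U t θ ^ 2 + (S.a t θ * pθ S.U t θ) ^ 2
      + Real.exp (4 * S.U t θ) / (4 * t ^ 2) * (pt S.A t θ ^ 2 - (S.a t θ * pθ S.A t θ) ^ 2)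
      - S.α t θ * Real.exp (2 * S.ν t θ - 4 * S.U t θ) * S.J t θ ^ 2 / (4 * t ^ 2)
      - 3 * S.α t θ * Real.exp (2 * S.ν t θ) * (S.K t θ - S.A t θ * S.J t θ) ^ 2 / (4 * t ^ 4)
      - S.s3 t θ) := by linear_combination e1
    rw [e2, hW, pt_ν ht, p]
    generalize Real.exp (4 * S.U t θ) = x1
    generalize Real.exp (2 * S.ν t θ - 4 * S.U t θ) = x2
    generalize Real.exp (2 * S.ν t θ) = x3
    field_simp
    ring
  have hα := αpos ht θ
  have hW0 : 0 ≤ W := by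
    have := rho_nonneg (mem_Ioc ht) θ
    have := s3_nonneg (mem_Ioc ht) θ
    positivity
  have hW1 : W ≤ 4 * pt S.ν t θ / t := by
    have i1 := s3_le (mem_Ioc ht) θ
    have i2 := r_le (mem_Ioc ht) θ
    have i3 : S.r t θ / t ≤ 2 * S.rho t θ / t := by gcongr
    have i4 : 4 * pt S.ν t θ / t = 4 * pt S.U t θ ^ 2 + 4 * (S.a t θ * pθ S.U t θ) ^ 2
      + Real.exp (4 * S.U t θ) / t ^ 2 * (pt S.A t θ ^ 2 + (S.a t θ * pθ S.A t θ) ^ 2)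
      + S.α t θ * Real.exp (2 * S.ν t θ - 4 * S.U t θ) * S.J t θ ^ 2 / t ^ 2
      + S.α t θ * Real.exp (2 * S.ν t θ) * (S.K t θ - S.A t θ * S.J t θ) ^ 2 / t ^ 4
      + 4 * (S.rho t θ / t) := by
      rw [pt_ν ht, p]
      generalize Real.exp (4 * S.U t θ) = x1
      generalize Real.exp (2 * S.ν t θ - 4 * S.U t θ) = x2
      generalize Real.exp (2 * S.ν t θ) = x3
      field_simp
      ring
    have i5 : 0 ≤ Real.exp (4 * S.U t θ) / t ^ 2 * pt S.A t θ ^ 2 := by positivity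
    have i6 : Real.exp (4 * S.U t θ) / (2 * t ^ 2) * (S.a t θ * pθ S.A t θ) ^ 2
      = Real.exp (4 * S.U t θ) / t ^ 2 * (S.a t θ * pθ S.A t θ) ^ 2 / 2 := by field_simp
    have i7 : 0 ≤ Real.exp (4 * S.U t θ) / t ^ 2 * (S.a t θ * pθ S.A t θ) ^ 2 := by positivity
    have i8 : S.α t θ * Real.exp (2 * S.ν t θ - 4 * S.U t θ) * S.J t θ ^ 2 / (2 * t ^ 2)
      = S.α t θ * Real.exp (2 * S.ν t θ - 4 * S.U t θ) * S.J t θ ^ 2 / t ^ 2 / 2 := by field_simp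
    have i9 : 0 ≤ S.α t θ * Real.exp (2 * S.ν t θ - 4 * S.U t θ) * S.J t θ ^ 2 / t ^ 2 := by
      positivity
    rw [i4, hW, i6, i8]
    have i10 : 2 * S.rho t θ / t = 2 * (S.rho t θ / t) := by ring
    have i11 : 0 ≤ S.rho t θ / t := div_nonneg (rho_nonneg (mem_Ioc ht) θ) htp.le
    linarith [sq_nonneg (pt S.U t θ), sq_nonneg (S.a t θ * pθ S.U t θ)]
  have hht : 0 ≤ S.h t θ / t := by positivity
  rw [h2]
  constructor
  · have := mul_le_mul_of_nonneg_left hW1 hht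
    have e : S.h t θ / t * (4 * pt S.ν t θ / t) = 4 / t * S.en t θ := by rw [en]; field_simp
    linarith
  · have := mul_nonneg hht hW0
    linarith

theorem energy_bdd : ∃ E, 0 < E ∧ ∀ t ∈ Ioc S.tp S.t0, ∫ θ in (0:ℝ)..1, S.en t θ ≤ E := by
  set E : ℝ → ℝ := fun t => ∫ θ in (0:ℝ)..1, S.en t θ with hE
  have hd : ∀ t ∈ Ioo S.tp S.ti, HasDerivAt (fun s => s ^ 4 * E s)
      (4 * t ^ 3 * E t + t ^ 4 * ∫ θ in (0:ℝ)..1, pt S.en t θ) t := fun t ht => by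
    have := (hasDerivAt_pow 4 t).mul (smen.hasDerivAt_integral ht 0 1)
    exact this.congr_deriv (by simp [hE])
  have hge : ∀ t ∈ Ioo S.tp S.ti, 0 ≤ 4 * t ^ 3 * E t + t ^ 4 * ∫ θ in (0:ℝ)..1, pt S.en t θ := by
    intro t ht
    have h1 : ∫ θ in (0:ℝ)..1, (pθ S.B t θ / t - 4 / t * S.en t θ) ≤ ∫ θ in (0:ℝ)..1, pt S.en t θ :=
      integral01_mono (((smB.pθ.contθ ht).div_const t).sub ((smen.contθ ht).const_mul _))
        (smen.pt.contθ ht) fun θ => (pt_en ht θ).1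
    rw [intervalIntegral.integral_sub (((smB.pθ.contθ ht).div_const t).intervalIntegrable _ _)
      (((smen.contθ ht).const_mul _).intervalIntegrable _ _), intervalIntegral.integral_div,
      smB.integral_pθ_per perB ht, intervalIntegral.integral_const_mul] at h1
    have htp := tpos ht
    have h2 := mul_le_mul_of_nonneg_left h1 (pow_pos htp 4).le
    have h3 : t ^ 4 * (0 / t - 4 / t * ∫ θ in (0:ℝ)..1, S.en t θ) = - (4 * t ^ 3 * E t) := by
      simp only [hE]; field_simp; ring
    linarith
  have hmono : MonotoneOn (fun s => s ^ 4 * E s) (Ioo S.tp S.ti) := by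
    refine monotoneOn_of_deriv_nonneg (convex_Ioo _ _)
      (fun t ht => (hd t ht).continuousAt.continuousWithinAt) ?_ ?_
    · rw [interior_Ioo]; exact fun t ht => (hd t ht).differentiableAt.differentiableWithinAt
    · rw [interior_Ioo]; exact fun t ht => by rw [(hd t ht).deriv]; exact hge t ht
  have htp := S.htp
  have hE0 : ∀ t ∈ Ioo S.tp S.ti, 0 ≤ E t := fun t ht => integral01_nonneg fun θ => en_nonneg ht θ
  refine ⟨S.t0 ^ 4 * E S.t0 / S.tp ^ 4 + 1, ?_, fun t ht => ?_⟩
  · have := hE0 _ t0_mem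
    positivity
  · have h1 : t ^ 4 * E t ≤ S.t0 ^ 4 * E S.t0 := hmono (mem_Ioo ht) t0_mem ht.2
    have h2 : S.tp ^ 4 * E t ≤ t ^ 4 * E t :=
      mul_le_mul_of_nonneg_right (pow_le_pow_left₀ htp.le ht.1.le 4) (hE0 t (mem_Ioo ht))
    have h3 : E t ≤ S.t0 ^ 4 * E S.t0 / S.tp ^ 4 := by
      rw [le_div_iff₀ (by positivity)]; linarith
    linarith

theorem α_antitone (ht : t ∈ Ioc S.tp S.t0) (θ : ℝ) : S.α S.t0 θ ≤ S.α t θ := by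
  have hanti : AntitoneOn (fun s => S.α s θ) (Ioo S.tp S.ti) := by
    refine antitoneOn_of_deriv_nonpos (convex_Ioo _ _)
      (fun t ht => (smα.dt ht θ).continuousAt.continuousWithinAt) ?_ ?_
    · rw [interior_Ioo]; exact fun t ht => (smα.dt ht θ).differentiableAt.differentiableWithinAt
    · rw [interior_Ioo]
      exact fun t ht => by
        have h1 : deriv (fun s => S.α s θ) t = - S.q t θ * S.α t θ := q_eq ht θ
        rw [h1, neg_mul, neg_nonpos]
        exact mul_nonneg (q_nonneg ht θ) (αpos ht θ).le
  exact hanti (mem_Ioo ht) t0_mem ht.2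

/-- `1/√α` is bounded. -/
theorem bdh : S.Bd S.h := by
  refine (smh (S := S)).bdd perh (c := S.t0) (d := S.t0) tp_lt_t0 t0_lt_ti |>.elim fun C hC => ?_
  refine Bd.mk' (C := C) fun t ht θ => ?_
  have h1 := hC.2 S.t0 ⟨le_rfl, le_rfl⟩ θ
  refine le_trans ?_ h1
  rw [abs_of_pos (hpos (mem_Ioo ht) θ), abs_of_pos (hpos t0_mem θ)]
  exact inv_anti₀ (apos t0_mem θ) (Real.sqrt_le_sqrt (α_antitone ht θ))

end EV

/-! ### Weighted means -/

namespace EV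

variable {S : EV} {t θ : ℝ}

/-- a density with bounded integral that dominates the relevant first derivatives -/
def dm (S : EV) (t θ : ℝ) : ℝ := S.h t θ + S.en t θ + S.n t θ

theorem dm_cont (ht : t ∈ Ioo S.tp S.ti) : Continuous fun θ => S.dm t θ :=
  ((smh.contθ ht).add (smen.contθ ht)).add (n_contθ (mem_Ioc ht))

theorem h_le_dm (ht : t ∈ Ioo S.tp S.ti) (θ : ℝ) : S.h t θ ≤ S.dm t θ := by
  have := en_nonneg ht θ
  have := n_nonneg (mem_Ioc ht) θ
  unfold dm; linarith
theorem en_le_dm (ht : t ∈ Ioo S.tp S.ti) (θ : ℝ) : S.en t θ ≤ S.dm t θ := by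
  have := hpos ht θ
  have := n_nonneg (mem_Ioc ht) θ
  unfold dm; linarith
theorem n_le_dm (ht : t ∈ Ioo S.tp S.ti) (θ : ℝ) : S.n t θ ≤ S.dm t θ := by
  have := hpos ht θ
  have := en_nonneg ht θ
  unfold dm; linarith
theorem dm_nonneg (ht : t ∈ Ioo S.tp S.ti) (θ : ℝ) : 0 ≤ S.dm t θ :=
  (hpos ht θ).le.trans (h_le_dm ht θ)

theorem dm_bdd : ∃ M, 0 < M ∧ ∀ t ∈ Ioc S.tp S.t0, ∫ θ in (0:ℝ)..1, S.dm t θ ≤ M := by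
  obtain ⟨E, hE0, hE⟩ := energy_bdd (S := S)
  obtain ⟨C, hC0, hC⟩ := (bdh (S := S)).upper
  refine ⟨C + E + ∫ θ in (0:ℝ)..1, S.n S.ti θ, by have := S.hC2; unfold n; positivity, fun t ht => ?_⟩
  have ht' := mem_Ioo ht
  have h1 : ∫ θ in (0:ℝ)..1, S.h t θ ≤ ∫ θ in (0:ℝ)..1, C :=
    integral01_mono (smh.contθ ht') continuous_const fun θ => (le_abs_self _).trans (hC t ht θ)
  have e : ∫ θ in (0:ℝ)..1, S.dm t θ = (∫ θ in (0:ℝ)..1, S.h t θ) + (∫ θ in (0:ℝ)..1, S.en t θ)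
      + ∫ θ in (0:ℝ)..1, S.n t θ := by
    unfold dm
    have c12 : Continuous fun θ => S.h t θ + S.en t θ := (smh.contθ ht').add (smen.contθ ht')
    rw [intervalIntegral.integral_add (c12.intervalIntegrable _ _)
      ((n_contθ (mem_Ioc ht')).intervalIntegrable _ _), intervalIntegral.integral_add
      ((smh.contθ ht').intervalIntegrable _ _) ((smen.contθ ht').intervalIntegrable _ _)]
  rw [e, number_eq ht']
  have := hE t ht
  simp at h1
  linarith

/-- Concentration of `f` on small velocities is limited by the bound on `f`. -/
theorem moment_lower : ∃ c, 0 < c ∧ ∀ t ∈ Ioc S.tp S.ti, ∀ θ, ∀ l, 0 < l →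
    l * S.n t θ - c * l ^ 2 ≤ ∫ v, S.f t θ v * |v.1| := by
  obtain ⟨F, hF, hf⟩ := exists_max_f (S := S)
  obtain ⟨V, hV, hfV⟩ := exists_supp23 (S := S)
  refine ⟨8 * F * V ^ 2, by positivity, fun t ht θ l hl => ?_⟩
  set X : Set V3 := Icc (-l) l ×ˢ (Icc (-V) V ×ˢ Icc (-V) V) with hX
  have hXm : MeasurableSet X := measurableSet_Icc.prod (measurableSet_Icc.prod measurableSet_Icc)
  have hXc : IsCompact X := isCompact_Icc.prod (isCompact_Icc.prod isCompact_Icc)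
  have hvol : volume.real X = 8 * l * V ^ 2 := by
    rw [hX, Measure.real, Measure.volume_eq_prod, Measure.prod_prod, Measure.volume_eq_prod,
      Measure.prod_prod, Real.volume_Icc, Real.volume_Icc, ENNReal.toReal_mul, ENNReal.toReal_mul,
      ENNReal.toReal_ofReal (by linarith), ENNReal.toReal_ofReal (by linarith)]
    ring
  have i1 : Integrable (X.indicator fun _ => l * F) :=
    (integrable_indicator_iff hXm).2 (integrableOn_const hXc.measure_ne_top)
  have i2 : Integrable fun v => S.f t θ v * |v.1| := integrable_f ht θ (by fun_prop)
  have i3 : Integrable fun v => S.f t θ v * l := integrable_f ht θ (by fun_prop)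
  have h1 : ∫ v, S.f t θ v * l ≤ ∫ v, (S.f t θ v * |v.1| + X.indicator (fun _ => l * F) v) := by
    refine integral_mono i3 (i2.add i1) fun v => ?_
    show S.f t θ v * l ≤ S.f t θ v * |v.1| + X.indicator (fun _ => l * F) v
    have hf0 := S.hfnn t ht θ v
    by_cases hv : v ∈ X
    · rw [indicator_of_mem hv]
      have := mul_le_mul_of_nonneg_right (hf t ht θ v) hl.le
      have := mul_nonneg hf0 (abs_nonneg v.1)
      nlinarith
    · rw [indicator_of_notMem hv, add_zero]
      by_cases h0 : S.f t θ v = 0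
      · simp [h0]
      · have h23 : ¬ (V < |v.2.1| ∨ V < |v.2.2|) := fun h => h0 (hfV t ht θ v h)
        push Not at h23
        have : l ≤ |v.1| := by
          by_contra! hlt
          exact hv ⟨abs_le.1 hlt.le, abs_le.1 h23.1, abs_le.1 h23.2⟩
        exact mul_le_mul_of_nonneg_left this hf0
  rw [integral_add i2 i1, integral_mul_const, integral_indicator_const _ hXm, hvol] at h1
  have e : (8 * l * V ^ 2) • (l * F) = 8 * F * V ^ 2 * l ^ 2 := by rw [smul_eq_mul]; ring
  rw [e] at h1
  unfold n
  linarith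

theorem h_rho_ge (ht : t ∈ Ioc S.tp S.ti) (θ : ℝ) :
    S.a t θ * ∫ v, S.f t θ v * |v.1| ≤ S.h t θ * S.rho t θ := by
  have h1 := integral_f_mono ht θ (g := fun v => |v.1|) (k := fun v => S.w t θ v) (c := S.a t θ)
    (d := 1) (by fun_prop) (cont_w t θ) (fun v => by rw [one_mul]; exact a_v1_le ht θ v)
  have e : S.h t θ * S.rho t θ = 1 * ∫ v, S.f t θ v * S.w t θ v := by
    rw [h, rho, ← mul_assoc, inv_mul_cancel₀ (apos' ht θ).ne']
  rw [e]; exact h1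

theorem H_lower : ∃ c, 0 < c ∧ ∀ t ∈ Ioc S.tp S.t0, c ≤ ∫ θ in (0:ℝ)..1, S.h t θ := by
  obtain ⟨E, hE0, hE⟩ := energy_bdd (S := S)
  obtain ⟨c, hc, hm⟩ := moment_lower (S := S)
  set N := ∫ θ in (0:ℝ)..1, S.n S.ti θ with hN
  have hN0 : 0 < N := S.hC2
  have hti : 0 < S.ti := S.htp.trans S.hti
  set k := (S.ti * E + 1) / N with hk
  have hk0 : 0 < k := by positivity
  refine ⟨1 / (c * k ^ 2), by positivity, fun t ht => ?_⟩
  have ht' := mem_Ioo ht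
  have h1 : ∀ θ, k * S.n t θ - c * k ^ 2 * S.h t θ ≤ t * S.en t θ := fun θ => by
    have ha := apos ht' θ
    have i1 := hm t (mem_Ioc ht') θ (k * S.h t θ) (mul_pos hk0 (hpos ht' θ))
    have i2 := h_rho_ge (mem_Ioc ht') θ
    have i3 := mul_le_mul_of_nonneg_left i1 ha.le
    have i4 : S.a t θ * (k * S.h t θ * S.n t θ - c * (k * S.h t θ) ^ 2)
        = k * S.n t θ - c * k ^ 2 * S.h t θ := by
      rw [h]; field_simp
    have i5 : t * S.en t θ = S.h t θ * pt S.ν t θ := by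
      rw [en, mul_div_cancel₀ _ (tpos ht').ne']
    have i6 := mul_le_mul_of_nonneg_left (rho_le ht' θ) (hpos ht' θ).le
    linarith
  have c1 := n_contθ (mem_Ioc ht')
  have c2 := (smh (S := S)).contθ ht'
  have h2 : ∫ θ in (0:ℝ)..1, (k * S.n t θ - c * k ^ 2 * S.h t θ) ≤ ∫ θ in (0:ℝ)..1, t * S.en t θ :=
    integral01_mono ((c1.const_mul k).sub (c2.const_mul (c * k ^ 2)))
    ((smen.contθ ht').const_mul t) h1
  rw [intervalIntegral.integral_sub ((c1.const_mul k).intervalIntegrable _ _)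
    ((c2.const_mul (c * k ^ 2)).intervalIntegrable _ _), intervalIntegral.integral_const_mul,
    intervalIntegral.integral_const_mul, intervalIntegral.integral_const_mul, number_eq ht', ← hN] at h2
  have h3 : k * N = S.ti * E + 1 := by rw [hk]; field_simp
  have h4 : t * ∫ θ in (0:ℝ)..1, S.en t θ ≤ S.ti * E :=
    mul_le_mul ht'.2.le (hE t ht) (integral01_nonneg fun θ => en_nonneg ht' θ) hti.le
  rw [div_le_iff₀ (by positivity)]
  linarith

theorem pt_h_le (ht : t ∈ Ioo S.tp S.ti) (θ : ℝ) : 0 ≤ pt S.h t θ ∧ pt S.h t θ ≤ 2 * S.ti * S.en t θ := by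
  rw [pt_h ht]
  have h1 := q_nonneg ht θ
  have h2 := hpos ht θ
  refine ⟨by positivity, ?_⟩
  have h3 := q_le ht θ
  have e : S.h t θ * pt S.ν t θ = t * S.en t θ := by rw [en, mul_div_cancel₀ _ (tpos ht).ne']
  have h4 := mul_le_mul_of_nonneg_right h3 h2.le
  have h5 : t * S.en t θ ≤ S.ti * S.en t θ := mul_le_mul_of_nonneg_right ht.2.le (en_nonneg ht θ)
  nlinarith

/-- A periodic function whose derivatives are dominated by `dm` in the mean is bounded. -/
theorem Bd.of_density {G : ℝ → ℝ → ℝ} (hG : Sm S.tp S.ti G) (hp : Per G) {c : ℝ}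
    (h1 : ∀ t ∈ Ioc S.tp S.t0, ∀ θ, |pθ G t θ| ≤ c * S.dm t θ)
    (h2 : ∀ t ∈ Ioc S.tp S.t0, ∀ θ, S.h t θ * |pt G t θ| ≤ c * S.dm t θ) : S.Bd G := by
  obtain ⟨M, hM0, hM⟩ := dm_bdd (S := S)
  obtain ⟨b, hb0, hb⟩ := H_lower (S := S)
  have hc0 : ∀ t ∈ Ioc S.tp S.t0, 0 ≤ c := fun t ht => by
    have h3 := (mul_nonneg (hpos (mem_Ioo ht) 0).le (abs_nonneg _)).trans (h2 t ht 0)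
    have h4 := (hpos (mem_Ioo ht) 0).trans_le (h_le_dm (mem_Ioo ht) 0)
    exact nonneg_of_mul_nonneg_left h3 h4
  have hosc : ∀ t ∈ Ioc S.tp S.t0, ∀ θ θ', |G t θ - G t θ'| ≤ c * M := fun t ht θ θ' => by
    have ht' := mem_Ioo ht
    refine (hG.osc hp ht' θ θ').trans ((integral01_mono (hG.pθ.contθ ht').abs
      ((dm_cont ht').const_mul c) fun θ => h1 t ht θ).trans ?_)
    rw [intervalIntegral.integral_const_mul]
    exact mul_le_mul_of_nonneg_left (hM t ht) (hc0 t ht)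
  set H : ℝ → ℝ := fun t => ∫ θ in (0:ℝ)..1, S.h t θ with hH
  set I : ℝ → ℝ := fun t => ∫ θ in (0:ℝ)..1, S.h t θ * G t θ with hI
  have hHd : ∀ t ∈ Ioo S.tp S.ti, HasDerivAt H (∫ θ in (0:ℝ)..1, pt S.h t θ) t :=
    fun t ht => smh.hasDerivAt_integral ht 0 1
  have hId : ∀ t ∈ Ioo S.tp S.ti, HasDerivAt I (∫ θ in (0:ℝ)..1,
      (pt S.h t θ * G t θ + S.h t θ * pt G t θ)) t := fun t ht => by
    refine ((smh.mul hG).hasDerivAt_integral ht 0 1).congr_deriv ?_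
    refine intervalIntegral.integral_congr fun θ _ => ?_
    exact ((smh.dt ht θ).mul (hG.dt ht θ)).deriv
  -- the mean differs little from the values
  have hmean : ∀ t ∈ Ioc S.tp S.t0, ∀ θ, |G t θ - I t / H t| ≤ c * M := fun t ht θ => by
    have ht' := mem_Ioo ht
    have hHpos : 0 < H t := hb0.trans_le (hb t ht)
    have e : G t θ - I t / H t = (∫ x in (0:ℝ)..1, S.h t x * (G t θ - G t x)) / H t := by
      have e1 : ∫ x in (0:ℝ)..1, S.h t x * (G t θ - G t x) = H t * G t θ - I t := by
        simp only [mul_sub]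
        have d1 : Continuous fun x => S.h t x * G t θ := (smh.contθ ht').mul continuous_const
        have d2 : Continuous fun x => S.h t x * G t x := (smh.contθ ht').mul (hG.contθ ht')
        rw [intervalIntegral.integral_sub (d1.intervalIntegrable _ _) (d2.intervalIntegrable _ _),
          intervalIntegral.integral_mul_const]
      rw [e1]; field_simp
    rw [e, abs_div, abs_of_pos hHpos, div_le_iff₀ hHpos]
    have h3 := abs_integral01_le (g := fun x => S.h t x * (G t θ - G t x))
      (k := fun x => c * M * S.h t x) ((smh.contθ ht').mul (continuous_const.sub (hG.contθ ht')))
      ((smh.contθ ht').const_mul _) fun x => by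
        rw [abs_mul, abs_of_pos (hpos ht' x), mul_comm]
        exact mul_le_mul_of_nonneg_right (hosc t ht θ x) (hpos ht' x).le
    rwa [intervalIntegral.integral_const_mul] at h3
  have hmd : ∀ t ∈ Ioo S.tp S.ti, 0 < H t → HasDerivAt (fun s => I s / H s)
      ((∫ θ in (0:ℝ)..1, (pt S.h t θ * (G t θ - I t / H t) + S.h t θ * pt G t θ)) / H t) t := by
    intro t ht hHpos
    refine ((hId t ht).div (hHd t ht) hHpos.ne').congr_deriv ?_
    have c1 := (smh (S := S)).pt.contθ ht
    have c2 := (smh (S := S)).contθ ht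
    have c3 := hG.contθ ht
    have c4 := hG.pt.contθ ht
    have e : ∫ θ in (0:ℝ)..1, (pt S.h t θ * (G t θ - I t / H t) + S.h t θ * pt G t θ)
      = (∫ θ in (0:ℝ)..1, (pt S.h t θ * G t θ + S.h t θ * pt G t θ))
        - (∫ θ in (0:ℝ)..1, pt S.h t θ) * (I t / H t) := by
      have d1 : Continuous fun θ => pt S.h t θ * G t θ + S.h t θ * pt G t θ :=
        (c1.mul c3).add (c2.mul c4)
      have d2 : Continuous fun θ => pt S.h t θ * (I t / H t) := c1.mul continuous_const
      rw [← intervalIntegral.integral_mul_const, ← intervalIntegral.integral_sub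
        (d1.intervalIntegrable _ _) (d2.intervalIntegrable _ _)]
      refine intervalIntegral.integral_congr fun θ _ => ?_
      show _ = _
      ring
    rw [e]
    field_simp
  have hti : 0 < S.ti := S.htp.trans S.hti
  set L := (2 * S.ti * (c * M) + c) * M / b with hL
  have hmd' : ∀ t ∈ Ioc S.tp S.t0,
      ‖(∫ θ in (0:ℝ)..1, (pt S.h t θ * (G t θ - I t / H t) + S.h t θ * pt G t θ)) / H t‖ ≤ L := by
    intro t ht
    have ht' := mem_Ioo ht
    have hHb := hb t ht
    have hHpos : 0 < H t := hb0.trans_le hHb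
    have c1 := (smh (S := S)).pt.contθ ht'
    have c2 := (smh (S := S)).contθ ht'
    have c3 := hG.contθ ht'
    have c4 := hG.pt.contθ ht'
    have hcM : 0 ≤ c * M := mul_nonneg (hc0 t ht) hM0.le
    have h3 := abs_integral01_le (g := fun θ => pt S.h t θ * (G t θ - I t / H t) + S.h t θ * pt G t θ)
      (k := fun θ => (2 * S.ti * (c * M) + c) * S.dm t θ)
      ((c1.mul (c3.sub continuous_const)).add (c2.mul c4)) ((dm_cont ht').const_mul _) fun θ => by
        refine (abs_add_le _ _).trans ?_
        rw [abs_mul, abs_mul, abs_of_pos (hpos ht' θ), abs_of_nonneg (pt_h_le ht' θ).1, add_mul]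
        refine add_le_add ?_ (h2 t ht θ)
        have h5 : 2 * S.ti * S.en t θ ≤ 2 * S.ti * S.dm t θ :=
          mul_le_mul_of_nonneg_left (en_le_dm ht' θ) (by linarith)
        calc pt S.h t θ * |G t θ - I t / H t| ≤ (2 * S.ti * S.dm t θ) * (c * M) :=
              mul_le_mul ((pt_h_le ht' θ).2.trans h5) (hmean t ht θ) (abs_nonneg _)
                (mul_nonneg (by linarith) (dm_nonneg ht' θ))
          _ = _ := by ring
    rw [intervalIntegral.integral_const_mul] at h3
    have h0 : 0 ≤ 2 * S.ti * (c * M) + c := by have := hc0 t ht; positivity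
    rw [norm_div, Real.norm_eq_abs, Real.norm_eq_abs, abs_of_pos hHpos, hL]
    exact div_le_div₀ (by positivity) (h3.trans (mul_le_mul_of_nonneg_left (hM t ht) h0)) hb0 hHb
  set m : ℝ → ℝ := fun s => I s / H s with hm
  have hlip : ∀ t ∈ Ioc S.tp S.t0, ‖m S.t0 - m t‖ ≤ L * ‖S.t0 - t‖ := fun t ht =>
    (convex_Icc t S.t0).norm_image_sub_le_of_norm_hasDerivWithin_le
      (f := m) (f' := fun t => (∫ θ in (0:ℝ)..1, (pt S.h t θ * (G t θ - I t / H t)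
        + S.h t θ * pt G t θ)) / H t)
      (fun s hs => (hmd s (mem_Ioo ⟨ht.1.trans_le hs.1, hs.2⟩)
        (hb0.trans_le (hb s ⟨ht.1.trans_le hs.1, hs.2⟩))).hasDerivWithinAt)
      (fun s hs => hmd' s ⟨ht.1.trans_le hs.1, hs.2⟩) ⟨le_rfl, ht.2⟩ ⟨ht.2, le_rfl⟩
  have hL0 : 0 ≤ L := (norm_nonneg _).trans (hmd' S.t0 ⟨tp_lt_t0, le_rfl⟩)
  refine Bd.mk' (C := c * M + (|m S.t0| + L * (S.t0 - S.tp))) fun t ht θ => ?_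
  have h3 := hmean t ht θ
  have h4 := hlip t ht
  rw [Real.norm_eq_abs, Real.norm_eq_abs, abs_of_nonneg (sub_nonneg.2 ht.2)] at h4
  have h5 : L * (S.t0 - t) ≤ L * (S.t0 - S.tp) :=
    mul_le_mul_of_nonneg_left (by linarith [ht.1]) hL0
  have h6 : |G t θ| ≤ |G t θ - m t| + |m t| := by
    simpa using abs_add_le (G t θ - m t) (m t)
  have h7 : |m t| ≤ |m S.t0| + |m S.t0 - m t| := by
    have := abs_sub (m S.t0) (m S.t0 - m t)
    simpa using this
  have h8 : |G t θ - m t| ≤ c * M := h3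
  linarith

end EV

/-! ### Boundedness of `U`, `A`, `J`, `K` and upper bound for `β` -/

namespace EV

variable {S : EV} {t θ : ℝ}

theorem h_pt_ν (ht : t ∈ Ioo S.tp S.ti) (θ : ℝ) : S.h t θ * pt S.ν t θ = t * S.en t θ := by
  rw [en, mul_div_cancel₀ _ (tpos ht).ne']

theorem h_mul_a (ht : t ∈ Ioo S.tp S.ti) (θ : ℝ) : S.h t θ * S.a t θ = 1 :=
  inv_mul_cancel₀ (apos ht θ).ne'

theorem abs_le_one_add_sq (x : ℝ) : |x| ≤ 1 + x ^ 2 := by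
  rcases abs_cases x with ⟨h, _⟩ | ⟨h, _⟩ <;> rw [h] <;> nlinarith [sq_nonneg (x - 1), sq_nonneg (x + 1)]

/-- a quantity whose square is dominated by `ν_t` is dominated by `dm` in the mean -/
theorem h_mul_le_dm (ht : t ∈ Ioo S.tp S.ti) (θ : ℝ) {x C : ℝ} (hC : 0 ≤ C)
    (hx : x ^ 2 ≤ C * pt S.ν t θ) : S.h t θ * |x| ≤ (1 + C * S.ti) * S.dm t θ := by
  have hh := hpos ht θ
  have h1 := mul_le_mul_of_nonneg_left (abs_le_one_add_sq x) hh.le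
  have h2 := mul_le_mul_of_nonneg_left hx hh.le
  have h3 : S.h t θ * (C * pt S.ν t θ) = C * (t * S.en t θ) := by rw [← h_pt_ν ht]; ring
  have h4 : C * (t * S.en t θ) ≤ C * (S.ti * S.dm t θ) :=
    mul_le_mul_of_nonneg_left (mul_le_mul ht.2.le (en_le_dm ht θ) (en_nonneg ht θ)
      (S.htp.trans S.hti).le) hC
  have h5 := h_le_dm ht θ
  linarith

theorem abs_h_a (ht : t ∈ Ioo S.tp S.ti) (θ x : ℝ) : |x| = S.h t θ * |S.a t θ * x| := by
  rw [abs_mul, abs_of_pos (apos ht θ), ← mul_assoc, h_mul_a ht, one_mul]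

theorem wave_le (ht : t ∈ Ioo S.tp S.ti) (θ : ℝ) :
    t * (pt S.U t θ ^ 2 + (S.a t θ * pθ S.U t θ) ^ 2
      + Real.exp (4 * S.U t θ) / (4 * t ^ 2) * (pt S.A t θ ^ 2 + (S.a t θ * pθ S.A t θ) ^ 2))
      ≤ pt S.ν t θ := by
  have h1 := pt_ν ht θ
  have h2 := rho_nonneg (mem_Ioc ht) θ
  have h3 := p_nonneg ht θ
  linarith

theorem U_sq_le (ht : t ∈ Ioo S.tp S.ti) (θ : ℝ) : pt S.U t θ ^ 2 ≤ S.tp⁻¹ * pt S.ν t θ ∧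
    (S.a t θ * pθ S.U t θ) ^ 2 ≤ S.tp⁻¹ * pt S.ν t θ := by
  have h1 := wave_le ht θ
  have htp := S.htp
  have ht0 := tpos ht
  have h2 : 0 ≤ Real.exp (4 * S.U t θ) / (4 * t ^ 2) * (pt S.A t θ ^ 2 + (S.a t θ * pθ S.A t θ) ^ 2) := by
    positivity
  have h3 : t * (pt S.U t θ ^ 2 + (S.a t θ * pθ S.U t θ) ^ 2) ≤ pt S.ν t θ := by nlinarith
  have h4 : S.tp * (pt S.U t θ ^ 2 + (S.a t θ * pθ S.U t θ) ^ 2) ≤ pt S.ν t θ :=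
    (mul_le_mul_of_nonneg_right ht.1.le (by positivity)).trans h3
  rw [inv_mul_eq_div, le_div_iff₀ htp, le_div_iff₀ htp]
  constructor <;> nlinarith [sq_nonneg (pt S.U t θ), sq_nonneg (S.a t θ * pθ S.U t θ)]

theorem bdU : S.Bd S.U := by
  have h0 : (0:ℝ) ≤ S.tp⁻¹ := (inv_pos.2 S.htp).le
  refine Bd.of_density smU perU (c := 1 + S.tp⁻¹ * S.ti) (fun t ht θ => ?_) fun t ht θ =>
    h_mul_le_dm (mem_Ioo ht) θ h0 (U_sq_le (mem_Ioo ht) θ).1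
  rw [abs_h_a (mem_Ioo ht)]
  exact h_mul_le_dm (mem_Ioo ht) θ h0 (U_sq_le (mem_Ioo ht) θ).2

theorem A_sq_le : ∃ C, 0 ≤ C ∧ ∀ t ∈ Ioc S.tp S.t0, ∀ θ, pt S.A t θ ^ 2 ≤ C * pt S.ν t θ ∧
    (S.a t θ * pθ S.A t θ) ^ 2 ≤ C * pt S.ν t θ := by
  obtain ⟨C, hC0, hC⟩ := (bdU (S := S)).neg.exp.upper
  have hti : 0 < S.ti := S.htp.trans S.hti
  refine ⟨4 * S.ti * C ^ 4, by positivity, fun t ht' θ => ?_⟩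
  have ht := mem_Ioo ht'
  have h1 := wave_le ht θ
  have ht0 := tpos ht
  set X := pt S.A t θ ^ 2 + (S.a t θ * pθ S.A t θ) ^ 2 with hX
  have hX0 : 0 ≤ X := by positivity
  have h2 : 0 ≤ t * (pt S.U t θ ^ 2 + (S.a t θ * pθ S.U t θ) ^ 2) := by positivity
  have h3 : t * (Real.exp (4 * S.U t θ) / (4 * t ^ 2) * X) ≤ pt S.ν t θ := by linarith
  have h4 : Real.exp (- S.U t θ) ≤ C := (le_abs_self _).trans (hC t ht' θ)
  have h5 : Real.exp (4 * S.U t θ) * Real.exp (- S.U t θ) ^ 4 = 1 := by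
    rw [← Real.exp_nat_mul, ← Real.exp_add, Real.exp_eq_one_iff]; push_cast; ring
  have h6 : X ≤ 4 * t * C ^ 4 * pt S.ν t θ := by
    have i1 : X = 4 * t * Real.exp (- S.U t θ) ^ 4 * (t * (Real.exp (4 * S.U t θ) / (4 * t ^ 2) * X)) := by
      field_simp
      linear_combination - X * h5
    rw [i1]
    have i2 := pow_le_pow_left₀ (Real.exp_pos (- S.U t θ)).le h4 4
    have i3 := mul_le_mul_of_nonneg_left i2 (by positivity : 0 ≤ 4 * t)
    exact mul_le_mul i3 h3 (by positivity) (by positivity)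
  have h7 : 4 * t * C ^ 4 * pt S.ν t θ ≤ 4 * S.ti * C ^ 4 * pt S.ν t θ := by
    refine mul_le_mul_of_nonneg_right ?_ (pt_ν_nonneg ht θ)
    refine mul_le_mul_of_nonneg_right ?_ (by positivity)
    linarith [ht.2]
  constructor <;> nlinarith [sq_nonneg (pt S.A t θ), sq_nonneg (S.a t θ * pθ S.A t θ)]

theorem bdA : S.Bd S.A := by
  obtain ⟨C, hC0, hC⟩ := A_sq_le (S := S)
  refine Bd.of_density smA perA (c := 1 + C * S.ti) (fun t ht θ => ?_) fun t ht θ =>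
    h_mul_le_dm (mem_Ioo ht) θ hC0 (hC t ht θ).1
  rw [abs_h_a (mem_Ioo ht)]
  exact h_mul_le_dm (mem_Ioo ht) θ hC0 (hC t ht θ).2

theorem abs_integral_f_le (ht : t ∈ Ioc S.tp S.ti) (θ : ℝ) {g k : V3 → ℝ} (hg : Continuous g)
    (hk : Continuous k) (h : ∀ v, S.f t θ v ≠ 0 → |g v| ≤ k v) :
    |∫ v, S.f t θ v * g v| ≤ ∫ v, S.f t θ v * k v := by
  refine (abs_integral_le_integral_abs).trans (integral_mono (integrable_f ht θ hg).abs
    (integrable_f ht θ hk) fun v => ?_)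
  show |S.f t θ v * g v| ≤ S.f t θ v * k v
  rw [abs_mul, abs_of_nonneg (S.hfnn t ht θ v)]
  by_cases h0 : S.f t θ v = 0
  · simp [h0]
  · exact mul_le_mul_of_nonneg_left (h v h0) (S.hfnn t ht θ v)

theorem bd_charge {G : ℝ → ℝ → ℝ} (hG : Sm S.tp S.ti G) (hp : Per G) {g : V3 → ℝ} (hg : Continuous g)
    {V : ℝ} (hV : ∀ t ∈ Ioc S.tp S.ti, ∀ θ v, S.f t θ v ≠ 0 → |g v| ≤ V)
    (h1 : ∀ t ∈ Ioo S.tp S.ti, ∀ θ, pθ G t θ = 2 * ∫ v, S.f t θ v * g v)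
    (h2 : ∀ t ∈ Ioo S.tp S.ti, ∀ θ, pt G t θ
      = - (2 * S.α t θ) * ∫ v, S.f t θ v * (v.1 * g v / S.w t θ v)) :
    S.Bd G := by
  have hn : ∀ t ∈ Ioo S.tp S.ti, ∀ θ, ∫ v, S.f t θ v * V = V * S.n t θ := fun t ht θ => by
    rw [integral_mul_const, n, mul_comm]
  have hV0 : ∀ t ∈ Ioo S.tp S.ti, ∀ θ, 0 ≤ V * S.n t θ := fun t ht θ => by
    rw [← hn t ht θ]
    exact (abs_nonneg _).trans (abs_integral_f_le (mem_Ioc ht) θ hg continuous_const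
      (hV t (mem_Ioc ht) θ))
  refine Bd.of_density hG hp (c := 2 * max V 0) (fun t ht θ => ?_) fun t ht θ => ?_
  all_goals
    have ht' := mem_Ioo ht
    have hm : V * S.n t θ ≤ max V 0 * S.dm t θ :=
      (mul_le_mul_of_nonneg_right (le_max_left V 0) (n_nonneg (mem_Ioc ht') θ)).trans
        (mul_le_mul_of_nonneg_left (n_le_dm ht' θ) (le_max_right V 0))
  · rw [h1 t ht', abs_mul, abs_two, mul_assoc]
    have := abs_integral_f_le (mem_Ioc ht') θ hg continuous_const (hV t (mem_Ioc ht') θ)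
    rw [hn t ht'] at this
    linarith
  · have ha := apos ht' θ
    have h3 := abs_integral_f_le (mem_Ioc ht') θ (cont_div_w (mem_Ioc ht') θ (continuous_fst.mul hg))
      (continuous_const (y := S.h t θ * V)) fun v hv => by
        have hw := w_pos' (mem_Ioc ht') θ v
        have i1 : |v.1| ≤ S.h t θ * S.w t θ v := by
          rw [h, inv_mul_eq_div, le_div_iff₀ ha, mul_comm]; exact a_v1_le (mem_Ioc ht') θ v
        show |v.1 * g v / S.w t θ v| ≤ _
        rw [abs_div, abs_mul, abs_of_pos hw, div_le_iff₀ hw]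
        calc |v.1| * |g v| ≤ (S.h t θ * S.w t θ v) * V :=
              mul_le_mul i1 (hV t (mem_Ioc ht') θ v hv) (abs_nonneg _) (mul_nonneg (hpos ht' θ).le hw.le)
          _ = _ := by ring
    have h4 : ∫ v, S.f t θ v * (S.h t θ * V) = S.h t θ * (V * S.n t θ) := by
      rw [integral_mul_const, n]; ring
    rw [h4] at h3
    have h5 : S.h t θ * S.α t θ * S.h t θ = 1 := by
      rw [← a_sq ht', h]; field_simp
    rw [h2 t ht', abs_mul, abs_neg, abs_mul, abs_two, abs_of_pos (αpos ht' θ)]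
    have h6 := mul_le_mul_of_nonneg_left h3 (mul_pos (hpos ht' θ) (αpos ht' θ)).le
    have h7 : S.h t θ * S.α t θ * (S.h t θ * (V * S.n t θ)) = V * S.n t θ := by
      linear_combination (V * S.n t θ) * h5
    have h8 : S.h t θ * (2 * S.α t θ * |∫ v, S.f t θ v * (v.1 * g v / S.w t θ v)|)
      = 2 * (S.h t θ * S.α t θ * |∫ v, S.f t θ v * (v.1 * g v / S.w t θ v)|) := by ring
    show S.h t θ * (2 * S.α t θ * |∫ v, S.f t θ v * (v.1 * g v / S.w t θ v)|) ≤ _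
    rw [h8]
    have h9 : S.h t θ * S.α t θ * |∫ v, S.f t θ v * (v.1 * g v / S.w t θ v)| ≤ V * S.n t θ :=
      h6.trans h7.le
    linarith

theorem bdJ : S.Bd S.J := by
  obtain ⟨V, hV0, hV⟩ := exists_supp23 (S := S)
  refine bd_charge smJ perJ (g := fun v => v.2.1) (V := V) (by fun_prop) (fun t ht θ v hv => ?_)
    (fun t ht θ => S.hjth t (mem_Ioc ht) θ) fun t ht θ => ?_
  · by_contra! hlt
    exact hv (hV t ht θ v (Or.inl hlt))
  · have := S.hjt t (mem_Ioc ht) θ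
    simp only [abs_v0] at this
    rw [this]
    congr 1
    · ring
    · exact integral_congr_ae (Filter.Eventually.of_forall fun v => by show _ / _ = _; ring)

theorem bdK : S.Bd S.K := by
  obtain ⟨V, hV0, hV⟩ := exists_supp23 (S := S)
  refine bd_charge smK perK (g := fun v => v.2.2) (V := V) (by fun_prop) (fun t ht θ v hv => ?_)
    (fun t ht θ => S.hkth t (mem_Ioc ht) θ) fun t ht θ => ?_
  · by_contra! hlt
    exact hv (hV t ht θ v (Or.inr hlt))
  · have := S.hkt t (mem_Ioc ht) θ
    simp only [abs_v0] at this
    rw [this]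
    congr 1
    · ring
    · exact integral_congr_ae (Filter.Eventually.of_forall fun v => by show _ / _ = _; ring)

/-- `β = ν + (ln α)/2` -/
def be (S : EV) (t θ : ℝ) : ℝ := S.ν t θ + Real.log (S.α t θ) / 2

theorem smbe : Sm S.tp S.ti S.be :=
  smν.add ((smα.log fun t ht θ => (αpos ht θ).ne').div (Sm.const 2) fun _ _ _ => two_ne_zero)
theorem perbe : Per S.be := fun t θ => by simp only [be, perν t θ, perα t θ]

theorem pθ_be (ht : t ∈ Ioo S.tp S.ti) (θ : ℝ) : pθ S.be t θ = S.h t θ * S.B t θ := by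
  have h1 : HasDerivAt (fun x => S.be t x) (pθ S.ν t θ + pθ S.α t θ / S.α t θ / 2) θ :=
    (smν.dθ ht θ).add (((smα.dθ ht θ).log (αpos ht θ).ne').div_const 2)
  have h2 : pθ S.be t θ = pθ S.ν t θ + pθ S.α t θ / S.α t θ / 2 := h1.deriv
  have ha := apos ht θ
  rw [h2, h, B, ← a_sq ht]
  field_simp

theorem exp_be (ht : t ∈ Ioo S.tp S.ti) (θ : ℝ) :
    Real.exp (S.be t θ) = S.a t θ * Real.exp (S.ν t θ) := by
  rw [be, Real.exp_add, mul_comm, a, Real.sqrt_eq_rpow, Real.rpow_def_of_pos (αpos ht θ)]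
  ring_nf

theorem exp_two_be (ht : t ∈ Ioo S.tp S.ti) (θ : ℝ) :
    Real.exp (S.be t θ) ^ 2 = S.α t θ * Real.exp (2 * S.ν t θ) := by
  rw [exp_be ht, mul_pow, a_sq ht, ← Real.exp_nat_mul]; push_cast; rfl

theorem h_B_le (ht : t ∈ Ioo S.tp S.ti) (θ : ℝ) : |S.h t θ * S.B t θ| ≤ S.ti * S.dm t θ := by
  rw [abs_mul, abs_of_pos (hpos ht θ)]
  have h1 := mul_le_mul_of_nonneg_left (abs_B_le ht θ) (hpos ht θ).le
  rw [h_pt_ν ht] at h1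
  exact h1.trans (mul_le_mul ht.2.le (en_le_dm ht θ) (en_nonneg ht θ) (S.htp.trans S.hti).le)

theorem be_upper : ∃ C, ∀ t ∈ Ioc S.tp S.t0, ∀ θ, S.be t θ ≤ C := by
  obtain ⟨E, hE0, hE⟩ := energy_bdd (S := S)
  obtain ⟨M, hM0, hM⟩ := dm_bdd (S := S)
  obtain ⟨D, hD0, hD⟩ := (bdU (S := S)).upper
  set N := ∫ θ in (0:ℝ)..1, S.n S.ti θ with hN
  have hN0 : 0 < N := S.hC2
  have hti : 0 < S.ti := S.htp.trans S.hti
  refine ⟨Real.log (S.ti * E / N) + S.ti * M + 2 * D, fun t ht' θ => ?_⟩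
  have ht := mem_Ioo ht'
  have hosc : ∀ x, S.be t θ - S.ti * M - 2 * D ≤ S.be t x - S.U t x := fun x => by
    have h1 := smbe.osc perbe ht θ x
    have h2 := h1.trans (integral01_mono (smbe.pθ.contθ ht).abs ((dm_cont ht).const_mul S.ti) fun y => by
      show |pθ S.be t y| ≤ S.ti * S.dm t y
      rw [pθ_be ht]; exact h_B_le ht y)
    rw [intervalIntegral.integral_const_mul] at h2
    have h3 := mul_le_mul_of_nonneg_left (hM t ht') hti.le
    have h4 := abs_le.1 (h2.trans h3)
    have h6 := abs_le.1 (hD t ht' x)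
    linarith [h4.2]
  set c := Real.exp (S.be t θ - S.ti * M - 2 * D) with hc
  have h1 : ∫ x in (0:ℝ)..1, c * S.n t x ≤ ∫ x in (0:ℝ)..1, t * S.en t x := by
    refine integral01_mono ((n_contθ (mem_Ioc ht)).const_mul c) ((smen.contθ ht).const_mul t) fun x => ?_
    have i1 := n_le_rho (mem_Ioc ht) x
    have i2 := i1.trans (rho_le ht x)
    have i3 := mul_le_mul_of_nonneg_left i2 (hpos ht x).le
    rw [h_pt_ν ht] at i3
    refine le_trans ?_ i3
    have i4 : S.h t x * (S.α t x * Real.exp (S.ν t x - S.U t x) * S.n t x)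
      = Real.exp (S.be t x - S.U t x) * S.n t x := by
      rw [Real.exp_sub, Real.exp_sub, exp_be ht, ← a_sq ht, h]
      have := apos ht x
      field_simp
    rw [i4]
    exact mul_le_mul_of_nonneg_right (Real.exp_le_exp.2 (hosc x)) (n_nonneg (mem_Ioc ht) x)
  rw [intervalIntegral.integral_const_mul, intervalIntegral.integral_const_mul, number_eq ht, ← hN] at h1
  have h2 : t * ∫ x in (0:ℝ)..1, S.en t x ≤ S.ti * E :=
    mul_le_mul ht.2.le (hE t ht') (integral01_nonneg fun θ => en_nonneg ht θ) hti.le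
  have h3 : c ≤ S.ti * E / N := by rw [le_div_iff₀ hN0]; linarith
  have h4 := Real.log_le_log (Real.exp_pos _) h3
  rw [Real.log_exp] at h4
  linarith

theorem bd_exp_be : S.Bd (fun t θ => S.α t θ * Real.exp (2 * S.ν t θ)) := by
  obtain ⟨C, hC⟩ := be_upper (S := S)
  refine Bd.mk' (C := Real.exp C ^ 2) fun t ht θ => ?_
  rw [← exp_two_be (mem_Ioo ht), abs_of_nonneg (sq_nonneg _)]
  exact pow_le_pow_left₀ (Real.exp_pos _).le (Real.exp_le_exp.2 (hC t ht θ)) 2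

theorem bd_exp_be' : S.Bd (fun t θ => S.α t θ * Real.exp (2 * S.ν t θ - 4 * S.U t θ)) :=
  (bd_exp_be.mul ((Bd.const (-4)).mul bdU).exp).congr fun t ht θ => by
    rw [sub_eq_add_neg, Real.exp_add]; ring_nf

theorem bdp : S.Bd S.p :=
  (((bd_exp_be'.mul (bdJ.pow 2)).div_time).add
    ((bd_exp_be.mul ((bdK.sub (bdA.mul bdJ)).pow 2)).mul (Bd.time_inv.pow 3))).congr fun t ht θ => by
    rw [p, inv_pow]; rfl

end EV

/-! ### The renormalised primitive of the energy density -/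

theorem Sm.primitive {a b : ℝ} {G : ℝ → ℝ → ℝ} (hG : Sm a b G) :
    Sm a b (fun t θ => ∫ x in (0:ℝ)..θ, G t x) := by
  obtain ⟨χ, hχ1, -, hχc⟩ : ∃ χ : ContDiffBump (0:ℝ), (∀ x, |x| ≤ 1 → χ x = 1) ∧ True ∧ (∀ x, x ∉ Metric.closedBall (0:ℝ) 2 → χ x = 0) := by
    refine ⟨⟨1, 2, one_pos, one_lt_two⟩, fun x hx => ?_, trivial, fun x hx => ?_⟩
    · exact ContDiffBump.one_of_mem_closedBall _ (by simpa using hx)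
    · exact ContDiffBump.zero_of_le_dist _ (by simpa using (not_le.1 (by simpa using hx)).le)
  let g : ℝ × ℝ → ℝ → ℝ := fun p x => χ x * (p.2 * G p.1 (-(p.2 * x)))
  have hg : ContDiffOn ℝ (⊤ : ℕ∞) ↿g ((Ioo a b ×ˢ (univ : Set ℝ)) ×ˢ univ) := by
    refine ContDiffOn.mul (χ.contDiff.comp contDiff_snd).contDiffOn (ContDiffOn.mul (contDiff_snd.comp contDiff_fst).contDiffOn ?_)
    refine ContDiffOn.comp (g := fun p : ℝ × ℝ => G p.1 p.2) (f := fun q : (ℝ × ℝ) × ℝ => (q.1.1, -(q.1.2 * q.2))) hG ?_ ?_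
    · exact (ContDiff.prodMk (contDiff_fst.comp contDiff_fst) (((contDiff_snd.comp contDiff_fst).mul contDiff_snd).neg)).contDiffOn
    · exact fun q hq => ⟨hq.1.1, mem_univ _⟩
  have hf : LocallyIntegrable ((Ioc (0:ℝ) 1).indicator (fun _ => (1:ℝ))) volume :=
    (locallyIntegrable_const (1:ℝ)).indicator measurableSet_Ioc
  have key := contDiffOn_convolution_right_with_param_comp (μ := volume) (ContinuousLinearMap.mul ℝ ℝ)
    (v := fun _ : ℝ × ℝ => (0:ℝ)) contDiffOn_const (isOpen_strip a b)
    (isCompact_closedBall (0:ℝ) 2) (fun p x _ hx => by simp [g, hχc x hx]) hf hg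
  refine ContDiffOn.congr key fun p hp => ?_
  have h1 : ∀ s ∈ Ioc (0:ℝ) 1, g p (0 - s) = p.2 * G p.1 (p.2 * s) := by
    intro s hs
    simp only [g]
    rw [hχ1 _ (by rw [zero_sub, abs_neg, abs_of_pos hs.1]; exact hs.2), one_mul]
    congr 2; ring
  rw [convolution_def]
  have h2 : ∀ s, (ContinuousLinearMap.mul ℝ ℝ) ((Ioc (0:ℝ) 1).indicator (fun _ => (1:ℝ)) s) (g p (0 - s))
      = (Ioc (0:ℝ) 1).indicator (fun s => p.2 * G p.1 (p.2 * s)) s := by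
    intro s
    by_cases hs : s ∈ Ioc (0:ℝ) 1
    · simp only [indicator_of_mem hs, h1 s hs, ContinuousLinearMap.mul_apply', one_mul]
    · simp only [indicator_of_notMem hs, ContinuousLinearMap.mul_apply', zero_mul]
  simp only [h2]
  rw [integral_indicator measurableSet_Ioc, ← intervalIntegral.integral_of_le zero_le_one,
    intervalIntegral.integral_const_mul]
  have h3 := intervalIntegral.smul_integral_comp_mul_left (a := 0) (b := 1) (fun x => G p.1 x) p.2
  simp only [mul_zero, mul_one, smul_eq_mul] at h3
  exact h3.symm

theorem Sm.time_primitive {a b c : ℝ} {g : ℝ → ℝ} (hg : ContDiffOn ℝ (⊤ : ℕ∞) g (Ioo a b))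
    (hc : c ∈ Ioo a b) :
    ContDiffOn ℝ (⊤ : ℕ∞) (fun t => ∫ s in c..t, g s) (Ioo a b) ∧
    ∀ t ∈ Ioo a b, HasDerivAt (fun t => ∫ s in c..t, g s) (g t) t := by
  have hd : ∀ t ∈ Ioo a b, HasDerivAt (fun t => ∫ s in c..t, g s) (g t) t := by
    intro t ht
    have hsub : uIcc c t ⊆ Ioo a b := (convex_Ioo a b).ordConnected.uIcc_subset hc ht
    refine intervalIntegral.integral_hasDerivAt_right
      ((hg.continuousOn.mono hsub).intervalIntegrable) ?_
      (hg.continuousOn.continuousAt (isOpen_Ioo.mem_nhds ht))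
    exact hg.continuousOn.stronglyMeasurableAtFilter isOpen_Ioo t ht
  refine ⟨?_, hd⟩
  rw [contDiffOn_infty_iff_deriv_of_isOpen isOpen_Ioo]
  exact ⟨fun t ht => (hd t ht).differentiableAt.differentiableWithinAt,
    hg.congr fun t ht => (hd t ht).deriv⟩

theorem Sm.slice {a b : ℝ} {G : ℝ → ℝ → ℝ} (hG : Sm a b G) (θ : ℝ) :
    ContDiffOn ℝ (⊤ : ℕ∞) (fun t => G t θ) (Ioo a b) :=
  ContDiffOn.comp (g := fun p : ℝ × ℝ => G p.1 p.2) (f := fun t : ℝ => (t, θ)) hG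
    (contDiff_id.prodMk contDiff_const).contDiffOn fun t ht => ⟨ht, mem_univ _⟩

namespace EV

variable {S : EV} {t θ : ℝ}

/-- the energy-to-length ratio -/
def ratio (S : EV) (t : ℝ) : ℝ := (∫ x in (0:ℝ)..1, S.en t x) / (∫ x in (0:ℝ)..1, S.h t x)

theorem H_pos (ht : t ∈ Ioo S.tp S.ti) : 0 < ∫ x in (0:ℝ)..1, S.h t x :=
  intervalIntegral.intervalIntegral_pos_of_pos ((smh.contθ ht).intervalIntegrable _ _)
    (fun x => hpos ht x) one_pos

theorem smratio : ContDiffOn ℝ (⊤ : ℕ∞) S.ratio (Ioo S.tp S.ti) :=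
  ContDiffOn.div (smen.primitive.slice 1) (smh.primitive.slice 1) fun t ht => ne_of_gt (H_pos ht)

/-- the phase `Λ` -/
def lam (S : EV) (t θ : ℝ) : ℝ := open Classical in
  if t ∈ Ioo S.tp S.ti then (∫ s in S.t0..t, S.B s 0 / s) + ∫ x in (0:ℝ)..θ, (S.en t x - S.ratio t * S.h t x)
  else 0

theorem lam_eq : ∀ t ∈ Ioo S.tp S.ti, ∀ θ, S.lam t θ =
    (∫ s in S.t0..t, S.B s 0 / s) + ∫ x in (0:ℝ)..θ, (S.en t x - S.ratio t * S.h t x) :=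
  fun t ht θ => if_pos ht

theorem sm_dens : Sm S.tp S.ti (fun t θ => S.en t θ - S.ratio t * S.h t θ) :=
  smen.sub ((Sm.of_time smratio).mul smh)

theorem sm_B_time : ContDiffOn ℝ (⊤ : ℕ∞) (fun s => S.B s 0 / s) (Ioo S.tp S.ti) :=
  ContDiffOn.div (smB.slice 0) contDiffOn_id fun t ht => (tpos ht).ne'

theorem smlam : Sm S.tp S.ti S.lam :=
  ((Sm.of_time (Sm.time_primitive sm_B_time t0_mem).1).add sm_dens.primitive).congr lam_eq

theorem perlam : Per S.lam := by
  intro t θ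
  by_cases ht : t ∈ Ioo S.tp S.ti
  · have hen := (smen (S := S)).contθ ht
    have hh := (smh (S := S)).contθ ht
    have hc := (sm_dens (S := S)).contθ ht
    rw [lam_eq t ht, lam_eq t ht, ← intervalIntegral.integral_add_adjacent_intervals
      (hc.intervalIntegrable 0 θ) (hc.intervalIntegrable θ (θ + 1))]
    have hper : Function.Periodic (fun x => S.en t x - S.ratio t * S.h t x) 1 := fun x => by
      simp only [peren t x, perh t x]
    have h0 : ∫ x in (0:ℝ)..1, (S.en t x - S.ratio t * S.h t x) = 0 := by
      rw [intervalIntegral.integral_sub (hen.intervalIntegrable _ _)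
        ((hh.const_mul _).intervalIntegrable _ _), intervalIntegral.integral_const_mul, ratio,
        div_mul_cancel₀ _ (H_pos ht).ne', sub_self]
    rw [hper.intervalIntegral_add_eq θ 0, zero_add, h0, add_zero]
  · simp only [lam, if_neg ht]

theorem pθ_lam (ht : t ∈ Ioo S.tp S.ti) (θ : ℝ) :
    pθ S.lam t θ = S.en t θ - S.ratio t * S.h t θ := by
  rw [pθ_congr lam_eq ht θ]
  have h1 := (((sm_dens (S := S)).contθ ht).integral_hasStrictDerivAt 0 θ).hasDerivAt.const_add
    (∫ s in S.t0..t, S.B s 0 / s)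
  exact h1.deriv

theorem pt_lam (ht : t ∈ Ioo S.tp S.ti) (θ : ℝ) :
    pt S.lam t θ = S.B t 0 / t + ((∫ x in (0:ℝ)..θ, pt S.en t x) -
      (deriv S.ratio t * (∫ x in (0:ℝ)..θ, S.h t x) + S.ratio t * ∫ x in (0:ℝ)..θ, pt S.h t x)) := by
  have hE : (fun s => ∫ x in (0:ℝ)..θ, (S.en s x - S.ratio s * S.h s x)) =ᶠ[nhds t]
      fun s => (∫ x in (0:ℝ)..θ, S.en s x) - S.ratio s * ∫ x in (0:ℝ)..θ, S.h s x := by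
    filter_upwards [isOpen_Ioo.mem_nhds ht] with s hs
    rw [intervalIntegral.integral_sub ((smen.contθ hs).intervalIntegrable _ _)
      (((smh.contθ hs).const_mul _).intervalIntegrable _ _), intervalIntegral.integral_const_mul]
  have h1 : HasDerivAt (fun s => ∫ x in (0:ℝ)..θ, (S.en s x - S.ratio s * S.h s x))
      ((∫ x in (0:ℝ)..θ, pt S.en t x) -
      (deriv S.ratio t * (∫ x in (0:ℝ)..θ, S.h t x) + S.ratio t * ∫ x in (0:ℝ)..θ, pt S.h t x)) t := by
    have hr : HasDerivAt S.ratio (deriv S.ratio t) t :=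
      ((smratio.contDiffAt (isOpen_Ioo.mem_nhds ht)).differentiableAt (by simp)).hasDerivAt
    exact ((smen.hasDerivAt_integral ht 0 θ).sub (hr.mul (smh.hasDerivAt_integral ht 0 θ))).congr_of_eventuallyEq hE
  rw [pt_congr lam_eq ht θ]
  exact (((Sm.time_primitive sm_B_time t0_mem).2 t ht).add h1).deriv

theorem abs_integral_le_integral01 {g k : ℝ → ℝ} (hg : Continuous g) (hk : Continuous k)
    (h : ∀ x, |g x| ≤ k x) (hθ : θ ∈ Icc (0:ℝ) 1) :
    |∫ x in (0:ℝ)..θ, g x| ≤ ∫ x in (0:ℝ)..1, k x := by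
  refine (intervalIntegral.abs_integral_le_integral_abs hθ.1).trans ?_
  refine le_trans ?_ (integral01_mono_sub hk (fun x => (abs_nonneg _).trans (h x)) le_rfl hθ.1 hθ.2)
  exact intervalIntegral.integral_mono_on hθ.1 (hg.abs.intervalIntegrable _ _)
    (hk.intervalIntegrable _ _) fun x _ => h x

theorem abs_pt_lam_sub_le (ht : t ∈ Ioo S.tp S.ti) (hθ : θ ∈ Icc (0:ℝ) 1) {E b : ℝ} (hb : 0 < b)
    (hE : ∫ x in (0:ℝ)..1, S.en t x ≤ E) (hH : b ≤ ∫ x in (0:ℝ)..1, S.h t x) :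
    |pt S.lam t θ - S.B t θ / t| ≤ 8 / S.tp * E + E / b * (2 * S.ti * E) + E / b * (2 * S.ti * E)
    := by
  have htp := S.htp
  have hti : 0 < S.ti := S.htp.trans S.hti
  have ht0 := tpos ht
  have hen := (smen (S := S)).contθ ht
  have hent := (smen (S := S)).pt.contθ ht
  have hh := (smh (S := S)).contθ ht
  have hht := (smh (S := S)).pt.contθ ht
  have hB := (smB (S := S)).pθ.contθ ht
  set e := ∫ x in (0:ℝ)..1, S.en t x with he
  set H := ∫ x in (0:ℝ)..1, S.h t x with hHd
  have hHp : 0 < H := hb.trans_le hH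
  have he0 : 0 ≤ e := integral01_nonneg fun x => en_nonneg ht x
  have hE0 : 0 ≤ E := he0.trans hE
  have h4 : 4 / t ≤ 4 / S.tp := div_le_div_of_nonneg_left (by norm_num) htp ht.1.le
  have hr0 : 0 ≤ S.ratio t := div_nonneg he0 hHp.le
  have hr1 : S.ratio t ≤ E / b := div_le_div₀ hE0 hE hb hH
  have hcd : Continuous fun x => pt S.en t x - pθ S.B t x / t := hent.sub (hB.div_const t)
  have hcdb : ∀ x, |pt S.en t x - pθ S.B t x / t| ≤ 4 / S.tp * S.en t x := fun x => by
    have h1 := pt_en ht x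
    have h2 := mul_le_mul_of_nonneg_right h4 (en_nonneg ht x)
    have h3 := mul_nonneg (div_nonneg zero_le_four htp.le) (en_nonneg ht x)
    rw [abs_le]; constructor <;> linarith
  have i1 : |∫ x in (0:ℝ)..θ, (pt S.en t x - pθ S.B t x / t)| ≤ 4 / S.tp * E := by
    refine (abs_integral_le_integral01 (k := fun x => 4 / S.tp * S.en t x)
      hcd (hen.const_mul _) hcdb hθ).trans ?_
    rw [intervalIntegral.integral_const_mul]
    exact mul_le_mul_of_nonneg_left hE (by positivity)
  have i2 : (∫ x in (0:ℝ)..θ, (pt S.en t x - pθ S.B t x / t))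
      = (∫ x in (0:ℝ)..θ, pt S.en t x) - (S.B t θ - S.B t 0) / t := by
    rw [intervalIntegral.integral_sub (hent.intervalIntegrable _ _)
      ((hB.div_const t).intervalIntegrable _ _), intervalIntegral.integral_div, smB.integral_pθ ht]
  have i3 : |∫ x in (0:ℝ)..1, pt S.en t x| ≤ 4 / S.tp * E := by
    have h0 : ∫ x in (0:ℝ)..1, (pt S.en t x - pθ S.B t x / t) = ∫ x in (0:ℝ)..1, pt S.en t x := by
      rw [intervalIntegral.integral_sub (hent.intervalIntegrable _ _)
        ((hB.div_const t).intervalIntegrable _ _), intervalIntegral.integral_div,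
        smB.integral_pθ_per perB ht]; simp
    rw [← h0]
    refine (abs_integral01_le (k := fun x => 4 / S.tp * S.en t x)
      hcd (hen.const_mul _) hcdb).trans ?_
    rw [intervalIntegral.integral_const_mul]
    exact mul_le_mul_of_nonneg_left hE (by positivity)
  have hht1 : ∀ x, |pt S.h t x| ≤ 2 * S.ti * S.en t x := fun x => by
    rw [abs_of_nonneg (pt_h_le ht x).1]; exact (pt_h_le ht x).2
  have h_int : ∫ x in (0:ℝ)..1, 2 * S.ti * S.en t x ≤ 2 * S.ti * E := by
    rw [intervalIntegral.integral_const_mul]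
    exact mul_le_mul_of_nonneg_left hE (by positivity)
  have i4 : |∫ x in (0:ℝ)..θ, pt S.h t x| ≤ 2 * S.ti * E :=
    (abs_integral_le_integral01 hht (hen.const_mul _) hht1 hθ).trans h_int
  have i5 : |∫ x in (0:ℝ)..1, pt S.h t x| ≤ 2 * S.ti * E :=
    (abs_integral01_le hht (hen.const_mul _) hht1).trans h_int
  have i6 : |∫ x in (0:ℝ)..θ, S.h t x| ≤ H :=
    abs_integral_le_integral01 hh hh (fun x => (abs_of_pos (hpos ht x)).le) hθ
  have hr' : deriv S.ratio t = ((∫ x in (0:ℝ)..1, pt S.en t x) * H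
      - e * ∫ x in (0:ℝ)..1, pt S.h t x) / H ^ 2 :=
    ((smen.hasDerivAt_integral ht 0 1).div (smh.hasDerivAt_integral ht 0 1) hHp.ne').deriv
  have hr2 : deriv S.ratio t * H = (∫ x in (0:ℝ)..1, pt S.en t x)
      - S.ratio t * ∫ x in (0:ℝ)..1, pt S.h t x := by
    rw [hr']
    have : S.ratio t = e / H := rfl
    rw [this]; field_simp
  have hr3 : |deriv S.ratio t * H| ≤ 4 / S.tp * E + E / b * (2 * S.ti * E) := by
    rw [hr2]
    refine (abs_sub _ _).trans (add_le_add i3 ?_)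
    rw [abs_mul, abs_of_nonneg hr0]
    exact mul_le_mul hr1 i5 (abs_nonneg _) (by positivity)
  have e1 : pt S.lam t θ - S.B t θ / t = (∫ x in (0:ℝ)..θ, (pt S.en t x - pθ S.B t x / t))
      - deriv S.ratio t * (∫ x in (0:ℝ)..θ, S.h t x) - S.ratio t * ∫ x in (0:ℝ)..θ, pt S.h t x := by
    rw [pt_lam ht, i2]; ring
  rw [e1]
  have j1 : |deriv S.ratio t * (∫ x in (0:ℝ)..θ, S.h t x)| ≤ |deriv S.ratio t * H| := by
    rw [abs_mul, abs_mul, abs_of_pos hHp]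
    exact mul_le_mul_of_nonneg_left i6 (abs_nonneg _)
  have j2 : |S.ratio t * ∫ x in (0:ℝ)..θ, pt S.h t x| ≤ E / b * (2 * S.ti * E) := by
    rw [abs_mul, abs_of_nonneg hr0]
    exact mul_le_mul hr1 i4 (abs_nonneg _) (by positivity)
  have e2 : 8 / S.tp * E = 4 / S.tp * E + 4 / S.tp * E := by ring
  refine (abs_sub _ _).trans ?_
  have := abs_sub (∫ x in (0:ℝ)..θ, (pt S.en t x - pθ S.B t x / t)) (deriv S.ratio t * (∫ x in (0:ℝ)..θ, S.h t x))
  linarith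

theorem bd_lam_t : S.Bd (fun t θ => pt S.lam t θ - S.B t θ / t) := by
  obtain ⟨E, hE0, hE⟩ := energy_bdd (S := S)
  obtain ⟨b, hb, hH⟩ := H_lower (S := S)
  have hp : Per (fun t θ => pt S.lam t θ - S.B t θ / t) := fun t θ => by
    simp only [perlam.pt t θ, perB t θ]
  refine Bd.mk' (C := 8 / S.tp * E + E / b * (2 * S.ti * E) + E / b * (2 * S.ti * E)) fun t ht θ => ?_
  have := abs_pt_lam_sub_le (mem_Ioo ht) (fract_mem θ) hb (hE t ht) (hH t ht)
  rw [← hp.fract t θ]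
  exact this

theorem bd_ratio : S.Bd (fun t θ => S.ratio t) := by
  obtain ⟨E, hE0, hE⟩ := energy_bdd (S := S)
  obtain ⟨b, hb, hH⟩ := H_lower (S := S)
  refine Bd.mk' (C := E / b) fun t ht θ => ?_
  have he0 : 0 ≤ ∫ x in (0:ℝ)..1, S.en t x := integral01_nonneg fun x => en_nonneg (mem_Ioo ht) x
  have hr0 : 0 ≤ S.ratio t := div_nonneg he0 (H_pos (mem_Ioo ht)).le
  rw [abs_of_nonneg hr0]
  exact div_le_div₀ hE0.le (hE t ht) hb (hH t ht)

theorem bd_lam_θ : S.Bd (fun t θ => S.a t θ * pθ S.lam t θ - pt S.ν t θ / t) := by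
  refine bd_ratio.neg.congr fun t ht θ => ?_
  have h1 := h_mul_a (mem_Ioo ht) θ
  rw [pθ_lam (mem_Ioo ht), en]
  have : S.a t θ * (S.h t θ * pt S.ν t θ / t - S.ratio t * S.h t θ) - pt S.ν t θ / t
    = (S.h t θ * S.a t θ) * (pt S.ν t θ / t) - S.ratio t * (S.h t θ * S.a t θ) - pt S.ν t θ / t := by ring
  rw [this, h1]; ring

theorem bdlam : S.Bd S.lam := by
  obtain ⟨C, hC0, hC⟩ := bd_ratio (S := S)
  obtain ⟨D, hD0, hD⟩ := bd_lam_t (S := S)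
  refine Bd.of_density (c := 1 + C + (S.ti / S.tp + D)) smlam perlam (fun t ht θ => ?_) fun t ht θ => ?_
  all_goals
    have ht' := mem_Ioo ht
    have htp := S.htp
    have hti : 0 < S.ti := S.htp.trans S.hti
    have hdm := dm_nonneg ht' θ
    have hh := h_le_dm ht' θ
    have hh0 := hpos ht' θ
    have x1 : 0 ≤ (S.ti / S.tp + D) * S.dm t θ := by positivity
    have x2 : 0 ≤ (1 + C) * S.dm t θ := by positivity
  · rw [pθ_lam ht']
    refine (abs_sub _ _).trans ?_
    rw [abs_of_nonneg (en_nonneg ht' θ), abs_mul, abs_of_pos hh0]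
    have h1 := en_le_dm ht' θ
    have h2 := mul_le_mul (hC t ht θ) hh hh0.le hC0
    nlinarith
  · have h1 : |pt S.lam t θ| ≤ |S.B t θ / t| + D := by
      have := abs_add_le (pt S.lam t θ - S.B t θ / t) (S.B t θ / t)
      rw [sub_add_cancel] at this
      have := hD t ht θ
      linarith
    have h2 : S.h t θ * |S.B t θ / t| ≤ S.ti / S.tp * S.dm t θ := by
      have h3 := h_B_le ht' θ
      rw [abs_mul, abs_of_pos hh0] at h3
      rw [abs_div, abs_of_pos (tpos ht'), ← mul_div_assoc, div_mul_eq_mul_div]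
      exact div_le_div₀ (by positivity) h3 htp ht'.1.le
    have h4 := mul_le_mul_of_nonneg_left h1 hh0.le
    have h5 := mul_le_mul_of_nonneg_right hh hD0
    nlinarith

end EV

/-! ### Pointwise bounds on the first derivatives of the wave maps -/

namespace EV

variable {S : EV} {t θ : ℝ}

theorem forward_max {ψ : ℝ → ℝ → ℝ} (hψ : Sm S.tp S.ti ψ) (hp : Per ψ)
    (hesc : ∀ t ∈ Ioo S.tp S.t0, ∀ θ, ∃ c d, 0 < d ∧
      HasDerivAt (fun s => ψ (t + s) (θ + s * c)) d 0) :
    ∃ C, ∀ t ∈ Ioc S.tp S.t0, ∀ θ, ψ t θ ≤ C := by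
  obtain ⟨C, -, hC⟩ := hψ.bdd hp (c := S.t0) (d := S.t0) tp_lt_t0 t0_lt_ti
  refine ⟨C, fun t1 ht1 θ1 => ?_⟩
  refine max_principle (S := Icc t1 S.t0 ×ˢ (univ : Set ℝ)) (S' := Icc t1 S.t0 ×ˢ Icc (0:ℝ) 1)
    (isCompact_Icc.prod isCompact_Icc) (ψ := fun p => ψ p.1 p.2)
    (hψ.continuousOn.mono fun p hp => ⟨⟨ht1.1.trans_le hp.1.1, hp.1.2.trans_lt t0_lt_ti⟩, mem_univ _⟩)
    (fun p hp1 => ⟨(p.1, Int.fract p.2), ⟨hp1.1, fract_mem _⟩, hp.fract _ _⟩) (c := C)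
    (fun p hp1 hc => ?_) (t1, θ1) ⟨⟨le_rfl, ht1.2⟩, mem_univ _⟩
  have hlt : p.1 < S.t0 := by
    refine lt_of_le_of_ne hp1.1.2 fun h => ?_
    have := (le_abs_self _).trans (hC p.1 ⟨h.ge, h.le⟩ p.2)
    linarith
  obtain ⟨c, d, hd, hder⟩ := hesc p.1 ⟨ht1.1.trans_le hp1.1.1, hlt⟩ p.2
  refine ⟨fun s => (p.1 + s, p.2 + s * c), d, hd, by simp, ?_, hder⟩
  have : ∀ᶠ s in nhdsWithin (0:ℝ) (Ioi 0), s < S.t0 - p.1 :=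
    nhdsWithin_le_nhds (Iio_mem_nhds (by linarith))
  filter_upwards [this, self_mem_nhdsWithin] with s h1 h2
  have h2 : 0 < s := h2
  exact ⟨⟨by linarith [hp1.1.1], by linarith⟩, mem_univ _⟩

/-- null derivative of a function -/
def nul (S : EV) (ε : ℝ) (W : ℝ → ℝ → ℝ) (t θ : ℝ) : ℝ := pt W t θ + ε * (S.a t θ * pθ W t θ)

theorem smnul {W : ℝ → ℝ → ℝ} (hW : Sm S.tp S.ti W) (ε : ℝ) : Sm S.tp S.ti (S.nul ε W) :=
  hW.pt.add ((Sm.const ε).mul (sma.mul hW.pθ))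
theorem pernul {W : ℝ → ℝ → ℝ} (hW : Per W) (ε : ℝ) : Per (S.nul ε W) := fun t θ => by
  simp only [nul, hW.pt t θ, hW.pθ t θ, pera t θ]

theorem nul_transport {W : ℝ → ℝ → ℝ} (hW : Sm S.tp S.ti W) {ε : ℝ} (hε : ε ^ 2 = 1)
    (ht : t ∈ Ioo S.tp S.ti) (θ : ℝ) :
    pt (S.nul ε W) t θ + -ε * S.a t θ * pθ (S.nul ε W) t θ
      = pt (pt W) t θ - S.a t θ * pθ (fun t θ => S.a t θ * pθ W t θ) t θ
        - ε * (S.q t θ / 2) * (S.a t θ * pθ W t θ) := by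
  have h1 : pt (S.nul ε W) t θ = pt (pt W) t θ
      + ε * (pt S.a t θ * pθ W t θ + S.a t θ * pt (pθ W) t θ) :=
    ((hW.pt.dt ht θ).add (((sma.dt ht θ).mul (hW.pθ.dt ht θ)).const_mul ε)).deriv
  have h2 : pθ (S.nul ε W) t θ = pθ (pt W) t θ
      + ε * pθ (fun t θ => S.a t θ * pθ W t θ) t θ :=
    ((hW.pt.dθ ht θ).add (((sma.mul hW.pθ).dθ ht θ).const_mul ε)).deriv
  have h3 : pt (pθ W) t θ = pθ (pt W) t θ := hW.comm ht θ
  rw [h1, h2, h3, pt_a ht]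
  linear_combination (-S.a t θ * pθ (fun t θ => S.a t θ * pθ W t θ) t θ) * hε

/-- the rescaled null derivative of `A` -/
def zn (S : EV) (ε t θ : ℝ) : ℝ := Real.exp (2 * S.U t θ) * S.nul ε S.A t θ / (2 * t)
/-- the null wave energy -/
def Nn (S : EV) (ε t θ : ℝ) : ℝ := S.nul ε S.U t θ ^ 2 + S.zn ε t θ ^ 2
/-- the field and matter source of the wave equation for `U` -/
def srcU (S : EV) (t θ : ℝ) : ℝ :=
  S.α t θ * Real.exp (2 * S.ν t θ - 4 * S.U t θ) / (2 * t ^ 2) * S.J t θ ^ 2 + S.SU t θ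
/-- the field and matter source of the wave equation for `A` -/
def srcA (S : EV) (t θ : ℝ) : ℝ :=
  S.α t θ * Real.exp (2 * S.ν t θ - 4 * S.U t θ) / t ^ 2 * S.J t θ
    * (S.K t θ - S.A t θ * S.J t θ) + S.SA t θ

theorem smzn (ε : ℝ) : Sm S.tp S.ti (S.zn ε) :=
  (((Sm.const 2).mul smU).exp.mul (smnul smA ε)).div ((Sm.const 2).mul Sm.time)
    fun t ht θ => (mul_pos two_pos (tpos ht)).ne'
theorem smNn (ε : ℝ) : Sm S.tp S.ti (S.Nn ε) := ((smnul smU ε).pow 2).add ((smzn ε).pow 2)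
theorem perNn (ε : ℝ) : Per (S.Nn ε) := fun t θ => by
  simp only [Nn, zn, pernul perU ε t θ, pernul perA ε t θ, perU t θ]
theorem Nn_nonneg (ε t θ : ℝ) : 0 ≤ S.Nn ε t θ := by unfold Nn; positivity

theorem srcU_le (ht : t ∈ Ioo S.tp S.ti) (θ : ℝ) :
    |S.srcU t θ| ≤ S.p t θ / (2 * t) + S.r t θ / t := by
  have h0 := tpos ht
  have h1 := αpos ht θ
  have h2 := SU_nonneg (mem_Ioc ht) θ
  have h3 := SU_le (mem_Ioc ht) θ
  rw [abs_of_nonneg (by unfold srcU; positivity)]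
  refine add_le_add ?_ h3
  rw [p, add_div]
  have e1 : S.α t θ * Real.exp (2 * S.ν t θ - 4 * S.U t θ) / (2 * t ^ 2) * S.J t θ ^ 2
    = S.α t θ * Real.exp (2 * S.ν t θ - 4 * S.U t θ) * S.J t θ ^ 2 / t / (2 * t) := by
    field_simp
  rw [e1]
  exact le_add_of_nonneg_right (by positivity)

theorem srcA_le (ht : t ∈ Ioo S.tp S.ti) (θ : ℝ) :
    Real.exp (2 * S.U t θ) / t * |S.srcA t θ| ≤ S.p t θ / (2 * t) + S.r t θ / t := by
  have h0 := tpos ht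
  have h1 := αpos ht θ
  have h3 := SA_le (mem_Ioc ht) θ
  have hE : 0 < Real.exp (2 * S.U t θ) / t := by positivity
  have h4 := mul_le_mul_of_nonneg_left (abs_add_le (S.α t θ * Real.exp (2 * S.ν t θ - 4 * S.U t θ) / t ^ 2 * S.J t θ
    * (S.K t θ - S.A t θ * S.J t θ)) (S.SA t θ)) hE.le
  rw [mul_add] at h4
  refine h4.trans (add_le_add ?_ h3)
  have e0 : Real.exp (2 * S.ν t θ - 4 * S.U t θ) = Real.exp (2 * S.ν t θ) * (Real.exp (-2 * S.U t θ)) ^ 2 := by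
    rw [← Real.exp_nat_mul, ← Real.exp_add]; congr 1; push_cast; ring
  have e1 : Real.exp (2 * S.U t θ) * Real.exp (-2 * S.U t θ) = 1 := by
    rw [← Real.exp_add]; simp
  set g := Real.exp (-2 * S.U t θ)
  set D := S.K t θ - S.A t θ * S.J t θ
  set k := S.α t θ * Real.exp (2 * S.ν t θ) with hk
  have hk0 : 0 < k := by positivity
  have hg : 0 < g := Real.exp_pos _
  have e2 : Real.exp (2 * S.U t θ) / t * |S.α t θ * Real.exp (2 * S.ν t θ - 4 * S.U t θ) / t ^ 2 * S.J t θ * D|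
      = k / t ^ 2 * (|g * S.J t θ| * |D / t|) := by
    rw [e0, show S.α t θ * (Real.exp (2 * S.ν t θ) * g ^ 2) / t ^ 2 * S.J t θ * D
      = (k * g / t) * ((g * S.J t θ) * (D / t)) by rw [hk]; field_simp, abs_mul, abs_mul (g * S.J t θ),
      abs_of_pos (by positivity : 0 < k * g / t)]
    calc _ = (Real.exp (2 * S.U t θ) * g) * (k / t ^ 2 * (|g * S.J t θ| * |D / t|)) := by field_simp
      _ = _ := by rw [e1, one_mul]
  have e3 : S.p t θ / (2 * t) = k / t ^ 2 * (((g * S.J t θ) ^ 2 + (D / t) ^ 2) / 2) := by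
    rw [p, e0]; field_simp; rw [hk]; ring
  rw [e2, e3]
  refine mul_le_mul_of_nonneg_left ?_ (by positivity)
  rw [← sq_abs (g * S.J t θ), ← sq_abs (D / t)]
  nlinarith [sq_nonneg (|g * S.J t θ| - |D / t|)]

theorem Nn_deriv {ε : ℝ} (hε : ε ^ 2 = 1) (ht : t ∈ Ioo S.tp S.ti) (θ : ℝ) :
    HasDerivAt (fun s => S.Nn ε (t + s) (θ + s * (-ε * S.a t θ)))
      (-S.q t θ * S.Nn ε t θ - (S.nul ε S.U t θ ^ 2 + S.nul ε S.U t θ * S.nul (-ε) S.U t θ) / t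
        - (S.zn ε t θ ^ 2 - S.zn ε t θ * S.zn (-ε) t θ) / t + 2 * S.nul ε S.U t θ * S.srcU t θ
        + S.zn ε t θ * (Real.exp (2 * S.U t θ) / t * S.srcA t θ)) 0 := by
  have h0 := tpos ht
  set c := -ε * S.a t θ with hc
  have hX := (smnul smU ε).dpath ht θ c
  have hY := (smnul smA ε).dpath ht θ c
  have hU := smU.dpath ht θ c
  have htm : HasDerivAt (fun s => t + s) 1 0 := (hasDerivAt_id (0:ℝ)).const_add t
  have hne : (2 * (t + 0)) ≠ 0 := by rw [add_zero]; positivity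
  have hz := ((hU.const_mul 2).exp.mul hY).div (htm.const_mul 2) hne
  have hN := (hX.pow 2).add (hz.pow 2)
  have tX := nul_transport smU hε ht θ
  have tY := nul_transport smA hε ht θ
  rw [← hc] at tX tY
  rw [tX, tY] at hN
  rw [eqU ht, eqA ht] at hN
  refine hN.congr_deriv ?_
  have e4 : Real.exp (4 * S.U t θ) = Real.exp (2 * S.U t θ) ^ 2 := by
    rw [← Real.exp_nat_mul]; congr 1; push_cast; ring
  simp only [Pi.mul_apply, Pi.div_apply, add_zero, zero_mul, Nat.cast_ofNat, e4, Nat.add_one_sub_one, pow_one]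
  simp only [Nn, zn, srcU, srcA, nul, hc]
  set ut := pt S.U t θ
  set ux := S.a t θ * pθ S.U t θ with hux
  set wt := pt S.A t θ
  set wx := S.a t θ * pθ S.A t θ
  have e5 : ut + -ε * S.a t θ * pθ S.U t θ = ut - ε * ux := by rw [hux]; ring
  rw [e5]
  generalize Real.exp (2 * S.U t θ) = E
  generalize S.a t θ * pθ (fun t θ => S.a t θ * pθ S.U t θ) t θ = w1
  generalize S.a t θ * pθ (fun t θ => S.a t θ * pθ S.A t θ) t θ = w2
  generalize S.α t θ * Real.exp (2 * S.ν t θ - 4 * S.U t θ) = w3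
  generalize S.K t θ - S.A t θ * S.J t θ = w4
  generalize S.q t θ = w5
  generalize S.J t θ = w6
  generalize S.SU t θ = w7
  generalize S.SA t θ = w8
  have hε' : ε * ε = 1 := by rw [← sq]; exact hε
  clear_value ut ux wt wx
  clear hN hz tX tY hX hY hU hne htm e4 e5 hc hux hε
  clear c
  have h0' : t ≠ 0 := h0.ne'
  rcases mul_self_eq_one_iff.1 hε' with rfl | rfl <;> field_simp <;> ring
theorem pt_ν_sub_ge {ε : ℝ} (hε : ε ^ 2 = 1) (ht : t ∈ Ioo S.tp S.ti) (θ : ℝ) :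
    t * S.Nn (-ε) t θ + S.r t θ / 2 ≤ pt S.ν t θ - ε * S.B t θ := by
  have h0 := tpos ht
  have h1 := pt_ν_sub_B ht θ
  have h2 := pt_ν_add_B ht θ
  have h3 := r_le_sub (mem_Ioc ht) θ
  have h4 := r_le_add (mem_Ioc ht) θ
  have h5 := p_nonneg ht θ
  have e4 : Real.exp (4 * S.U t θ) = Real.exp (2 * S.U t θ) ^ 2 := by
    rw [← Real.exp_nat_mul]; congr 1; push_cast; ring
  rw [e4] at h1 h2
  have hz : ∀ ε, S.zn ε t θ ^ 2 = Real.exp (2 * S.U t θ) ^ 2 / (4 * t ^ 2) * S.nul ε S.A t θ ^ 2 := by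
    intro ε; rw [zn]; field_simp; ring
  rcases mul_self_eq_one_iff.1 (by rw [← sq]; exact hε : ε * ε = 1) with rfl | rfl
  · have : S.Nn (-1) t θ = (pt S.U t θ - S.a t θ * pθ S.U t θ) ^ 2
      + Real.exp (2 * S.U t θ) ^ 2 / (4 * t ^ 2) * (pt S.A t θ - S.a t θ * pθ S.A t θ) ^ 2 := by
      rw [Nn, hz]; simp only [nul]; ring
    rw [this]; linarith
  · have : S.Nn (- -1) t θ = (pt S.U t θ + S.a t θ * pθ S.U t θ) ^ 2
      + Real.exp (2 * S.U t θ) ^ 2 / (4 * t ^ 2) * (pt S.A t θ + S.a t θ * pθ S.A t θ) ^ 2 := by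
      rw [Nn, hz]; simp only [nul]; ring
    rw [this]; linarith

theorem Nn_escape {ε : ℝ} (hε : ε ^ 2 = 1) {P : ℝ} (hP : ∀ t ∈ Ioc S.tp S.t0, ∀ θ, S.p t θ ≤ P)
    (ht : t ∈ Ioc S.tp S.t0) (θ : ℝ) {d : ℝ}
    (hd : HasDerivAt (fun s => S.Nn ε (t + s) (θ + s * (-ε * S.a t θ))) d 0) :
    -((P + 2 + S.tp⁻¹ * (P + 4)) * ((1 + S.Nn ε t θ) * (1 + S.r t θ + S.Nn (-ε) t θ))) ≤ d := by
  have ht' := mem_Ioo ht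
  have h0 := tpos ht'
  have htp := S.htp
  rw [hd.unique (Nn_deriv hε ht' θ)]
  have hr := r_nonneg (mem_Ioc ht') θ
  have hp0 := p_nonneg ht' θ
  have hp1 := hP t ht θ
  have hτ : t⁻¹ ≤ S.tp⁻¹ := inv_anti₀ htp ht.1.le
  have hτ0 : 0 < t⁻¹ := by positivity
  have sU := srcU_le ht' θ
  have sA := srcA_le ht' θ
  rw [← abs_of_nonneg (by positivity : 0 ≤ Real.exp (2 * S.U t θ) / t), ← abs_mul] at sA
  have e1 : S.p t θ / (2 * t) + S.r t θ / t = t⁻¹ * (S.p t θ / 2 + S.r t θ) := by field_simp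
  rw [e1] at sU sA
  have b1 : t⁻¹ * (S.p t θ / 2 + S.r t θ) ≤ S.tp⁻¹ * (P / 2 + S.r t θ) :=
    mul_le_mul hτ (by linarith) (by positivity) (by positivity)
  have sU' := sU.trans b1
  have sA' := sA.trans b1
  rw [q]
  have hN := Nn_nonneg (S := S) ε t θ
  have hN' := Nn_nonneg (S := S) (-ε) t θ
  have eN : S.Nn ε t θ = S.nul ε S.U t θ ^ 2 + S.zn ε t θ ^ 2 := rfl
  have eN' : S.Nn (-ε) t θ = S.nul (-ε) S.U t θ ^ 2 + S.zn (-ε) t θ ^ 2 := rfl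
  generalize S.srcU t θ = su at *
  generalize Real.exp (2 * S.U t θ) / t * S.srcA t θ = sa at *
  generalize S.nul ε S.U t θ = X at *
  generalize S.nul (-ε) S.U t θ = X' at *
  generalize S.zn ε t θ = z at *
  generalize S.zn (-ε) t θ = z' at *
  generalize S.Nn ε t θ = N at *
  generalize S.Nn (-ε) t θ = N' at *
  generalize S.r t θ = r at *
  generalize S.p t θ = p at *
  generalize S.tp⁻¹ = τ at *
  have hτ' : 0 < τ := hτ0.trans_le hτ
  have hP0 : 0 ≤ P := hp0.trans hp1
  have c1 : -((1 + N) * (τ * (P / 2 + r))) ≤ 2 * X * su := by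
    have := neg_abs_le (2 * X * su)
    have h2 : |2 * X| ≤ 1 + N := by rw [abs_le]; constructor <;> nlinarith [sq_nonneg (X + 1), sq_nonneg (X - 1), sq_nonneg z]
    have h3 : |2 * X * su| ≤ (1 + N) * (τ * (P / 2 + r)) := by
      rw [abs_mul]; exact mul_le_mul h2 sU' (abs_nonneg _) (by positivity)
    linarith
  have c2 : -((1 + N) * (τ * (P / 2 + r))) ≤ z * sa := by
    have := neg_abs_le (z * sa)
    have h2 : |z| ≤ 1 + N := by rw [abs_le]; constructor <;> nlinarith [sq_nonneg (z + 1), sq_nonneg (z - 1), sq_nonneg X]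
    have h3 : |z * sa| ≤ (1 + N) * (τ * (P / 2 + r)) := by
      rw [abs_mul]; exact mul_le_mul h2 sA' (abs_nonneg _) (by positivity)
    linarith
  have c3 : -(τ * (2 * N + N')) ≤ -(X ^ 2 + X * X') / t - (z ^ 2 - z * z') / t := by
    have h2 : (X ^ 2 + X * X') + (z ^ 2 - z * z') ≤ 2 * N + N' := by
      nlinarith [sq_nonneg (X - X'), sq_nonneg (z + z'), sq_nonneg X', sq_nonneg z', sq_nonneg X, sq_nonneg z]
    have h3 : t⁻¹ * ((X ^ 2 + X * X') + (z ^ 2 - z * z')) ≤ τ * (2 * N + N') :=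
      (mul_le_mul_of_nonneg_left h2 hτ0.le).trans (mul_le_mul_of_nonneg_right hτ (by positivity))
    have e : -(X ^ 2 + X * X') / t - (z ^ 2 - z * z') / t = -(t⁻¹ * ((X ^ 2 + X * X') + (z ^ 2 - z * z'))) := by
      field_simp; ring
    rw [e]; linarith
  have c4 : p * N ≤ P * N := mul_le_mul_of_nonneg_right hp1 hN
  have key : (P + 2 * r) * N + τ * (2 * N + N') + 2 * ((1 + N) * (τ * (P / 2 + r)))
      ≤ (P + 2 + τ * (P + 4)) * ((1 + N) * (1 + r + N')) := by
    have d1 : (P + 2 * r) * N ≤ (P + 2) * ((1 + N) * (1 + r + N')) := by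
      have : (P + 2) * ((1 + N) * (1 + r + N')) - (P + 2 * r) * N
        = (P + 2) * ((1 + r + N') + N * (1 + N')) + P * (N * r) - P * N + 2 * N * r - 2 * N * r := by ring
      nlinarith [mul_nonneg hN hN', mul_nonneg hP0 (mul_nonneg hN hr), mul_nonneg hP0 hr, mul_nonneg hP0 hN', mul_nonneg hP0 (mul_nonneg hN hN')]
    have d2 : (2 * N + N') + 2 * ((1 + N) * (P / 2 + r)) ≤ (P + 4) * ((1 + N) * (1 + r + N')) := by
      nlinarith [mul_nonneg hN hN', mul_nonneg hP0 (mul_nonneg hN hr), mul_nonneg hP0 hr, mul_nonneg hP0 hN', mul_nonneg hP0 (mul_nonneg hN hN'), mul_nonneg hN hr]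
    have d3 := mul_le_mul_of_nonneg_left d2 hτ'.le
    linarith
  have e : -(X ^ 2 + X * X') / t = - ((X ^ 2 + X * X') / t) := neg_div _ _
  rw [e] at c3
  linarith

theorem Nn_bdd {ε : ℝ} (hε : ε ^ 2 = 1) : S.Bd (S.Nn ε) := by
  obtain ⟨P, hP0, hP⟩ := bdp (S := S)
  obtain ⟨C1, hC10, hC1⟩ := bd_lam_t (S := S)
  obtain ⟨C2, hC20, hC2⟩ := bd_lam_θ (S := S)
  obtain ⟨C3, hC30, hC3⟩ := bdlam (S := S)
  have htp := S.htp
  have hti : 0 < S.ti := S.htp.trans S.hti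
  set D := P + 2 + S.tp⁻¹ * (P + 4) with hD
  have hD0 : 0 < D := by positivity
  set k := D * (1 + 2 * S.ti) with hk
  have hk0 : 0 < k := by positivity
  set L := D + k * (C1 + C2) + 1 with hL
  have he1 : |ε| ≤ 1 := by
    have : |ε| ^ 2 = 1 := by rw [sq_abs, hε]
    nlinarith [abs_nonneg ε]
  obtain ⟨C, hC⟩ := forward_max (S := S)
    (ψ := fun t θ => (1 + S.Nn ε t θ) * Real.exp (-(ε * k) * S.lam t θ + L * t))
    (((Sm.const 1).add (smNn ε)).mul (((Sm.const _).mul smlam).add ((Sm.const L).mul Sm.time)).exp)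
    (fun t θ => by simp only [perNn ε t θ, perlam t θ]) fun t ht θ => by
      have ht1 : t ∈ Ioc S.tp S.t0 := ⟨ht.1, ht.2.le⟩
      have ht' := mem_Ioo ht1
      have h0 := tpos ht'
      have hN := Nn_deriv hε ht' θ
      have hNe := Nn_escape hε (fun t ht θ => (le_abs_self _).trans (hP t ht θ)) ht1 θ hN
      set c := -ε * S.a t θ with hc
      have hlam := smlam.dpath ht' θ c
      have htm : HasDerivAt (fun s => t + s) 1 0 := (hasDerivAt_id (0:ℝ)).const_add t
      have hψ := (hN.const_add 1).mul ((hlam.const_mul (-(ε * k))).add (htm.const_mul L)).exp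
      refine ⟨c, _, ?_, hψ⟩
      have hl1 := abs_le.1 (hC1 t ht1 θ)
      have hl2 := abs_le.1 (hC2 t ht1 θ)
      simp only [Pi.add_apply, add_zero, zero_mul]
      set g := Real.exp (-(ε * k) * S.lam t θ + L * t)
      have hg : 0 < g := Real.exp_pos _
      set d := (-S.q t θ * S.Nn ε t θ - (S.nul ε S.U t θ ^ 2 + S.nul ε S.U t θ * S.nul (-ε) S.U t θ) / t
        - (S.zn ε t θ ^ 2 - S.zn ε t θ * S.zn (-ε) t θ) / t + 2 * S.nul ε S.U t θ * S.srcU t θ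
        + S.zn ε t θ * (Real.exp (2 * S.U t θ) / t * S.srcA t θ))
      have hNp := Nn_nonneg (S := S) ε t θ
      have hNp' := Nn_nonneg (S := S) (-ε) t θ
      have hr := r_nonneg (mem_Ioc ht') θ
      have hge := pt_ν_sub_ge hε ht' θ
      have hLam : S.Nn (-ε) t θ + S.r t θ / (2 * S.ti) - (C1 + C2)
          ≤ -ε * (pt S.lam t θ + c * pθ S.lam t θ) := by
        have e1 : -ε * (pt S.lam t θ + c * pθ S.lam t θ) = (pt S.ν t θ - ε * S.B t θ) / t
            - ε * (pt S.lam t θ - S.B t θ / t) + (S.a t θ * pθ S.lam t θ - pt S.ν t θ / t) := by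
          rw [hc]; field_simp; linear_combination (t * S.a t θ * pθ S.lam t θ) * hε
        have e2 : S.Nn (-ε) t θ + S.r t θ / (2 * S.ti) ≤ (pt S.ν t θ - ε * S.B t θ) / t := by
          rw [le_div_iff₀ h0]
          have : S.r t θ / (2 * S.ti) * t ≤ S.r t θ / 2 := by
            rw [div_mul_eq_mul_div, div_le_div_iff₀ (by positivity) two_pos]
            nlinarith [ht'.2]
          linarith
        have e3 : ε * (pt S.lam t θ - S.B t θ / t) ≤ C1 := by
          refine (le_abs_self _).trans ?_
          rw [abs_mul]
          exact (mul_le_mul he1 (hC1 t ht1 θ) (abs_nonneg _) zero_le_one).trans (by rw [one_mul])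
        rw [e1]; linarith [hl2.1]
      have hk1 := mul_le_mul_of_nonneg_left hLam hk0.le
      have h5 : D * (1 + S.r t θ + S.Nn (-ε) t θ) ≤ L - 1 + k * (S.Nn (-ε) t θ + S.r t θ / (2 * S.ti) - (C1 + C2)) := by
        have e4 : k * (S.r t θ / (2 * S.ti)) = D * S.r t θ + D * (S.r t θ / (2 * S.ti)) := by
          rw [hk]; field_simp; ring
        have e5 : k * S.Nn (-ε) t θ = D * S.Nn (-ε) t θ + D * (2 * S.ti) * S.Nn (-ε) t θ := by rw [hk]; ring
        have e6 : 0 ≤ D * (S.r t θ / (2 * S.ti)) := by positivity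
        have e7 : 0 ≤ D * (2 * S.ti) * S.Nn (-ε) t θ := by positivity
        have e8 : k * (S.Nn (-ε) t θ + S.r t θ / (2 * S.ti) - (C1 + C2))
          = k * S.Nn (-ε) t θ + k * (S.r t θ / (2 * S.ti)) - k * (C1 + C2) := by ring
        rw [hL, e8, e4, e5]; linarith
      have h6 : 0 < d + (1 + S.Nn ε t θ) * (-(ε * k) * (pt S.lam t θ + c * pθ S.lam t θ) + L * 1) := by
        have h7 : D * (1 + S.r t θ + S.Nn (-ε) t θ) + 1 ≤ -(ε * k) * (pt S.lam t θ + c * pθ S.lam t θ) + L * 1 := by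
          linarith
        have h8 := mul_le_mul_of_nonneg_left h7 (by positivity : 0 ≤ 1 + S.Nn ε t θ)
        have e9 : (1 + S.Nn ε t θ) * (D * (1 + S.r t θ + S.Nn (-ε) t θ) + 1)
          = D * ((1 + S.Nn ε t θ) * (1 + S.r t θ + S.Nn (-ε) t θ)) + (1 + S.Nn ε t θ) := by ring
        rw [e9] at h8
        linarith
      have h9 := mul_pos hg h6
      linarith
  have hC0 : 0 ≤ C := le_trans (by have := Nn_nonneg (S := S) ε S.t0 0; positivity) (hC S.t0 ⟨tp_lt_t0, le_rfl⟩ 0)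
  refine Bd.mk' (C := C * Real.exp (k * C3)) fun t ht θ => ?_
  have hN := Nn_nonneg (S := S) ε t θ
  have h0 := tpos (mem_Ioo ht)
  rw [abs_of_nonneg hN]
  have h1 := hC t ht θ
  have h2 : Real.exp (-(k * C3)) ≤ Real.exp (-(ε * k) * S.lam t θ + L * t) := by
    refine Real.exp_le_exp.2 ?_
    have : |ε * k * S.lam t θ| ≤ k * C3 := by
      rw [abs_mul, abs_mul, abs_of_pos hk0]
      calc |ε| * k * |S.lam t θ| ≤ 1 * k * C3 :=
            mul_le_mul (mul_le_mul_of_nonneg_right he1 hk0.le) (hC3 t ht θ) (abs_nonneg _) (by positivity)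
        _ = _ := by ring
    have h3 : 0 ≤ L * t := by positivity
    have := (abs_le.1 this).2
    linarith
  have h3 : (1 + S.Nn ε t θ) * Real.exp (-(k * C3)) ≤ C :=
    (mul_le_mul_of_nonneg_left h2 (by positivity)).trans h1
  have h4 := mul_le_mul_of_nonneg_right h3 (Real.exp_pos (k * C3)).le
  rw [mul_assoc, ← Real.exp_add, neg_add_cancel, Real.exp_zero, mul_one] at h4
  linarith

end EV

/-! ### Bounds on the momentum support -/

namespace EV

variable {S : EV} {t θ : ℝ}

theorem bd_nulU {ε : ℝ} (hε : ε ^ 2 = 1) : S.Bd (S.nul ε S.U) := by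
  refine ((Bd.const 1).add (Nn_bdd hε)).le fun t ht θ => ?_
  refine (abs_le_one_add_sq _).trans (le_trans ?_ (le_abs_self _))
  have := sq_nonneg (S.zn ε t θ)
  simp only [Nn]; linarith

theorem bd_zn {ε : ℝ} (hε : ε ^ 2 = 1) : S.Bd (S.zn ε) := by
  refine ((Bd.const 1).add (Nn_bdd hε)).le fun t ht θ => ?_
  refine (abs_le_one_add_sq _).trans (le_trans ?_ (le_abs_self _))
  have := sq_nonneg (S.nul ε S.U t θ)
  simp only [Nn]; linarith

theorem bd_nulA {ε : ℝ} (hε : ε ^ 2 = 1) : S.Bd (S.nul ε S.A) := by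
  refine (((bd_zn hε).mul ((Bd.const 2).mul Bd.time)).mul
    ((Bd.const (-2)).mul bdU).exp).congr fun t ht θ => ?_
  have h0 := (tpos (mem_Ioo ht)).ne'
  have : Real.exp (2 * S.U t θ) * Real.exp (-2 * S.U t θ) = 1 := by
    rw [← Real.exp_add]; simp
  rw [neg_mul] at this
  unfold zn
  field_simp
  linear_combination (-S.nul ε S.A t θ) * this

theorem bd_of_nul {W : ℝ → ℝ → ℝ} (h1 : S.Bd (S.nul 1 W)) (h2 : S.Bd (S.nul (-1) W)) :
    S.Bd (pt W) ∧ S.Bd (fun t θ => S.a t θ * pθ W t θ) := by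
  constructor
  · refine ((Bd.const (1/2)).mul (h1.add h2)).congr fun t ht θ => ?_
    unfold nul; ring
  · refine ((Bd.const (1/2)).mul (h1.sub h2)).congr fun t ht θ => ?_
    unfold nul; ring

theorem bd_pt_U : S.Bd (pt S.U) := (bd_of_nul (bd_nulU (by norm_num)) (bd_nulU (by norm_num))).1
theorem bd_aU : S.Bd (fun t θ => S.a t θ * pθ S.U t θ) :=
  (bd_of_nul (bd_nulU (by norm_num)) (bd_nulU (by norm_num))).2
theorem bd_pt_A : S.Bd (pt S.A) := (bd_of_nul (bd_nulA (by norm_num)) (bd_nulA (by norm_num))).1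
theorem bd_aA : S.Bd (fun t θ => S.a t θ * pθ S.A t θ) :=
  (bd_of_nul (bd_nulA (by norm_num)) (bd_nulA (by norm_num))).2

theorem bd_aexpν : S.Bd (fun t θ => S.a t θ * Real.exp (S.ν t θ)) := by
  obtain ⟨C, hC⟩ := be_upper (S := S)
  refine Bd.mk' (C := Real.exp C) fun t ht θ => ?_
  rw [← exp_be (mem_Ioo ht), abs_of_pos (Real.exp_pos _)]
  exact Real.exp_le_exp.2 (hC t ht θ)

theorem Bd.abs {G : ℝ → ℝ → ℝ} (h : S.Bd G) : S.Bd (fun t θ => |G t θ|) :=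
  h.le fun t ht θ => by rw [abs_abs]

theorem bdKAJ : S.Bd (fun t θ => S.K t θ - S.A t θ * S.J t θ) := bdK.sub (bdA.mul bdJ)

theorem bdLq : S.Bd S.Lq := by
  have h1 : S.Bd (fun t θ => 4 * |pt S.U t θ| + 2 * t⁻¹ + |pt S.A t θ| * Real.exp (2 * S.U t θ) * t⁻¹
    + S.a t θ * Real.exp (S.ν t θ) * (|S.K t θ - S.A t θ * S.J t θ| * (t⁻¹) ^ 2
      + Real.exp (-2 * S.U t θ) * |S.J t θ| * t⁻¹)) :=
    ((((Bd.const 4).mul bd_pt_U.abs).add ((Bd.const 2).mul Bd.time_inv)).add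
      ((bd_pt_A.abs.mul ((Bd.const 2).mul bdU).exp).mul Bd.time_inv)).add
      (bd_aexpν.mul ((bdKAJ.abs.mul (Bd.time_inv.pow 2)).add
        ((((Bd.const (-2)).mul bdU).exp.mul bdJ.abs).mul Bd.time_inv)))
  refine h1.congr fun t ht θ => ?_
  simp only [Lq, div_eq_mul_inv, inv_pow]

/-- a compact range of `(v₂, v₃)` outside of which `f` vanishes -/
theorem m2_le (V : ℝ) : ∃ M, 1 ≤ M ∧ ∀ t ∈ Ioc S.tp S.t0, ∀ θ v, |v.2.1| ≤ V → |v.2.2| ≤ V →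
    S.m2 v t θ ≤ M := by
  obtain ⟨C1, hC1, h1⟩ := ((bd_exp_be (S := S)).mul ((Bd.const (-2)).mul bdU).exp).upper
  obtain ⟨C2, hC2, h2⟩ := ((bd_exp_be (S := S)).mul ((Bd.const (-4)).mul bdU).exp).upper
  obtain ⟨C3, hC3, h3⟩ := ((bd_exp_be (S := S)).mul (Bd.time_inv.pow 2)).upper
  obtain ⟨C4, hC4, h4⟩ := (bdA (S := S)).upper
  refine ⟨C1 + C2 * V ^ 2 + C3 * (V + C4 * V) ^ 2 + 1, ?_, fun t ht θ v hv2 hv3 => ?_⟩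
  · have : 0 ≤ C1 + C2 * V ^ 2 + C3 * (V + C4 * V) ^ 2 := by positivity
    linarith
  have k1 := (le_abs_self _).trans (h1 t ht θ)
  have k2 := (le_abs_self _).trans (h2 t ht θ)
  have k3 := (le_abs_self _).trans (h3 t ht θ)
  have e2 : v.2.1 ^ 2 ≤ V ^ 2 := by rw [← sq_abs]; gcongr
  have e3 : (v.2.2 - S.A t θ * v.2.1) ^ 2 ≤ (V + C4 * V) ^ 2 := by
    rw [← sq_abs]
    refine pow_le_pow_left₀ (abs_nonneg _) ((abs_sub _ _).trans (add_le_add hv3 (abs_mul_le_of (h4 t ht θ) hv2))) 2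
  have e : S.m2 v t θ = S.α t θ * Real.exp (2 * S.ν t θ) * Real.exp (-2 * S.U t θ)
      + S.α t θ * Real.exp (2 * S.ν t θ) * Real.exp (-4 * S.U t θ) * v.2.1 ^ 2
      + S.α t θ * Real.exp (2 * S.ν t θ) * (t⁻¹) ^ 2 * (v.2.2 - S.A t θ * v.2.1) ^ 2 := by
    unfold m2 mu; rw [inv_pow]; ring
  have k2' := mul_le_mul k2 e2 (sq_nonneg _) hC2.le
  have k3' := mul_le_mul k3 e3 (sq_nonneg _) hC3.le
  rw [e]
  linarith

theorem arsinh_exp_le {s : ℝ} (hs : 0 ≤ s) : Real.arsinh (Real.exp (s / 2)) ≤ 2 + s := by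
  rw [Real.arsinh]
  have h1 : 1 ≤ Real.exp (s / 2) := Real.one_le_exp (by linarith)
  have h2 : √(1 + Real.exp (s / 2) ^ 2) ≤ 2 * Real.exp (s / 2) := by
    rw [Real.sqrt_le_left (by positivity)]; nlinarith
  have h3 : Real.exp (s / 2) + √(1 + Real.exp (s / 2) ^ 2) ≤ Real.exp (2 + s / 2) := by
    rw [Real.exp_add]
    have : (3:ℝ) ≤ Real.exp 2 := by have := Real.add_one_le_exp (2:ℝ); linarith
    nlinarith
  have h4 := Real.log_le_log (by positivity) h3
  rw [Real.log_exp] at h4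
  linarith

theorem integral_inv_sqrt {a l : ℝ} (hl : 0 ≤ l) :
    ∫ y in Icc (-l) l, a * (√(1 + (a * y) ^ 2))⁻¹ = 2 * Real.arsinh (a * l) := by
  rw [integral_Icc_eq_integral_Ioc, ← intervalIntegral.integral_of_le (by linarith)]
  rw [intervalIntegral.integral_eq_sub_of_hasDerivAt (f := fun y => Real.arsinh (a * y))]
  · rw [mul_neg, Real.arsinh_neg]; ring
  · intro y _
    have h := (Real.hasDerivAt_arsinh (a * y)).comp y ((hasDerivAt_id y).const_mul a)
    refine h.congr_deriv ?_
    simp [mul_comm]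
  · refine Continuous.intervalIntegrable ?_ _ _
    refine continuous_const.mul (Continuous.inv₀ (by fun_prop) fun y => ?_)
    positivity

theorem moment_log : ∃ C, 0 < C ∧ ∀ t ∈ Ioc S.tp S.t0, ∀ θ s, 0 ≤ s →
    (∀ v, Real.exp s ≤ S.Q t θ v → S.f t θ v = 0) → S.r t θ ≤ C * (1 + s) := by
  obtain ⟨F, hF, hf⟩ := exists_max_f (S := S)
  obtain ⟨V, hV, hfV⟩ := exists_supp23 (S := S)
  obtain ⟨M, hM1, hM⟩ := m2_le (S := S) V
  refine ⟨16 * F * M * V ^ 2 , by positivity, fun t ht θ s hs hsupp => ?_⟩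
  have ht' := mem_Ioo ht
  have ha := apos ht' θ
  set a := S.a t θ with ha_def
  set l := Real.exp (s / 2) / a with hl
  have hl0 : 0 < l := by positivity
  set Y : Set (ℝ × ℝ) := Icc (-V) V ×ˢ Icc (-V) V with hY
  set G : ℝ → ℝ := (Icc (-l) l).indicator fun y => a * (√(1 + (a * y) ^ 2))⁻¹ with hG
  set H : ℝ × ℝ → ℝ := Y.indicator fun _ => F * M with hH
  have hYm : MeasurableSet Y := measurableSet_Icc.prod measurableSet_Icc
  have hGc : Continuous fun y : ℝ => a * (√(1 + (a * y) ^ 2))⁻¹ := by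
    refine continuous_const.mul (Continuous.inv₀ (by fun_prop) fun y => ?_)
    positivity
  have iG : Integrable G := by
    rw [hG, integrable_indicator_iff measurableSet_Icc]
    exact hGc.continuousOn.integrableOn_compact isCompact_Icc
  have iH : Integrable H := by
    rw [hH, integrable_indicator_iff hYm]
    exact continuousOn_const.integrableOn_compact (isCompact_Icc.prod isCompact_Icc)
  have hIG : ∫ y, G y = 2 * Real.arsinh (Real.exp (s / 2)) := by
    rw [hG, integral_indicator measurableSet_Icc, integral_inv_sqrt hl0.le, hl, mul_div_cancel₀ _ ha.ne']
  have hIH : ∫ y, H y = 4 * V ^ 2 * (F * M) := by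
    rw [hH, integral_indicator_const _ hYm, hY, Measure.real, Measure.volume_eq_prod, Measure.prod_prod,
      Real.volume_Icc, ENNReal.toReal_mul, ENNReal.toReal_ofReal (by linarith), smul_eq_mul]
    ring
  have key : ∀ v : V3, S.f t θ v * (S.m2 v t θ * a / S.w t θ v) ≤ G v.1 * H v.2 := by
    intro v
    have hm := m2_pos (mem_Ioc ht') θ v
    have hw := w_pos' (mem_Ioc ht') θ v
    by_cases hv : S.f t θ v = 0
    · rw [hv, zero_mul]
      exact mul_nonneg (indicator_nonneg (fun y _ => by positivity) _)
        (indicator_nonneg (fun y _ => by positivity) _)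
    have hV2 : |v.2.1| ≤ V ∧ |v.2.2| ≤ V := by
      by_contra hcon
      refine hv (hfV t (mem_Ioc ht') θ v ?_)
      by_contra! h3
      exact hcon ⟨h3.1, h3.2⟩
    have hQ : S.Q t θ v < Real.exp s := by
      by_contra! h3
      exact hv (hsupp v h3)
    have hl1 : |v.1| ≤ l := by
      rw [hl, le_div_iff₀ ha]
      refine abs_le_of_sq_le_sq' ?_ (Real.exp_pos _).le |>.2
      rw [mul_pow, sq_abs, ha_def, a_sq ht', ← Real.exp_nat_mul]
      have := Q_eq (S := S) t θ v
      rw [show ((2:ℕ):ℝ) * (s / 2) = s by push_cast; ring]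
      linarith
    have hG' : G v.1 = a * (√(1 + (a * v.1) ^ 2))⁻¹ := by
      rw [hG, indicator_of_mem (show v.1 ∈ Icc (-l) l from abs_le.1 hl1)]
    have hH' : H v.2 = F * M := by
      rw [hH, indicator_of_mem]
      exact ⟨abs_le.1 hV2.1, abs_le.1 hV2.2⟩
    have hMm := hM t ht θ v hV2.1 hV2.2
    rw [hG', hH']
    have h5 : S.m2 v t θ * √(1 + (a * v.1) ^ 2) ≤ M * S.w t θ v := by
      refine abs_le_of_sq_le_sq' ?_ (by positivity) |>.2
      rw [mul_pow, Real.sq_sqrt (by positivity), mul_pow M, w_sq (mem_Ioc ht'), mul_pow, ha_def, a_sq ht']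
      have hα := αpos ht' θ
      have e1 : S.m2 v t θ ^ 2 ≤ M ^ 2 := by gcongr
      have e2 : S.m2 v t θ ^ 2 ≤ M ^ 2 * S.m2 v t θ := by
        have : S.m2 v t θ ≤ M ^ 2 := by nlinarith
        nlinarith
      have e3 := mul_le_mul_of_nonneg_right e1 (by positivity : 0 ≤ S.α t θ * v.1 ^ 2)
      linarith
    have h6 : S.m2 v t θ * a / S.w t θ v ≤ M * (a * (√(1 + (a * v.1) ^ 2))⁻¹) := by
      rw [div_le_iff₀ hw]
      have hs1 : 0 < √(1 + (a * v.1) ^ 2) := by positivity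
      have : M * (a * (√(1 + (a * v.1) ^ 2))⁻¹) * S.w t θ v = a * (M * S.w t θ v) / √(1 + (a * v.1) ^ 2) := by
        field_simp
      rw [this, le_div_iff₀ hs1]
      have := mul_le_mul_of_nonneg_left h5 ha.le
      linarith
    have h7 := mul_le_mul (hf t (mem_Ioc ht') θ v) h6 (by positivity) hF.le
    linarith
  have hr : S.r t θ = ∫ v, S.f t θ v * (S.m2 v t θ * a / S.w t θ v) := by
    rw [r_eq_mul, ← integral_const_mul]
    congr 1; funext v
    unfold m2; ring
  have hcm : Continuous fun v => S.m2 v t θ * a := by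
    have := cont_mu (S := S) t θ
    unfold m2; fun_prop
  have h8 : S.r t θ ≤ ∫ v : V3, G v.1 * H v.2 := by
    rw [hr]
    refine integral_mono (integrable_f (mem_Ioc ht') θ (cont_div_w (mem_Ioc ht') θ hcm)) ?_ key
    exact iG.mul_prod iH
  have h9 : ∫ v : V3, G v.1 * H v.2 = (∫ y, G y) * ∫ y, H y := integral_prod_mul G H
  rw [h9, hIG, hIH] at h8
  have h10 := mul_le_mul_of_nonneg_right (arsinh_exp_le hs) (by positivity : 0 ≤ 2 * (4 * V ^ 2 * (F * M)))
  nlinarith [show 0 ≤ F * M * V ^ 2 * s by positivity]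

/-- the momentum support on `[t, t0]` is contained in `{Q < exp s}` -/
def suppLt (S : EV) (t s : ℝ) : Prop :=
  ∀ t' ∈ Icc t S.t0, ∀ θ v, Real.exp s ≤ S.Q t' θ v → S.f t' θ v = 0

theorem suppLt.mono {t s s' : ℝ} (h : S.suppLt t s) (hs : s ≤ s') : S.suppLt t s' :=
  fun t' ht' θ v hv => h t' ht' θ v ((Real.exp_le_exp.2 hs).trans hv)

theorem suppLt_exists (ht : t ∈ Ioc S.tp S.t0) : ∃ s, 0 ≤ s ∧ S.suppLt t s := by
  obtain ⟨R, hR1, hR⟩ := exists_suppQ ht.1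
  refine ⟨Real.log R, Real.log_nonneg hR1, fun t' ht' θ v hv => hR t' ⟨ht'.1, ht'.2.trans t0_lt_ti.le⟩ θ v ?_⟩
  rwa [Real.exp_log (by linarith)] at hv

theorem suppLt_step : ∃ C, 0 < C ∧ ∀ t1 t2 s1 s2, S.tp < t1 → t1 ≤ t2 → t2 ≤ S.t0 → 0 ≤ s1 → 0 ≤ s2 →
    S.suppLt t1 s1 → S.suppLt t2 s2 → S.suppLt t1 (s2 + C * (1 + s1) * (t2 - t1)) := by
  obtain ⟨C1, hC1, h1⟩ := moment_log (S := S)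
  obtain ⟨C2, hC2, h2⟩ := (bdLq (S := S)).upper
  obtain ⟨C3, hC3, h3⟩ := (bdp (S := S)).upper
  refine ⟨2 * C1 + C2 + C3 + 1, by positivity, fun t1 t2 s1 s2 ht1 h12 ht2 hs1 hs2 hP1 hP2 t ht θ v hv => ?_⟩
  have hC : 0 < 2 * C1 + C2 + C3 + 1 := by positivity
  set L := (2 * C1 + C2 + C3 + 1) * (1 + s1) with hL
  have hL0 : 0 < L := by positivity
  by_cases htt : t2 ≤ t
  · refine hP2 t ⟨htt, ht.2⟩ θ v (le_trans (Real.exp_le_exp.2 ?_) hv)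
    have := mul_nonneg hL0.le (sub_nonneg.2 h12)
    linarith
  push Not at htt
  have hq : ∀ t' ∈ Ico t t2, ∀ θ, S.q t' θ + S.Lq t' θ < L := by
    intro t' ht' θ
    have hm : t' ∈ Ioc S.tp S.t0 := ⟨(ht1.trans_le ht.1).trans_le ht'.1, ht'.2.le.trans ht2⟩
    have k1 := h1 t' hm θ s1 hs1 (hP1 t' ⟨ht.1.trans ht'.1, hm.2⟩ θ)
    have k2 := (le_abs_self _).trans (h2 t' hm θ)
    have k3 := (le_abs_self _).trans (h3 t' hm θ)
    have : L = 2 * (C1 * (1 + s1)) + (C2 + C3 + 1) + (C2 + C3 + 1) * s1 := by rw [hL]; ring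
    have : 0 ≤ (C2 + C3 + 1) * s1 := by positivity
    unfold q
    linarith
  have hti' : t2 ≤ S.ti := ht2.trans t0_lt_ti.le
  have ht0 : S.tp < t := ht1.trans_le ht.1
  obtain ⟨L', -, hL'⟩ := rates_bdd (S := S) ht0
  have ht' : t ∈ Ioc S.tp S.ti := ⟨ht0, htt.le.trans hti'⟩
  refine le_antisymm ?_ (S.hfnn t ht' θ v)
  refine propagate (c := 0) (R0 := Real.exp s2) ht0 htt.le hti' hq
    (fun s hs => hL' s ⟨hs.1, hs.2.trans_le hti'⟩) v.2
    (fun θ y h => (hP2 t2 ⟨le_rfl, ht2⟩ θ _ h).le) θ v.1 ?_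
  rw [← Real.exp_add]
  refine le_trans (Real.exp_le_exp.2 ?_) hv
  have := mul_le_mul_of_nonneg_left (sub_le_sub_left ht.1 t2) hL0.le
  linarith

theorem suppLt_improve : ∃ δ, 0 < δ ∧ ∀ t1 t2 s2, S.tp < t1 → t1 ≤ t2 → t2 ≤ S.t0 → t2 - t1 ≤ δ → 0 ≤ s2 →
    S.suppLt t2 s2 → S.suppLt t1 (2 * s2 + 2) := by
  obtain ⟨C, hC, h⟩ := suppLt_step (S := S)
  refine ⟨1 / (2 * C), by positivity, fun t1 t2 s2 ht1 h12 ht2 hδ hs2 hP => ?_⟩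
  set D := {s | 0 ≤ s ∧ S.suppLt t1 s} with hD
  have hne : D.Nonempty := suppLt_exists ⟨ht1, h12.trans ht2⟩
  have hbdd : BddBelow D := ⟨0, fun s hs => hs.1⟩
  have hstep : ∀ s ∈ D, sInf D ≤ s2 + (1 + s) / 2 := by
    intro s hs
    refine csInf_le hbdd ⟨by linarith [hs.1], (h t1 t2 s s2 ht1 h12 ht2 hs.1 hs2 hs.2 hP).mono ?_⟩
    have h3 := mul_le_mul_of_nonneg_left hδ (mul_nonneg hC.le (by linarith [hs.1] : 0 ≤ 1 + s))
    have h4 : C * (1 + s) * (1 / (2 * C)) = (1 + s) / 2 := by field_simp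
    linarith
  have h5 : sInf D < 2 * s2 + 2 := by
    have h6 : 2 * (sInf D - s2) - 1 ≤ sInf D := le_csInf hne fun s hs => by linarith [hstep s hs]
    linarith
  obtain ⟨s, hs, hlt⟩ := exists_lt_of_csInf_lt hne h5
  exact hs.2.mono hlt.le

/-- The momentum support is bounded up to the singular time. -/
theorem suppQ_bdd : ∃ R, 1 ≤ R ∧ ∀ t ∈ Ioc S.tp S.t0, ∀ θ v, R ≤ S.Q t θ v → S.f t θ v = 0 := by
  obtain ⟨δ, hδ, h⟩ := suppLt_improve (S := S)
  have hind : ∀ n : ℕ, ∃ s, 0 ≤ s ∧ ∀ t ∈ Ioc S.tp S.t0, S.t0 - n * δ ≤ t → S.suppLt t s := by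
    intro n
    induction n with
    | zero =>
      obtain ⟨s, hs, hP⟩ := suppLt_exists (S := S) (t := S.t0) ⟨tp_lt_t0, le_rfl⟩
      refine ⟨s, hs, fun t ht h0 => ?_⟩
      have : t = S.t0 := le_antisymm ht.2 (by simpa using h0)
      rwa [this]
    | succ n ih =>
      obtain ⟨s, hs, hP⟩ := ih
      refine ⟨2 * s + 2, by linarith, fun t ht h0 => ?_⟩
      push_cast at h0
      have hn : (0:ℝ) ≤ n * δ := by positivity
      set t2 := max t (S.t0 - n * δ) with ht2
      have h1 : t ≤ t2 := le_max_left _ _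
      have h2 : t2 ≤ S.t0 := max_le ht.2 (by linarith)
      refine h t t2 s ht.1 h1 h2 ?_ hs (hP t2 ⟨ht.1.trans_le h1, h2⟩ (le_max_right _ _))
      have : t2 ≤ t + δ := max_le (by linarith) (by linarith)
      linarith
  obtain ⟨n, hn⟩ := exists_nat_gt ((S.t0 - S.tp) / δ)
  rw [div_lt_iff₀ hδ] at hn
  obtain ⟨s, hs, hP⟩ := hind n
  refine ⟨Real.exp s, Real.one_le_exp hs, fun t ht θ v hv => ?_⟩
  exact hP t ht (by linarith [ht.1]) t ⟨le_rfl, ht.2⟩ θ v hv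

end EV

/-! ### Bounds on the metric coefficients and the matter quantities -/

namespace EV

variable {S : EV} {t θ : ℝ}

theorem Bd.of_pt {G : ℝ → ℝ → ℝ} (hG : Sm S.tp S.ti G) (hp : Per G) (h : S.Bd (pt G)) : S.Bd G := by
  obtain ⟨C, hC0, hC⟩ := h
  obtain ⟨D, hD0, hD⟩ := hG.bdd hp (c := S.t0) (d := S.t0) tp_lt_t0 t0_lt_ti
  refine Bd.mk' (C := D + C * (S.t0 - S.tp)) fun t ht θ => ?_
  have h1 := (convex_Icc t S.t0).norm_image_sub_le_of_norm_hasDerivWithin_le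
    (f := fun s => G s θ) (f' := fun s => pt G s θ) (C := C)
    (fun x hx => (hG.dt (mem_Ioo ⟨ht.1.trans_le hx.1, hx.2⟩) θ).hasDerivWithinAt)
    (fun x hx => hC x ⟨ht.1.trans_le hx.1, hx.2⟩ θ) ⟨ht.2, le_rfl⟩ ⟨le_rfl, ht.2⟩
  rw [Real.norm_eq_abs, Real.norm_eq_abs, abs_sub_comm t, abs_of_nonneg (sub_nonneg.2 ht.2)] at h1
  have h2 := hD S.t0 ⟨le_rfl, le_rfl⟩ θ
  have h3 := abs_sub_abs_le_abs_sub (G t θ) (G S.t0 θ)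
  have h4 := mul_le_mul_of_nonneg_left (sub_le_sub_left ht.1.le S.t0) hC0
  linarith

theorem bdr : S.Bd S.r := by
  obtain ⟨C, hC, h⟩ := moment_log (S := S)
  obtain ⟨R, hR1, hR⟩ := suppQ_bdd (S := S)
  refine Bd.mk' (C := C * (1 + Real.log R)) fun t ht θ => ?_
  rw [abs_of_nonneg (r_nonneg (mem_Ioc (mem_Ioo ht)) θ)]
  refine h t ht θ _ (Real.log_nonneg hR1) fun v hv => hR t ht θ v ?_
  rwa [Real.exp_log (by linarith)] at hv

theorem bdq : S.Bd S.q := bdp.add ((Bd.const 2).mul bdr)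

/-- the logarithm of `α` -/
def la (S : EV) (t θ : ℝ) : ℝ := Real.log (S.α t θ)

theorem smla : Sm S.tp S.ti S.la := smα.log fun t ht θ => (αpos ht θ).ne'
theorem perla : Per S.la := fun t θ => by simp only [la, perα t θ]
theorem pt_la (ht : t ∈ Ioo S.tp S.ti) (θ : ℝ) : pt S.la t θ = -S.q t θ := by
  have h := (smα.dt ht θ).log (αpos ht θ).ne'
  rw [pt, show (fun s => S.la s θ) = fun s => Real.log (S.α s θ) from rfl, h.deriv, q_eq ht]
  field_simp [(αpos ht θ).ne']
theorem bdla : S.Bd S.la := Bd.of_pt smla perla (bdq.neg.congr fun t ht θ => pt_la (mem_Ioo ht) θ)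
theorem exp_la (ht : t ∈ Ioo S.tp S.ti) (θ : ℝ) : Real.exp (S.la t θ) = S.α t θ := Real.exp_log (αpos ht θ)
theorem bdα : S.Bd S.α := bdla.exp.congr fun t ht θ => (exp_la (mem_Ioo ht) θ).symm
theorem bda : S.Bd S.a := by
  refine ((Bd.const 1).add bdα).le fun t ht θ => (abs_le_one_add_sq _).trans ?_
  rw [a_sq (mem_Ioo ht)]; exact le_abs_self _

/-- A uniform ball containing the momentum support up to the singular time. -/
theorem supp_ball : ∃ R, 1 ≤ R ∧ ∀ t ∈ Ioc S.tp S.t0, ∀ θ v, R < ‖v‖ → S.f t θ v = 0 := by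
  obtain ⟨R, hR1, hR⟩ := suppQ_bdd (S := S)
  obtain ⟨V, hV, hfV⟩ := exists_supp23 (S := S)
  obtain ⟨C, hC, hh⟩ := (bdh (S := S)).upper
  refine ⟨max V (C ^ 2 * R + 1), ?_, fun t ht θ v hv => ?_⟩
  · exact le_max_of_le_right (by have : 0 ≤ C ^ 2 * R := by positivity
                                 linarith)
  have ht' := mem_Ioo ht
  by_cases h23 : V < |v.2.1| ∨ V < |v.2.2|
  · exact hfV t (mem_Ioc ht') θ v h23
  push Not at h23
  refine hR t ht θ v ?_
  have h4 : C ^ 2 * R + 1 < |v.1| := by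
    by_contra! hcon
    have : ‖v‖ ≤ max V (C ^ 2 * R + 1) := by
      simp only [Prod.norm_def, Real.norm_eq_abs]
      exact max_le (hcon.trans (le_max_right _ _)) (max_le (h23.1.trans (le_max_left _ _)) (h23.2.trans (le_max_left _ _)))
    linarith
  rw [Q_eq]
  have h5 : 0 ≤ C ^ 2 * R := by positivity
  have h6 : C ^ 2 * R ≤ v.1 ^ 2 := by rw [← sq_abs v.1]; nlinarith
  have h7 : S.h t θ ^ 2 ≤ C ^ 2 := by rw [← sq_abs]; exact pow_le_pow_left₀ (abs_nonneg _) (hh t ht θ) 2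
  have h8 : S.h t θ ^ 2 * S.α t θ = 1 := by
    rw [← a_sq ht', ← mul_pow, h_mul_a ht', one_pow]
  have hα := αpos ht' θ
  have h9 := mul_le_mul_of_nonneg_right h7 (mul_nonneg (zero_le_one.trans hR1) hα.le)
  have h10 := mul_le_mul_of_nonneg_left h6 hα.le
  have := m2_pos (mem_Ioc ht') θ v
  have e : S.h t θ ^ 2 * (R * S.α t θ) = R := by rw [mul_left_comm, h8, mul_one]
  rw [e] at h9
  linarith

/-- Integrals of `f` against weights bounded on the support are bounded. -/
theorem bd_int {g : ℝ → ℝ → V3 → ℝ} {C : ℝ}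
    (hg : ∀ t ∈ Ioc S.tp S.t0, ∀ θ v, S.f t θ v ≠ 0 → |g t θ v| ≤ C) :
    S.Bd (fun t θ => ∫ v, S.f t θ v * g t θ v) := by
  obtain ⟨R, hR1, hR⟩ := supp_ball (S := S)
  obtain ⟨F, hF, hf⟩ := exists_max_f (S := S)
  refine Bd.mk' (C := F * max C 0 * volume.real (Metric.closedBall (0:V3) R)) fun t ht θ => ?_
  have ht' := mem_Ioc (mem_Ioo ht)
  have h1 : ∫ v, S.f t θ v * g t θ v = ∫ v in Metric.closedBall (0:V3) R, S.f t θ v * g t θ v := by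
    refine (setIntegral_eq_integral_of_forall_compl_eq_zero fun v hv => ?_).symm
    rw [hR t ht θ v (by simpa using hv), zero_mul]
  rw [h1, ← Real.norm_eq_abs]
  refine norm_setIntegral_le_of_norm_le_const measure_closedBall_lt_top fun v hv => ?_
  rw [Real.norm_eq_abs, abs_mul, abs_of_nonneg (S.hfnn t ht' θ v)]
  by_cases h0 : S.f t θ v = 0
  · rw [h0, zero_mul]; positivity
  · exact mul_le_mul (hf t ht' θ v) ((hg t ht θ v h0).trans (le_max_left _ _)) (abs_nonneg _) hF.le

theorem supp_le {R : ℝ} (hR : ∀ t ∈ Ioc S.tp S.t0, ∀ θ v, R < ‖v‖ → S.f t θ v = 0) (ht : t ∈ Ioc S.tp S.t0)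
    {v : V3} (hv : S.f t θ v ≠ 0) : |v.1| ≤ R ∧ |v.2.1| ≤ R ∧ |v.2.2| ≤ R := by
  have h : ‖v‖ ≤ R := by
    by_contra! h
    exact hv (hR t ht θ v h)
  exact ⟨(norm_fst_le v).trans h, ((norm_fst_le v.2).trans (norm_snd_le v)).trans h,
    ((norm_snd_le v.2).trans (norm_snd_le v)).trans h⟩

theorem bdrho : S.Bd S.rho := by
  obtain ⟨R, hR1, hR⟩ := suppQ_bdd (S := S)
  refine bda.mul (bd_int (S := S) (g := fun t θ v => S.w t θ v) (C := √R) fun t ht θ v hv => ?_)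
  rw [abs_of_pos (w_pos' (mem_Ioc (mem_Ioo ht)) θ v)]
  refine Real.sqrt_le_sqrt ?_
  by_contra! h
  exact hv (hR t ht θ v h.le)

theorem bd_pt_ν : S.Bd (pt S.ν) := by
  have h1 : S.Bd (fun t θ => t * (pt S.U t θ ^ 2 + (S.a t θ * pθ S.U t θ) ^ 2
      + Real.exp (4 * S.U t θ) * (1 / 4 * (t⁻¹) ^ 2) * (pt S.A t θ ^ 2 + (S.a t θ * pθ S.A t θ) ^ 2))
      + S.p t θ * (1 / 4) + S.rho t θ) :=
    ((Bd.time.mul (((bd_pt_U.pow 2).add (bd_aU.pow 2)).add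
      ((((Bd.const 4).mul bdU).exp.mul ((Bd.const (1/4)).mul (Bd.time_inv.pow 2))).mul
        ((bd_pt_A.pow 2).add (bd_aA.pow 2))))).add (bdp.mul (Bd.const (1/4)))).add bdrho
  refine h1.congr fun t ht θ => ?_
  rw [pt_ν (mem_Ioo ht)]
  have := (tpos (mem_Ioo ht)).ne'
  field_simp

theorem bdB : S.Bd S.B := bd_pt_ν.le fun t ht θ => (abs_B_le (mem_Ioo ht) θ).trans (le_abs_self _)

theorem bdν : S.Bd S.ν := Bd.of_pt smν perν bd_pt_ν

theorem bdSU : S.Bd S.SU := by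
  refine (bdr.mul Bd.time_inv).le fun t ht θ => ?_
  rw [abs_of_nonneg (SU_nonneg (mem_Ioc (mem_Ioo ht)) θ)]
  exact (SU_le (mem_Ioc (mem_Ioo ht)) θ).trans (le_abs_self _)

theorem bds3 : S.Bd S.s3 := by
  refine (bdr.mul Bd.time_inv).le fun t ht θ => ?_
  rw [abs_of_nonneg (s3_nonneg (mem_Ioc (mem_Ioo ht)) θ)]
  exact (s3_le (mem_Ioc (mem_Ioo ht)) θ).trans (le_abs_self _)

theorem bdSA : S.Bd S.SA := by
  refine ((bdr.mul ((Bd.const (-2)).mul bdU).exp)).le fun t ht θ => ?_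
  have h := SA_le (mem_Ioc (mem_Ioo ht)) θ
  have h0 := tpos (mem_Ioo ht)
  rw [abs_mul, abs_of_nonneg (r_nonneg (mem_Ioc (mem_Ioo ht)) θ), abs_of_pos (Real.exp_pos _)]
  rw [div_mul_eq_mul_div, div_le_div_iff_of_pos_right h0] at h
  have h1 : Real.exp (2 * S.U t θ) * Real.exp (-2 * S.U t θ) = 1 := by rw [← Real.exp_add]; simp
  have h2 := mul_le_mul_of_nonneg_right h (Real.exp_pos (-2 * S.U t θ)).le
  rwa [mul_right_comm, h1, one_mul] at h2

theorem bd_aJ : S.Bd (fun t θ => S.a t θ * pθ S.J t θ) := by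
  obtain ⟨R, hR1, hR⟩ := supp_ball (S := S)
  refine bda.mul (((Bd.const 2).mul (bd_int (S := S) (g := fun t θ v => v.2.1) (C := R)
    fun t ht θ v hv => (supp_le hR ht hv).2.1)).congr fun t ht θ => ?_)
  exact S.hjth t (mem_Ioc (mem_Ioo ht)) θ

theorem bd_aK : S.Bd (fun t θ => S.a t θ * pθ S.K t θ) := by
  obtain ⟨R, hR1, hR⟩ := supp_ball (S := S)
  refine bda.mul (((Bd.const 2).mul (bd_int (S := S) (g := fun t θ v => v.2.2) (C := R)
    fun t ht θ v hv => (supp_le hR ht hv).2.2)).congr fun t ht θ => ?_)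
  exact S.hkth t (mem_Ioc (mem_Ioo ht)) θ

end EV

/-! ### Functions on phase space bounded for bounded momenta -/

namespace EV

variable {S : EV} {t θ : ℝ}

/-- `G` is bounded on `(tp, t0]` for momenta in bounded sets. -/
def B5 (S : EV) (G : ℝ → ℝ → V3 → ℝ) : Prop :=
  ∀ R, ∃ C, 0 ≤ C ∧ ∀ t ∈ Ioc S.tp S.t0, ∀ θ v, ‖v‖ ≤ R → |G t θ v| ≤ C

theorem B5.of_bd {G : ℝ → ℝ → ℝ} (h : S.Bd G) : S.B5 (fun t θ _ => G t θ) := fun R => by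
  obtain ⟨C, hC0, hC⟩ := h
  exact ⟨C, hC0, fun t ht θ v _ => hC t ht θ⟩
theorem B5.v1 : S.B5 (fun _ _ v => v.1) := fun R =>
  ⟨max R 0, le_max_right _ _, fun t ht θ v hv => ((norm_fst_le v).trans hv).trans (le_max_left _ _)⟩
theorem B5.v2 : S.B5 (fun _ _ v => v.2.1) := fun R =>
  ⟨max R 0, le_max_right _ _, fun t ht θ v hv =>
    (((norm_fst_le v.2).trans (norm_snd_le v)).trans hv).trans (le_max_left _ _)⟩
theorem B5.v3 : S.B5 (fun _ _ v => v.2.2) := fun R =>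
  ⟨max R 0, le_max_right _ _, fun t ht θ v hv =>
    (((norm_snd_le v.2).trans (norm_snd_le v)).trans hv).trans (le_max_left _ _)⟩

section
variable {G H : ℝ → ℝ → V3 → ℝ}
theorem B5.le (h : S.B5 G) (k : ∀ t ∈ Ioc S.tp S.t0, ∀ θ v, |H t θ v| ≤ |G t θ v|) : S.B5 H := fun R => by
  obtain ⟨C, hC0, hC⟩ := h R
  exact ⟨C, hC0, fun t ht θ v hv => (k t ht θ v).trans (hC t ht θ v hv)⟩
theorem B5.congr (h : S.B5 G) (k : ∀ t ∈ Ioc S.tp S.t0, ∀ θ v, H t θ v = G t θ v) : S.B5 H :=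
  h.le fun t ht θ v => by rw [k t ht θ]
theorem B5.add (h : S.B5 G) (k : S.B5 H) : S.B5 (fun t θ v => G t θ v + H t θ v) := fun R => by
  obtain ⟨C, hC0, hC⟩ := h R
  obtain ⟨D, hD0, hD⟩ := k R
  exact ⟨C + D, add_nonneg hC0 hD0, fun t ht θ v hv =>
    (abs_add_le _ _).trans (add_le_add (hC t ht θ v hv) (hD t ht θ v hv))⟩
theorem B5.neg (h : S.B5 G) : S.B5 (fun t θ v => - G t θ v) := h.le fun t ht θ v => by rw [abs_neg]
theorem B5.sub (h : S.B5 G) (k : S.B5 H) : S.B5 (fun t θ v => G t θ v - H t θ v) := by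
  simpa only [sub_eq_add_neg] using h.add k.neg
theorem B5.mul (h : S.B5 G) (k : S.B5 H) : S.B5 (fun t θ v => G t θ v * H t θ v) := fun R => by
  obtain ⟨C, hC0, hC⟩ := h R
  obtain ⟨D, hD0, hD⟩ := k R
  exact ⟨C * D, mul_nonneg hC0 hD0, fun t ht θ v hv => by
    rw [abs_mul]; exact mul_le_mul (hC t ht θ v hv) (hD t ht θ v hv) (abs_nonneg _) hC0⟩
theorem B5.pow (h : S.B5 G) (n : ℕ) : S.B5 (fun t θ v => G t θ v ^ n) := fun R => by
  obtain ⟨C, hC0, hC⟩ := h R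
  exact ⟨C ^ n, pow_nonneg hC0 n, fun t ht θ v hv => by
    rw [abs_pow]; exact pow_le_pow_left₀ (abs_nonneg _) (hC t ht θ v hv) n⟩
end

theorem B5.const (c : ℝ) : S.B5 (fun _ _ _ => c) := B5.of_bd (Bd.const c)

variable (S) in
/-- `√α U_θ` -/
def aU (t θ : ℝ) : ℝ := S.a t θ * pθ S.U t θ
variable (S) in
/-- `√α A_θ` -/
def aA (t θ : ℝ) : ℝ := S.a t θ * pθ S.A t θ
theorem smaU : Sm S.tp S.ti S.aU := sma.mul smU.pθ
theorem smaA : Sm S.tp S.ti S.aA := sma.mul smA.pθ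

variable (S) in
/-- the third momentum component relative to the frame -/
def sv (t θ : ℝ) (v : V3) : ℝ := v.2.2 - S.A t θ * v.2.1
variable (S) in
/-- the time derivative of `mu` -/
def mt (t θ : ℝ) (v : V3) : ℝ :=
  -2 * pt S.U t θ * Real.exp (-2 * S.U t θ) - 4 * pt S.U t θ * (Real.exp (-4 * S.U t θ) * v.2.1 ^ 2)
    - 2 * (t⁻¹ ^ 3 * S.sv t θ v ^ 2) - 2 * (t⁻¹ ^ 2 * pt S.A t θ * (S.sv t θ v * v.2.1))
variable (S) in
/-- `√α` times the space derivative of `mu` -/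
def mx (t θ : ℝ) (v : V3) : ℝ :=
  -2 * S.aU t θ * Real.exp (-2 * S.U t θ) - 4 * S.aU t θ * (Real.exp (-4 * S.U t θ) * v.2.1 ^ 2)
    - 2 * (t⁻¹ ^ 2 * S.aA t θ * (S.sv t θ v * v.2.1))

theorem sv_dt (ht : t ∈ Ioo S.tp S.ti) (θ : ℝ) (v : V3) :
    HasDerivAt (fun s => S.sv s θ v) (-(pt S.A t θ * v.2.1)) t :=
  ((smA.dt ht θ).mul_const v.2.1).const_sub v.2.2
theorem sv_dθ (ht : t ∈ Ioo S.tp S.ti) (θ : ℝ) (v : V3) :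
    HasDerivAt (fun s => S.sv t s v) (-(pθ S.A t θ * v.2.1)) θ :=
  ((smA.dθ ht θ).mul_const v.2.1).const_sub v.2.2

theorem mu_dt (ht : t ∈ Ioo S.tp S.ti) (θ : ℝ) (v : V3) :
    HasDerivAt (fun s => S.mu s θ v) (S.mt t θ v) t :=
  ((smmu v).dt ht θ).congr_deriv (by
    rw [pt_mu_eq ht, mt, sv]
    have := (tpos ht).ne'
    field_simp)

theorem mu_dθ (ht : t ∈ Ioo S.tp S.ti) (θ : ℝ) (v : V3) :
    HasDerivAt (fun s => S.mu t s v) (S.h t θ * S.mx t θ v) θ := by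
  have h1 := ((smU.dθ ht θ).const_mul (-2)).exp
  have h2 := (((smU.dθ ht θ).const_mul (-4)).exp).mul_const (v.2.1 ^ 2)
  have h3 := ((sv_dθ ht θ v).pow 2).const_mul ((t ^ 2)⁻¹)
  refine ((h1.add h2).add h3).congr_deriv ?_
  have e := h_mul_a ht θ
  have e2 : S.h t θ * S.aU t θ = pθ S.U t θ := by rw [aU, ← mul_assoc, e, one_mul]
  have e3 : S.h t θ * S.aA t θ = pθ S.A t θ := by rw [aA, ← mul_assoc, e, one_mul]
  rw [mx, ← e2, ← e3]
  simp only [Nat.cast_ofNat, Nat.add_one_sub_one, pow_one, inv_pow]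
  ring

theorem bd_aU' : S.Bd S.aU := bd_aU
theorem bd_aA' : S.Bd S.aA := bd_aA

theorem b_sv : S.B5 S.sv := B5.v3.sub ((B5.of_bd bdA).mul B5.v2)
theorem b_e2 : S.Bd (fun t θ => Real.exp (-2 * S.U t θ)) := ((Bd.const _).mul bdU).exp
theorem b_e4 : S.Bd (fun t θ => Real.exp (-4 * S.U t θ)) := ((Bd.const _).mul bdU).exp

theorem b_mt : S.B5 S.mt :=
  ((((B5.of_bd (((Bd.const (-2)).mul bd_pt_U).mul b_e2)).sub
    ((B5.of_bd ((Bd.const 4).mul bd_pt_U)).mul ((B5.of_bd b_e4).mul (B5.v2.pow 2)))).sub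
    ((B5.const 2).mul ((B5.of_bd (Bd.time_inv.pow 3)).mul (b_sv.pow 2)))).sub
    ((B5.const 2).mul ((B5.of_bd ((Bd.time_inv.pow 2).mul bd_pt_A)).mul (b_sv.mul B5.v2))))

theorem b_mx : S.B5 S.mx :=
  ((B5.of_bd (((Bd.const (-2)).mul bd_aU').mul b_e2)).sub
    ((B5.of_bd ((Bd.const 4).mul bd_aU')).mul ((B5.of_bd b_e4).mul (B5.v2.pow 2)))).sub
    ((B5.const 2).mul ((B5.of_bd ((Bd.time_inv.pow 2).mul bd_aA')).mul (b_sv.mul B5.v2)))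

theorem b_mu_inv : S.B5 (fun t θ v => (S.mu t θ v)⁻¹) := by
  refine (B5.of_bd ((Bd.const 2).mul bdU).exp).le fun t ht θ v => ?_
  rw [abs_of_pos (inv_pos.2 (mu_pos t θ v)), abs_of_pos (Real.exp_pos _)]
  have e : Real.exp (2 * S.U t θ) = (Real.exp (-2 * S.U t θ))⁻¹ := by rw [← Real.exp_neg]; ring_nf
  rw [e]
  refine inv_anti₀ (Real.exp_pos _) ?_
  unfold mu
  have := Real.exp_pos (-4 * S.U t θ)
  have : 0 ≤ Real.exp (-4 * S.U t θ) * v.2.1 ^ 2 + (t ^ 2)⁻¹ * (v.2.2 - S.A t θ * v.2.1) ^ 2 := by positivity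
  linarith

theorem b_mu : S.B5 S.mu :=
  ((B5.of_bd b_e2).add ((B5.of_bd b_e4).mul (B5.v2.pow 2))).add
    ((B5.of_bd (Bd.time_inv.pow 2)).mul (b_sv.pow 2)) |>.congr fun t ht θ v => by
      rw [mu, sv, inv_pow]

variable (S) in
/-- `√mu` -/
def sm (t θ : ℝ) (v : V3) : ℝ := √(S.mu t θ v)
theorem sm_pos (t θ : ℝ) (v : V3) : 0 < S.sm t θ v := Real.sqrt_pos.2 (mu_pos t θ v)
theorem sm_sq (t θ : ℝ) (v : V3) : S.sm t θ v ^ 2 = S.mu t θ v := Real.sq_sqrt (mu_pos t θ v).le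

theorem b_sm_inv : S.B5 (fun t θ v => (S.sm t θ v)⁻¹) :=
  ((B5.const 1).add b_mu_inv).le fun t ht θ v => by
    refine (abs_le_one_add_sq _).trans ?_
    rw [inv_pow, sm_sq]; exact le_abs_self _

variable (S) in
/-- the logarithmic time derivative of `e^ν √mu` -/
def Ga (t θ : ℝ) (v : V3) : ℝ := pt S.ν t θ + 1 / 2 * (S.mt t θ v * (S.mu t θ v)⁻¹)
variable (S) in
/-- the logarithmic space derivative of `√α e^ν √mu`, times `√α` -/
def Al (t θ : ℝ) (v : V3) : ℝ := S.B t θ + 1 / 2 * (S.mx t θ v * (S.mu t θ v)⁻¹)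
variable (S) in
/-- the twist factor of the magnetic force -/
def Nf (t θ : ℝ) (v : V3) : ℝ :=
  t⁻¹ ^ 3 * (S.K t θ - S.A t θ * S.J t θ) * S.sv t θ v
    + t⁻¹ * Real.exp (-4 * S.U t θ) * S.J t θ * v.2.1
variable (S) in
/-- the magnetic force in the rapidity variable -/
def Mf (t θ : ℝ) (v : V3) : ℝ :=
  S.a t θ * Real.exp (S.ν t θ) * (S.Nf t θ v * (S.sm t θ v)⁻¹)

theorem b_Ga : S.B5 S.Ga := (B5.of_bd bd_pt_ν).add ((B5.const (1/2)).mul (b_mt.mul b_mu_inv))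
theorem b_Al : S.B5 S.Al := (B5.of_bd bdB).add ((B5.const (1/2)).mul (b_mx.mul b_mu_inv))
theorem b_Nf : S.B5 S.Nf :=
  ((B5.of_bd ((Bd.time_inv.pow 3).mul bdKAJ)).mul b_sv).add
    ((B5.of_bd ((Bd.time_inv.mul b_e4).mul bdJ)).mul B5.v2)
theorem b_Mf : S.B5 S.Mf := (B5.of_bd bd_aexpν).mul (b_Nf.mul b_sm_inv)

section
variable {G : ℝ → ℝ → V3 → ℝ}
theorem sm5_fix (h : Sm5 S.tp S.ti (fun x => G x.1 x.2.1 x.2.2)) (v : V3) :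
    Sm S.tp S.ti (fun t θ => G t θ v) :=
  ContDiffOn.comp (t := Ioo S.tp S.ti ×ˢ univ) h (f := fun p : ℝ × ℝ => (p.1, p.2, v))
    (by fun_prop) fun p hp => ⟨hp.1, mem_univ _⟩
theorem sm5_dt (h : Sm5 S.tp S.ti (fun x => G x.1 x.2.1 x.2.2)) (ht : t ∈ Ioo S.tp S.ti) (θ : ℝ) (v : V3) :
    fderiv ℝ (fun x : ℝ × ℝ × V3 => G x.1 x.2.1 x.2.2) (t, θ, v) (1, 0, 0) = pt (fun t θ => G t θ v) t θ :=
  (deriv_line (fun s => G s θ v) (by simpa using h.line (x := (t, θ, v)) ht (1, 0, 0))).symm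
theorem sm5_dθ (h : Sm5 S.tp S.ti (fun x => G x.1 x.2.1 x.2.2)) (ht : t ∈ Ioo S.tp S.ti) (θ : ℝ) (v : V3) :
    fderiv ℝ (fun x : ℝ × ℝ × V3 => G x.1 x.2.1 x.2.2) (t, θ, v) (0, 1, 0) = pθ (fun t θ => G t θ v) t θ :=
  (deriv_line (fun s => G t s v) (by simpa using h.line (x := (t, θ, v)) ht (0, 1, 0))).symm
theorem sm5_dv (h : Sm5 S.tp S.ti (fun x => G x.1 x.2.1 x.2.2)) (ht : t ∈ Ioo S.tp S.ti) (θ : ℝ) (v d : V3) {c : ℝ}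
    (hc : HasDerivAt (fun s : ℝ => G t θ (v + s • d)) c 0) :
    fderiv ℝ (fun x : ℝ × ℝ × V3 => G x.1 x.2.1 x.2.2) (t, θ, v) (0, 0, d) = c :=
  h.line_eq (x := (t, θ, v)) ht (by simpa using hc)
end

theorem sm5_mu : Sm5 S.tp S.ti (fun x => S.mu x.1 x.2.1 x.2.2) := by
  have c2 : Sm5 S.tp S.ti (fun x => x.2.2.2.1) := Sm5.of_contDiff (by fun_prop)
  have c3 : Sm5 S.tp S.ti (fun x => x.2.2.2.2) := Sm5.of_contDiff (by fun_prop)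
  have e4 : Sm5 S.tp S.ti (fun x => (x.1 ^ 2)⁻¹) :=
    (Sm5.of_contDiff (by fun_prop)).inv fun x hx => (pow_pos (tpos hx) 2).ne'
  exact (((Sm.const (-2)).mul (smU (S := S))).exp.sm5.add
    (((Sm.const (-4)).mul (smU (S := S))).exp.sm5.mul (c2.pow 2))).add
    (e4.mul ((c3.sub (smA.sm5.mul c2)).pow 2))
theorem sm5_sv : Sm5 S.tp S.ti (fun x => S.sv x.1 x.2.1 x.2.2) :=
  (Sm5.of_contDiff (by fun_prop)).sub (smA.sm5.mul (Sm5.of_contDiff (by fun_prop)))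
theorem sm5_mt : Sm5 S.tp S.ti (fun x => S.mt x.1 x.2.1 x.2.2) := by
  refine (sm5_mu.fderiv_apply (1, 0, 0)).congr fun x hx => ?_
  rw [sm5_dt sm5_mu hx]; exact ((mu_dt hx x.2.1 x.2.2).deriv).symm
theorem sm5_mx : Sm5 S.tp S.ti (fun x => S.mx x.1 x.2.1 x.2.2) := by
  refine (sma.sm5.mul (sm5_mu.fderiv_apply (0, 1, 0))).congr fun x hx => ?_
  rw [sm5_dθ sm5_mu hx, pθ, (mu_dθ hx x.2.1 x.2.2).deriv, ← mul_assoc, mul_comm (S.a _ _), h_mul_a hx, one_mul]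
theorem sm5_mu_inv : Sm5 S.tp S.ti (fun x => (S.mu x.1 x.2.1 x.2.2)⁻¹) :=
  sm5_mu.inv fun x _ => (mu_pos _ _ _).ne'
theorem sm5_sm : Sm5 S.tp S.ti (fun x => S.sm x.1 x.2.1 x.2.2) :=
  sm5_mu.sqrt fun x _ => (mu_pos _ _ _).ne'
theorem sm5_Ga : Sm5 S.tp S.ti (fun x => S.Ga x.1 x.2.1 x.2.2) :=
  smν.pt.sm5.add ((Sm5.of_contDiff contDiff_const).mul (sm5_mt.mul sm5_mu_inv))
theorem sm5_Al : Sm5 S.tp S.ti (fun x => S.Al x.1 x.2.1 x.2.2) :=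
  smB.sm5.add ((Sm5.of_contDiff contDiff_const).mul (sm5_mx.mul sm5_mu_inv))
theorem sm5_Nf : Sm5 S.tp S.ti (fun x => S.Nf x.1 x.2.1 x.2.2) := by
  have c2 : Sm5 S.tp S.ti (fun x => x.2.2.2.1) := Sm5.of_contDiff (by fun_prop)
  have e1 : Sm5 S.tp S.ti (fun x => x.1⁻¹) :=
    (Sm5.of_contDiff (by fun_prop)).inv fun x hx => (tpos hx).ne'
  exact (((e1.pow 3).mul (smK.sub (smA.mul smJ)).sm5).mul sm5_sv).add
    (((e1.mul ((Sm.const (-4)).mul (smU (S := S))).exp.sm5).mul smJ.sm5).mul c2)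
theorem sm5_Mf : Sm5 S.tp S.ti (fun x => S.Mf x.1 x.2.1 x.2.2) :=
  (sma.mul smν.exp).sm5.mul (sm5_Nf.mul (sm5_sm.inv fun x _ => (sm_pos _ _ _).ne'))

end EV

/-! ### Bounds for the coefficients of the differentiated Vlasov equation -/

namespace EV

variable {S : EV} {t θ : ℝ}

variable (S) in
/-- the lower order part of the wave equation for `U` -/
def RU (t θ : ℝ) : ℝ := S.a t θ * pθ S.aU t θ - pt (pt S.U) t θ - S.q t θ / 2 * pt S.U t θ
variable (S) in
/-- the lower order part of the wave equation for `A` -/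
def RA (t θ : ℝ) : ℝ := S.a t θ * pθ S.aA t θ - pt (pt S.A) t θ - S.q t θ / 2 * pt S.A t θ
variable (S) in
/-- the lower order part of the wave equation for `ν` -/
def Rν (t θ : ℝ) : ℝ := S.a t θ * pθ S.B t θ - pt (pt S.ν) t θ - S.q t θ / 2 * pt S.ν t θ

theorem bdRU : S.Bd S.RU := by
  have h : S.Bd (fun t θ => pt S.U t θ * t⁻¹
      - (Real.exp (4 * S.U t θ) * (1 / 2 * t⁻¹ ^ 2) * (pt S.A t θ ^ 2 - S.aA t θ ^ 2)
      + S.α t θ * Real.exp (2 * S.ν t θ - 4 * S.U t θ) * (1 / 2 * t⁻¹ ^ 2) * S.J t θ ^ 2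
      + S.SU t θ)) :=
    (bd_pt_U.mul Bd.time_inv).sub ((((((Bd.const 4).mul bdU).exp.mul ((Bd.const _).mul (Bd.time_inv.pow 2))).mul
      ((bd_pt_A.pow 2).sub (bd_aA'.pow 2))).add
      ((bd_exp_be'.mul ((Bd.const _).mul (Bd.time_inv.pow 2))).mul (bdJ.pow 2))).add bdSU)
  refine h.congr fun t ht θ => ?_
  have h0 := (tpos (mem_Ioo ht)).ne'
  rw [RU, eqU (mem_Ioo ht), show (fun t θ => S.a t θ * pθ S.U t θ) = S.aU from rfl,
    show S.a t θ * pθ S.A t θ = S.aA t θ from rfl]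
  field_simp
  ring

theorem bdRA : S.Bd S.RA := by
  have h : S.Bd (fun t θ => 4 * (pt S.A t θ * pt S.U t θ - S.aA t θ * S.aU t θ) - pt S.A t θ * t⁻¹
      - (S.α t θ * Real.exp (2 * S.ν t θ - 4 * S.U t θ) * t⁻¹ ^ 2 * S.J t θ * (S.K t θ - S.A t θ * S.J t θ)
      + S.SA t θ)) :=
    (((Bd.const 4).mul ((bd_pt_A.mul bd_pt_U).sub (bd_aA'.mul bd_aU'))).sub (bd_pt_A.mul Bd.time_inv)).sub
      ((((bd_exp_be'.mul (Bd.time_inv.pow 2)).mul bdJ).mul bdKAJ).add bdSA)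
  refine h.congr fun t ht θ => ?_
  have h0 := (tpos (mem_Ioo ht)).ne'
  rw [RA, eqA (mem_Ioo ht), show (fun t θ => S.a t θ * pθ S.A t θ) = S.aA from rfl,
    show S.a t θ * pθ S.A t θ = S.aA t θ from rfl, show S.a t θ * pθ S.U t θ = S.aU t θ from rfl]
  field_simp
  ring

theorem bdRν : S.Bd S.Rν := by
  have h : S.Bd (fun t θ => pt S.U t θ ^ 2 - S.aU t θ ^ 2
      - Real.exp (4 * S.U t θ) * (1 / 4 * t⁻¹ ^ 2) * (pt S.A t θ ^ 2 - S.aA t θ ^ 2)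
      + S.α t θ * Real.exp (2 * S.ν t θ - 4 * S.U t θ) * (1 / 4 * t⁻¹ ^ 2) * S.J t θ ^ 2
      + S.α t θ * Real.exp (2 * S.ν t θ) * (3 / 4 * t⁻¹ ^ 4) * (S.K t θ - S.A t θ * S.J t θ) ^ 2
      + S.s3 t θ) :=
    (((((bd_pt_U.pow 2).sub (bd_aU'.pow 2)).sub
      ((((Bd.const 4).mul bdU).exp.mul ((Bd.const _).mul (Bd.time_inv.pow 2))).mul
      ((bd_pt_A.pow 2).sub (bd_aA'.pow 2)))).add
      ((bd_exp_be'.mul ((Bd.const _).mul (Bd.time_inv.pow 2))).mul (bdJ.pow 2))).add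
      ((bd_exp_be.mul ((Bd.const _).mul (Bd.time_inv.pow 4))).mul (bdKAJ.pow 2))).add bds3
  refine h.congr fun t ht θ => ?_
  have h0 := (tpos (mem_Ioo ht)).ne'
  rw [Rν, eqν (mem_Ioo ht),
    show S.a t θ * pθ S.A t θ = S.aA t θ from rfl, show S.a t θ * pθ S.U t θ = S.aU t θ from rfl]
  field_simp
  ring

variable (S) in
/-- the wave operator applied to `mu`, up to sign -/
def bx (t θ : ℝ) (v : V3) : ℝ :=
  -2 * S.RU t θ * Real.exp (-2 * S.U t θ) - 4 * S.RU t θ * (Real.exp (-4 * S.U t θ) * v.2.1 ^ 2)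
    - 2 * (t⁻¹ ^ 2 * S.RA t θ * (S.sv t θ v * v.2.1))
    + (4 * (S.aU t θ ^ 2 - pt S.U t θ ^ 2) * Real.exp (-2 * S.U t θ)
      + 16 * (S.aU t θ ^ 2 - pt S.U t θ ^ 2) * (Real.exp (-4 * S.U t θ) * v.2.1 ^ 2)
      + 2 * (t⁻¹ ^ 2 * (S.aA t θ ^ 2 - pt S.A t θ ^ 2) * v.2.1 ^ 2))
    - (6 * (t⁻¹ ^ 4 * S.sv t θ v ^ 2) + 8 * (t⁻¹ ^ 3 * pt S.A t θ * (S.sv t θ v * v.2.1)))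
    + S.q t θ * (t⁻¹ ^ 3 * S.sv t θ v ^ 2)

theorem b_bx : S.B5 S.bx :=
  ((((((B5.of_bd (((Bd.const (-2)).mul bdRU).mul b_e2)).sub
    ((B5.of_bd ((Bd.const 4).mul bdRU)).mul ((B5.of_bd b_e4).mul (B5.v2.pow 2)))).sub
    ((B5.const 2).mul ((B5.of_bd ((Bd.time_inv.pow 2).mul bdRA)).mul (b_sv.mul B5.v2)))).add
    (((B5.of_bd (((Bd.const 4).mul ((bd_aU'.pow 2).sub (bd_pt_U.pow 2))).mul b_e2)).add
      ((B5.of_bd ((Bd.const 16).mul ((bd_aU'.pow 2).sub (bd_pt_U.pow 2)))).mul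
        ((B5.of_bd b_e4).mul (B5.v2.pow 2)))).add
      ((B5.const 2).mul ((B5.of_bd ((Bd.time_inv.pow 2).mul ((bd_aA'.pow 2).sub (bd_pt_A.pow 2)))).mul
        (B5.v2.pow 2))))).sub
    (((B5.const 6).mul ((B5.of_bd (Bd.time_inv.pow 4)).mul (b_sv.pow 2))).add
      ((B5.const 8).mul ((B5.of_bd ((Bd.time_inv.pow 3).mul bd_pt_A)).mul (b_sv.mul B5.v2))))).add
    ((B5.of_bd bdq).mul ((B5.of_bd (Bd.time_inv.pow 3)).mul (b_sv.pow 2))))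

theorem inv_dt (ht : t ∈ Ioo S.tp S.ti) : HasDerivAt (fun s : ℝ => s⁻¹) (-(t⁻¹ ^ 2)) t :=
  (hasDerivAt_inv (tpos ht).ne').congr_deriv (by rw [inv_pow])

theorem mt_dt (ht : t ∈ Ioo S.tp S.ti) (θ : ℝ) (v : V3) :
    HasDerivAt (fun s => S.mt s θ v) (
      (-2 * pt (pt S.U) t θ + 4 * pt S.U t θ ^ 2) * Real.exp (-2 * S.U t θ)
      + (-4 * pt (pt S.U) t θ + 16 * pt S.U t θ ^ 2) * (Real.exp (-4 * S.U t θ) * v.2.1 ^ 2)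
      + 6 * (t⁻¹ ^ 4 * S.sv t θ v ^ 2) + 8 * (t⁻¹ ^ 3 * pt S.A t θ * (S.sv t θ v * v.2.1))
      - 2 * (t⁻¹ ^ 2 * pt (pt S.A) t θ * (S.sv t θ v * v.2.1))
      + 2 * (t⁻¹ ^ 2 * pt S.A t θ ^ 2 * v.2.1 ^ 2)) t := by
  have hs := sv_dt ht θ v
  have h1 := ((smU.pt.dt ht θ).const_mul (-2)).mul (((smU.dt ht θ).const_mul (-2)).exp)
  have h2 := ((smU.pt.dt ht θ).const_mul 4).mul ((((smU.dt ht θ).const_mul (-4)).exp).mul_const (v.2.1 ^ 2))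
  have h3 := (((inv_dt ht).pow 3).mul (hs.pow 2)).const_mul 2
  have h4 := ((((inv_dt ht).pow 2).mul (smA.pt.dt ht θ)).mul (hs.mul_const v.2.1)).const_mul 2
  refine (((h1.sub h2).sub h3).sub h4).congr_deriv ?_
  simp only [Pi.mul_apply, Pi.pow_apply, Nat.cast_ofNat, Nat.add_one_sub_one, pow_one]
  ring

theorem mx_dθ (ht : t ∈ Ioo S.tp S.ti) (θ : ℝ) (v : V3) :
    HasDerivAt (fun s => S.mx t s v) (
      (-2 * pθ S.aU t θ + 4 * S.aU t θ * pθ S.U t θ) * Real.exp (-2 * S.U t θ)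
      + (-4 * pθ S.aU t θ + 16 * S.aU t θ * pθ S.U t θ) * (Real.exp (-4 * S.U t θ) * v.2.1 ^ 2)
      - 2 * (t⁻¹ ^ 2 * pθ S.aA t θ * (S.sv t θ v * v.2.1))
      + 2 * (t⁻¹ ^ 2 * S.aA t θ * pθ S.A t θ * v.2.1 ^ 2)) θ := by
  have hs := sv_dθ ht θ v
  have h1 := ((smaU.dθ ht θ).const_mul (-2)).mul (((smU.dθ ht θ).const_mul (-2)).exp)
  have h2 := ((smaU.dθ ht θ).const_mul 4).mul ((((smU.dθ ht θ).const_mul (-4)).exp).mul_const (v.2.1 ^ 2))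
  have h4 := (((smaA.dθ ht θ).const_mul (t⁻¹ ^ 2)).mul (hs.mul_const v.2.1)).const_mul 2
  refine ((h1.sub h2).sub h4).congr_deriv ?_
  ring

variable (S) in
/-- the coefficient of the `y`-derivative in the commutator with the characteristic derivative -/
def Wf (t θ : ℝ) (v : V3) : ℝ :=
  S.Rν t θ + 1 / 2 * (S.bx t θ v * (S.mu t θ v)⁻¹
    + (S.mt t θ v ^ 2 - S.mx t θ v ^ 2) * ((S.mu t θ v)⁻¹) ^ 2)

theorem b_Wf : S.B5 S.Wf :=
  (B5.of_bd bdRν).add ((B5.const _).mul ((b_bx.mul b_mu_inv).add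
    (((b_mt.pow 2).sub (b_mx.pow 2)).mul (b_mu_inv.pow 2))))

theorem Wf_eq (ht : t ∈ Ioo S.tp S.ti) (θ : ℝ) (v : V3) :
    S.a t θ * pθ (fun t θ => S.Al t θ v) t θ - pt (fun t θ => S.Ga t θ v) t θ - S.q t θ / 2 * S.Ga t θ v
      = S.Wf t θ v := by
  have hm := (mu_pos (S := S) t θ v).ne'
  have h1 := ((smB.dθ ht θ).add (((mx_dθ ht θ v).mul ((mu_dθ ht θ v).inv hm)).const_mul (1/2))).deriv
  have h2 := ((smν.pt.dt ht θ).add (((mt_dt ht θ v).mul ((mu_dt ht θ v).inv hm)).const_mul (1/2))).deriv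
  have h1' : pθ (fun t θ => S.Al t θ v) t θ = _ := h1
  have h2' : pt (fun t θ => S.Ga t θ v) t θ = _ := h2
  have e1 : S.a t θ * pθ S.U t θ = S.aU t θ := rfl
  have e2 : S.a t θ * pθ S.A t θ = S.aA t θ := rfl
  have e3 : S.a t θ * pθ S.aU t θ = S.RU t θ + pt (pt S.U) t θ + S.q t θ / 2 * pt S.U t θ := by rw [RU]; ring
  have e4 : S.a t θ * pθ S.aA t θ = S.RA t θ + pt (pt S.A) t θ + S.q t θ / 2 * pt S.A t θ := by rw [RA]; ring
  have e5 : S.a t θ * pθ S.B t θ = S.Rν t θ + pt (pt S.ν) t θ + S.q t θ / 2 * pt S.ν t θ := by rw [Rν]; ring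
  have e6 : S.a t θ * S.h t θ = 1 := by rw [mul_comm]; exact h_mul_a ht θ
  have key : S.a t θ * ((-2 * pθ S.aU t θ + 4 * S.aU t θ * pθ S.U t θ) * Real.exp (-2 * S.U t θ)
      + (-4 * pθ S.aU t θ + 16 * S.aU t θ * pθ S.U t θ) * (Real.exp (-4 * S.U t θ) * v.2.1 ^ 2)
      - 2 * (t⁻¹ ^ 2 * pθ S.aA t θ * (S.sv t θ v * v.2.1))
      + 2 * (t⁻¹ ^ 2 * S.aA t θ * pθ S.A t θ * v.2.1 ^ 2))
      - ((-2 * pt (pt S.U) t θ + 4 * pt S.U t θ ^ 2) * Real.exp (-2 * S.U t θ)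
      + (-4 * pt (pt S.U) t θ + 16 * pt S.U t θ ^ 2) * (Real.exp (-4 * S.U t θ) * v.2.1 ^ 2)
      + 6 * (t⁻¹ ^ 4 * S.sv t θ v ^ 2) + 8 * (t⁻¹ ^ 3 * pt S.A t θ * (S.sv t θ v * v.2.1))
      - 2 * (t⁻¹ ^ 2 * pt (pt S.A) t θ * (S.sv t θ v * v.2.1))
      + 2 * (t⁻¹ ^ 2 * pt S.A t θ ^ 2 * v.2.1 ^ 2))
      - S.q t θ / 2 * S.mt t θ v = S.bx t θ v := by
    rw [bx, mt]
    linear_combination (-2 * Real.exp (-2 * S.U t θ) - 4 * (Real.exp (-4 * S.U t θ) * v.2.1 ^ 2)) * e3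
      + (- 2 * (t⁻¹ ^ 2 * (S.sv t θ v * v.2.1))) * e4
      + (4 * S.aU t θ * Real.exp (-2 * S.U t θ) + 16 * S.aU t θ * (Real.exp (-4 * S.U t θ) * v.2.1 ^ 2)) * e1
      + 2 * t⁻¹ ^ 2 * S.aA t θ * v.2.1 ^ 2 * e2
  rw [h1', h2', Ga, Wf, ← key]
  set m := S.mu t θ v with hmdef
  simp only [Pi.inv_apply]
  rw [← hmdef]
  set X := (-2 * pθ S.aU t θ + 4 * S.aU t θ * pθ S.U t θ) * Real.exp (-2 * S.U t θ)
      + (-4 * pθ S.aU t θ + 16 * S.aU t θ * pθ S.U t θ) * (Real.exp (-4 * S.U t θ) * v.2.1 ^ 2)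
      - 2 * (t⁻¹ ^ 2 * pθ S.aA t θ * (S.sv t θ v * v.2.1))
      + 2 * (t⁻¹ ^ 2 * S.aA t θ * pθ S.A t θ * v.2.1 ^ 2)
  set Y := (-2 * pt (pt S.U) t θ + 4 * pt S.U t θ ^ 2) * Real.exp (-2 * S.U t θ)
      + (-4 * pt (pt S.U) t θ + 16 * pt S.U t θ ^ 2) * (Real.exp (-4 * S.U t θ) * v.2.1 ^ 2)
      + 6 * (t⁻¹ ^ 4 * S.sv t θ v ^ 2) + 8 * (t⁻¹ ^ 3 * pt S.A t θ * (S.sv t θ v * v.2.1))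
      - 2 * (t⁻¹ ^ 2 * pt (pt S.A) t θ * (S.sv t θ v * v.2.1))
      + 2 * (t⁻¹ ^ 2 * pt S.A t θ ^ 2 * v.2.1 ^ 2)
  linear_combination (exp := 1) e5 - 1 / 2 * S.mx t θ v ^ 2 * m⁻¹ ^ 2 * e6

variable (S) in
/-- `√α` times the space derivative of `Nf` -/
def Nx (t θ : ℝ) (v : V3) : ℝ :=
  t⁻¹ ^ 3 * (S.a t θ * pθ S.K t θ - S.aA t θ * S.J t θ - S.A t θ * (S.a t θ * pθ S.J t θ)) * S.sv t θ v
    - t⁻¹ ^ 3 * (S.K t θ - S.A t θ * S.J t θ) * (S.aA t θ * v.2.1)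
    + t⁻¹ * Real.exp (-4 * S.U t θ) * (S.a t θ * pθ S.J t θ - 4 * S.aU t θ * S.J t θ) * v.2.1
theorem b_Nx : S.B5 S.Nx :=
  (((B5.of_bd ((Bd.time_inv.pow 3).mul ((bd_aK.sub (bd_aA'.mul bdJ)).sub (bdA.mul bd_aJ)))).mul b_sv).sub
    ((B5.of_bd ((Bd.time_inv.pow 3).mul bdKAJ)).mul ((B5.of_bd bd_aA').mul B5.v2))).add
    ((B5.of_bd ((Bd.time_inv.mul b_e4).mul (bd_aJ.sub (((Bd.const 4).mul bd_aU').mul bdJ)))).mul B5.v2)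

theorem Nf_dθ (ht : t ∈ Ioo S.tp S.ti) (θ : ℝ) (v : V3) :
    HasDerivAt (fun s => S.Nf t s v) (S.h t θ * S.Nx t θ v) θ := by
  have h1 := (((smK.dθ ht θ).sub ((smA.dθ ht θ).mul (smJ.dθ ht θ))).const_mul (t⁻¹ ^ 3)).mul (sv_dθ ht θ v)
  have h2 := (((((smU.dθ ht θ).const_mul (-4)).exp.const_mul t⁻¹).mul (smJ.dθ ht θ)).mul_const v.2.1)
  refine (h1.add h2).congr_deriv ?_
  have e6 := h_mul_a ht θ
  rw [Nx, aU, aA]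
  simp only [Pi.mul_apply, Pi.sub_apply]
  linear_combination (-(t⁻¹ ^ 3 * (pθ S.K t θ - pθ S.A t θ * S.J t θ - S.A t θ * pθ S.J t θ) * S.sv t θ v
    - t⁻¹ ^ 3 * (S.K t θ - S.A t θ * S.J t θ) * (pθ S.A t θ * v.2.1)
    + t⁻¹ * Real.exp (-4 * S.U t θ) * (pθ S.J t θ - 4 * pθ S.U t θ * S.J t θ) * v.2.1)) * e6

variable (S) in
/-- `√α` times the space derivative of `Mf` -/
def Mx (t θ : ℝ) (v : V3) : ℝ :=
  S.a t θ * Real.exp (S.ν t θ) * (S.B t θ * (S.Nf t θ v * (S.sm t θ v)⁻¹) + S.Nx t θ v * (S.sm t θ v)⁻¹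
    - 1 / 2 * (S.Nf t θ v * S.mx t θ v * ((S.sm t θ v)⁻¹ * (S.mu t θ v)⁻¹)))
theorem b_Mx : S.B5 S.Mx :=
  (B5.of_bd bd_aexpν).mul ((((B5.of_bd bdB).mul (b_Nf.mul b_sm_inv)).add (b_Nx.mul b_sm_inv)).sub
    ((B5.const _).mul ((b_Nf.mul b_mx).mul (b_sm_inv.mul b_mu_inv))))

theorem sm_inv_deriv {G : ℝ → ℝ} {c x : ℝ} (hG : HasDerivAt G c x) (h0 : 0 < G x) :
    HasDerivAt (fun s => (√(G s))⁻¹) (-(1 / 2 * c * ((√(G x))⁻¹ * (G x)⁻¹))) x := by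
  have hs := Real.sqrt_pos.2 h0
  refine ((hG.sqrt h0.ne').inv hs.ne').congr_deriv ?_
  have e := Real.sq_sqrt h0.le
  have e' : (G x)⁻¹ = (√(G x) ^ 2)⁻¹ := by rw [e]
  rw [e']
  field_simp

theorem Mf_dθ (ht : t ∈ Ioo S.tp S.ti) (θ : ℝ) (v : V3) :
    S.a t θ * pθ (fun t θ => S.Mf t θ v) t θ = S.Mx t θ v := by
  have h1 := ((sma.dθ ht θ).mul (smν.dθ ht θ).exp).mul
    ((Nf_dθ ht θ v).mul (sm_inv_deriv (mu_dθ ht θ v) (mu_pos t θ v)))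
  have h2 : pθ (fun t θ => S.Mf t θ v) t θ = _ := h1.deriv
  have e6 := h_mul_a ht θ
  rw [h2, Mx, B, ← pθ_a ht, pθ_a ht]
  simp only [Pi.mul_apply]
  rw [show √(S.mu t θ v) = S.sm t θ v from rfl]
  linear_combination (S.a t θ * Real.exp (S.ν t θ) * (S.Nx t θ v * (S.sm t θ v)⁻¹
    - 1 / 2 * (S.Nf t θ v * S.mx t θ v * ((S.sm t θ v)⁻¹ * (S.mu t θ v)⁻¹)))) * e6

end EV

/-! ### Momentum derivatives of the coefficients -/

namespace EV

variable {S : EV} {t θ : ℝ}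

variable (S) in
/-- the momentum derivative of `sv` -/
def svd (d : ℝ × ℝ) (t θ : ℝ) : ℝ := d.2 - S.A t θ * d.1
variable (S) in
/-- the momentum derivative of `mu` -/
def mud (d : ℝ × ℝ) (t θ : ℝ) (v : V3) : ℝ :=
  2 * (Real.exp (-4 * S.U t θ) * (v.2.1 * d.1)) + 2 * (t⁻¹ ^ 2 * (S.sv t θ v * S.svd d t θ))
variable (S) in
/-- the momentum derivative of `mt` -/
def mtd (d : ℝ × ℝ) (t θ : ℝ) (v : V3) : ℝ :=
  - 8 * pt S.U t θ * (Real.exp (-4 * S.U t θ) * (v.2.1 * d.1))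
    - 4 * (t⁻¹ ^ 3 * (S.sv t θ v * S.svd d t θ))
    - 2 * (t⁻¹ ^ 2 * pt S.A t θ * (S.svd d t θ * v.2.1 + S.sv t θ v * d.1))
variable (S) in
/-- the momentum derivative of `mx` -/
def mxd (d : ℝ × ℝ) (t θ : ℝ) (v : V3) : ℝ :=
  - 8 * S.aU t θ * (Real.exp (-4 * S.U t θ) * (v.2.1 * d.1))
    - 2 * (t⁻¹ ^ 2 * S.aA t θ * (S.svd d t θ * v.2.1 + S.sv t θ v * d.1))
variable (S) in
/-- the momentum derivative of `Ga` -/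
def Gad (d : ℝ × ℝ) (t θ : ℝ) (v : V3) : ℝ :=
  1 / 2 * (S.mtd d t θ v * (S.mu t θ v)⁻¹ - S.mt t θ v * (S.mud d t θ v * (S.mu t θ v)⁻¹ ^ 2))
variable (S) in
/-- the momentum derivative of `Al` -/
def Ald (d : ℝ × ℝ) (t θ : ℝ) (v : V3) : ℝ :=
  1 / 2 * (S.mxd d t θ v * (S.mu t θ v)⁻¹ - S.mx t θ v * (S.mud d t θ v * (S.mu t θ v)⁻¹ ^ 2))
variable (S) in
/-- the momentum derivative of `Nf` -/
def Nfd (d : ℝ × ℝ) (t θ : ℝ) : ℝ :=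
  t⁻¹ ^ 3 * (S.K t θ - S.A t θ * S.J t θ) * S.svd d t θ + t⁻¹ * Real.exp (-4 * S.U t θ) * S.J t θ * d.1
variable (S) in
/-- the momentum derivative of `Mf` -/
def Mfd (d : ℝ × ℝ) (t θ : ℝ) (v : V3) : ℝ :=
  S.a t θ * Real.exp (S.ν t θ) * (S.Nfd d t θ * (S.sm t θ v)⁻¹
    - 1 / 2 * (S.Nf t θ v * S.mud d t θ v * ((S.sm t θ v)⁻¹ * (S.mu t θ v)⁻¹)))

theorem b_svd (d : ℝ × ℝ) : S.Bd (S.svd d) := (Bd.const _).sub (bdA.mul (Bd.const _))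
theorem b_mud (d : ℝ × ℝ) : S.B5 (S.mud d) :=
  ((B5.const _).mul ((B5.of_bd b_e4).mul (B5.v2.mul (B5.const _)))).add
    ((B5.const _).mul ((B5.of_bd (Bd.time_inv.pow 2)).mul (b_sv.mul (B5.of_bd (b_svd d)))))
theorem b_mtd (d : ℝ × ℝ) : S.B5 (S.mtd d) :=
  (((B5.of_bd ((Bd.const _).mul bd_pt_U)).mul ((B5.of_bd b_e4).mul (B5.v2.mul (B5.const _)))).sub
    ((B5.const _).mul ((B5.of_bd (Bd.time_inv.pow 3)).mul (b_sv.mul (B5.of_bd (b_svd d)))))).sub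
    ((B5.const _).mul ((B5.of_bd ((Bd.time_inv.pow 2).mul bd_pt_A)).mul
      (((B5.of_bd (b_svd d)).mul B5.v2).add (b_sv.mul (B5.const _)))))
theorem b_mxd (d : ℝ × ℝ) : S.B5 (S.mxd d) :=
  ((B5.of_bd ((Bd.const _).mul bd_aU')).mul ((B5.of_bd b_e4).mul (B5.v2.mul (B5.const _)))).sub
    ((B5.const _).mul ((B5.of_bd ((Bd.time_inv.pow 2).mul bd_aA')).mul
      (((B5.of_bd (b_svd d)).mul B5.v2).add (b_sv.mul (B5.const _)))))
theorem b_Gad (d : ℝ × ℝ) : S.B5 (S.Gad d) :=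
  (B5.const _).mul (((b_mtd d).mul b_mu_inv).sub (b_mt.mul ((b_mud d).mul (b_mu_inv.pow 2))))
theorem b_Ald (d : ℝ × ℝ) : S.B5 (S.Ald d) :=
  (B5.const _).mul (((b_mxd d).mul b_mu_inv).sub (b_mx.mul ((b_mud d).mul (b_mu_inv.pow 2))))
theorem b_Nfd (d : ℝ × ℝ) : S.Bd (S.Nfd d) :=
  (((Bd.time_inv.pow 3).mul bdKAJ).mul (b_svd d)).add
    (((Bd.time_inv.mul b_e4).mul bdJ).mul (Bd.const _))
theorem b_Mfd (d : ℝ × ℝ) : S.B5 (S.Mfd d) :=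
  (B5.of_bd bd_aexpν).mul (((B5.of_bd (b_Nfd d)).mul b_sm_inv).sub
    ((B5.const _).mul ((b_Nf.mul (b_mud d)).mul (b_sm_inv.mul b_mu_inv))))

section
variable (t θ : ℝ) (v : V3) (d : ℝ × ℝ)

theorem v2_deriv : HasDerivAt (fun s : ℝ => (v + s • ((0, d) : V3)).2.1) d.1 0 := by
  have : HasDerivAt (fun s : ℝ => v.2.1 + s * d.1) d.1 0 := by
    simpa using ((hasDerivAt_id (0:ℝ)).mul_const d.1).const_add v.2.1
  simpa using this
theorem v3_deriv : HasDerivAt (fun s : ℝ => (v + s • ((0, d) : V3)).2.2) d.2 0 := by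
  have : HasDerivAt (fun s : ℝ => v.2.2 + s * d.2) d.2 0 := by
    simpa using ((hasDerivAt_id (0:ℝ)).mul_const d.2).const_add v.2.2
  simpa using this
theorem line_zero : v + (0:ℝ) • ((0, d) : V3) = v := by simp
theorem sv_dv : HasDerivAt (fun s : ℝ => S.sv t θ (v + s • ((0, d) : V3))) (S.svd d t θ) 0 :=
  (v3_deriv v d).sub ((v2_deriv v d).const_mul (S.A t θ))
theorem mu_dv : HasDerivAt (fun s : ℝ => S.mu t θ (v + s • ((0, d) : V3))) (S.mud d t θ v) 0 := by
  have h := ((((v2_deriv v d).pow 2).const_mul (Real.exp (-4 * S.U t θ))).const_add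
    (Real.exp (-2 * S.U t θ))).add (((sv_dv (S := S) t θ v d).pow 2).const_mul ((t ^ 2)⁻¹))
  refine h.congr_deriv ?_
  simp only [line_zero, mud, Nat.cast_ofNat, Nat.add_one_sub_one, pow_one, inv_pow]
  ring
theorem mt_dv : HasDerivAt (fun s : ℝ => S.mt t θ (v + s • ((0, d) : V3))) (S.mtd d t θ v) 0 := by
  have hs := sv_dv (S := S) t θ v d
  have h2 := v2_deriv v d
  have h := (((((h2.pow 2).const_mul (Real.exp (-4 * S.U t θ))).const_mul (4 * pt S.U t θ)).const_sub
    (-2 * pt S.U t θ * Real.exp (-2 * S.U t θ))).sub (((hs.pow 2).const_mul (t⁻¹ ^ 3)).const_mul 2)).sub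
    (((hs.mul h2).const_mul (t⁻¹ ^ 2 * pt S.A t θ)).const_mul 2)
  refine h.congr_deriv ?_
  simp only [line_zero, mtd, Nat.cast_ofNat, Nat.add_one_sub_one, pow_one]
  ring
theorem mx_dv : HasDerivAt (fun s : ℝ => S.mx t θ (v + s • ((0, d) : V3))) (S.mxd d t θ v) 0 := by
  have hs := sv_dv (S := S) t θ v d
  have h2 := v2_deriv v d
  have h := ((((h2.pow 2).const_mul (Real.exp (-4 * S.U t θ))).const_mul (4 * S.aU t θ)).const_sub
    (-2 * S.aU t θ * Real.exp (-2 * S.U t θ))).sub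
    (((hs.mul h2).const_mul (t⁻¹ ^ 2 * S.aA t θ)).const_mul 2)
  refine h.congr_deriv ?_
  simp only [line_zero, mxd, Nat.cast_ofNat, Nat.add_one_sub_one, pow_one]
  ring
theorem mu_inv_dv : HasDerivAt (fun s : ℝ => (S.mu t θ (v + s • ((0, d) : V3)))⁻¹)
    (-(S.mud d t θ v * (S.mu t θ v)⁻¹ ^ 2)) 0 := by
  refine ((mu_dv t θ v d).inv (mu_pos _ _ _).ne').congr_deriv ?_
  rw [line_zero]
  have := (mu_pos (S := S) t θ v).ne'
  field_simp
theorem Ga_dv : HasDerivAt (fun s : ℝ => S.Ga t θ (v + s • ((0, d) : V3))) (S.Gad d t θ v) 0 := by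
  refine ((((mt_dv t θ v d).mul (mu_inv_dv t θ v d)).const_mul (1/2)).const_add (pt S.ν t θ)).congr_deriv ?_
  simp only [line_zero, Gad]
  ring
theorem Al_dv : HasDerivAt (fun s : ℝ => S.Al t θ (v + s • ((0, d) : V3))) (S.Ald d t θ v) 0 := by
  refine ((((mx_dv t θ v d).mul (mu_inv_dv t θ v d)).const_mul (1/2)).const_add (S.B t θ)).congr_deriv ?_
  simp only [line_zero, Ald]
  ring
theorem Nf_dv : HasDerivAt (fun s : ℝ => S.Nf t θ (v + s • ((0, d) : V3))) (S.Nfd d t θ) 0 :=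
  ((sv_dv t θ v d).const_mul _).add ((v2_deriv v d).const_mul _)
theorem Mf_dv : HasDerivAt (fun s : ℝ => S.Mf t θ (v + s • ((0, d) : V3))) (S.Mfd d t θ v) 0 := by
  refine (((Nf_dv t θ v d).mul (sm_inv_deriv (mu_dv (S := S) t θ v d) (mu_pos _ _ _))).const_mul
    (S.a t θ * Real.exp (S.ν t θ))).congr_deriv ?_
  simp only [line_zero, Mfd]
  rw [show √(S.mu t θ v) = S.sm t θ v from rfl]
  ring
end

end EV

/-! ### The distribution function in the rapidity variable -/

theorem sm5_of_y {a b : ℝ} {F : ℝ → ℝ} (h : ContDiff ℝ (⊤ : ℕ∞) F) : Sm5 a b (fun x => F x.2.2.1) :=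
  Sm5.of_contDiff (h.comp (by fun_prop))

/-- hyperbolic secant -/
def sech (y : ℝ) : ℝ := (Real.cosh y)⁻¹
/-- hyperbolic tangent -/
def thy (y : ℝ) : ℝ := Real.sinh y * sech y

theorem sech_deriv (y : ℝ) : HasDerivAt sech (-(thy y * sech y)) y := by
  refine ((Real.hasDerivAt_cosh y).inv (Real.cosh_pos y).ne').congr_deriv ?_
  rw [thy, sech]
  have := (Real.cosh_pos y).ne'
  field_simp
theorem thy_deriv (y : ℝ) : HasDerivAt thy (sech y ^ 2) y := by
  refine ((Real.hasDerivAt_sinh y).mul (sech_deriv y)).congr_deriv ?_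
  have h := Real.cosh_sq y
  have := (Real.cosh_pos y).ne'
  rw [thy, sech]
  field_simp
  linear_combination h
theorem abs_sech_le (y : ℝ) : |sech y| ≤ 1 := by
  rw [sech, abs_of_pos (inv_pos.2 (Real.cosh_pos y))]
  exact inv_le_one_of_one_le₀ (Real.one_le_cosh y)
theorem abs_thy_le (y : ℝ) : |thy y| ≤ 1 := by
  have h : thy y ^ 2 + sech y ^ 2 = 1 := by
    have h := Real.cosh_sq y
    have := (Real.cosh_pos y).ne'
    rw [thy, sech]
    field_simp
    linear_combination -h
  rw [← sq_le_one_iff_abs_le_one]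
  nlinarith [sq_nonneg (sech y)]

namespace EV

variable {S : EV} {t θ : ℝ}

variable (S) in
/-- the momentum scale `e^ν √mu` -/
def ke (t θ : ℝ) (v : V3) : ℝ := Real.exp (S.ν t θ) * S.sm t θ v
theorem ke_pos (t θ : ℝ) (v : V3) : 0 < S.ke t θ v := mul_pos (Real.exp_pos _) (sm_pos _ _ _)
theorem ke_sq (t θ : ℝ) (v : V3) : S.ke t θ v ^ 2 = Real.exp (2 * S.ν t θ) * S.mu t θ v := by
  rw [ke, mul_pow, sm_sq, ← Real.exp_nat_mul]; norm_num
theorem sm5_ke : Sm5 S.tp S.ti (fun x => S.ke x.1 x.2.1 x.2.2) := smν.exp.sm5.mul sm5_sm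
theorem sqrt_deriv' {G : ℝ → ℝ} {c x : ℝ} (hG : HasDerivAt G c x) (h0 : 0 < G x) :
    HasDerivAt (fun s => √(G s)) (√(G x) * (1 / 2 * c * (G x)⁻¹)) x := by
  refine (hG.sqrt h0.ne').congr_deriv ?_
  have h1 := (Real.sqrt_pos.2 h0).ne'
  have e := Real.sq_sqrt h0.le
  have e' : (G x)⁻¹ = (√(G x) ^ 2)⁻¹ := by rw [e]
  rw [e']
  field_simp
theorem ke_dt (ht : t ∈ Ioo S.tp S.ti) (θ : ℝ) (v : V3) :
    pt (fun t θ => S.ke t θ v) t θ = S.ke t θ v * S.Ga t θ v := by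
  have h : pt (fun t θ => S.ke t θ v) t θ = _ :=
    ((smν.dt ht θ).exp.mul (sqrt_deriv' (mu_dt ht θ v) (mu_pos _ _ _))).deriv
  rw [h, ke, sm, Ga]; ring
theorem ke_dθ (ht : t ∈ Ioo S.tp S.ti) (θ : ℝ) (v : V3) :
    pθ (fun t θ => S.ke t θ v) t θ = S.ke t θ v * (S.h t θ * (S.Al t θ v - pθ S.a t θ)) := by
  have h : pθ (fun t θ => S.ke t θ v) t θ = _ :=
    ((smν.dθ ht θ).exp.mul (sqrt_deriv' (mu_dθ ht θ v) (mu_pos _ _ _))).deriv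
  rw [h, ke, sm, Al, B, pθ_a ht]
  linear_combination (-(Real.exp (S.ν t θ) * √(S.mu t θ v) * pθ S.ν t θ)) * h_mul_a ht θ
theorem ke_dv (t θ : ℝ) (v : V3) (d : ℝ × ℝ) :
    HasDerivAt (fun s : ℝ => S.ke t θ (v + s • ((0, d) : V3)))
      (S.ke t θ v * (1 / 2 * S.mud d t θ v * (S.mu t θ v)⁻¹)) 0 := by
  refine ((sqrt_deriv' (mu_dv (S := S) t θ v d) (mu_pos _ _ _)).const_mul (Real.exp (S.ν t θ))).congr_deriv ?_
  rw [line_zero, ke, sm]; ring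

variable (S) in
/-- the change of variables from rapidity to momentum -/
def rap (x : ℝ × ℝ × V3) : ℝ × ℝ × V3 :=
  (x.1, x.2.1, (S.ke x.1 x.2.1 x.2.2 * Real.sinh x.2.2.1, x.2.2.2))
variable (S) in
/-- the distribution function in the rapidity variable -/
def gr (x : ℝ × ℝ × V3) : ℝ := S.fu (S.rap x)

theorem sm5_rap1 : Sm5 S.tp S.ti (fun x => S.ke x.1 x.2.1 x.2.2 * Real.sinh x.2.2.1) :=
  sm5_ke.mul (sm5_of_y Real.contDiff_sinh)

theorem sm5_gr : Sm5 S.tp S.ti S.gr := by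
  have h1 : ContDiffOn ℝ (⊤ : ℕ∞) S.rap (Ioo S.tp S.ti ×ˢ (univ : Set (ℝ × V3))) := by
    refine ContDiffOn.prodMk (by fun_prop) (ContDiffOn.prodMk (by fun_prop) (ContDiffOn.prodMk ?_ (by fun_prop)))
    exact sm5_rap1
  exact ContDiffOn.comp (t := Ioo S.tp S.ti ×ˢ (univ : Set (ℝ × V3))) smf h1 fun x hx => ⟨hx.1, mem_univ _⟩

theorem gr_fderiv (ht : t ∈ Ioo S.tp S.ti) (θ : ℝ) (v : V3) (e : ℝ × ℝ × V3) :
    fderiv ℝ S.gr (t, θ, v) e = fderiv ℝ S.fu (S.rap (t, θ, v)) (e.1, e.2.1,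
      (fderiv ℝ (fun x : ℝ × ℝ × V3 => S.ke x.1 x.2.1 x.2.2) (t, θ, v) e * Real.sinh v.1
        + S.ke t θ v * (Real.cosh v.1 * e.2.2.1), e.2.2.2)) := by
  have hk := (sm5_ke (S := S)).line (x := (t, θ, v)) ht e
  have hy : HasDerivAt (fun s : ℝ => v.1 + s * e.2.2.1) e.2.2.1 0 := by
    simpa using ((hasDerivAt_id (0:ℝ)).mul_const e.2.2.1).const_add v.1
  have h1 : HasDerivAt (fun s : ℝ => S.ke (t + s * e.1) (θ + s * e.2.1) (v + s • e.2.2) * Real.sinh (v.1 + s * e.2.2.1))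
      (fderiv ℝ (fun x : ℝ × ℝ × V3 => S.ke x.1 x.2.1 x.2.2) (t, θ, v) e * Real.sinh v.1
        + S.ke t θ v * (Real.cosh v.1 * e.2.2.1)) 0 := by
    refine (hk.mul hy.sinh).congr_deriv ?_
    simp
  have aux : ∀ x y : ℝ, HasDerivAt (fun s : ℝ => x + s * y) y 0 := fun x y => by
    simpa using ((hasDerivAt_id (0:ℝ)).mul_const y).const_add x
  have h3 : HasDerivAt (fun s : ℝ => v.2 + s • e.2.2.2) e.2.2.2 0 := by
    simpa using ((hasDerivAt_id (0:ℝ)).smul_const e.2.2.2).const_add v.2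
  have h2 : HasDerivAt (fun s : ℝ => S.rap ((t, θ, v) + s • e)) (e.1, e.2.1,
      (fderiv ℝ (fun x : ℝ × ℝ × V3 => S.ke x.1 x.2.1 x.2.2) (t, θ, v) e * Real.sinh v.1
        + S.ke t θ v * (Real.cosh v.1 * e.2.2.1), e.2.2.2)) 0 :=
    (aux t e.1).prodMk ((aux θ e.2.1).prodMk (h1.prodMk h3))
  have h4 : HasFDerivAt S.fu (fderiv ℝ S.fu (S.rap (t, θ, v))) (S.rap ((t, θ, v) + (0:ℝ) • e)) := by
    rw [zero_smul, add_zero]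
    exact (smf (S := S)).diff ht
  exact sm5_gr.line_eq (x := (t, θ, v)) ht (h4.comp_hasDerivAt 0 h2)

theorem fu_split (x : ℝ × ℝ × V3) (a b c : ℝ) (d : ℝ × ℝ) :
    fderiv ℝ S.fu x (a, b, (c, d)) = a * fderiv ℝ S.fu x (1, 0) + b * fderiv ℝ S.fu x (0, 1, 0)
      + c * fderiv ℝ S.fu x (0, 0, 1, 0) + d.1 * fderiv ℝ S.fu x (0, 0, 0, 1, 0)
      + d.2 * fderiv ℝ S.fu x (0, 0, 0, 0, 1) := by
  have e : ((a, b, (c, d)) : ℝ × ℝ × V3) = a • (1, 0) + b • (0, 1, 0) + c • (0, 0, 1, 0)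
      + d.1 • (0, 0, 0, 1, 0) + d.2 • (0, 0, 0, 0, 1) := by
    simp
  rw [e]
  simp only [map_add, map_smul, smul_eq_mul]

theorem gr_dy (ht : t ∈ Ioo S.tp S.ti) (θ : ℝ) (v : V3) :
    fderiv ℝ S.gr (t, θ, v) (0, 0, 1, 0)
      = S.ke t θ v * Real.cosh v.1 * fderiv ℝ S.fu (S.rap (t, θ, v)) (0, 0, 1, 0) := by
  have h0 : fderiv ℝ (fun x : ℝ × ℝ × V3 => S.ke x.1 x.2.1 x.2.2) (t, θ, v) (0, 0, 1, 0) = 0 := by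
    refine sm5_dv sm5_ke ht θ v (1, 0) ?_
    have : (fun s : ℝ => S.ke t θ (v + s • ((1, 0) : V3))) = fun _ => S.ke t θ v := by
      funext s
      simp [ke, sm, mu]
    rw [this]; exact hasDerivAt_const _ _
  rw [gr_fderiv ht, h0, fu_split]
  simp
theorem gr_dθ (ht : t ∈ Ioo S.tp S.ti) (θ : ℝ) (v : V3) :
    fderiv ℝ S.gr (t, θ, v) (0, 1, 0) = fderiv ℝ S.fu (S.rap (t, θ, v)) (0, 1, 0)
      + S.ke t θ v * (S.h t θ * (S.Al t θ v - pθ S.a t θ)) * Real.sinh v.1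
        * fderiv ℝ S.fu (S.rap (t, θ, v)) (0, 0, 1, 0) := by
  rw [gr_fderiv ht, sm5_dθ sm5_ke ht, ke_dθ ht]
  rw [show ((0, 1, 0) : ℝ × ℝ × V3).2.2 = (0, (0, 0)) from rfl, fu_split]
  simp
theorem gr_dv (ht : t ∈ Ioo S.tp S.ti) (θ : ℝ) (v : V3) (d : ℝ × ℝ) :
    fderiv ℝ S.gr (t, θ, v) (0, 0, 0, d) = fderiv ℝ S.fu (S.rap (t, θ, v)) (0, 0, 0, d)
      + S.ke t θ v * (1 / 2 * S.mud d t θ v * (S.mu t θ v)⁻¹) * Real.sinh v.1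
        * fderiv ℝ S.fu (S.rap (t, θ, v)) (0, 0, 1, 0) := by
  rw [gr_fderiv ht, sm5_dv sm5_ke ht θ v (0, d) (ke_dv t θ v d), fu_split,
    show ((0, 0, 0, d) : ℝ × ℝ × V3) = (0, 0, ((0 : ℝ), d)) from rfl, fu_split (S := S) (S.rap (t, θ, v)) 0 0 0 d]
  simp; ring

theorem w_rap (ht : t ∈ Ioo S.tp S.ti) (θ : ℝ) (v : V3) :
    S.w t θ (S.ke t θ v * Real.sinh v.1, v.2) = S.a t θ * S.ke t θ v * Real.cosh v.1 := by
  have h1 := w_sq' (mem_Ioc ht) θ (S.ke t θ v * Real.sinh v.1, v.2)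
  have h2 : S.mu t θ (S.ke t θ v * Real.sinh v.1, v.2) = S.mu t θ v := rfl
  rw [h2, mul_assoc, ← ke_sq, ← a_sq ht] at h1
  have h3 := w_pos' (mem_Ioc ht) θ (S.ke t θ v * Real.sinh v.1, v.2)
  have h4 : 0 < S.a t θ * S.ke t θ v * Real.cosh v.1 :=
    mul_pos (mul_pos (apos ht θ) (ke_pos t θ v)) (Real.cosh_pos _)
  refine (sq_eq_sq₀ h3.le h4.le).1 ?_
  rw [h1]
  linear_combination (-(S.a t θ ^ 2 * S.ke t θ v ^ 2)) * Real.cosh_sq v.1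

variable (S) in
/-- the acceleration in the rapidity variable -/
def Yf (t θ : ℝ) (v : V3) : ℝ :=
  -S.Al t θ v - thy v.1 * S.Ga t θ v + S.Mf t θ v * sech v.1

theorem F1_eq (ht : t ∈ Ioo S.tp S.ti) (θ : ℝ) (v : V3) :
    S.F1 t θ (S.ke t θ v * Real.sinh v.1, v.2) = S.ke t θ v * S.Mf t θ v := by
  have h1 : Real.exp (2 * S.ν t θ) = Real.exp (S.ν t θ) ^ 2 := by rw [← Real.exp_nat_mul]; norm_num
  have h2 : Real.exp (2 * S.ν t θ - 4 * S.U t θ) = Real.exp (S.ν t θ) ^ 2 * Real.exp (-4 * S.U t θ) := by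
    rw [← h1, ← Real.exp_add]; ring_nf
  have h3 := (sm_pos (S := S) t θ v).ne'
  have h4 := (tpos ht).ne'
  rw [F1, ke, Mf, Nf, sv, h1, h2]
  field_simp

theorem gr_vlasov (ht : t ∈ Ioo S.tp S.ti) (θ : ℝ) (v : V3) :
    fderiv ℝ S.gr (t, θ, v) (1, 0, 0) + S.a t θ * thy v.1 * fderiv ℝ S.gr (t, θ, v) (0, 1, 0)
      + S.Yf t θ v * fderiv ℝ S.gr (t, θ, v) (0, 0, 1, 0) = 0 := by
  have ha := (apos ht θ).ne'
  have hk := (ke_pos (S := S) t θ v).ne'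
  have hc := (Real.cosh_pos v.1).ne'
  have h0 := fu_dir ht θ (S.ke t θ v * Real.sinh v.1, v.2)
  have e1 : S.a1 t θ (S.ke t θ v * Real.sinh v.1, v.2) = S.a t θ * thy v.1 := by
    rw [a1, w_rap ht, ← a_sq ht, thy, sech]
    field_simp
  have e2 : S.bF t θ (S.ke t θ v * Real.sinh v.1, v.2) = S.ke t θ v * S.Ga t θ v * Real.sinh v.1
      + S.a t θ * thy v.1 * (S.ke t θ v * (S.h t θ * (S.Al t θ v - pθ S.a t θ)) * Real.sinh v.1)
      + S.Yf t θ v * (S.ke t θ v * Real.cosh v.1) := by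
    have e3 : S.m2 (S.ke t θ v * Real.sinh v.1, v.2) = fun t θ => S.α t θ * S.ke t θ v ^ 2 := by
      funext t' θ'
      rw [m2, ke_sq, ← mul_assoc]; rfl
    have e4 : pθ (fun t θ => S.α t θ * S.ke t θ v ^ 2) t θ = _ :=
      ((smα.dθ ht θ).mul (((sm5_fix sm5_ke v).dθ ht θ).pow 2)).deriv
    have e5 : pθ S.α t θ = 2 * S.a t θ * pθ S.a t θ := by rw [pθ_a ht]; field_simp
    rw [bF, e3, e4, ke_dθ ht, F1_eq ht, w_rap ht, e5, ← a_sq ht, Yf, thy, sech, h]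
    simp only [Pi.pow_apply, Nat.cast_ofNat, Nat.add_one_sub_one, pow_one]
    field_simp
    linear_combination (S.Al t θ v) * Real.cosh_sq v.1
  rw [dir, e1, e2, fu_split] at h0
  have e6 : fderiv ℝ S.gr (t, θ, v) (1, 0, 0) = fderiv ℝ S.fu (S.rap (t, θ, v)) (1, 0)
      + S.ke t θ v * S.Ga t θ v * Real.sinh v.1 * fderiv ℝ S.fu (S.rap (t, θ, v)) (0, 0, 1, 0) := by
    rw [gr_fderiv ht, sm5_dt sm5_ke ht, ke_dt ht]
    rw [show ((1, 0, 0) : ℝ × ℝ × V3).2.2 = (0, (0, 0)) from rfl, fu_split]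
    simp
  rw [gr_dy ht, gr_dθ ht, e6]
  rw [show ((t, θ, S.ke t θ v * Real.sinh v.1, v.2) : ℝ × ℝ × V3) = S.rap (t, θ, v) from rfl] at h0
  linear_combination h0

end EV

/-! ### Transport equations for the derivatives of the distribution function -/

namespace EV

variable {S : EV} {t θ : ℝ}

variable (S) in
/-- the characteristic direction in the rapidity variable -/
def dT (t θ : ℝ) (v : V3) : ℝ × ℝ × V3 := (1, S.a t θ * thy v.1, (S.Yf t θ v, 0))
variable (S) in
/-- the derivative of `gr` in the direction `e` -/
def gd (e : ℝ × ℝ × V3) (x : ℝ × ℝ × V3) : ℝ := fderiv ℝ S.gr x e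

theorem sm5_gd (e : ℝ × ℝ × V3) : Sm5 S.tp S.ti (S.gd e) := sm5_gr.fderiv_apply e

theorem fd_split (Φ : ℝ × ℝ × V3 → ℝ) (x : ℝ × ℝ × V3) (a b c : ℝ) :
    fderiv ℝ Φ x (a, b, (c, 0)) = a * fderiv ℝ Φ x (1, 0, 0) + b * fderiv ℝ Φ x (0, 1, 0)
      + c * fderiv ℝ Φ x (0, 0, 1, 0) := by
  have e : ((a, b, (c, 0)) : ℝ × ℝ × V3) = a • (1, 0, 0) + b • (0, 1, 0) + c • (0, 0, 1, 0) := by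
    simp
  rw [e]
  simp only [map_add, map_smul, smul_eq_mul]

/-- differentiation of the Vlasov equation -/
theorem gd_dT (ht : t ∈ Ioo S.tp S.ti) (θ : ℝ) (v : V3) (e : ℝ × ℝ × V3) {C1 Y : ℝ}
    (hC1 : HasDerivAt (fun s : ℝ => S.a (t + s * e.1) (θ + s * e.2.1) * thy (v.1 + s * e.2.2.1)) C1 0)
    (hY : HasDerivAt (fun s : ℝ => S.Yf (t + s * e.1) (θ + s * e.2.1) (v + s • e.2.2)) Y 0) :
    fderiv ℝ (S.gd e) (t, θ, v) (S.dT t θ v)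
      = -(C1 * S.gd (0, 1, 0) (t, θ, v) + Y * S.gd (0, 0, 1, 0) (t, θ, v)) := by
  have hx : ((t, θ, v) : ℝ × ℝ × V3).1 ∈ Ioo S.tp S.ti := ht
  have l1 := (sm5_gd (S := S) (1, 0, 0)).line hx e
  have l2 := (sm5_gd (S := S) (0, 1, 0)).line hx e
  have l3 := (sm5_gd (S := S) (0, 0, 1, 0)).line hx e
  have hs := ((l1.add (hC1.mul l2)).add (hY.mul l3))
  have hev : ∀ᶠ s in nhds (0:ℝ), t + s * e.1 ∈ Ioo S.tp S.ti := by
    have : ContinuousAt (fun s : ℝ => t + s * e.1) 0 := by fun_prop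
    exact this.eventually (isOpen_Ioo.mem_nhds (by simpa using ht))
  have h0 := hs.congr_of_eventuallyEq (f₁ := fun _ => (0:ℝ)) (by
    filter_upwards [hev] with s hs'
    exact (gr_vlasov hs' (θ + s * e.2.1) (v + s • e.2.2)).symm)
  have h1 := h0.unique (hasDerivAt_const 0 0)
  simp only [zero_mul, add_zero, zero_smul] at h1
  have c1 : fderiv ℝ (S.gd (1, 0, 0)) (t, θ, v) e = fderiv ℝ (S.gd e) (t, θ, v) (1, 0, 0) := sm5_gr.comm hx _ _
  have c2 : fderiv ℝ (S.gd (0, 1, 0)) (t, θ, v) e = fderiv ℝ (S.gd e) (t, θ, v) (0, 1, 0) := sm5_gr.comm hx _ _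
  have c3 : fderiv ℝ (S.gd (0, 0, 1, 0)) (t, θ, v) e = fderiv ℝ (S.gd e) (t, θ, v) (0, 0, 1, 0) :=
    sm5_gr.comm hx _ _
  rw [dT, fd_split, ← c1, ← c2, ← c3]
  linear_combination h1

variable (S) in
/-- the `y`-derivative of `Mf sech y` -/
def Fy (t θ : ℝ) (v : V3) : ℝ := -(S.Mf t θ v * (thy v.1 * sech v.1))
variable (S) in
/-- the characteristic part of the `θ`-derivative -/
def Pg (x : ℝ × ℝ × V3) : ℝ :=
  S.a x.1 x.2.1 * S.gd (0, 1, 0) x - S.Ga x.1 x.2.1 x.2.2 * S.gd (0, 0, 1, 0) x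
variable (S) in
/-- the `y`-derivative -/
def Rg (x : ℝ × ℝ × V3) : ℝ := S.gd (0, 0, 1, 0) x

theorem sm5_Pg : Sm5 S.tp S.ti S.Pg := (sma.sm5.mul (sm5_gd _)).sub (sm5_Ga.mul (sm5_gd _))
theorem sm5_Rg : Sm5 S.tp S.ti S.Rg := sm5_gd _

theorem gdy_dT (ht : t ∈ Ioo S.tp S.ti) (θ : ℝ) (v : V3) :
    fderiv ℝ (S.gd (0, 0, 1, 0)) (t, θ, v) (S.dT t θ v)
      = -(S.a t θ * sech v.1 ^ 2 * S.gd (0, 1, 0) (t, θ, v)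
        + (-(S.Ga t θ v * sech v.1 ^ 2) + S.Fy t θ v) * S.gd (0, 0, 1, 0) (t, θ, v)) := by
  have hy : HasDerivAt (fun s : ℝ => v.1 + s * 1) 1 0 := by
    simpa using (hasDerivAt_id (0:ℝ)).const_add v.1
  have h1 : HasDerivAt (fun s : ℝ => thy (v.1 + s * 1)) (sech v.1 ^ 2) 0 := by
    have := HasDerivAt.comp (h₂ := thy) (h := fun s : ℝ => v.1 + s * 1) (0:ℝ) (thy_deriv _) hy
    refine this.congr_deriv (by simp)
  have h2 : HasDerivAt (fun s : ℝ => sech (v.1 + s * 1)) (-(thy v.1 * sech v.1)) 0 := by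
    have := HasDerivAt.comp (h₂ := sech) (h := fun s : ℝ => v.1 + s * 1) (0:ℝ) (sech_deriv _) hy
    refine this.congr_deriv (by simp)
  refine gd_dT ht θ v (0, 0, 1, 0) ?_ ?_
  · simpa using h1.const_mul (S.a t θ)
  · have h3 := ((h1.mul_const (S.Ga t θ v)).const_sub (-S.Al t θ v)).add (h2.const_mul (S.Mf t θ v))
    have e : (fun s : ℝ => S.Yf (t + s * 0) (θ + s * 0) (v + s • (1, 0))) = fun s =>
        -S.Al t θ v - thy (v.1 + s * 1) * S.Ga t θ v + S.Mf t θ v * sech (v.1 + s * 1) := by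
      funext s
      have e1 : (v + s • ((1, 0) : V3)) = (v.1 + s * 1, v.2) := by
        ext <;> simp
      rw [e1, mul_zero, add_zero, add_zero]
      rfl
    rw [e]
    refine h3.congr_deriv ?_
    rw [Fy]; ring

theorem gdθ_dT (ht : t ∈ Ioo S.tp S.ti) (θ : ℝ) (v : V3) :
    S.a t θ * fderiv ℝ (S.gd (0, 1, 0)) (t, θ, v) (S.dT t θ v)
      = -(S.a t θ * pθ S.a t θ * thy v.1 * S.gd (0, 1, 0) (t, θ, v)
        + (-(S.a t θ * pθ (fun t θ => S.Al t θ v) t θ) - S.a t θ * thy v.1 * pθ (fun t θ => S.Ga t θ v) t θ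
          + S.Mx t θ v * sech v.1) * S.gd (0, 0, 1, 0) (t, θ, v)) := by
  have hl : ∀ {G : ℝ → ℝ → ℝ}, Sm S.tp S.ti G →
      HasDerivAt (fun s : ℝ => G (t + s * 0) (θ + s * 1)) (pθ G t θ) 0 := fun {G} hG => by
    simpa using hG.sm5.line (x := (t, θ, v)) ht (0, 1, 0) |>.congr_deriv
      (sm5_dθ (G := fun t θ _ => G t θ) hG.sm5 ht θ v)
  rw [gd_dT ht θ v (0, 1, 0) (C1 := pθ S.a t θ * thy v.1) (Y := -pθ (fun t θ => S.Al t θ v) t θ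
    - thy v.1 * pθ (fun t θ => S.Ga t θ v) t θ + pθ (fun t θ => S.Mf t θ v) t θ * sech v.1), ← Mf_dθ ht]
  · ring
  · simpa using (hl sma).mul_const (thy v.1)
  · have h3 := ((hl (sm5_fix sm5_Al v)).neg.sub ((hl (sm5_fix sm5_Ga v)).const_mul (thy v.1))).add
      ((hl (sm5_fix sm5_Mf v)).mul_const (sech v.1))
    refine h3.congr_of_eventuallyEq (Filter.Eventually.of_forall fun s => ?_)
    show S.Yf (t + s * 0) (θ + s * 1) (v + s • ((0 : ℝ), (0 : ℝ × ℝ))) = _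
    have : v + s • ((0 : ℝ), (0 : ℝ × ℝ)) = v := by ext <;> simp
    rw [this]; rfl

theorem gdv_dT (ht : t ∈ Ioo S.tp S.ti) (θ : ℝ) (v : V3) (d : ℝ × ℝ) :
    fderiv ℝ (S.gd (0, 0, 0, d)) (t, θ, v) (S.dT t θ v)
      = -((-S.Ald d t θ v - thy v.1 * S.Gad d t θ v + S.Mfd d t θ v * sech v.1) * S.Rg (t, θ, v)) := by
  have e1 : ∀ s : ℝ, (v + s • ((0, d) : V3)).1 = v.1 := fun s => by simp
  rw [gd_dT ht θ v (0, 0, 0, d) (C1 := 0) (Y := -S.Ald d t θ v - thy v.1 * S.Gad d t θ v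
    + S.Mfd d t θ v * sech v.1), Rg]
  · ring
  · simpa using hasDerivAt_const (0:ℝ) (S.a t θ * thy v.1)
  · have h3 := ((Al_dv (S := S) t θ v d).neg.sub ((Ga_dv (S := S) t θ v d).const_mul (thy v.1))).add
      ((Mf_dv (S := S) t θ v d).mul_const (sech v.1))
    refine h3.congr_of_eventuallyEq (Filter.Eventually.of_forall fun s => ?_)
    show S.Yf (t + s * 0) (θ + s * 0) (v + s • ((0, d) : V3)) = _
    rw [mul_zero, add_zero, add_zero, Yf, e1]; rfl

theorem Rg_dT (ht : t ∈ Ioo S.tp S.ti) (θ : ℝ) (v : V3) :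
    fderiv ℝ S.Rg (t, θ, v) (S.dT t θ v)
      = -(sech v.1 ^ 2 * S.Pg (t, θ, v) + S.Fy t θ v * S.Rg (t, θ, v)) := by
  have := gdy_dT ht θ v
  rw [show S.Rg = S.gd (0, 0, 1, 0) from rfl, this, Pg]
  ring

theorem Pg_dT (ht : t ∈ Ioo S.tp S.ti) (θ : ℝ) (v : V3) :
    fderiv ℝ S.Pg (t, θ, v) (S.dT t θ v)
      = (-(S.q t θ / 2) + S.Ga t θ v * sech v.1 ^ 2) * S.Pg (t, θ, v)
        + (S.Wf t θ v - S.Mx t θ v * sech v.1 + S.Ga t θ v * S.Fy t θ v) * S.Rg (t, θ, v) := by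
  have hx : ((t, θ, v) : ℝ × ℝ × V3).1 ∈ Ioo S.tp S.ti := ht
  have l1 := (sma (S := S)).sm5.line hx (S.dT t θ v)
  have l2 := (sm5_gd (S := S) (0, 1, 0)).line hx (S.dT t θ v)
  have l3 := (sm5_Ga (S := S)).line hx (S.dT t θ v)
  have l4 := (sm5_gd (S := S) (0, 0, 1, 0)).line hx (S.dT t θ v)
  have h : fderiv ℝ S.Pg (t, θ, v) (S.dT t θ v) = _ :=
    sm5_Pg.line_eq hx ((l1.mul l2).sub (l3.mul l4))
  have ea : fderiv ℝ (fun x : ℝ × ℝ × V3 => S.a x.1 x.2.1) (t, θ, v) (S.dT t θ v)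
      = -(S.q t θ / 2) * S.a t θ + S.a t θ * thy v.1 * pθ S.a t θ := by
    have e0 : fderiv ℝ (fun x : ℝ × ℝ × V3 => S.a x.1 x.2.1) (t, θ, v) (0, 0, 1, 0) = 0 :=
      sm5_dv (G := fun t θ _ => S.a t θ) sma.sm5 ht θ v (1, 0) (hasDerivAt_const _ _)
    rw [dT, fd_split, e0, sm5_dt (G := fun t θ _ => S.a t θ) sma.sm5 ht θ v,
      sm5_dθ (G := fun t θ _ => S.a t θ) sma.sm5 ht θ v,
      show pt (fun t θ => S.a t θ) t θ = -(S.q t θ / 2) * S.a t θ from ?_]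
    · ring
    · rw [show (fun t θ => S.a t θ) = S.a from rfl, pt_a ht]; ring
  have eG : fderiv ℝ (fun x : ℝ × ℝ × V3 => S.Ga x.1 x.2.1 x.2.2) (t, θ, v) (S.dT t θ v)
      = pt (fun t θ => S.Ga t θ v) t θ + S.a t θ * thy v.1 * pθ (fun t θ => S.Ga t θ v) t θ := by
    have e0 : fderiv ℝ (fun x : ℝ × ℝ × V3 => S.Ga x.1 x.2.1 x.2.2) (t, θ, v) (0, 0, 1, 0) = 0 := by
      refine sm5_dv sm5_Ga ht θ v (1, 0) ?_
      have : (fun s : ℝ => S.Ga t θ (v + s • ((1, 0) : V3))) = fun _ => S.Ga t θ v := by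
        funext s
        simp [Ga, mt, mu, sv]
      rw [this]; exact hasDerivAt_const _ _
    rw [dT, fd_split, e0, sm5_dt sm5_Ga ht θ v, sm5_dθ sm5_Ga ht θ v]
    ring
  simp only [zero_smul, add_zero] at h
  rw [h, ea, eG, gdy_dT ht, Pg, Rg, ← Wf_eq ht]
  linear_combination gdθ_dT ht θ v
end EV

/-! ### Bounds on the derivatives of the distribution function -/

namespace EV

variable {S : EV} {t θ : ℝ}

theorem ke_lower : ∃ c, 0 < c ∧ ∀ t ∈ Ioc S.tp S.t0, ∀ θ v, c ≤ S.ke t θ v := by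
  obtain ⟨C, hC, h⟩ := ((bdν (S := S)).add bdU.neg).upper
  refine ⟨Real.exp (-C), Real.exp_pos _, fun t ht θ v => ?_⟩
  have h1 : Real.exp (-S.U t θ) ≤ S.sm t θ v := by
    refine Real.le_sqrt_of_sq_le ?_
    rw [mu, ← Real.exp_nat_mul]
    have : Real.exp ((2 : ℕ) * -S.U t θ) = Real.exp (-2 * S.U t θ) := by congr 1; push_cast; ring
    rw [this]
    have : 0 ≤ Real.exp (-4 * S.U t θ) * v.2.1 ^ 2 := by positivity
    have : 0 ≤ (t ^ 2)⁻¹ * (v.2.2 - S.A t θ * v.2.1) ^ 2 := by positivity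
    linarith
  calc Real.exp (-C) ≤ Real.exp (S.ν t θ + -S.U t θ) :=
        Real.exp_le_exp.2 (abs_le.1 (h t ht θ)).1
    _ = Real.exp (S.ν t θ) * Real.exp (-S.U t θ) := Real.exp_add _ _
    _ ≤ _ := mul_le_mul_of_nonneg_left h1 (Real.exp_pos _).le

theorem abs_le_abs_sinh (y : ℝ) : |y| ≤ |Real.sinh y| := by
  rw [Real.abs_sinh]
  exact Real.self_le_sinh_iff.2 (abs_nonneg y)

/-- the support of the distribution function is bounded in rapidity -/
theorem supp_gr : ∃ R, 1 ≤ R ∧ ∀ t ∈ Ioc S.tp S.t0, ∀ θ v, R < ‖v‖ → S.gr (t, θ, v) = 0 := by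
  obtain ⟨R, hR1, hR⟩ := supp_ball (S := S)
  obtain ⟨c, hc, hk⟩ := ke_lower (S := S)
  refine ⟨max R (R / c), le_max_of_le_left hR1, fun t ht θ v hv => ?_⟩
  refine hR t ht θ (S.ke t θ v * Real.sinh v.1, v.2) ?_
  rw [Prod.norm_def] at hv ⊢
  rcases lt_max_iff.1 hv with h | h
  · refine lt_max_of_lt_left ?_
    have h1 : R / c < |Real.sinh v.1| := (le_max_right _ _).trans_lt (h.trans_le (abs_le_abs_sinh _))
    rw [Real.norm_eq_abs, abs_mul, abs_of_pos (ke_pos _ _ _)]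
    rw [div_lt_iff₀ hc] at h1
    have := mul_le_mul_of_nonneg_left (hk t ht θ v) (abs_nonneg (Real.sinh v.1))
    linarith
  · exact lt_max_of_lt_right ((le_max_left _ _).trans_lt h)

theorem gr_per (x : ℝ × ℝ × V3) : S.gr (x + (0, 1, 0)) = S.gr x := by
  obtain ⟨t, θ, v⟩ := x
  have e : ((t, θ, v) : ℝ × ℝ × V3) + (0, 1, 0) = (t, θ + 1, v) := by simp
  rw [e]
  have hk : S.ke t (θ + 1) v = S.ke t θ v := by
    simp only [ke, sm, mu, perν t θ, perU t θ, perA t θ]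
  show S.f t (θ + 1) (S.ke t (θ + 1) v * Real.sinh v.1, v.2) = S.f t θ (S.ke t θ v * Real.sinh v.1, v.2)
  rw [hk, S.hfper]
theorem gd_per (e : ℝ × ℝ × V3) (v : V3) : Per (fun t θ => S.gd e (t, θ, v)) := fun t θ => by
  have h := fderiv_comp_add_right (𝕜 := ℝ) (f := S.gr) (x := (t, θ, v)) ((0, 1, 0) : ℝ × ℝ × V3)
  have e1 : (fun x => S.gr (x + (0, 1, 0))) = S.gr := funext gr_per
  have e2 : ((t, θ, v) : ℝ × ℝ × V3) + (0, 1, 0) = (t, θ + 1, v) := by simp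
  rw [e1, e2] at h
  simp only [gd, h]
theorem perGa (v : V3) : Per (fun t θ => S.Ga t θ v) := fun t θ => by
  simp only [Ga, mt, mu, sv, perU t θ, perA t θ, perν.pt t θ, perU.pt t θ, perA.pt t θ]

variable (S) in
/-- the sum of squares of the derivatives -/
def Eg (x : ℝ × ℝ × V3) : ℝ :=
  S.Pg x ^ 2 + S.Rg x ^ 2 + S.gd (0, 0, 0, 1, 0) x ^ 2 + S.gd (0, 0, 0, 0, 1) x ^ 2

theorem sm5_Eg : Sm5 S.tp S.ti S.Eg :=
  (((sm5_Pg.pow 2).add (sm5_Rg.pow 2)).add ((sm5_gd _).pow 2)).add ((sm5_gd _).pow 2)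
theorem perEg (v : V3) : Per (fun t θ => S.Eg (t, θ, v)) := fun t θ => by
  have h1 := fun e => gd_per (S := S) e v t θ
  simp only at h1
  simp only [Eg, Pg, Rg, h1, pera t θ, perGa (S := S) v t θ]
theorem Eg_nonneg (x : ℝ × ℝ × V3) : 0 ≤ S.Eg x := by rw [Eg]; positivity

theorem supp_Eg : ∃ R, 1 ≤ R ∧ ∀ t ∈ Ioo S.tp S.t0, ∀ θ v, R < ‖v‖ → S.Eg (t, θ, v) = 0 := by
  obtain ⟨R, hR1, hR⟩ := supp_gr (S := S)
  refine ⟨R, hR1, fun t ht θ v hv => ?_⟩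
  have h : ∀ e, S.gd e (t, θ, v) = 0 := fun e => by
    rw [gd, fderiv_zero_of_supp (t1 := S.tp) (b := S.t0) (R := R)
      (fun t ht => hR t ⟨ht.1, ht.2.le⟩) ht hv]
    rfl
  simp [Eg, Pg, Rg, h]

variable (S) in
/-- the derivative of `Eg` along characteristics -/
def EgT (x : ℝ × ℝ × V3) : ℝ := fderiv ℝ S.Eg x (S.dT x.1 x.2.1 x.2.2)

theorem B5.thy' : S.B5 (fun _ _ v => thy v.1) := fun R =>
  ⟨1, zero_le_one, fun t ht θ v _ => abs_thy_le _⟩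
theorem B5.sech' : S.B5 (fun _ _ v => sech v.1) := fun R =>
  ⟨1, zero_le_one, fun t ht θ v _ => abs_sech_le _⟩
theorem b_Fy : S.B5 S.Fy := (b_Mf.mul (B5.thy'.mul B5.sech')).neg

theorem abs_quad_le {C x y c : ℝ} (hc : |c| ≤ C) : |2 * (c * (x * y))| ≤ C * (x ^ 2 + y ^ 2) := by
  have h1 : |x * y| * 2 ≤ x ^ 2 + y ^ 2 := by
    rw [abs_mul, ← sq_abs x, ← sq_abs y]
    nlinarith [sq_nonneg (|x| - |y|)]
  rw [abs_mul, abs_mul, abs_two]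
  have h2 := mul_le_mul hc h1 (by positivity) ((abs_nonneg c).trans hc)
  linarith

theorem EgT_le (R : ℝ) : ∃ L, 0 < L ∧ ∀ t ∈ Ioc S.tp S.t0, ∀ θ v, ‖v‖ ≤ R →
    |S.EgT (t, θ, v)| ≤ L * S.Eg (t, θ, v) := by
  obtain ⟨C1, h10, h1⟩ := ((B5.of_bd ((bdq (S := S)).mul (Bd.const (1/2)))).neg.add (b_Ga.mul (B5.sech'.pow 2))) R
  obtain ⟨C2, h20, h2⟩ := ((b_Wf (S := S)).sub (b_Mx.mul B5.sech')|>.add (b_Ga.mul b_Fy)) R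
  obtain ⟨C4, h40, h4⟩ := b_Fy (S := S) R
  have h6 : ∀ d, S.B5 (fun t θ v => -S.Ald d t θ v - thy v.1 * S.Gad d t θ v + S.Mfd d t θ v * sech v.1) :=
    fun d => ((b_Ald d).neg.sub (B5.thy'.mul (b_Gad d))).add ((b_Mfd d).mul B5.sech')
  obtain ⟨C5, h50, h5⟩ := h6 (1, 0) R
  obtain ⟨C6, h60, h6⟩ := h6 (0, 1) R
  refine ⟨2 * C1 + C2 + 1 + 2 * C4 + C5 + C6 + 1, by positivity, fun t ht θ v hv => ?_⟩
  have ht' := mem_Ioo ht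
  have hx : ((t, θ, v) : ℝ × ℝ × V3).1 ∈ Ioo S.tp S.ti := ht'
  have l1 := ((sm5_Pg (S := S)).line hx (S.dT t θ v)).pow 2
  have l2 := ((sm5_Rg (S := S)).line hx (S.dT t θ v)).pow 2
  have l3 := ((sm5_gd (S := S) (0, 0, 0, 1, 0)).line hx (S.dT t θ v)).pow 2
  have l4 := ((sm5_gd (S := S) (0, 0, 0, 0, 1)).line hx (S.dT t θ v)).pow 2
  have h : S.EgT (t, θ, v) = _ := sm5_Eg.line_eq hx (((l1.add l2).add l3).add l4)
  simp only [zero_smul, add_zero, Nat.cast_ofNat, Nat.add_one_sub_one, pow_one] at h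
  have g3 := gdv_dT ht' θ v (1, 0)
  have g4 := gdv_dT ht' θ v (0, 1)
  rw [Pg_dT ht', Rg_dT ht', g3, g4] at h
  have k1 := h1 t ht θ v hv
  have k2 := h2 t ht θ v hv
  have k4 := h4 t ht θ v hv
  have k5 := h5 t ht θ v hv
  have k6 := h6 t ht θ v hv
  have k3 : |sech v.1 ^ 2| ≤ 1 := by
    rw [abs_pow]; exact pow_le_one₀ (abs_nonneg _) (abs_sech_le _)
  set c1 := -(S.q t θ * (1/2)) + S.Ga t θ v * sech v.1 ^ 2 with hc1
  set P := S.Pg (t, θ, v) with hP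
  set Rr := S.Rg (t, θ, v) with hRr
  set Q1 := S.gd (0, 0, 0, 1, 0) (t, θ, v) with hQ1
  set Q2 := S.gd (0, 0, 0, 0, 1) (t, θ, v) with hQ2
  have m1 := abs_le.1 (abs_quad_le (x := P) (y := P) k1)
  have m2 := abs_le.1 (abs_quad_le (x := P) (y := Rr) k2)
  have m3 := abs_le.1 (abs_quad_le (x := P) (y := Rr) k3)
  have m4 := abs_le.1 (abs_quad_le (x := Rr) (y := Rr) k4)
  have m5 := abs_le.1 (abs_quad_le (x := Q1) (y := Rr) k5)
  have m6 := abs_le.1 (abs_quad_le (x := Q2) (y := Rr) k6)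
  have hE : S.Eg (t, θ, v) = P ^ 2 + Rr ^ 2 + Q1 ^ 2 + Q2 ^ 2 := rfl
  have n1 := mul_nonneg h10 (sq_nonneg Rr)
  have n1' := mul_nonneg h10 (sq_nonneg Q1)
  have n1'' := mul_nonneg h10 (sq_nonneg Q2)
  have n2' := mul_nonneg h20 (sq_nonneg Q1)
  have n2'' := mul_nonneg h20 (sq_nonneg Q2)
  have n4 := mul_nonneg h40 (sq_nonneg P)
  have n4' := mul_nonneg h40 (sq_nonneg Q1)
  have n4'' := mul_nonneg h40 (sq_nonneg Q2)
  have n5 := mul_nonneg h50 (sq_nonneg P)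
  have n5'' := mul_nonneg h50 (sq_nonneg Q2)
  have n6 := mul_nonneg h60 (sq_nonneg P)
  have n6'' := mul_nonneg h60 (sq_nonneg Q1)
  have p1 := sq_nonneg P
  have p2 := sq_nonneg Rr
  have p3 := sq_nonneg Q1
  have p4 := sq_nonneg Q2
  rw [hE, h, abs_le]
  constructor <;> linarith

theorem Eg_bdd : ∃ C, 0 ≤ C ∧ ∀ t ∈ Ioo S.tp S.t0, ∀ θ v, S.Eg (t, θ, v) ≤ C := by
  obtain ⟨R, hR1, hR⟩ := supp_Eg (S := S)
  obtain ⟨L, hL0, hL⟩ := EgT_le (S := S) (R + 1)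
  have hcont : ∀ {D : Set (ℝ × ℝ × V3)}, (∀ x ∈ D, x.1 ∈ Ioo S.tp S.ti) → ContinuousOn S.Eg D :=
    fun h => sm5_Eg.continuousOn.mono fun x hx => ⟨h x hx, mem_univ _⟩
  have hend : ∃ M, 0 ≤ M ∧ ∀ θ v, ‖v‖ ≤ R + 1 → S.Eg (S.t0, θ, v) ≤ M := by
    have hc : IsCompact (({S.t0} : Set ℝ) ×ˢ Icc (0:ℝ) 1 ×ˢ Metric.closedBall (0 : V3) (R + 1)) :=
      isCompact_singleton.prod (isCompact_Icc.prod (isCompact_closedBall _ _))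
    obtain ⟨M, hM⟩ := hc.exists_bound_of_continuousOn (hcont fun x hx => by
      rw [show x.1 = S.t0 from hx.1]; exact t0_mem)
    refine ⟨max M 0, le_max_right _ _, fun θ v hv => ?_⟩
    have := hM (S.t0, Int.fract θ, v) ⟨rfl, fract_mem _, by simpa using hv⟩
    rw [show S.Eg (S.t0, Int.fract θ, v) = _ from (perEg (S := S) v).fract S.t0 θ] at this
    exact ((le_abs_self _).trans this).trans (le_max_left _ _)
  obtain ⟨M, hM0, hM⟩ := hend
  have key : ∀ t1, S.tp < t1 → t1 < S.t0 → ∀ p ∈ Icc t1 S.t0 ×ˢ (univ : Set ℝ) ×ˢ Metric.closedBall (0 : V3) (R + 1),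
      S.Eg p * Real.exp ((L + 1) * (p.1 - S.t0)) ≤ M := by
    intro t1 h1 h10
    have hD : ∀ x ∈ Icc t1 S.t0 ×ˢ Icc (0:ℝ) 1 ×ˢ Metric.closedBall (0 : V3) (R + 1), x.1 ∈ Ioo S.tp S.ti :=
      fun x hx => ⟨h1.trans_le hx.1.1, hx.1.2.trans_lt t0_lt_ti⟩
    refine max_principle (S' := Icc t1 S.t0 ×ˢ Icc (0:ℝ) 1 ×ˢ Metric.closedBall (0 : V3) (R + 1))
      (isCompact_Icc.prod (isCompact_Icc.prod (isCompact_closedBall _ _)))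
      (ψ := fun p : ℝ × ℝ × V3 => S.Eg p * Real.exp ((L + 1) * (p.1 - S.t0)))
      ((hcont hD).mul (by fun_prop)) ?_ ?_
    · rintro ⟨t, θ, v⟩ hp
      refine ⟨(t, Int.fract θ, v), ⟨hp.1, fract_mem _, hp.2.2⟩, ?_⟩
      show S.Eg (t, Int.fract θ, v) * _ = _
      rw [show S.Eg (t, Int.fract θ, v) = _ from (perEg (S := S) v).fract t θ]
    · rintro ⟨t, θ, v⟩ hp hψ
      have hti := hD _ hp
      simp only at hψ hti
      have hvle : ‖v‖ ≤ R + 1 := by simpa using hp.2.2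
      have hlt : t < S.t0 := by
        refine lt_of_le_of_ne hp.1.2 fun he => ?_
        rw [he, sub_self, mul_zero, Real.exp_zero, mul_one] at hψ
        exact absurd (hM θ v hvle) (not_le.2 hψ)
      have hE : 0 < S.Eg (t, θ, v) := by
        refine lt_of_le_of_ne (Eg_nonneg _) fun he => ?_
        rw [← he, zero_mul] at hψ
        linarith
      have hv : ‖v‖ ≤ R := by
        by_contra! hv
        exact hE.ne' (hR t ⟨hti.1, hlt⟩ θ v hv)
      have htc : t ∈ Ioc S.tp S.t0 := ⟨hti.1, hlt.le⟩
      have hexp : HasDerivAt (fun s : ℝ => Real.exp ((L + 1) * (t + s * 1 - S.t0)))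
          (Real.exp ((L + 1) * (t - S.t0)) * (L + 1)) 0 := by
        have h1 : HasDerivAt (fun s : ℝ => (L + 1) * (t + s * 1 - S.t0)) (L + 1) 0 := by
          simpa using ((((hasDerivAt_id (0:ℝ)).const_add t).sub_const S.t0).const_mul (L + 1))
        refine h1.exp.congr_deriv (by simp)
      refine ⟨fun s => (t, θ, v) + s • S.dT t θ v, (S.EgT (t, θ, v) + S.Eg (t, θ, v) * (L + 1))
        * Real.exp ((L + 1) * (t - S.t0)), ?_, by simp, ?_, ?_⟩
      · refine mul_pos ?_ (Real.exp_pos _)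
        have := (abs_le.1 (hL t htc θ v hvle)).1
        nlinarith
      · have c1 : ContinuousAt (fun s : ℝ => t + s * 1) 0 := by fun_prop
        have c2 : ContinuousAt (fun s : ℝ => ‖v + s • ((S.Yf t θ v, 0) : V3)‖) 0 := by fun_prop
        have e1 := c1.eventually (gt_mem_nhds (show t + 0 * 1 < S.t0 by simpa using hlt))
        have e2 := c2.eventually (gt_mem_nhds (show ‖v + (0:ℝ) • ((S.Yf t θ v, 0) : V3)‖ < R + 1 by
          rw [zero_smul, add_zero]; linarith))
        filter_upwards [nhdsWithin_le_nhds e1, nhdsWithin_le_nhds e2, self_mem_nhdsWithin] with s h1 h2 h3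
        have h3' : (0:ℝ) < s := h3
        refine ⟨⟨?_, ?_⟩, mem_univ _, ?_⟩
        · show t1 ≤ t + s * 1
          linarith [hp.1.1]
        · exact h1.le
        · rw [mem_closedBall_zero_iff]; exact h2.le
      · have l := (sm5_Eg (S := S)).line (x := (t, θ, v)) hti (S.dT t θ v)
        refine (l.mul hexp).congr_deriv ?_
        rw [EgT]
        simp only [zero_smul, add_zero, zero_mul]
        ring
  refine ⟨M * Real.exp ((L + 1) * (S.t0 - S.tp)), by positivity, fun t ht θ v => ?_⟩
  rcases le_or_gt ‖v‖ (R + 1) with hv | hv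
  · have h1 := key ((S.tp + t) / 2) (by linarith [ht.1]) (by linarith [ht.1, ht.2]) (t, θ, v)
      ⟨⟨by linarith [ht.1], ht.2.le⟩, mem_univ _, by simpa using hv⟩
    have h2 : S.Eg (t, θ, v) = S.Eg (t, θ, v) * Real.exp ((L + 1) * (t - S.t0))
        * Real.exp ((L + 1) * (S.t0 - t)) := by
      rw [mul_assoc, ← Real.exp_add]; ring_nf; simp
    rw [h2]
    refine mul_le_mul h1 (Real.exp_le_exp.2 ?_) (Real.exp_pos _).le hM0
    exact mul_le_mul_of_nonneg_left (by linarith [ht.1]) (by linarith)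
  · rw [hR t ht θ v (by linarith)]
    positivity

end EV

/-! ### Bounds in the momentum variables -/

namespace EV

variable {S : EV} {t θ : ℝ}

theorem pθ_la (ht : t ∈ Ioo S.tp S.ti) (θ : ℝ) : pθ S.la t θ = pθ S.α t θ / S.α t θ :=
  ((smα.dθ ht θ).log (αpos ht θ).ne').deriv

theorem h_pθ_a (ht : t ∈ Ioo S.tp S.ti) (θ : ℝ) : S.h t θ * pθ S.a t θ = pθ S.la t θ / 2 := by
  have ha := (apos ht θ).ne'
  rw [pθ_la ht, pθ_a ht, ← a_sq ht, h]
  field_simp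

variable (S) in
/-- the point with rapidity corresponding to a given momentum -/
def unrap (t θ : ℝ) (u : V3) : V3 := (Real.arsinh (u.1 / S.ke t θ u), u.2)

theorem rap_unrap (t θ : ℝ) (u : V3) : S.rap (t, θ, S.unrap t θ u) = (t, θ, u) := by
  have hk : S.ke t θ (S.unrap t θ u) = S.ke t θ u := rfl
  show ((t, θ, (S.ke t θ (S.unrap t θ u) * Real.sinh (Real.arsinh (u.1 / S.ke t θ u)), u.2)) : ℝ × ℝ × V3) = _
  rw [hk, Real.sinh_arsinh, mul_div_cancel₀ _ (ke_pos _ _ _).ne']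

theorem fu1_eq (ht : t ∈ Ioo S.tp S.ti) (θ : ℝ) (v : V3) :
    fderiv ℝ S.fu (S.rap (t, θ, v)) (0, 0, 1, 0) = (S.ke t θ v)⁻¹ * sech v.1 * S.Rg (t, θ, v) := by
  have hk := (ke_pos (S := S) t θ v).ne'
  have hc := (Real.cosh_pos v.1).ne'
  rw [Rg, gd, gr_dy ht, sech]
  field_simp

theorem fud_eq (ht : t ∈ Ioo S.tp S.ti) (θ : ℝ) (v : V3) (d : ℝ × ℝ) :
    fderiv ℝ S.fu (S.rap (t, θ, v)) (0, 0, 0, d) = S.gd (0, 0, 0, d) (t, θ, v)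
      - (1 / 2 * S.mud d t θ v * (S.mu t θ v)⁻¹) * thy v.1 * S.Rg (t, θ, v) := by
  have hk := (ke_pos (S := S) t θ v).ne'
  rw [gd, gr_dv ht, fu1_eq ht, thy]
  field_simp
  ring

theorem fuθ_eq (ht : t ∈ Ioo S.tp S.ti) (θ : ℝ) (v : V3) :
    fderiv ℝ S.fu (S.rap (t, θ, v)) (0, 1, 0) = S.h t θ * S.Pg (t, θ, v)
      + S.h t θ * (S.Ga t θ v - S.Al t θ v * thy v.1) * S.Rg (t, θ, v)
      + pθ S.la t θ / 2 * (thy v.1 * S.Rg (t, θ, v)) := by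
  have hk := mul_inv_cancel₀ (ke_pos (S := S) t θ v).ne'
  have e := gr_dθ ht θ v
  rw [fu1_eq ht, thy] at *
  rw [Pg]
  have e1' : S.gd (0, 0, 1, 0) (t, θ, v) = S.Rg (t, θ, v) := rfl
  have e1 : S.gd (0, 1, 0) (t, θ, v) = fderiv ℝ S.gr (t, θ, v) (0, 1, 0) := rfl
  simp only [e1, e1']
  rw [← h_pθ_a ht]
  have hh := h_mul_a ht θ
  linear_combination (-1 : ℝ) * e - fderiv ℝ S.gr (t, θ, v) (0, 1, 0) * hh
    - (S.h t θ * (S.Al t θ v - pθ S.a t θ)) * Real.sinh v.1 * sech v.1 * S.Rg (t, θ, v) * hk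

theorem fu_bdd : ∃ C, 0 ≤ C ∧ ∀ t ∈ Ioo S.tp S.t0, ∀ θ u,
    |fderiv ℝ S.fu (t, θ, u) (0, 0, 1, 0)| ≤ C ∧ |fderiv ℝ S.fu (t, θ, u) (0, 0, 0, 1, 0)| ≤ C ∧
    |fderiv ℝ S.fu (t, θ, u) (0, 0, 0, 0, 1)| ≤ C ∧
    |fderiv ℝ S.fu (t, θ, u) (0, 1, 0)| ≤ C * (1 + |pθ S.la t θ|) := by
  obtain ⟨R, hR1, hR⟩ := supp_Eg (S := S)
  obtain ⟨c, hc, hk⟩ := ke_lower (S := S)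
  obtain ⟨E, hE0, hE⟩ := Eg_bdd (S := S)
  have hm : ∀ d, S.B5 (fun t θ v => (1 / 2 * S.mud d t θ v * (S.mu t θ v)⁻¹) * thy v.1) := fun d =>
    (((B5.const (1/2)).mul (b_mud d)).mul b_mu_inv).mul B5.thy'
  obtain ⟨C2, h20, h2⟩ := hm (1, 0) R
  obtain ⟨C3, h30, h3⟩ := hm (0, 1) R
  obtain ⟨C4, h40, h4⟩ := (B5.of_bd (bdh (S := S))) R
  obtain ⟨C5, h50, h5⟩ := ((B5.of_bd (bdh (S := S))).mul (b_Ga.sub (b_Al.mul B5.thy'))) R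
  set s := E + 1 with hs
  have hs0 : 0 ≤ s := by linarith
  have hsq : ∀ x : ℝ, x ^ 2 ≤ E → |x| ≤ s := fun x hx => by
    refine abs_le_of_sq_le_sq ?_ hs0
    nlinarith
  refine ⟨c⁻¹ * s + s + C2 * s + C3 * s + C4 * s + C5 * s, by positivity, fun t ht θ u => ?_⟩
  have ht' : t ∈ Ioo S.tp S.ti := ⟨ht.1, ht.2.trans t0_lt_ti⟩
  have htc : t ∈ Ioc S.tp S.t0 := ⟨ht.1, ht.2.le⟩
  rw [← rap_unrap t θ u]
  set v := S.unrap t θ u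
  rw [fu1_eq ht', show ((0, 0, 0, 1, 0) : ℝ × ℝ × V3) = (0, 0, 0, ((1, 0) : ℝ × ℝ)) from rfl,
    show ((0, 0, 0, 0, 1) : ℝ × ℝ × V3) = (0, 0, 0, ((0, 1) : ℝ × ℝ)) from rfl, fud_eq ht', fud_eq ht', fuθ_eq ht']
  have hEe : S.Eg (t, θ, v) = S.Pg (t, θ, v) ^ 2 + S.Rg (t, θ, v) ^ 2
    + S.gd (0, 0, 0, 1, 0) (t, θ, v) ^ 2 + S.gd (0, 0, 0, 0, 1) (t, θ, v) ^ 2 := rfl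
  have hEv := hE t ht θ v
  have p1 := sq_nonneg (S.Pg (t, θ, v))
  have p2 := sq_nonneg (S.Rg (t, θ, v))
  have p3 := sq_nonneg (S.gd (0, 0, 0, 1, 0) (t, θ, v))
  have p4 := sq_nonneg (S.gd (0, 0, 0, 0, 1) (t, θ, v))
  have n1 : 0 ≤ c⁻¹ * s := by positivity
  have n2 : 0 ≤ C2 * s := by positivity
  have n3 : 0 ≤ C3 * s := by positivity
  have n4 : 0 ≤ C4 * s := by positivity
  have n5 : 0 ≤ C5 * s := by positivity
  rcases le_or_gt ‖v‖ R with hv | hv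
  · have b1 := hsq (S.Pg (t, θ, v)) (by linarith)
    have b2 := hsq (S.Rg (t, θ, v)) (by linarith)
    have b3 := hsq (S.gd (0, 0, 0, 1, 0) (t, θ, v)) (by linarith)
    have b4 := hsq (S.gd (0, 0, 0, 0, 1) (t, θ, v)) (by linarith)
    have mm : ∀ {x y X Y : ℝ}, |x| ≤ X → |y| ≤ Y → |x * y| ≤ X * Y := fun hx hy => by
      rw [abs_mul]; exact mul_le_mul hx hy (abs_nonneg _) ((abs_nonneg _).trans hx)
    have k0 : |(S.ke t θ v)⁻¹| ≤ c⁻¹ := by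
      rw [abs_of_pos (inv_pos.2 (ke_pos _ _ _))]
      exact inv_anti₀ hc (hk t htc θ v)
    have a1 := mm (mm k0 (abs_sech_le v.1)) b2
    have a2 := mm (h2 t htc θ v hv) b2
    have a3 := mm (h3 t htc θ v hv) b2
    have a4 := mm (h4 t htc θ v hv) b1
    have a5 := mm (h5 t htc θ v hv) b2
    have a6 := mm (abs_thy_le v.1) b2
    rw [mul_one] at a1
    rw [one_mul] at a6
    refine ⟨by linarith, ?_, ?_, ?_⟩
    · exact (abs_sub _ _).trans (by linarith)
    · exact (abs_sub _ _).trans (by linarith)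
    · have a7 : |pθ S.la t θ / 2 * (thy v.1 * S.Rg (t, θ, v))| ≤ |pθ S.la t θ| * s := by
        refine mm ?_ a6
        rw [abs_div, abs_two]
        have := abs_nonneg (pθ S.la t θ)
        linarith
      have a8 := (abs_add_three (S.h t θ * S.Pg (t, θ, v))
        (S.h t θ * (S.Ga t θ v - S.Al t θ v * thy v.1) * S.Rg (t, θ, v))
        (pθ S.la t θ / 2 * (thy v.1 * S.Rg (t, θ, v))))
      refine a8.trans ?_
      have a9 : 0 ≤ |pθ S.la t θ| * (c⁻¹ * s + C2 * s + C3 * s + C4 * s + C5 * s) := by positivity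
      linarith
  · have h0 := hR t ht θ v hv
    rw [hEe] at h0
    have b1 : S.Pg (t, θ, v) = 0 := pow_eq_zero_iff two_ne_zero |>.1 (by linarith)
    have b2 : S.Rg (t, θ, v) = 0 := pow_eq_zero_iff two_ne_zero |>.1 (by linarith)
    have b3 : S.gd (0, 0, 0, 1, 0) (t, θ, v) = 0 := pow_eq_zero_iff two_ne_zero |>.1 (by linarith)
    have b4 : S.gd (0, 0, 0, 0, 1) (t, θ, v) = 0 := pow_eq_zero_iff two_ne_zero |>.1 (by linarith)
    rw [b1, b2, b3, b4]
    simp only [mul_zero, add_zero, sub_zero, abs_zero]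
    have : 0 ≤ c⁻¹ * s + s + C2 * s + C3 * s + C4 * s + C5 * s := by linarith
    exact ⟨this, this, this, by positivity⟩

end EV

/-! ### The bound on the spatial derivative of `log α` -/

namespace EV

variable {S : EV} {t θ : ℝ}

variable (S) in
/-- smooth functions that are bounded together with their spatial derivatives -/
def Bt (G : ℝ → ℝ → ℝ) : Prop := Sm S.tp S.ti G ∧ S.Bd G ∧ S.Bd (pθ G)

theorem Bt.add {G H : ℝ → ℝ → ℝ} (hG : S.Bt G) (hH : S.Bt H) : S.Bt (fun t θ => G t θ + H t θ) :=
  ⟨hG.1.add hH.1, hG.2.1.add hH.2.1, (hG.2.2.add hH.2.2).congr fun t ht θ =>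
    ((hG.1.dθ (mem_Ioo ht) θ).add (hH.1.dθ (mem_Ioo ht) θ)).deriv⟩
theorem Bt.mul {G H : ℝ → ℝ → ℝ} (hG : S.Bt G) (hH : S.Bt H) : S.Bt (fun t θ => G t θ * H t θ) :=
  ⟨hG.1.mul hH.1, hG.2.1.mul hH.2.1, ((hG.2.2.mul hH.2.1).add (hG.2.1.mul hH.2.2)).congr fun t ht θ =>
    ((hG.1.dθ (mem_Ioo ht) θ).mul (hH.1.dθ (mem_Ioo ht) θ)).deriv⟩
theorem Bt.exp {G : ℝ → ℝ → ℝ} (hG : S.Bt G) : S.Bt (fun t θ => Real.exp (G t θ)) :=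
  ⟨hG.1.exp, hG.2.1.exp, (hG.2.1.exp.mul hG.2.2).congr fun t ht θ =>
    ((hG.1.dθ (mem_Ioo ht) θ).exp).deriv⟩
theorem Bt.of_time {c : ℝ → ℝ} (h : Sm S.tp S.ti (fun t _ => c t)) (hb : S.Bd (fun t _ => c t)) :
    S.Bt (fun t _ => c t) :=
  ⟨h, hb, (Bd.const 0).congr fun t ht θ => by simp [pθ]⟩
theorem Bt.const (c : ℝ) : S.Bt (fun _ _ => c) := Bt.of_time (Sm.const c) (Bd.const c)
theorem Bt.tinv : S.Bt (fun t _ => t⁻¹) :=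
  Bt.of_time (Sm.time.inv fun t ht θ => (tpos ht).ne') Bd.time_inv

theorem bd_of_a {G : ℝ → ℝ → ℝ} (h : S.Bd (fun t θ => S.a t θ * pθ G t θ)) : S.Bd (pθ G) :=
  (bdh.mul h).congr fun t ht θ => by linear_combination (-(pθ G t θ)) * h_mul_a (mem_Ioo ht) θ

theorem btU : S.Bt S.U := ⟨smU, bdU, bd_of_a bd_aU⟩
theorem btA : S.Bt S.A := ⟨smA, bdA, bd_of_a bd_aA⟩
theorem btJ : S.Bt S.J := ⟨smJ, bdJ, bd_of_a bd_aJ⟩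
theorem btK : S.Bt S.K := ⟨smK, bdK, bd_of_a bd_aK⟩
theorem btbe : S.Bt S.be :=
  ⟨smbe, bdν.add (bdla.mul (Bd.const (1/2))) |>.congr fun t ht θ => by rw [be, la]; ring,
    (bdh.mul bdB).congr fun t ht θ => pθ_be (mem_Ioo ht) θ⟩

theorem btp : ∃ G, S.Bt G ∧ ∀ t ∈ Ioo S.tp S.ti, ∀ θ, S.p t θ = G t θ := by
  have hk := btK.add ((Bt.const (-1)).mul (btA.mul (btJ (S := S))))
  refine ⟨_, (((Bt.const 2).mul btbe).exp.mul ((((Bt.const (-4)).mul btU).exp.mul (btJ.mul btJ)).mul Bt.tinv)).add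
    (((Bt.const 2).mul btbe).exp.mul ((hk.mul hk).mul (Bt.tinv.mul (Bt.tinv.mul Bt.tinv)))), fun t ht θ => ?_⟩
  have e1 : Real.exp (2 * S.be t θ) = S.α t θ * Real.exp (2 * S.ν t θ) := by
    rw [← exp_two_be ht, ← Real.exp_nat_mul]; norm_num
  have e2 : Real.exp (2 * S.ν t θ - 4 * S.U t θ) = Real.exp (2 * S.ν t θ) * Real.exp (-4 * S.U t θ) := by
    rw [← Real.exp_add]; ring_nf
  rw [p, e1, e2]
  have := (tpos ht).ne'
  field_simp
  ring

theorem bd_pθ_p : S.Bd (pθ S.p) := by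
  obtain ⟨G, hG, h⟩ := btp (S := S)
  exact hG.2.2.congr fun t ht θ => pθ_congr h (mem_Ioo ht) θ

variable (S) in
/-- the inverse energy -/
def wi (t θ : ℝ) (v : V3) : ℝ := (S.w t θ v)⁻¹

theorem Q_be (ht : t ∈ Ioo S.tp S.ti) (θ : ℝ) (v : V3) :
    S.Q t θ v = Real.exp (2 * S.be t θ) * S.mu t θ v + S.α t θ * v.1 ^ 2 := by
  have e1 : Real.exp (2 * S.be t θ) = S.α t θ * Real.exp (2 * S.ν t θ) := by
    rw [← exp_two_be ht, ← Real.exp_nat_mul]; norm_num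
  rw [Q, e1]; ring

theorem b_wi : S.B5 S.wi := by
  refine ((B5.const 1).add ((B5.of_bd ((Bd.const (-2)).mul btbe.2.1).exp).mul b_mu_inv)).le fun t ht θ v => ?_
  have ht' := mem_Ioo ht
  refine (abs_le_one_add_sq _).trans ((le_abs_self _).trans' ?_)
  have h1 : (S.wi t θ v) ^ 2 = (S.Q t θ v)⁻¹ := by
    rw [wi, inv_pow, w, Real.sq_sqrt (Q_pos' (mem_Ioc ht') θ v).le]
  rw [h1, Q_be ht']
  have hα := αpos ht' θ
  have hm := mu_pos (S := S) t θ v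
  have e : Real.exp (-2 * S.be t θ) = (Real.exp (2 * S.be t θ))⁻¹ := by rw [← Real.exp_neg]; ring_nf
  rw [e, ← mul_inv]
  have : (Real.exp (2 * S.be t θ) * S.mu t θ v + S.α t θ * v.1 ^ 2)⁻¹ ≤ (Real.exp (2 * S.be t θ) * S.mu t θ v)⁻¹ :=
    inv_anti₀ (by positivity) (by have : 0 ≤ S.α t θ * v.1 ^ 2 := by positivity
                                  linarith)
  linarith

variable (S) in
/-- the regular part of the spatial derivative of `Q` -/
def Qr (t θ : ℝ) (v : V3) : ℝ :=
  Real.exp (2 * S.be t θ) * (2 * pθ S.be t θ) * S.mu t θ v + Real.exp (2 * S.be t θ) * (S.h t θ * S.mx t θ v)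

theorem b_Qr : S.B5 S.Qr :=
  ((B5.of_bd (((Bd.const 2).mul btbe.2.1).exp.mul ((Bd.const 2).mul btbe.2.2))).mul b_mu).add
    ((B5.of_bd ((Bd.const 2).mul btbe.2.1).exp).mul ((B5.of_bd bdh).mul b_mx))

theorem Q_dθ (ht : t ∈ Ioo S.tp S.ti) (θ : ℝ) (v : V3) :
    HasDerivAt (fun x => S.Q t x v) (S.Qr t θ v + pθ S.la t θ * (S.α t θ * v.1 ^ 2)) θ := by
  have h1 := ((((smbe (S := S)).dθ ht θ).const_mul 2).exp.mul (mu_dθ ht θ v)).add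
    ((smα.dθ ht θ).mul_const (v.1 ^ 2))
  have e : (fun x => S.Q t x v) = fun x => Real.exp (2 * S.be t x) * S.mu t x v + S.α t x * v.1 ^ 2 :=
    funext fun x => Q_be ht x v
  rw [e]
  refine h1.congr_deriv ?_
  have := (αpos ht θ).ne'
  rw [Qr, pθ_la ht]
  field_simp

theorem wi_dθ (ht : t ∈ Ioo S.tp S.ti) (θ : ℝ) (v : V3) :
    HasDerivAt (fun x => S.wi t x v)
      (-(1 / 2 * S.wi t θ v ^ 3 * (S.Qr t θ v + pθ S.la t θ * (S.α t θ * v.1 ^ 2)))) θ := by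
  have hQ := Q_dθ ht θ v
  have h0 := Q_pos' (mem_Ioc ht) θ v
  have hw := (w_pos' (mem_Ioc ht) θ v).ne'
  refine ((hQ.sqrt h0.ne').inv hw).congr_deriv ?_
  rw [wi, show √(S.Q t θ v) = S.w t θ v from rfl]
  field_simp

variable (S) in
/-- the integrand of the matter part of `q` -/
def ir (x : ℝ × ℝ × V3) : ℝ := S.fu x * (S.mu x.1 x.2.1 x.2.2 * S.wi x.1 x.2.1 x.2.2)

theorem sm5_ir : Sm5 S.tp S.ti S.ir :=
  smf.mul (sm5_mu.mul (smw.inv fun x hx => (w_pos' (mem_Ioc hx) _ _).ne'))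

theorem ir_dθ (ht : t ∈ Ioo S.tp S.ti) (θ : ℝ) (v : V3) : fderiv ℝ S.ir (t, θ, v) (0, 1, 0)
    = fderiv ℝ S.fu (t, θ, v) (0, 1, 0) * (S.mu t θ v * S.wi t θ v)
      + S.f t θ v * (S.h t θ * S.mx t θ v * S.wi t θ v - 1 / 2 * S.wi t θ v ^ 3 * S.mu t θ v * S.Qr t θ v)
      + S.f t θ v * (pθ S.la t θ * (-(1 / 2 * S.wi t θ v ^ 3 * S.mu t θ v * (S.α t θ * v.1 ^ 2)))) := by
  have h1 : HasDerivAt (fun x => S.f t x v) (fderiv ℝ S.fu (t, θ, v) (0, 1, 0)) θ := by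
    have := (smf (S := S)).diff (x := (t, θ, v)) ht
    have hc : HasDerivAt (fun x : ℝ => ((t, x, v) : ℝ × ℝ × V3)) (0, 1, 0) θ :=
      (hasDerivAt_const θ t).prodMk ((hasDerivAt_id θ).prodMk (hasDerivAt_const θ v))
    exact HasFDerivAt.comp_hasDerivAt θ this hc
  have h2 := h1.mul ((mu_dθ ht θ v).mul (wi_dθ ht θ v))
  have h3 : HasDerivAt (fun x => S.ir (t, x, v)) (fderiv ℝ S.ir (t, θ, v) (0, 1, 0)) θ := by
    have := (sm5_ir (S := S)).diff (x := (t, θ, v)) ht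
    have hc : HasDerivAt (fun x : ℝ => ((t, x, v) : ℝ × ℝ × V3)) (0, 1, 0) θ :=
      (hasDerivAt_const θ t).prodMk ((hasDerivAt_id θ).prodMk (hasDerivAt_const θ v))
    exact HasFDerivAt.comp_hasDerivAt θ this hc
  rw [h3.unique h2]
  simp only [Pi.mul_apply]
  ring

end EV

namespace EV

variable {S : EV} {t θ : ℝ}

variable (S) in
/-- the integral of `ir` -/
def ri (t θ : ℝ) : ℝ := ∫ v : V3, S.ir (t, θ, v)

theorem r_eq (ht : t ∈ Ioo S.tp S.ti) (θ : ℝ) :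
    S.r t θ = Real.exp (2 * S.be t θ) * (S.a t θ * S.ri t θ) := by
  have e1 : Real.exp (2 * S.be t θ) = S.α t θ * Real.exp (2 * S.ν t θ) := by
    rw [← exp_two_be ht, ← Real.exp_nat_mul]; norm_num
  have e2 : S.ri t θ = ∫ v : V3, S.f t θ v * S.mu t θ v / S.w t θ v :=
    integral_congr_ae (Filter.Eventually.of_forall fun v => by
      show S.f t θ v * (S.mu t θ v * (S.w t θ v)⁻¹) = S.f t θ v * S.mu t θ v / S.w t θ v
      rw [div_eq_mul_inv, mul_assoc])
  rw [r, e1, e2]; ring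

theorem bdri : S.Bd S.ri := by
  obtain ⟨R, hR1, hR⟩ := supp_ball (S := S)
  obtain ⟨C, hC0, hC⟩ := (b_mu (S := S)).mul b_wi R
  refine bd_int (S := S) (g := fun t θ v => S.mu t θ v * S.wi t θ v) (C := C) fun t ht θ v hv => hC t ht θ v ?_
  by_contra! h
  exact hv (hR t ht θ v h)

theorem ri_dθ_le : ∃ C, 0 ≤ C ∧ ∀ t ∈ Ioo S.tp S.t0, ∀ θ, ∃ D, HasDerivAt (fun x => S.ri t x) D θ ∧
    |D| ≤ C * (1 + |pθ S.la t θ|) := by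
  obtain ⟨R, hR1, hR⟩ := supp_ball (S := S)
  obtain ⟨F, hF, hf⟩ := exists_max_f (S := S)
  obtain ⟨E, hE0, hE⟩ := fu_bdd (S := S)
  obtain ⟨C1, h10, h1⟩ := (b_mu (S := S)).mul b_wi R
  obtain ⟨C2, h20, h2⟩ := ((((B5.of_bd (bdh (S := S))).mul b_mx).mul b_wi).sub
    ((((B5.const (1 / 2)).mul (b_wi.pow 3)).mul b_mu).mul b_Qr)) R
  obtain ⟨C3, h30, h3⟩ := ((((B5.const (1 / 2)).mul ((b_wi (S := S)).pow 3)).mul b_mu).mul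
    ((B5.of_bd bdα).mul (B5.v1.pow 2))).neg R
  have hV : 0 ≤ volume.real (Metric.closedBall (0:V3) R) := measureReal_nonneg
  refine ⟨(E * C1 + F * C2 + F * C3) * volume.real (Metric.closedBall (0:V3) R), by positivity,
    fun t ht θ => ?_⟩
  have ht' : t ∈ Ioo S.tp S.ti := ⟨ht.1, ht.2.trans t0_lt_ti⟩
  have htc : t ∈ Ioc S.tp S.t0 := ⟨ht.1, ht.2.le⟩
  have hs : ∀ t ∈ Ioo S.tp S.t0, ∀ θ v, R < ‖v‖ → S.ir (t, θ, v) = 0 := fun t ht θ v hv => by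
    rw [ir, fu]
    simp only
    rw [hR t ⟨ht.1, ht.2.le⟩ θ v hv, zero_mul]
  have hsm : Sm5 S.tp S.t0 S.ir :=
    ContDiffOn.mono sm5_ir (prod_mono (Ioo_subset_Ioo_right t0_lt_ti.le) Subset.rfl)
  refine ⟨∫ v, fderiv ℝ S.ir (t, θ, v) (0, 1, 0), ?_, ?_⟩
  · have l := hsm.integral_line le_rfl hs ht θ 0 1
    have hsub : HasDerivAt (fun x : ℝ => x - θ) 1 θ := (hasDerivAt_id θ).sub_const θ
    have l' : HasDerivAt (fun s : ℝ => ∫ v, S.ir (t + s * 0, θ + s * 1, v))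
      (∫ v, fderiv ℝ S.ir (t, θ, v) (0, 1, 0)) (θ - θ) := by rw [sub_self]; exact l
    have l2 := HasDerivAt.comp (h₂ := fun s : ℝ => ∫ v, S.ir (t + s * 0, θ + s * 1, v))
      (h := fun x : ℝ => x - θ) θ l' hsub
    rw [mul_one] at l2
    refine l2.congr_of_eventuallyEq (Filter.Eventually.of_forall fun x => ?_)
    simp [ri]
  · have e : ∫ v, fderiv ℝ S.ir (t, θ, v) (0, 1, 0)
        = ∫ v in Metric.closedBall (0:V3) R, fderiv ℝ S.ir (t, θ, v) (0, 1, 0) := by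
      refine (setIntegral_eq_integral_of_forall_compl_eq_zero fun v hv => ?_).symm
      rw [fderiv_zero_of_supp hs ht (by simpa using hv)]; rfl
    rw [e, ← Real.norm_eq_abs, mul_right_comm]
    refine norm_setIntegral_le_of_norm_le_const measure_closedBall_lt_top fun v hv => ?_
    have hv' : ‖v‖ ≤ R := by simpa using hv
    rw [Real.norm_eq_abs, ir_dθ ht']
    have hl := abs_nonneg (pθ S.la t θ)
    set l := pθ S.la t θ with hl'
    have mm : ∀ {x y X Y : ℝ}, |x| ≤ X → |y| ≤ Y → |x * y| ≤ X * Y := fun hx hy => by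
      rw [abs_mul]; exact mul_le_mul hx hy (abs_nonneg _) ((abs_nonneg _).trans hx)
    have k0 : |S.f t θ v| ≤ F := by
      rw [abs_of_nonneg (S.hfnn t (mem_Ioc ht') θ v)]; exact hf t (mem_Ioc ht') θ v
    have k1 := mm (hE t ht θ v).2.2.2 (h1 t htc θ v hv')
    have k2 := mm k0 (h2 t htc θ v hv')
    have k3 := mm k0 (mm (le_refl |l|) (h3 t htc θ v hv'))
    refine (abs_add_three _ _ _).trans ((add_le_add (add_le_add k1 k2) k3).trans ?_)
    have n2 : 0 ≤ F * C2 * |l| := by positivity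
    have n3 : 0 ≤ F * C3 := by positivity
    linarith

theorem pθ_q_le : ∃ L, 0 ≤ L ∧ ∀ t ∈ Ioo S.tp S.t0, ∀ θ, |pθ S.q t θ| ≤ L * (1 + |pθ S.la t θ|) := by
  obtain ⟨C, hC0, hC⟩ := ri_dθ_le (S := S)
  have hX := ((Bt.const 2).mul (btbe (S := S))).exp
  obtain ⟨C0, h00, h0⟩ := bd_pθ_p (S := S)
  obtain ⟨C1, h10, h1⟩ := hX.2.2.mul (bda.mul bdri)
  obtain ⟨C2, h20, h2⟩ := hX.2.1.mul (bda.mul bdri)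
  obtain ⟨C3, h30, h3⟩ := hX.2.1.mul (bda (S := S))
  refine ⟨C0 + 2 * C1 + C2 + 2 * (C3 * C), by positivity, fun t ht θ => ?_⟩
  have ht' : t ∈ Ioo S.tp S.ti := ⟨ht.1, ht.2.trans t0_lt_ti⟩
  have htc : t ∈ Ioc S.tp S.t0 := ⟨ht.1, ht.2.le⟩
  obtain ⟨D, hD, hDl⟩ := hC t ht θ
  have e : (fun x => S.q t x) = fun x => S.p t x + 2 * (Real.exp (2 * S.be t x) * (S.a t x * S.ri t x)) :=
    funext fun x => by rw [q, r_eq ht']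
  have hd := (smp.dθ ht' θ).add (((hX.1.dθ ht' θ).mul ((sma.dθ ht' θ).mul hD)).const_mul 2)
  have hq : pθ S.q t θ = pθ S.p t θ + 2 * (pθ (fun t θ => Real.exp (2 * S.be t θ)) t θ * (S.a t θ * S.ri t θ))
      + pθ S.la t θ * (Real.exp (2 * S.be t θ) * (S.a t θ * S.ri t θ))
      + 2 * ((Real.exp (2 * S.be t θ) * S.a t θ) * D) := by
    have h5 : pθ S.q t θ = deriv (fun x => S.q t x) θ := rfl
    rw [h5, e]
    refine hd.deriv.trans ?_
    simp only [Pi.mul_apply]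
    have e6 : pθ S.a t θ = S.a t θ * (pθ S.la t θ / 2) := by
      rw [← h_pθ_a ht']; linear_combination (-(pθ S.a t θ)) * h_mul_a ht' θ
    rw [e6]; ring
  rw [hq]
  have hl := abs_nonneg (pθ S.la t θ)
  have mm : ∀ {x y X Y : ℝ}, |x| ≤ X → |y| ≤ Y → |x * y| ≤ X * Y := fun hx hy => by
    rw [abs_mul]; exact mul_le_mul hx hy (abs_nonneg _) ((abs_nonneg _).trans hx)
  have k1 := mm (abs_two (α := ℝ)).le (h1 t htc θ)
  have k2 := mm (le_refl |pθ S.la t θ|) (h2 t htc θ)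
  have k3 := mm (abs_two (α := ℝ)).le (mm (h3 t htc θ) hDl)
  refine (abs_add_le _ _).trans ((add_le_add ((abs_add_three _ _ _).trans
    (add_le_add (add_le_add (h0 t htc θ) k1) k2)) k3).trans ?_)
  have n0 : 0 ≤ C0 * |pθ S.la t θ| := by positivity
  have n1 : 0 ≤ C1 * |pθ S.la t θ| := by positivity
  linarith

variable (S) in
/-- a second time close to the singular time -/
def t00 : ℝ := (S.tp + S.t0) / 2
theorem tp_lt_t00 : S.tp < S.t00 := by
  have := tp_lt_t0 (S := S)
  rw [t00]; linarith
theorem t00_lt_t0 : S.t00 < S.t0 := by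
  have := tp_lt_t0 (S := S)
  rw [t00]; linarith

theorem pθ_la_bdd : ∃ C, 0 ≤ C ∧ ∀ t ∈ Ioc S.tp S.t00, ∀ θ, |pθ S.la t θ| ≤ C := by
  obtain ⟨L, hL0, hL⟩ := pθ_q_le (S := S)
  obtain ⟨M, hM0, hM⟩ := (smla (S := S)).pθ.bdd perla.pθ (c := S.t00) (d := S.t00) tp_lt_t00
    (t00_lt_t0.trans t0_lt_ti)
  set N := (1 + M ^ 2) * Real.exp (4 * L * S.t00) with hN
  refine ⟨N + 1, by positivity, fun t ht θ => ?_⟩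
  set l : ℝ → ℝ := fun s => pθ S.la s θ with hl
  have hmem : ∀ s ∈ Icc t S.t00, s ∈ Ioo S.tp S.t0 := fun s hs =>
    ⟨ht.1.trans_le hs.1, hs.2.trans_lt t00_lt_t0⟩
  have hd : ∀ s ∈ Icc t S.t00, HasDerivAt (fun s => (1 + l s ^ 2) * Real.exp (4 * L * s))
      ((2 * l s * -pθ S.q s θ + 4 * L * (1 + l s ^ 2)) * Real.exp (4 * L * s)) s := fun s hs => by
    have hs0 := hmem s hs
    have hs' : s ∈ Ioo S.tp S.ti := ⟨hs0.1, hs0.2.trans t0_lt_ti⟩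
    have h1 : HasDerivAt l (-pθ S.q s θ) s := by
      refine ((smla (S := S)).pθ.dt hs' θ).congr_deriv ?_
      rw [smla.comm hs', pθ_congr (fun t ht θ => pt_la ht θ) hs']
      exact ((smq.dθ hs' θ).neg).deriv
    have h2 : HasDerivAt (fun s : ℝ => 4 * L * s) (4 * L) s := by
      simpa using (hasDerivAt_id s).const_mul (4 * L)
    refine (((h1.pow 2).const_add 1).mul h2.exp).congr_deriv ?_
    simp only [Pi.pow_apply, Nat.cast_ofNat, Nat.add_one_sub_one, pow_one]
    ring
  have hmono : MonotoneOn (fun s => (1 + l s ^ 2) * Real.exp (4 * L * s)) (Icc t S.t00) := by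
    refine monotoneOn_of_deriv_nonneg (convex_Icc _ _) (fun s hs => (hd s hs).continuousAt.continuousWithinAt)
      (fun s hs => (hd s (interior_subset hs)).differentiableAt.differentiableWithinAt) fun s hs => ?_
    have hs' := interior_subset hs
    rw [(hd s hs').deriv]
    refine mul_nonneg ?_ (Real.exp_pos _).le
    have h1 := hL s (hmem s hs') θ
    have h2 : |2 * l s * -pθ S.q s θ| ≤ 2 * |l s| * (L * (1 + |l s|)) := by
      rw [abs_mul, abs_neg, abs_mul, abs_two]
      exact mul_le_mul_of_nonneg_left h1 (by positivity)
    have h3 : 2 * |l s| * (1 + |l s|) ≤ 4 * (1 + l s ^ 2) := by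
      rw [← sq_abs (l s)]; nlinarith [sq_nonneg (|l s| - 1)]
    have h4 := mul_le_mul_of_nonneg_left h3 hL0
    have h5 := (abs_le.1 h2).1
    linarith
  have h1 := hmono ⟨le_rfl, ht.2⟩ ⟨ht.2, le_rfl⟩ ht.2
  simp only at h1
  have h2 := hM S.t00 ⟨le_rfl, le_rfl⟩ θ
  have h3 : l S.t00 ^ 2 ≤ M ^ 2 := by rw [← sq_abs]; exact pow_le_pow_left₀ (abs_nonneg _) h2 2
  have h4 : (1 : ℝ) ≤ Real.exp (4 * L * t) := Real.one_le_exp (by have := S.htp.trans ht.1; positivity)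
  have h5 : (1 + l S.t00 ^ 2) * Real.exp (4 * L * S.t00) ≤ N :=
    mul_le_mul_of_nonneg_right (by linarith) (Real.exp_pos _).le
  have h6 : (1 + l t ^ 2) * 1 ≤ (1 + l t ^ 2) * Real.exp (4 * L * t) :=
    mul_le_mul_of_nonneg_left h4 (by positivity)
  have h7 := abs_le_one_add_sq (l t)
  show |l t| ≤ N + 1
  linarith

end EV

/-! ### The bounds for the first derivatives -/

namespace EV

open Filter Topology

variable {S : EV} {t θ : ℝ}

theorem b_a1 : S.B5 S.a1 :=
  (((B5.of_bd bdα).mul B5.v1).mul b_wi).congr fun t ht θ v => by rw [a1, wi, div_eq_mul_inv]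

theorem b_F1 : S.B5 S.F1 := by
  have he : S.Bd (fun t θ => Real.exp (2 * S.ν t θ)) := ((Bd.const 2).mul bdν).exp
  refine (((B5.of_bd ((bda.mul he).mul ((Bd.time_inv.pow 3).mul bdKAJ))).mul b_sv).add
    ((B5.of_bd (((bda.mul he).mul b_e4).mul (Bd.time_inv.mul bdJ))).mul B5.v2)).congr fun t ht θ v => ?_
  have e2 : Real.exp (2 * S.ν t θ - 4 * S.U t θ) = Real.exp (2 * S.ν t θ) * Real.exp (-4 * S.U t θ) := by
    rw [← Real.exp_add]; ring_nf
  have := (tpos (mem_Ioo ht)).ne'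
  rw [F1, e2, sv]
  field_simp

theorem bF_eq (ht : t ∈ Ioo S.tp S.ti) (θ : ℝ) (v : V3) :
    S.bF t θ v = S.F1 t θ v
      - 1 / 2 * S.wi t θ v * (S.Qr t θ v + pθ S.la t θ * (S.α t θ * v.1 ^ 2)) := by
  have h1 : HasDerivAt (fun x => S.Q t x v) (pθ S.α t θ * v.1 ^ 2 + pθ (S.m2 v) t θ) θ := by
    rw [show (fun x => S.Q t x v) = fun x => S.α t x * v.1 ^ 2 + S.m2 v t x from
      funext fun x => Q_eq t x v]
    exact ((smα.dθ ht θ).mul_const _).add ((smm2 v).dθ ht θ)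
  have hw := (w_pos' (mem_Ioc ht) θ v).ne'
  rw [bF, h1.unique (Q_dθ ht θ v), wi]
  field_simp
  ring

theorem bF_bdd (R : ℝ) : ∃ C, 0 ≤ C ∧ ∀ t ∈ Ioc S.tp S.t00, ∀ θ v, ‖v‖ ≤ R → |S.bF t θ v| ≤ C := by
  obtain ⟨L, hL0, hL⟩ := pθ_la_bdd (S := S)
  obtain ⟨C1, h10, h1⟩ := (b_F1.sub (((B5.const (1 / 2)).mul b_wi).mul (b_Qr (S := S)))) R
  obtain ⟨C2, h20, h2⟩ :=
    (((B5.const (1 / 2)).mul b_wi).mul ((B5.of_bd (bdα (S := S))).mul (B5.v1.pow 2))) R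
  refine ⟨C1 + L * C2, by positivity, fun t ht θ v hv => ?_⟩
  have ht0 : t ∈ Ioc S.tp S.t0 := ⟨ht.1, ht.2.trans t00_lt_t0.le⟩
  have e : S.bF t θ v = (S.F1 t θ v - 1 / 2 * S.wi t θ v * S.Qr t θ v)
      - pθ S.la t θ * (1 / 2 * S.wi t θ v * (S.α t θ * v.1 ^ 2)) := by
    rw [bF_eq (mem_Ioo ht0)]; ring
  rw [e]
  refine (abs_sub _ _).trans (add_le_add (h1 t ht0 θ v hv) ?_)
  rw [abs_mul]
  exact mul_le_mul (hL t ht θ) (h2 t ht0 θ v hv) (abs_nonneg _) hL0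

/-- the bounds near the singular time -/
theorem derivs_bdd_near : ∃ C, ∀ t ∈ Ioc S.tp S.t00, ∀ θ v,
    |ptf S.f t θ v| ≤ C ∧ |pθf S.f t θ v| ≤ C ∧ |pv1 (S.f t θ) v| ≤ C ∧
    |pv2 (S.f t θ) v| ≤ C ∧ |pv3 (S.f t θ) v| ≤ C ∧ |pθ S.α t θ| ≤ C := by
  obtain ⟨D, hD0, hD⟩ := fu_bdd (S := S)
  obtain ⟨L, hL0, hL⟩ := pθ_la_bdd (S := S)
  obtain ⟨R, hR1, hR⟩ := supp_ball (S := S)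
  obtain ⟨C1, h10, h1⟩ := b_a1 (S := S) R
  obtain ⟨C2, h20, h2⟩ := bF_bdd (S := S) R
  obtain ⟨C3, h30, h3⟩ := B5.of_bd (bdα (S := S)) 0
  set N := C1 * (D * (1 + L)) + C2 * D with hN
  have hN0 : 0 ≤ N := by positivity
  refine ⟨N + D * (1 + L) + D + C3 * L, fun t ht θ v => ?_⟩
  have ht0 : t ∈ Ioo S.tp S.t0 := ⟨ht.1, ht.2.trans_lt t00_lt_t0⟩
  have ht' : t ∈ Ioo S.tp S.ti := ⟨ht.1, ht0.2.trans t0_lt_ti⟩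
  obtain ⟨d1, d2, d3, dθ⟩ := hD t ht0 θ v
  have dθ' := dθ.trans (mul_le_mul_of_nonneg_left (add_le_add_right (hL t ht θ) 1) hD0)
  have hα : |pθ S.α t θ| ≤ C3 * L := by
    have e : pθ S.α t θ = S.α t θ * pθ S.la t θ := by
      have := (αpos ht' θ).ne'
      rw [pθ_la ht']; field_simp
    rw [e, abs_mul]
    exact mul_le_mul (h3 t (Ioo_subset_Ioc_self ht0) θ 0 (by simp)) (hL t ht θ) (abs_nonneg _) h30
  have hT : |ptf S.f t θ v| ≤ N := by
    by_cases hv : ‖v‖ ≤ R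
    · rw [vlasov ht', fu_dθ ht', fu_d1 ht']
      refine (abs_sub _ _).trans (add_le_add ?_ ?_)
      · rw [abs_mul, abs_neg]
        exact mul_le_mul (h1 t (Ioo_subset_Ioc_self ht0) θ v hv) dθ' (abs_nonneg _) h10
      · rw [abs_mul]
        exact mul_le_mul (h2 t ht θ v hv) d1 (abs_nonneg _) h20
    · rw [fu_dt ht', fderiv_zero_of_supp (fun s hs x u hu => hR s (Ioo_subset_Ioc_self hs) x u hu)
        ht0 (not_le.1 hv)]
      simpa using hN0
  rw [fu_dθ ht', fu_d1 ht', fu_d2 ht', fu_d3 ht']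
  have h4 : 0 ≤ D * (1 + L) := by positivity
  have h5 : 0 ≤ C3 * L := by positivity
  exact ⟨by linarith, by linarith, by linarith, by linarith, by linarith, by linarith⟩

/-- the one-sided Fréchet derivative of the distribution function -/
def fW (S : EV) (x : ℝ × ℝ × V3) : ℝ × ℝ × V3 →L[ℝ] ℝ :=
  fderivWithin ℝ S.fu (Ioc S.tp S.ti ×ˢ univ) x

theorem fW_has (ht : t ∈ Ioc S.tp S.ti) (θ : ℝ) (v : V3) :
    HasFDerivWithinAt S.fu (S.fW (t, θ, v)) (Ioc S.tp S.ti ×ˢ univ) (t, θ, v) :=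
  ((S.hfsm.differentiableOn (by simp)) (t, θ, v) ⟨ht, mem_univ _⟩).hasFDerivWithinAt

theorem fW_bdd (R : ℝ) : ∃ C, 0 ≤ C ∧ ∀ t ∈ Icc S.t00 S.ti, ∀ θ ∈ Icc (0:ℝ) 1, ∀ v, ‖v‖ ≤ R →
    ‖S.fW (t, θ, v)‖ ≤ C := by
  have hu : UniqueDiffOn ℝ (Ioc S.tp S.ti ×ˢ (univ : Set (ℝ × V3))) :=
    (uniqueDiffOn_Ioc S.tp S.ti).prod uniqueDiffOn_univ
  have hK : IsCompact (Icc S.t00 S.ti ×ˢ (Icc (0:ℝ) 1 ×ˢ Metric.closedBall (0 : V3) R)) :=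
    isCompact_Icc.prod (isCompact_Icc.prod (isCompact_closedBall _ _))
  have hc : ContinuousOn S.fW (Ioc S.tp S.ti ×ˢ univ) :=
    S.hfsm.continuousOn_fderivWithin hu (by simp)
  obtain ⟨C, hC⟩ := hK.exists_bound_of_continuousOn (f := S.fW)
    (hc.mono fun x hx => ⟨⟨tp_lt_t00.trans_le hx.1.1, hx.1.2⟩, mem_univ _⟩)
  exact ⟨max C 0, le_max_right _ _, fun t ht θ hθ v hv =>
    (hC (t, θ, v) ⟨ht, hθ, by simpa using hv⟩).trans (le_max_left _ _)⟩

theorem fW_line (ht : t ∈ Ioc S.tp S.ti) (θ : ℝ) (v : V3) (d : ℝ × V3) :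
    HasDerivAt (fun s : ℝ => S.f t (θ + s * d.1)
      (v.1 + s * d.2.1, v.2.1 + s * d.2.2.1, v.2.2 + s * d.2.2.2)) (S.fW (t, θ, v) (0, d)) 0 := by
  have aux : ∀ x y : ℝ, HasDerivAt (fun s : ℝ => x + s * y) y 0 := fun x y => by
    simpa using ((hasDerivAt_id (0:ℝ)).mul_const y).const_add x
  have h1 : HasDerivAt (fun s : ℝ => ((t, θ + s * d.1,
      (v.1 + s * d.2.1, v.2.1 + s * d.2.2.1, v.2.2 + s * d.2.2.2)) : ℝ × ℝ × V3)) (0, d) 0 :=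
    (hasDerivAt_const _ _).prodMk ((aux _ _).prodMk ((aux _ _).prodMk ((aux _ _).prodMk (aux _ _))))
  have h2 : HasFDerivWithinAt S.fu (S.fW (t, θ, v)) (Ioc S.tp S.ti ×ˢ univ) ((fun s : ℝ => ((t, θ + s * d.1,
      (v.1 + s * d.2.1, v.2.1 + s * d.2.2.1, v.2.2 + s * d.2.2.2)) : ℝ × ℝ × V3)) 0) := by
    simpa using fW_has ht θ v
  exact h2.comp_hasDerivAt (0:ℝ) h1 (Eventually.of_forall fun s => mk_mem_prod ht (mem_univ _))

theorem abs_ptf_le (ht : t ∈ Ioc S.tp S.ti) (θ : ℝ) (v : V3) : |ptf S.f t θ v| ≤ ‖S.fW (t, θ, v)‖ := by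
  by_cases h : DifferentiableAt ℝ (fun s => S.f s θ v) t
  · have h1 : HasDerivWithinAt (fun s : ℝ => ((s, θ, v) : ℝ × ℝ × V3)) (1, 0) (Ioc S.tp S.ti) t :=
      ((hasDerivAt_id t).prodMk (hasDerivAt_const t (θ, v))).hasDerivWithinAt
    have h2 : HasDerivWithinAt (fun s => S.f s θ v) (S.fW (t, θ, v) (1, 0)) (Ioc S.tp S.ti) t :=
      (fW_has ht θ v).comp_hasDerivWithinAt (f := fun s : ℝ => ((s, θ, v) : ℝ × ℝ × V3)) t h1 fun s hs => mk_mem_prod hs (mem_univ _)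
    have e : ptf S.f t θ v = S.fW (t, θ, v) (1, 0) :=
      (uniqueDiffOn_Ioc S.tp S.ti t ht).eq_deriv _ h.hasDerivAt.hasDerivWithinAt h2
    rw [e, ← Real.norm_eq_abs]
    refine ((S.fW (t, θ, v)).le_opNorm _).trans ?_
    simp
  · rw [ptf, deriv_zero_of_not_differentiableAt h]
    simp

theorem abs_fW_le (x : ℝ × ℝ × V3) (d : ℝ × ℝ × V3) (hd : ‖d‖ ≤ 1) : |S.fW x d| ≤ ‖S.fW x‖ := by
  rw [← Real.norm_eq_abs]
  exact ((S.fW x).le_opNorm d).trans (mul_le_of_le_one_right (norm_nonneg _) hd)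

theorem fract_f (t θ : ℝ) (v : V3) : S.f t (Int.fract θ) v = S.f t θ v :=
  (show Per (fun t θ => S.f t θ v) from fun t θ => S.hfper t θ v).fract t θ

theorem fract_pθf (t θ : ℝ) (v : V3) : pθf S.f t (Int.fract θ) v = pθf S.f t θ v :=
  (show Per (fun t θ => S.f t θ v) from fun t θ => S.hfper t θ v).pθ.fract t θ

theorem fW_zero_of_supp {R t1 : ℝ} (h1 : S.tp < t1) (hR : ∀ t ∈ Icc t1 S.ti, ∀ θ v, R < ‖v‖ → S.f t θ v = 0)
    (ht : t ∈ Ioc t1 S.ti) (θ : ℝ) {v : V3} (hv : R < ‖v‖) : S.fW (t, θ, v) = 0 := by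
  have h2 : S.fu =ᶠ[𝓝[Ioc S.tp S.ti ×ˢ univ] (t, θ, v)] fun _ => 0 := by
    have o : IsOpen {x : ℝ × ℝ × V3 | t1 < x.1 ∧ R < ‖x.2.2‖} :=
      (isOpen_lt continuous_const continuous_fst).inter
        (isOpen_lt continuous_const (show Continuous fun x : ℝ × ℝ × V3 => ‖x.2.2‖ by fun_prop))
    filter_upwards [mem_nhdsWithin_of_mem_nhds (o.mem_nhds ⟨ht.1, hv⟩), self_mem_nhdsWithin] with x hx hs
    exact hR x.1 ⟨hx.1.le, hs.1.2⟩ x.2.1 x.2.2 hx.2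
  rw [fW, h2.fderivWithin_eq (hR t (Ioc_subset_Icc_self ht) θ v hv)]
  simp

/-- the bounds away from the singular time -/
theorem derivs_bdd_far : ∃ C, ∀ t ∈ Ioc S.t00 S.ti, ∀ θ v,
    |ptf S.f t θ v| ≤ C ∧ |pθf S.f t θ v| ≤ C ∧ |pv1 (S.f t θ) v| ≤ C ∧
    |pv2 (S.f t θ) v| ≤ C ∧ |pv3 (S.f t θ) v| ≤ C ∧ |pθ S.α t θ| ≤ C := by
  obtain ⟨R, hR0, hR⟩ := exists_suppR (S := S) tp_lt_t00
  obtain ⟨D, hD0, hD⟩ := fW_bdd (S := S) R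
  obtain ⟨M, hM0, -, hM, -⟩ := deriv_bdd_closed S.hαsm S.hαper tp_lt_t00
  refine ⟨D + M, fun t ht θ v => ?_⟩
  have ht' : t ∈ Ioc S.tp S.ti := ⟨tp_lt_t00.trans ht.1, ht.2⟩
  have hW : ‖S.fW (t, Int.fract θ, v)‖ ≤ D := by
    by_cases hv : ‖v‖ ≤ R
    · exact hD t (Ioc_subset_Icc_self ht) _ (fract_mem θ) v hv
    · rw [fW_zero_of_supp tp_lt_t00 hR ht _ (not_le.1 hv), norm_zero]
      exact hD0
  have hk : ∀ d : ℝ × ℝ × V3, ‖d‖ ≤ 1 → |S.fW (t, Int.fract θ, v) d| ≤ D + M := fun d hd =>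
    ((abs_fW_le _ d hd).trans hW).trans (by linarith)
  have ef : S.f t θ = S.f t (Int.fract θ) := funext fun u => (fract_f t θ u).symm
  refine ⟨?_, ?_, ?_, ?_, ?_, (hM t (Ioc_subset_Icc_self ht) θ).trans (by linarith)⟩
  · have e : ptf S.f t θ v = ptf S.f t (Int.fract θ) v := by
      simp only [ptf, fract_f]
    rw [e]
    exact ((abs_ptf_le ht' _ v).trans hW).trans (by linarith)
  · rw [← fract_pθf, show pθf S.f t (Int.fract θ) v = _ from
      deriv_line _ (by simpa using fW_line ht' (Int.fract θ) v (1, 0))]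
    exact hk _ (by simp)
  · rw [ef, show pv1 (S.f t (Int.fract θ)) v = _ from
      deriv_line (fun y => S.f t (Int.fract θ) (y, v.2.1, v.2.2))
        (by simpa using fW_line ht' (Int.fract θ) v (0, 1, 0))]
    exact hk _ (by simp)
  · rw [ef, show pv2 (S.f t (Int.fract θ)) v = _ from
      deriv_line (fun y => S.f t (Int.fract θ) (v.1, y, v.2.2))
        (by simpa using fW_line ht' (Int.fract θ) v (0, 0, 1, 0))]
    exact hk _ (by simp)
  · rw [ef, show pv3 (S.f t (Int.fract θ)) v = _ from
      deriv_line (fun y => S.f t (Int.fract θ) (v.1, v.2.1, y))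
        (by simpa using fW_line ht' (Int.fract θ) v (0, 0, 0, 1))]
    exact hk _ (by simp)

theorem derivs_bdd : ∃ C, ∀ t ∈ Ioc S.tp S.ti, ∀ θ v,
    |ptf S.f t θ v| ≤ C ∧ |pθf S.f t θ v| ≤ C ∧ |pv1 (S.f t θ) v| ≤ C ∧
    |pv2 (S.f t θ) v| ≤ C ∧ |pv3 (S.f t θ) v| ≤ C ∧ |pθ S.α t θ| ≤ C := by
  obtain ⟨C1, h1⟩ := derivs_bdd_near (S := S)
  obtain ⟨C2, h2⟩ := derivs_bdd_far (S := S)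
  refine ⟨max C1 C2, fun t ht θ v => ?_⟩
  rcases le_or_gt t S.t00 with h | h
  · obtain ⟨a1, a2, a3, a4, a5, a6⟩ := h1 t ⟨ht.1, h⟩ θ v
    exact ⟨le_max_of_le_left a1, le_max_of_le_left a2, le_max_of_le_left a3, le_max_of_le_left a4,
      le_max_of_le_left a5, le_max_of_le_left a6⟩
  · obtain ⟨a1, a2, a3, a4, a5, a6⟩ := h2 t ⟨h, ht.2⟩ θ v
    exact ⟨le_max_of_le_right a1, le_max_of_le_right a2, le_max_of_le_right a3, le_max_of_le_right a4,
      le_max_of_le_right a5, le_max_of_le_right a6⟩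

end EV

theorem first_derivatives_of_f_bounded
    (tp ti : ℝ) (htp : 0 < tp) (hti : tp < ti)
    (U A ν α J K : ℝ → ℝ → ℝ) (f : ℝ → ℝ → V3 → ℝ)
    (hUsm : ContDiffOn ℝ (⊤ : ℕ∞) (fun p : ℝ × ℝ => U p.1 p.2) (Ioc tp ti ×ˢ (univ : Set ℝ)))
    (hAsm : ContDiffOn ℝ (⊤ : ℕ∞) (fun p : ℝ × ℝ => A p.1 p.2) (Ioc tp ti ×ˢ (univ : Set ℝ)))
    (hνsm : ContDiffOn ℝ (⊤ : ℕ∞) (fun p : ℝ × ℝ => ν p.1 p.2) (Ioc tp ti ×ˢ (univ : Set ℝ)))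
    (hαsm : ContDiffOn ℝ (⊤ : ℕ∞) (fun p : ℝ × ℝ => α p.1 p.2) (Ioc tp ti ×ˢ (univ : Set ℝ)))
    (hJsm : ContDiffOn ℝ (⊤ : ℕ∞) (fun p : ℝ × ℝ => J p.1 p.2) (Ioc tp ti ×ˢ (univ : Set ℝ)))
    (hKsm : ContDiffOn ℝ (⊤ : ℕ∞) (fun p : ℝ × ℝ => K p.1 p.2) (Ioc tp ti ×ˢ (univ : Set ℝ)))
    (hfsm : ContDiffOn ℝ (⊤ : ℕ∞) (fun p : ℝ × ℝ × V3 => f p.1 p.2.1 p.2.2) (Ioc tp ti ×ˢ (univ : Set (ℝ × V3))))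
    (hUper : ∀ t θ, U t (θ + 1) = U t θ)
    (hAper : ∀ t θ, A t (θ + 1) = A t θ)
    (hνper : ∀ t θ, ν t (θ + 1) = ν t θ)
    (hαper : ∀ t θ, α t (θ + 1) = α t θ)
    (hJper : ∀ t θ, J t (θ + 1) = J t θ)
    (hKper : ∀ t θ, K t (θ + 1) = K t θ)
    (hfper : ∀ t θ v, f t (θ + 1) v = f t θ v)
    (hαpos : ∀ t ∈ Ioc tp ti, ∀ θ : ℝ, 0 < α t θ)
    (hfnn : ∀ t ∈ Ioc tp ti, ∀ (θ : ℝ) (v : V3), 0 ≤ f t θ v)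
    (hfsupp : ∀ t ∈ Ioc tp ti, ∃ R : ℝ, ∀ (θ : ℝ) (v : V3), R < ‖v‖ → f t θ v = 0)
    (hvlasov :
      ∀ t ∈ Ioc tp ti, ∀ (θ : ℝ) (v : V3),
      ptf f t θ v
        = pv1 (v0 α ν U A t θ) v * pθf f t θ v
          - (deriv (fun x => v0 α ν U A t x v) θ
              + Real.sqrt (α t θ) * Real.exp (2 * ν t θ) / t ^ 3 * (K t θ - A t θ * J t θ) * (v.2.2 - A t θ * v.2.1)
              + Real.sqrt (α t θ) * Real.exp (2 * ν t θ - 4 * U t θ) / t * J t θ * v.2.1)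
            * pv1 (f t θ) v)
    (hnut :
      ∀ t ∈ Ioc tp ti, ∀ θ : ℝ,
      (pt ν t θ)
        = t * ((pt U t θ) ^ 2 + α t θ * (pθ U t θ) ^ 2
              + Real.exp (4 * U t θ) / (4 * t ^ 2) * ((pt A t θ) ^ 2 + α t θ * (pθ A t θ) ^ 2))
          + α t θ * Real.exp (2 * ν t θ - 4 * U t θ) / (4 * t) * J t θ ^ 2
          + α t θ * Real.exp (2 * ν t θ) / (4 * t ^ 3) * (K t θ - A t θ * J t θ) ^ 2
          + Real.sqrt (α t θ) * ∫ v : V3, f t θ v * |v0 α ν U A t θ v|)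
    (hnuth :
      ∀ t ∈ Ioc tp ti, ∀ θ : ℝ,
      (pθ ν t θ)
        = 2 * t * ((pt U t θ) * (pθ U t θ) + Real.exp (4 * U t θ) / (4 * t ^ 2) * (pt A t θ) * (pθ A t θ))
          - (pθ α t θ) / (2 * α t θ)
          - Real.sqrt (α t θ) * ∫ v : V3, f t θ v * v.1)
    (halt :
      ∀ t ∈ Ioc tp ti, ∀ θ : ℝ,
      (pt α t θ) / α t θ
        = - (α t θ * Real.exp (2 * ν t θ - 4 * U t θ) * J t θ ^ 2 / t)
          - α t θ * Real.exp (2 * ν t θ) * (K t θ - A t θ * J t θ) ^ 2 / t ^ 3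
          - 2 * (α t θ * Real.sqrt (α t θ)) * Real.exp (2 * ν t θ)
            * ∫ v : V3, f t θ v
                * (Real.exp (-2 * U t θ) + Real.exp (-4 * U t θ) * v.2.1 ^ 2
                    + (t ^ 2)⁻¹ * (v.2.2 - A t θ * v.2.1) ^ 2)
                / |v0 α ν U A t θ v|)
    (hjt :
      ∀ t ∈ Ioc tp ti, ∀ θ : ℝ,
      (pt J t θ) = -2 * α t θ * ∫ v : V3, f t θ v * v.1 * v.2.1 / |v0 α ν U A t θ v|)
    (hjth :
      ∀ t ∈ Ioc tp ti, ∀ θ : ℝ,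
      (pθ J t θ) = 2 * ∫ v : V3, f t θ v * v.2.1)
    (hkt :
      ∀ t ∈ Ioc tp ti, ∀ θ : ℝ,
      (pt K t θ) = -2 * α t θ * ∫ v : V3, f t θ v * v.1 * v.2.2 / |v0 α ν U A t θ v|)
    (hkth :
      ∀ t ∈ Ioc tp ti, ∀ θ : ℝ,
      (pθ K t θ) = 2 * ∫ v : V3, f t θ v * v.2.2)
    (hutt :
      ∀ t ∈ Ioc tp ti, ∀ θ : ℝ,
      (pt (pt U) t θ)
        = α t θ * (pθ (pθ U) t θ) - (pt U t θ) / t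
          + (pt α t θ) * (pt U t θ) / (2 * α t θ) + (pθ α t θ) * (pθ U t θ) / 2
          + Real.exp (4 * U t θ) / (2 * t ^ 2) * ((pt A t θ) ^ 2 - α t θ * (pθ A t θ) ^ 2)
          + α t θ * Real.exp (2 * ν t θ - 4 * U t θ) / (2 * t ^ 2) * J t θ ^ 2
          + (α t θ * Real.sqrt (α t θ)) * Real.exp (2 * ν t θ - 2 * U t θ) / (2 * t)
            * ∫ v : V3, f t θ v * (1 + 2 * Real.exp (-2 * U t θ) * v.2.1 ^ 2) / |v0 α ν U A t θ v|)
    (hatt :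
      ∀ t ∈ Ioc tp ti, ∀ θ : ℝ,
      (pt (pt A) t θ)
        = α t θ * (pθ (pθ A) t θ) + (pt A t θ) / t
          + (pt α t θ) * (pt A t θ) / (2 * α t θ) + (pθ α t θ) * (pθ A t θ) / 2
          - 4 * ((pt A t θ) * (pt U t θ) - α t θ * (pθ A t θ) * (pθ U t θ))
          + α t θ * Real.exp (2 * ν t θ - 4 * U t θ) / t ^ 2 * J t θ * (K t θ - A t θ * J t θ)
          + 2 * (α t θ * Real.sqrt (α t θ)) * Real.exp (2 * ν t θ - 4 * U t θ) / t
            * ∫ v : V3, f t θ v * v.2.1 * (v.2.2 - A t θ * v.2.1) / |v0 α ν U A t θ v|)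
    (hnutt :
      ∀ t ∈ Ioc tp ti, ∀ θ : ℝ,
      (pt (pt ν) t θ)
        = α t θ * (pθ (pθ ν) t θ)
          + (pt α t θ) * (pt ν t θ) / (2 * α t θ) + (pθ α t θ) * (pθ ν t θ) / 2
          + (pθ (pθ α) t θ) / 2 - (pθ α t θ) ^ 2 / (4 * α t θ)
          - (pt U t θ) ^ 2 + α t θ * (pθ U t θ) ^ 2
          + Real.exp (4 * U t θ) / (4 * t ^ 2) * ((pt A t θ) ^ 2 - α t θ * (pθ A t θ) ^ 2)
          - α t θ * Real.exp (2 * ν t θ - 4 * U t θ) * J t θ ^ 2 / (4 * t ^ 2)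
          - 3 * α t θ * Real.exp (2 * ν t θ) * (K t θ - A t θ * J t θ) ^ 2 / (4 * t ^ 4)
          - (α t θ * Real.sqrt (α t θ)) * Real.exp (2 * ν t θ) / t ^ 3
            * ∫ v : V3, f t θ v * (v.2.2 - A t θ * v.2.1) ^ 2 / |v0 α ν U A t θ v|)
    (hC2 : 0 < ∫ θ in (0:ℝ)..1, ∫ v : V3, f ti θ v) :
    ∃ C : ℝ, ∀ t ∈ Ioc tp ti, ∀ (θ : ℝ) (v : V3),
      |ptf f t θ v| ≤ C ∧ |pθf f t θ v| ≤ C ∧ |pv1 (f t θ) v| ≤ C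
      ∧ |pv2 (f t θ) v| ≤ C ∧ |pv3 (f t θ) v| ≤ C ∧ |pθ α t θ| ≤ C := by
  exact EV.derivs_bdd (S := ⟨tp, ti, htp, hti, U, A, ν, α, J, K, f, hUsm, hAsm, hνsm, hαsm, hJsm, hKsm, hfsm, hUper,
    hAper, hνper, hαper, hJper, hKper, hfper, hαpos, hfnn, hfsupp, hvlasov, hnut, hnuth, halt,
    hjt, hjth, hkt, hkth, hutt, hatt, hnutt, hC2⟩)
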